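/- Let N = 2, let Ω ⊂ ℝ² be a bounded domain with C³ boundary and unit area, and let p ∈ (1, +∞). For every λ with 0 ≤ λ < min{λ₀(Ω, p), λ₁(Ω, p)}, where λ₀(Ω, p) = Λ(Ω, 2p)/p and λ₁(Ω, p) = (8π/(p+1))^{(p−1)/(2p)} Λ(Ω, p+1)^{(p+1)/(2p)}, problem (P)_λ on Ω admits exactly one solution. -/

import Mathlib

open MeasureTheory Metric Set

noncomputable section

/-- The Laplacian of a function on Euclidean space. -/
def lapl {N : ℕ} (f : EuclideanSpace ℝ (Fin N) → ℝ) (x : EuclideanSpace ℝ (Fin N)) : ℝ :=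
  ∑ i : Fin N,
    fderiv ℝ (fun y => fderiv ℝ f y (EuclideanSpace.single i (1 : ℝ))) x
      (EuclideanSpace.single i (1 : ℝ))

/-- `(α, ψ)` is a solution of problem `(P)_λ` on `Ω`:
`ψ ∈ C²`, `-Δψ = (max (α + λψ) 0)^p` in `Ω`, `ψ = 0` on `∂Ω`, and
`∫_Ω (max (α + λψ) 0)^p = 1`. -/
def IsSol {N : ℕ} (Ω : Set (EuclideanSpace ℝ (Fin N))) (p lam α : ℝ)
    (ψ : EuclideanSpace ℝ (Fin N) → ℝ) : Prop :=
  ContDiff ℝ 2 ψ ∧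
  (∀ x ∈ Ω, -lapl ψ x = (max (α + lam * ψ x) 0) ^ p) ∧
  (∀ x ∈ frontier Ω, ψ x = 0) ∧
  (∫ x in Ω, (max (α + lam * ψ x) 0) ^ p) = 1

/-- `Ω` is a bounded domain of class `C³`: open, connected, bounded, and near every
boundary point `Ω` is the sublevel set of a `C³` function with nonvanishing gradient. -/
def IsC3Domain {N : ℕ} (Ω : Set (EuclideanSpace ℝ (Fin N))) : Prop :=
  IsOpen Ω ∧ IsConnected Ω ∧ Bornology.IsBounded Ω ∧
  ∀ x ∈ frontier Ω, ∃ (U : Set (EuclideanSpace ℝ (Fin N)))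
      (f : EuclideanSpace ℝ (Fin N) → ℝ),
    IsOpen U ∧ x ∈ U ∧ ContDiff ℝ 3 f ∧ (∀ y ∈ U, fderiv ℝ f y ≠ 0) ∧
    Ω ∩ U = {y ∈ U | f y < 0}

/-- `Λ(Ω, t)`: the infimum of `(∫_Ω ‖∇w‖²) / (∫_Ω |w|^t)^(2/t)` over nonzero smooth
compactly supported `w` with support contained in `Ω`. -/
def Lam {N : ℕ} (Ω : Set (EuclideanSpace ℝ (Fin N))) (t : ℝ) : ℝ :=
  sInf {r : ℝ | ∃ w : EuclideanSpace ℝ (Fin N) → ℝ, ContDiff ℝ (⊤ : ℕ∞) w ∧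
    HasCompactSupport w ∧ tsupport w ⊆ Ω ∧ w ≠ 0 ∧
    r = (∫ x in Ω, ‖gradient w x‖ ^ 2) / (∫ x in Ω, |w x| ^ t) ^ (2 / t)}

section

open InnerProductSpace Laplacian Topology Filter
open scoped Convolution

/-- `f` is `C²` near `z` with Laplacian `l` at `z`. -/
def HasLap (f : ℂ → ℝ) (l : ℝ) (z : ℂ) : Prop := ContDiffAt ℝ 2 f z ∧ (Δ f) z = l

namespace HasLap

variable {f g : ℂ → ℝ} {l m : ℝ} {z : ℂ}

theorem continuousAt (h : HasLap f l z) : ContinuousAt f z := h.1.continuousAt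

theorem add (hf : HasLap f l z) (hg : HasLap g m z) : HasLap (fun w => f w + g w) (l + m) z :=
  ⟨hf.1.add hg.1, by rw [← hf.2, ← hg.2]; exact hf.1.laplacian_add hg.1⟩

theorem sub (hf : HasLap f l z) (hg : HasLap g m z) : HasLap (fun w => f w - g w) (l - m) z :=
  ⟨hf.1.sub hg.1, by rw [← hf.2, ← hg.2]; exact hf.1.laplacian_sub hg.1⟩

theorem neg (hf : HasLap f l z) : HasLap (fun w => -f w) (-l) z :=
  ⟨hf.1.neg, by rw [← hf.2]; exact congrFun (laplacian_neg (f := f)) z⟩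

theorem const_mul (c : ℝ) (hf : HasLap f l z) : HasLap (fun w => c * f w) (c * l) z :=
  ⟨contDiffAt_const.mul hf.1, by rw [← hf.2]; exact laplacian_smul c hf.1⟩

theorem const (c : ℝ) : HasLap (fun _ => c) 0 z :=
  ⟨contDiffAt_const, by rw [laplacian_const]; rfl⟩

theorem congr (hf : HasLap f l z) (h : g =ᶠ[𝓝 z] f) : HasLap g l z :=
  ⟨hf.1.congr_of_eventuallyEq h, by rw [(laplacian_congr_nhds h).eq_of_nhds, hf.2]⟩

theorem congr_value (hf : HasLap f l z) (h : l = m) : HasLap f m z := h ▸ hf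

theorem of_harmonicAt (h : HarmonicAt f z) : HasLap f 0 z :=
  ⟨h.1, h.2.eq_of_nhds⟩

end HasLap

theorem hasLap_eventually_harmonicAt {f : ℂ → ℝ} {z : ℂ} (h : ∀ᶠ w in 𝓝 z, HasLap f 0 w) :
    HarmonicAt f z :=
  ⟨h.self_of_nhds.1, h.mono fun _ hw => hw.2⟩

theorem harmonicOnNhd_of_hasLap {f : ℂ → ℝ} {s : Set ℂ} (hs : IsOpen s)
    (h : ∀ z ∈ s, HasLap f 0 z) : HarmonicOnNhd f s := fun _ hz =>
  hasLap_eventually_harmonicAt (Filter.eventually_of_mem (hs.mem_nhds hz) h)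

theorem ContDiffAt.hasDerivAt_line {f : ℂ → ℝ} {z : ℂ} (hf : ContDiffAt ℝ 2 f z) (v : ℂ) :
    ∀ᶠ t : ℝ in 𝓝 0, HasDerivAt (fun t : ℝ => f (z + t * v)) (fderiv ℝ f (z + t * v) v) t := by
  have h1 : ∀ᶠ w in 𝓝 z, DifferentiableAt ℝ f w :=
    (hf.eventually (by simp)).mono fun w hw => hw.differentiableAt (by simp)
  have hc : Tendsto (fun t : ℝ => z + t * v) (𝓝 0) (𝓝 z) := by
    have : Continuous (fun t : ℝ => z + t * v) := by fun_prop
    simpa using this.tendsto 0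
  filter_upwards [hc.eventually h1] with t ht
  have hl : HasDerivAt (fun t : ℝ => z + t * v) v t := by
    simpa using ((hasDerivAt_id t).ofReal_comp.mul_const v).const_add z
  exact ht.hasFDerivAt.comp_hasDerivAt t hl

theorem ContDiffAt.hasDerivAt_fderiv_line {f : ℂ → ℝ} {z : ℂ} (hf : ContDiffAt ℝ 2 f z) (v : ℂ) :
    HasDerivAt (fun t : ℝ => fderiv ℝ f (z + t * v) v) (iteratedFDeriv ℝ 2 f z ![v, v]) 0 := by
  have h1 : DifferentiableAt ℝ (fderiv ℝ f) z :=
    (hf.fderiv_right (m := 1) (by norm_num)).differentiableAt (by simp)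
  have hl : HasDerivAt (fun t : ℝ => z + t * v) v 0 := by
    simpa using ((hasDerivAt_id (0 : ℝ)).ofReal_comp.mul_const v).const_add z
  have h2 : HasFDerivAt (fderiv ℝ f) (fderiv ℝ (fderiv ℝ f) z) (z + ((0 : ℝ) : ℂ) * v) := by
    simpa using h1.hasFDerivAt
  have h3 := h2.comp_hasDerivAt (0 : ℝ) hl
  have h4 := h3.clm_apply (hasDerivAt_const (0 : ℝ) v)
  simpa [iteratedFDeriv_two_apply] using h4

/-- The Laplacian from second derivatives along the coordinate lines. -/
theorem HasLap.of_lines {f : ℂ → ℝ} {z : ℂ} (hf : ContDiffAt ℝ 2 f z) {a b : ℝ} {g k : ℝ → ℝ}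
    (h1 : ∀ᶠ t : ℝ in 𝓝 0, HasDerivAt (fun t : ℝ => f (z + t)) (g t) t) (h2 : HasDerivAt g a 0)
    (h3 : ∀ᶠ t : ℝ in 𝓝 0, HasDerivAt (fun t : ℝ => f (z + t * Complex.I)) (k t) t)
    (h4 : HasDerivAt k b 0) : HasLap f (a + b) z := by
  refine ⟨hf, ?_⟩
  rw [laplacian_eq_iteratedFDeriv_complexPlane]
  have e1 : iteratedFDeriv ℝ 2 f z ![1, 1] = a := by
    refine (hf.hasDerivAt_fderiv_line 1).unique (h2.congr_of_eventuallyEq ?_)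
    filter_upwards [h1, hf.hasDerivAt_line 1] with t ht ht'
    simp only [mul_one] at ht' ⊢
    exact ht'.unique ht
  have e2 : iteratedFDeriv ℝ 2 f z ![Complex.I, Complex.I] = b := by
    refine (hf.hasDerivAt_fderiv_line Complex.I).unique (h4.congr_of_eventuallyEq ?_)
    filter_upwards [h3, hf.hasDerivAt_line Complex.I] with t ht ht'
    exact ht'.unique ht
  simp only [e1, e2]

theorem iteratedFDeriv_two_nonpos_of_isLocalMax {f : ℂ → ℝ} {z : ℂ} (hf : ContDiffAt ℝ 2 f z)
    (hm : IsLocalMax f z) (v : ℂ) : iteratedFDeriv ℝ 2 f z ![v, v] ≤ 0 := by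
  by_contra! hpos
  have hc : Tendsto (fun t : ℝ => z + t * v) (𝓝 0) (𝓝 z) := by
    have : Continuous (fun t : ℝ => z + t * v) := by fun_prop
    simpa using this.tendsto 0
  have hmax : IsLocalMax (fun t : ℝ => f (z + t * v)) 0 := by
    filter_upwards [hc.eventually hm] with t ht
    simpa using ht
  have hd : deriv (fun t : ℝ => f (z + t * v)) =ᶠ[𝓝 0] fun t : ℝ => fderiv ℝ f (z + t * v) v :=
    (hf.hasDerivAt_line v).mono fun t ht => ht.deriv
  have hmin : IsLocalMin (fun t : ℝ => f (z + t * v)) 0 := by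
    apply isLocalMin_of_deriv_deriv_pos
    · rw [hd.deriv_eq, (hf.hasDerivAt_fderiv_line v).deriv]; exact hpos
    · exact hmax.deriv_eq_zero
    · exact (hf.hasDerivAt_line v).self_of_nhds.continuousAt
  have hconst : (fun t : ℝ => f (z + t * v)) =ᶠ[𝓝 0] fun _ => f z := by
    filter_upwards [hmax, hmin] with t h1 h2
    simp at h1 h2
    exact le_antisymm h1 h2
  have h0 : deriv (fun t : ℝ => f (z + t * v)) =ᶠ[𝓝 0] fun _ => 0 := by
    simpa using hconst.deriv
  have := (hd.symm.trans h0).deriv_eq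
  rw [(hf.hasDerivAt_fderiv_line v).deriv] at this
  simp at this
  linarith

theorem HasLap.nonpos_of_isLocalMax {f : ℂ → ℝ} {l : ℝ} {z : ℂ} (hf : HasLap f l z)
    (hm : IsLocalMax f z) : l ≤ 0 := by
  rw [← hf.2, laplacian_eq_iteratedFDeriv_complexPlane]
  have h1 := iteratedFDeriv_two_nonpos_of_isLocalMax hf.1 hm 1
  have h2 := iteratedFDeriv_two_nonpos_of_isLocalMax hf.1 hm Complex.I
  simp only
  linarith

theorem HasLap.re {z : ℂ} : HasLap (fun w => w.re) 0 z := by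
  refine (HasLap.of_lines (a := 0) (b := 0) (g := fun _ => 1) (k := fun _ => 0)
    Complex.reCLM.contDiff.contDiffAt ?_ (hasDerivAt_const _ _) ?_
    (hasDerivAt_const _ _)).congr_value (by norm_num)
  · refine Eventually.of_forall fun t => ?_
    simpa using (hasDerivAt_id t).const_add z.re
  · refine Eventually.of_forall fun t => ?_
    simpa using hasDerivAt_const t z.re

theorem HasLap.im {z : ℂ} : HasLap (fun w => w.im) 0 z := by
  refine (HasLap.of_lines (a := 0) (b := 0) (g := fun _ => 0) (k := fun _ => 1)
    Complex.imCLM.contDiff.contDiffAt ?_ (hasDerivAt_const _ _) ?_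
    (hasDerivAt_const _ _)).congr_value (by norm_num)
  · refine Eventually.of_forall fun t => ?_
    simpa using hasDerivAt_const t z.im
  · refine Eventually.of_forall fun t => ?_
    simpa using (hasDerivAt_id t).const_add z.im

/-- A function of the real part. -/
theorem HasLap.comp_re {z : ℂ} {φ φ' : ℝ → ℝ} {a : ℝ} (hφ : ContDiffAt ℝ 2 φ z.re)
    (h1 : ∀ᶠ t in 𝓝 z.re, HasDerivAt φ (φ' t) t) (h2 : HasDerivAt φ' a z.re) :
    HasLap (fun w => φ w.re) a z := by
  refine (HasLap.of_lines (a := a) (b := 0) (g := fun t => φ' (z.re + t)) (k := fun _ => 0)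
    (ContDiffAt.comp (g := φ) (f := fun w : ℂ => w.re) z hφ Complex.reCLM.contDiff.contDiffAt) ?_ ?_
      ?_ (hasDerivAt_const _ _)).congr_value (by norm_num)
  · have hc : Tendsto (fun t : ℝ => z.re + t) (𝓝 0) (𝓝 z.re) := by
      have : Continuous (fun t : ℝ => z.re + t) := by fun_prop
      simpa using this.tendsto 0
    filter_upwards [hc.eventually h1] with t ht
    simpa using ht.comp_const_add z.re t
  · have : HasDerivAt φ' a (z.re + 0) := by simpa using h2
    exact this.comp_const_add z.re 0
  · refine Eventually.of_forall fun t => ?_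
    simpa using hasDerivAt_const t (φ z.re)

theorem HasLap.comp_im {z : ℂ} {φ φ' : ℝ → ℝ} {a : ℝ} (hφ : ContDiffAt ℝ 2 φ z.im)
    (h1 : ∀ᶠ t in 𝓝 z.im, HasDerivAt φ (φ' t) t) (h2 : HasDerivAt φ' a z.im) :
    HasLap (fun w => φ w.im) a z := by
  refine (HasLap.of_lines (a := 0) (b := a) (g := fun _ => 0) (k := fun t => φ' (z.im + t))
    (ContDiffAt.comp (g := φ) (f := fun w : ℂ => w.im) z hφ Complex.imCLM.contDiff.contDiffAt)
      ?_ (hasDerivAt_const _ _) ?_ ?_).congr_value (by norm_num)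
  · refine Eventually.of_forall fun t => ?_
    simpa using hasDerivAt_const t (φ z.im)
  · have hc : Tendsto (fun t : ℝ => z.im + t) (𝓝 0) (𝓝 z.im) := by
      have : Continuous (fun t : ℝ => z.im + t) := by fun_prop
      simpa using this.tendsto 0
    filter_upwards [hc.eventually h1] with t ht
    simpa using ht.comp_const_add z.im t
  · have : HasDerivAt φ' a (z.im + 0) := by simpa using h2
    exact this.comp_const_add z.im 0

theorem HasLap.re_sq {z : ℂ} : HasLap (fun w => w.re ^ 2) 2 z :=
  HasLap.comp_re (φ := fun t => t ^ 2) (φ' := fun t => 2 * t) (by fun_prop)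
    (Eventually.of_forall fun t => by simpa using hasDerivAt_pow 2 t)
    (by simpa using (hasDerivAt_id z.re).const_mul 2)

theorem HasLap.im_sq {z : ℂ} : HasLap (fun w => w.im ^ 2) 2 z :=
  HasLap.comp_im (φ := fun t => t ^ 2) (φ' := fun t => 2 * t) (by fun_prop)
    (Eventually.of_forall fun t => by simpa using hasDerivAt_pow 2 t)
    (by simpa using (hasDerivAt_id z.im).const_mul 2)

theorem HasLap.re_mul_im {z : ℂ} : HasLap (fun w => w.re * w.im) 0 z := by
  refine (HasLap.of_lines (a := 0) (b := 0) (g := fun _ => z.im) (k := fun _ => z.re)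
    (Complex.reCLM.contDiff.contDiffAt.mul Complex.imCLM.contDiff.contDiffAt) ?_
      (hasDerivAt_const _ _) ?_ (hasDerivAt_const _ _)).congr_value (by norm_num)
  · refine Eventually.of_forall fun t => ?_
    simpa using ((hasDerivAt_id t).const_add z.re).mul_const z.im
  · refine Eventually.of_forall fun t => ?_
    simpa using ((hasDerivAt_id t).const_add z.im).const_mul z.re

theorem HasLap.norm_sq {z : ℂ} : HasLap (fun w => ‖w‖ ^ 2) 4 z :=
  ((HasLap.re_sq (z := z)).add HasLap.im_sq |>.congr (Eventually.of_forall fun w => by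
    rw [← Complex.normSq_eq_norm_sq, Complex.normSq_apply]; ring)).congr_value (by norm_num)

/-- Behaviour of the Laplacian under complex affine maps. -/
theorem HasLap.comp_affine {u : ℂ → ℝ} {l : ℝ} {z : ℂ} (c m : ℂ) (h : HasLap u l (c + m * z)) :
    HasLap (fun w => u (c + m * w)) (‖m‖ ^ 2 * l) z := by
  have hA : ContDiff ℝ 2 (fun w : ℂ => c + m * w) := by fun_prop
  have hu : ContDiffAt ℝ 2 (fun w => u (c + m * w)) z :=
    ContDiffAt.comp (g := u) z h.1 hA.contDiffAt
  refine ⟨hu, ?_⟩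
  have key : ∀ v : ℂ, iteratedFDeriv ℝ 2 (fun w => u (c + m * w)) z ![v, v] =
      iteratedFDeriv ℝ 2 u (c + m * z) ![m * v, m * v] := by
    intro v
    refine (hu.hasDerivAt_fderiv_line v).unique
      ((h.1.hasDerivAt_fderiv_line (m * v)).congr_of_eventuallyEq ?_)
    filter_upwards [hu.hasDerivAt_line v, h.1.hasDerivAt_line (m * v)] with t h1 h2
    refine h1.unique (h2.congr_of_eventuallyEq (Eventually.of_forall fun t => ?_))
    simp only
    congr 1
    ring
  rw [laplacian_eq_iteratedFDeriv_complexPlane]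
  simp only [key]
  rw [← h.2, laplacian_eq_iteratedFDeriv_complexPlane]
  simp only [iteratedFDeriv_two_apply, Matrix.cons_val_zero, Matrix.cons_val_one]
  set B := fderiv ℝ (fderiv ℝ u) (c + m * z)
  have e1 : m * 1 = m.re • (1 : ℂ) + m.im • Complex.I := by
    apply Complex.ext <;> simp
  have e2 : m * Complex.I = (-m.im) • (1 : ℂ) + m.re • Complex.I := by
    apply Complex.ext <;> simp
  rw [e1, e2, ← Complex.normSq_eq_norm_sq, Complex.normSq_apply]
  simp only [map_add, map_smul, _root_.add_apply, _root_.smul_apply,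
    smul_eq_mul]
  ring

/-- Reflection in the imaginary axis. -/
theorem HasLap.comp_reflect {u : ℂ → ℝ} {l : ℝ} {z : ℂ}
    (h : HasLap u l (-(starRingEnd ℂ) z)) :
    HasLap (fun w => u (-(starRingEnd ℂ) w)) l z := by
  have hA : ContDiff ℝ 2 (fun w : ℂ => -(starRingEnd ℂ) w) := Complex.conjCLE.contDiff.neg
  have hu : ContDiffAt ℝ 2 (fun w => u (-(starRingEnd ℂ) w)) z :=
    ContDiffAt.comp (g := u) z h.1 hA.contDiffAt
  refine ⟨hu, ?_⟩
  have key : ∀ v : ℂ, iteratedFDeriv ℝ 2 (fun w => u (-(starRingEnd ℂ) w)) z ![v, v] =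
      iteratedFDeriv ℝ 2 u (-(starRingEnd ℂ) z)
        ![-(starRingEnd ℂ) v, -(starRingEnd ℂ) v] := by
    intro v
    refine (hu.hasDerivAt_fderiv_line v).unique
      ((h.1.hasDerivAt_fderiv_line (-(starRingEnd ℂ) v)).congr_of_eventuallyEq ?_)
    filter_upwards [hu.hasDerivAt_line v, h.1.hasDerivAt_line (-(starRingEnd ℂ) v)] with t h1 h2
    refine h1.unique (h2.congr_of_eventuallyEq (Eventually.of_forall fun t => ?_))
    simp only
    congr 1
    simp only [map_add, map_mul, Complex.conj_ofReal]
    ring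
  rw [laplacian_eq_iteratedFDeriv_complexPlane]
  simp only [key]
  rw [← h.2, laplacian_eq_iteratedFDeriv_complexPlane]
  simp [iteratedFDeriv_two_apply]

/-- Harmonicity of the logarithmic potential. -/
theorem HasLap.log_norm {z c : ℂ} (h : z ≠ c) : HasLap (fun w => Real.log ‖w - c‖) 0 z :=
  HasLap.of_harmonicAt (AnalyticAt.harmonicAt_log_norm (f := fun w => w - c)
    (by fun_prop) (sub_ne_zero.2 h))

/-- Weak maximum principle. -/
theorem le_of_hasLap_nonneg {D : Set ℂ} (hD : IsOpen D) (hb : Bornology.IsBounded D)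
    {w : ℂ → ℝ} (hc : ContinuousOn w (closure D)) (hl : ∀ z ∈ D, ∃ l, 0 ≤ l ∧ HasLap w l z)
    {m : ℝ} (hm : ∀ z ∈ frontier D, w z ≤ m) : ∀ z ∈ closure D, w z ≤ m := by
  obtain ⟨R, hR⟩ := hb.closure.exists_norm_le
  have hcomp : IsCompact (closure D) := hb.isCompact_closure
  intro z hz
  refine le_of_forall_pos_le_add fun ε hε => ?_
  set η : ℝ := ε / (R ^ 2 + 1)
  have hη : 0 < η := by positivity
  have hηR : η * R ^ 2 ≤ ε := by
    have : η * (R ^ 2 + 1) = ε := by simp only [η]; field_simp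
    nlinarith
  set v : ℂ → ℝ := fun z => w z + η * ‖z‖ ^ 2
  have hvc : ContinuousOn v (closure D) := hc.add (by fun_prop)
  obtain ⟨x, hx, hmax⟩ := hcomp.exists_isMaxOn ⟨z, hz⟩ hvc
  have hxf : x ∈ frontier D := by
    by_contra hnf
    have hxD : x ∈ D := by
      rw [hD.frontier_eq] at hnf
      by_contra h
      exact hnf ⟨hx, h⟩
    obtain ⟨l, hl0, hlap⟩ := hl x hxD
    have h1 : HasLap v (l + η * 4) x := hlap.add (HasLap.norm_sq.const_mul η)
    have h2 : IsLocalMax v x := hmax.isLocalMax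
      (Filter.mem_of_superset (hD.mem_nhds hxD) subset_closure)
    have := h1.nonpos_of_isLocalMax h2
    linarith
  have h1 : v z ≤ v x := hmax hz
  have h2 := hm x hxf
  have h3 := hR x hx
  have h4 : ‖x‖ ^ 2 ≤ R ^ 2 := by
    have := norm_nonneg x
    nlinarith
  have h5 : 0 ≤ η * ‖z‖ ^ 2 := by positivity
  have h6 : η * ‖x‖ ^ 2 ≤ η * R ^ 2 := by gcongr
  simp only [v] at h1
  linarith

/-- Comparison of two functions through the maximum principle. -/
theorem le_of_hasLap_le {D : Set ℂ} (hD : IsOpen D) (hb : Bornology.IsBounded D)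
    {u v : ℂ → ℝ} (hu : ContinuousOn u (closure D)) (hv : ContinuousOn v (closure D))
    (hl : ∀ z ∈ D, ∃ l m, m ≤ l ∧ HasLap u l z ∧ HasLap v m z)
    (hm : ∀ z ∈ frontier D, u z ≤ v z) : ∀ z ∈ closure D, u z ≤ v z := by
  intro z hz
  have := le_of_hasLap_nonneg hD hb (w := fun z => u z - v z) (m := 0) (hu.sub hv) (by
    intro z hz
    obtain ⟨l, m, hlm, h1, h2⟩ := hl z hz
    exact ⟨l - m, sub_nonneg.2 hlm, h1.sub h2⟩) (fun z hz => sub_nonpos.2 (hm z hz)) z hz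
  exact sub_nonpos.1 this

/-- Borel–Carathéodory estimate on a general disc. -/
theorem norm_le_of_re_le {F : ℂ → ℂ} {c : ℂ} {r M : ℝ} (hM : 0 < M) (hr : 0 < r)
    (hF : DifferentiableOn ℂ F (ball c r)) (h0 : F c = 0) (hre : ∀ z ∈ ball c r, (F z).re ≤ M) :
    ∀ z ∈ ball c r, ‖F z‖ ≤ 2 * M * ‖z - c‖ / (r - ‖z - c‖) := by
  intro z hz
  have hmap : ∀ w ∈ ball (0 : ℂ) r, c + w ∈ ball c r := by
    intro w hw
    simpa [dist_eq_norm] using hw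
  have := Complex.borelCaratheodory_zero (f := fun w => F (c + w)) (z := z - c) hM
    (hF.comp (by fun_prop) hmap) (fun w hw => hre _ (hmap w hw)) hr
    (by simpa [dist_eq_norm] using hz) (by simpa using h0)
  simpa using this

/-- Harnack-type convergence theorem for harmonic functions on a disc. -/
theorem harmonicOnNhd_of_tendsto {V : ℕ → ℂ → ℝ} {W : ℂ → ℝ} {c : ℂ} {r : ℝ} (hr : 0 < r)
    (hV : ∀ n, HarmonicOnNhd (V n) (ball c r)) {δ : ℕ → ℝ} (hδ : ∀ n, 0 < δ n)
    (hδ0 : Tendsto δ atTop (𝓝 0))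
    (hb : ∀ m n, m ≤ n → ∀ z ∈ ball c r, V n c - V m c - (V n z - V m z) ≤ δ m)
    (hW : ∀ z ∈ ball c r, Tendsto (fun n => V n z) atTop (𝓝 (W z))) :
    HarmonicOnNhd W (ball c r) := by
  have hc : c ∈ ball c r := mem_ball_self hr
  choose F hF hFre using fun n => (hV n).exists_analyticOnNhd_ball_re_eq
  set G : ℕ → ℂ → ℂ := fun n z => F n z - F n c
  have hG : ∀ n, DifferentiableOn ℂ (G n) (ball c r) := fun n =>
    (hF n).differentiableOn.sub_const _
  have hGre : ∀ n, ∀ z ∈ ball c r, (G n z).re = V n z - V n c := by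
    intro n z hz
    have h1 := hFre n hz
    have h2 := hFre n hc
    simp only at h1 h2
    simp [G, h1, h2]
  have hdist : ∀ m n, m ≤ n → ∀ z ∈ ball c r,
      ‖G m z - G n z‖ ≤ 2 * δ m * ‖z - c‖ / (r - ‖z - c‖) := by
    intro m n hmn
    refine norm_le_of_re_le (F := fun z => G m z - G n z) (hδ m) hr ((hG m).sub (hG n))
      (by simp [G]) fun z hz => ?_
    have := hb m n hmn z hz
    simp only [Complex.sub_re, hGre _ z hz]
    linarith
  have hdist2 : ∀ m n, ∀ z ∈ ball c r,
      ‖G m z - G n z‖ ≤ 2 * (δ m + δ n) * ‖z - c‖ / (r - ‖z - c‖) := by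
    intro m n z hz
    have hz' : 0 < r - ‖z - c‖ := by
      rw [mem_ball, dist_eq_norm] at hz; linarith
    rcases le_total m n with h | h
    · refine (hdist m n h z hz).trans ?_
      have := hδ n
      gcongr
      linarith
    · rw [norm_sub_rev]
      refine (hdist n m h z hz).trans ?_
      have := hδ m
      gcongr
      linarith
  have hcauchy : ∀ ρ, 0 < ρ → ρ < r → UniformCauchySeqOn G atTop (closedBall c ρ) := by
    intro ρ hρ0 hρ
    rw [Metric.uniformCauchySeqOn_iff]
    intro ε hε
    have h1 : Tendsto (fun n => 4 * ρ / (r - ρ) * δ n) atTop (𝓝 0) := by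
      simpa using hδ0.const_mul (4 * ρ / (r - ρ))
    obtain ⟨N, hN⟩ := eventually_atTop.1 (h1.eventually (gt_mem_nhds hε))
    refine ⟨N, fun m hm n hn z hz => ?_⟩
    rw [mem_closedBall, dist_eq_norm] at hz
    have hzb : z ∈ ball c r := by rw [mem_ball, dist_eq_norm]; linarith
    have hr' : 0 < r - ρ := by linarith
    have key : ∀ m n, N ≤ m → m ≤ n → dist (G m z) (G n z) < ε := by
      intro m n hm hmn
      rw [dist_eq_norm]
      have e := hdist m n hmn z hzb
      have hd := hδ m
      calc ‖G m z - G n z‖ ≤ 2 * δ m * ‖z - c‖ / (r - ‖z - c‖) := e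
        _ ≤ 2 * δ m * ρ / (r - ρ) := by gcongr
        _ ≤ 4 * ρ / (r - ρ) * δ m := by
          rw [div_mul_eq_mul_div]
          gcongr ?_ / _
          nlinarith
        _ < ε := hN m hm
    rcases le_total m n with h | h
    · exact key m n hm h
    · rw [dist_comm]; exact key n m hn h
  have hex : ∀ z ∈ ball c r, ∃ g, Tendsto (fun n => G n z) atTop (𝓝 g) := by
    intro z hz
    rw [mem_ball, dist_eq_norm] at hz
    have h := hcauchy ((‖z - c‖ + r) / 2) (by have := norm_nonneg (z - c); linarith) (by linarith)
    exact cauchySeq_tendsto_of_complete (h.cauchySeq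
      (by rw [mem_closedBall, dist_eq_norm]; linarith))
  choose! g hg using hex
  have hloc : TendstoLocallyUniformlyOn G g atTop (ball c r) := by
    rw [tendstoLocallyUniformlyOn_iff_forall_isCompact isOpen_ball]
    intro K hK hKc
    rcases K.eq_empty_or_nonempty with rfl | hne
    · exact tendstoUniformlyOn_empty
    obtain ⟨x, hx, hmax⟩ := hKc.exists_isMaxOn hne (f := fun z => ‖z - c‖) (by fun_prop)
    have hx' := hK hx
    rw [mem_ball, dist_eq_norm] at hx'
    have h := hcauchy ((‖x - c‖ + r) / 2) (by have := norm_nonneg (x - c); linarith) (by linarith)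
    refine (h.mono fun z hz => ?_).tendstoUniformlyOn_of_tendsto fun z hz => hg z (hK hz)
    rw [mem_closedBall, dist_eq_norm]
    have : ‖z - c‖ ≤ ‖x - c‖ := hmax hz
    linarith
  have hgd : DifferentiableOn ℂ g (ball c r) :=
    hloc.differentiableOn (Eventually.of_forall hG) isOpen_ball
  have hWg : ∀ z ∈ ball c r, W z = W c + (g z).re := by
    intro z hz
    have h1 : Tendsto (fun n => V n c + (G n z).re) atTop (𝓝 (W c + (g z).re)) :=
      (hW c hc).add ((Complex.continuous_re.tendsto _).comp (hg z hz))
    refine tendsto_nhds_unique (hW z hz) (h1.congr fun n => ?_)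
    rw [hGre n z hz]; ring
  intro z hz
  have han : AnalyticAt ℂ g z := hgd.analyticAt (isOpen_ball.mem_nhds hz)
  have hh : HarmonicAt (fun w => W c + (g w).re) z :=
    (harmonicAt_const (W c)).add han.harmonicAt_re
  refine (harmonicAt_congr_nhds ?_).2 hh
  filter_upwards [isOpen_ball.mem_nhds hz] with w hw using hWg w hw

/-- Real parts of entire functions are dense in the continuous functions on the circle. -/
theorem exists_entire_re_near (b : ℂ → ℝ) (hb : ContinuousOn b (sphere 0 1)) {ε : ℝ}
    (hε : 0 < ε) : ∃ F : ℂ → ℂ, Differentiable ℂ F ∧ ∀ z ∈ sphere (0 : ℂ) 1,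
      |(F z).re - b z| ≤ ε := by
  let T : ℝ := 1
  have : Fact (0 < T) := ⟨one_pos⟩
  have hcirc : ∀ x : AddCircle T, (AddCircle.toCircle x : ℂ) ∈ sphere (0 : ℂ) 1 := fun x =>
    mem_sphere_zero_iff_norm.2 (Circle.norm_coe _)
  have hcont : Continuous fun x : AddCircle T => ((b (AddCircle.toCircle x) : ℝ) : ℂ) := by
    refine Complex.continuous_ofReal.comp (hb.comp_continuous ?_ hcirc)
    exact continuous_subtype_val.comp AddCircle.continuous_toCircle
  let g : C(AddCircle T, ℂ) := ⟨_, hcont⟩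
  have hg : g ∈ (Submodule.span ℂ (range (@fourier T))).topologicalClosure := by
    rw [span_fourier_closure_eq_top]; trivial
  have hg' : g ∈ closure ((Submodule.span ℂ (range (@fourier T)) : Set C(AddCircle T, ℂ))) := hg
  obtain ⟨q, hq, hgq⟩ := Metric.mem_closure_iff.1 hg' ε hε
  have key : ∀ c : ℂ, ∃ F : ℂ → ℂ, Differentiable ℂ F ∧ ∀ x : AddCircle T,
      (F (AddCircle.toCircle x)).re = (c * q x).re := by
    refine Submodule.span_induction (p := fun q _ => ∀ c : ℂ, ∃ F : ℂ → ℂ, Differentiable ℂ F ∧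
      ∀ x : AddCircle T, (F (AddCircle.toCircle x)).re = (c * q x).re) ?_ ?_ ?_ ?_ hq
    · rintro _ ⟨n, rfl⟩ c
      rcases Int.eq_nat_or_neg n with ⟨k, rfl | rfl⟩
      · refine ⟨fun z => c * z ^ k, by fun_prop, fun x => ?_⟩
        simp [fourier_apply, AddCircle.toCircle_nsmul]
      · refine ⟨fun z => (starRingEnd ℂ) c * z ^ k, by fun_prop, fun x => ?_⟩
        rw [fourier_neg, ← Complex.conj_re]
        simp [fourier_apply, AddCircle.toCircle_nsmul]
    · exact fun c => ⟨fun _ => 0, by fun_prop, fun x => by simp⟩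
    · intro f g _ _ hf hg c
      obtain ⟨F, hF, h1⟩ := hf c
      obtain ⟨G, hG, h2⟩ := hg c
      exact ⟨fun z => F z + G z, hF.add hG, fun x => by
        simp only [Complex.add_re, h1, h2, ContinuousMap.add_apply, mul_add]⟩
    · intro a f _ hf c
      obtain ⟨F, hF, h1⟩ := hf (c * a)
      exact ⟨F, hF, fun x => by rw [h1]; simp [mul_assoc]⟩
  obtain ⟨F, hF, hFq⟩ := key 1
  refine ⟨F, hF, fun z hz => ?_⟩
  obtain ⟨x, hx⟩ := (AddCircle.homeomorphCircle (T := T) one_ne_zero).surjective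
    ⟨z, mem_sphere_zero_iff_norm.2 (by simpa using hz)⟩
  rw [AddCircle.homeomorphCircle_apply] at hx
  have hxz : (AddCircle.toCircle x : ℂ) = z := by rw [hx]
  have h1 : dist (g x) (q x) < ε := lt_of_le_of_lt (ContinuousMap.dist_apply_le_dist x) hgq
  have h2 := hFq x
  rw [hxz, one_mul] at h2
  rw [h2]
  have h3 : (g x).re = b z := by simp [g, hxz]
  rw [← h3, ← Complex.sub_re]
  rw [dist_comm, dist_eq_norm] at h1
  exact (Complex.abs_re_le_norm _).trans h1.le

/-- Solvability of the Dirichlet problem on the unit disc. -/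
theorem exists_harmonicContOnCl_unit (b : ℂ → ℝ) (hb : ContinuousOn b (sphere 0 1)) :
    ∃ v : ℂ → ℝ, HarmonicContOnCl v (ball 0 1) ∧ ∀ z ∈ sphere (0 : ℂ) 1, v z = b z := by
  have hpos : ∀ n : ℕ, (0 : ℝ) < 1 / ((n : ℝ) + 1) := fun n => by positivity
  choose F hF hFb using fun n : ℕ => exists_entire_re_near b hb (hpos n)
  set V : ℕ → ℂ → ℝ := fun n z => (F n z).re
  have hVh : ∀ n z, HasLap (V n) 0 z := fun n z =>
    HasLap.of_harmonicAt ((hF n).analyticAt z).harmonicAt_re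
  have hVc : ∀ n, Continuous (V n) := fun n => Complex.continuous_re.comp (hF n).continuous
  have hone : ∀ m n : ℕ, m ≤ n → 1 / ((n : ℝ) + 1) ≤ 1 / ((m : ℝ) + 1) := by
    intro m n h
    have : (m : ℝ) ≤ n := by exact_mod_cast h
    gcongr
  have hle : ∀ m n, m ≤ n → ∀ z ∈ closedBall (0 : ℂ) 1,
      V m z - V n z ≤ 2 * (1 / ((m : ℝ) + 1)) ∧ V n z - V m z ≤ 2 * (1 / ((m : ℝ) + 1)) := by
    intro m n hmn z hz
    have hb2 : ∀ z ∈ sphere (0 : ℂ) 1,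
        V m z - V n z ≤ 2 * (1 / ((m : ℝ) + 1)) ∧ V n z - V m z ≤ 2 * (1 / ((m : ℝ) + 1)) := by
      intro z hz
      have h1 := abs_le.1 (hFb m z hz)
      have h2 := abs_le.1 (hFb n z hz)
      have := hone m n hmn
      simp only [V]
      constructor <;> linarith [h1.1, h1.2, h2.1, h2.2]
    rw [← closure_ball (0 : ℂ) one_ne_zero] at hz
    constructor
    · refine le_of_hasLap_nonneg isOpen_ball isBounded_ball (w := fun z => V m z - V n z)
        (((hVc m).sub (hVc n)).continuousOn)
        (fun z _ => ⟨0 - 0, by simp, (hVh m z).sub (hVh n z)⟩) (fun z hz => ?_) z hz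
      rw [frontier_ball _ one_ne_zero] at hz
      exact (hb2 z hz).1
    · refine le_of_hasLap_nonneg isOpen_ball isBounded_ball (w := fun z => V n z - V m z)
        (((hVc n).sub (hVc m)).continuousOn)
        (fun z _ => ⟨0 - 0, by simp, (hVh n z).sub (hVh m z)⟩) (fun z hz => ?_) z hz
      rw [frontier_ball _ one_ne_zero] at hz
      exact (hb2 z hz).2
  have hlim0 : Tendsto (fun n : ℕ => 1 / ((n : ℝ) + 1)) atTop (𝓝 0) :=
    tendsto_one_div_add_atTop_nhds_zero_nat
  have hcau : UniformCauchySeqOn V atTop (closedBall 0 1) := by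
    rw [Metric.uniformCauchySeqOn_iff]
    intro ε hε
    have h1 : Tendsto (fun n : ℕ => 2 * (1 / ((n : ℝ) + 1))) atTop (𝓝 0) := by
      simpa using hlim0.const_mul 2
    obtain ⟨N, hN⟩ := eventually_atTop.1 (h1.eventually (gt_mem_nhds hε))
    refine ⟨N, fun m hm n hn z hz => ?_⟩
    rw [Real.dist_eq, abs_lt]
    rcases le_total m n with h | h
    · have := hle m n h z hz
      have := hN m hm
      constructor <;> linarith
    · have := hle n m h z hz
      have := hN n hn
      constructor <;> linarith
  have hex : ∀ z ∈ closedBall (0 : ℂ) 1, ∃ g, Tendsto (fun n => V n z) atTop (𝓝 g) :=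
    fun z hz => cauchySeq_tendsto_of_complete (hcau.cauchySeq hz)
  choose! v hv using hex
  refine ⟨v, HarmonicContOnCl.mk_ball ?_ ?_, fun z hz => ?_⟩
  · refine harmonicOnNhd_of_tendsto (V := V) (δ := fun n => 4 * (1 / ((n : ℝ) + 1))) one_pos
      (fun n z _ => hasLap_eventually_harmonicAt (Eventually.of_forall fun w => hVh n w))
      (fun n => by positivity) (by simpa using hlim0.const_mul 4) (fun m n hmn z hz => ?_)
      (fun z hz => hv z (ball_subset_closedBall hz))
    have h1 := hle m n hmn z (ball_subset_closedBall hz)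
    have h2 := hle m n hmn 0 (by simp)
    linarith [h1.1, h2.2]
  · exact (hcau.tendstoUniformlyOn_of_tendsto hv).continuousOn
      (Frequently.of_forall fun n => (hVc n).continuousOn)
  · refine tendsto_nhds_unique (hv z (sphere_subset_closedBall hz)) ?_
    rw [tendsto_iff_dist_tendsto_zero]
    refine squeeze_zero (fun n => dist_nonneg) (fun n => ?_) hlim0
    rw [Real.dist_eq]
    exact hFb n z hz

theorem HarmonicOnNhd.hasLap {f : ℂ → ℝ} {s : Set ℂ} (h : HarmonicOnNhd f s) {z : ℂ}
    (hz : z ∈ s) : HasLap f 0 z := HasLap.of_harmonicAt (h z hz)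

/-- Solvability of the Dirichlet problem on a disc. -/
theorem exists_harmonicContOnCl_ball (b : ℂ → ℝ) {c : ℂ} {r : ℝ} (hr : 0 < r)
    (hb : ContinuousOn b (sphere c r)) :
    ∃ v : ℂ → ℝ, HarmonicContOnCl v (ball c r) ∧ ∀ z ∈ sphere c r, v z = b z := by
  have hr0 : (r : ℂ) ≠ 0 := by exact_mod_cast hr.ne'
  have hs : ∀ z ∈ sphere (0 : ℂ) 1, c + r * z ∈ sphere c r := by
    intro z hz
    simp at hz
    simp [hz, abs_of_pos hr]
  obtain ⟨v, hv, hvb⟩ := exists_harmonicContOnCl_unit (fun z => b (c + r * z))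
    (hb.comp (by fun_prop) hs)
  have hinv : ∀ z : ℂ, ‖-c / r + (1 / r : ℂ) * z‖ = ‖z - c‖ / r := by
    intro z
    have : -c / r + (1 / r : ℂ) * z = (z - c) / r := by field_simp; ring
    rw [this, norm_div, Complex.norm_real, Real.norm_of_nonneg hr.le]
  refine ⟨fun z => v (-c / r + (1 / r : ℂ) * z), HarmonicContOnCl.mk_ball ?_ ?_, ?_⟩
  · refine harmonicOnNhd_of_hasLap isOpen_ball fun z hz => ?_
    have : -c / r + (1 / r : ℂ) * z ∈ ball (0 : ℂ) 1 := by
      rw [mem_ball_zero_iff, hinv, div_lt_one hr]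
      simpa [dist_eq_norm] using hz
    exact ((HarmonicOnNhd.hasLap hv.1 this).comp_affine).congr_value (by simp)
  · refine hv.continuousOn_ball.comp (by fun_prop) fun z hz => ?_
    rw [mem_closedBall_zero_iff, hinv, div_le_one hr]
    simpa [dist_eq_norm] using hz
  · intro z hz
    have h1 : -c / r + (1 / r : ℂ) * z ∈ sphere (0 : ℂ) 1 := by
      rw [mem_sphere_zero_iff_norm, hinv, div_eq_one_iff_eq hr.ne']
      simpa [dist_eq_norm] using hz
    have h2 : c + r * (-c / r + (1 / r : ℂ) * z) = z := by field_simp; ring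
    simp only [hvb _ h1, h2]

/-- A holomorphic function on a disc bounded by its second Taylor polynomial up to third order. -/
theorem exists_taylor_two {F : ℂ → ℂ} {c : ℂ} {r M : ℝ} (hr : 0 < r)
    (hF : DifferentiableOn ℂ F (ball c r)) (h0 : F c = 0) (hM : ∀ z ∈ ball c r, ‖F z‖ ≤ M) :
    ∃ a b : ℂ, ‖a‖ ≤ M / r ∧ ‖b‖ ≤ 2 * M / r ^ 2 ∧ ∀ z ∈ ball c r,
      ‖F z - a * (z - c) - b * (z - c) ^ 2‖ ≤ 4 * M / r ^ 3 * ‖z - c‖ ^ 3 := by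
  have hc : c ∈ ball c r := mem_ball_self hr
  have hnh := isOpen_ball.mem_nhds hc
  have bound : ∀ {G : ℂ → ℂ} {K : ℝ}, DifferentiableOn ℂ G (ball c r) →
      (∀ z ∈ ball c r, ‖G z - G c‖ ≤ K) → ∀ z ∈ ball c r, ‖dslope G c z‖ ≤ K / r :=
    fun hG hK z hz => Complex.norm_dslope_le_div_of_mapsTo_ball hG
      (fun w hw => by rw [mem_closedBall, dist_eq_norm]; exact hK w hw) hz
  have hd1 : DifferentiableOn ℂ (dslope F c) (ball c r) :=
    (Complex.differentiableOn_dslope hnh).2 hF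
  have hd2 : DifferentiableOn ℂ (dslope (dslope F c) c) (ball c r) :=
    (Complex.differentiableOn_dslope hnh).2 hd1
  have b1 := bound (K := M) hF (fun z hz => by rw [h0, sub_zero]; exact hM z hz)
  have b2 := bound (K := 2 * M / r) hd1 (fun z hz => (norm_sub_le _ _).trans (by
    have := b1 z hz; have := b1 c hc
    calc _ ≤ M / r + M / r := by linarith
      _ = _ := by ring))
  have b3 := bound (K := 4 * M / r ^ 2) hd2 (fun z hz => (norm_sub_le _ _).trans (by
    have := b2 z hz; have := b2 c hc
    calc _ ≤ 2 * M / r / r + 2 * M / r / r := by linarith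
      _ = _ := by field_simp; ring))
  refine ⟨dslope F c c, dslope (dslope F c) c c, b1 c hc, (b2 c hc).trans_eq (by field_simp),
    fun z hz => ?_⟩
  have e : ∀ G : ℂ → ℂ, G z = G c + (z - c) * dslope G c z := fun G => by
    have := sub_smul_dslope G c z
    rw [smul_eq_mul] at this
    rw [this]; ring
  have e1 : F z - dslope F c c * (z - c) - dslope (dslope F c) c c * (z - c) ^ 2 =
      dslope (dslope (dslope F c) c) c z * (z - c) ^ 3 := by
    have h1 := e F
    have h2 := e (dslope F c)
    have h3 := e (dslope (dslope F c) c)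
    rw [h1, h2, h3, h0]; ring
  rw [e1, norm_mul, norm_pow]
  have := b3 z hz
  calc _ ≤ 4 * M / r ^ 2 / r * ‖z - c‖ ^ 3 := by gcongr
    _ = _ := by field_simp

/-- Quantitative second-order Taylor expansion of a bounded harmonic function. -/
theorem harmonic_taylor {v : ℂ → ℝ} {c : ℂ} {r A : ℝ} (hr : 0 < r) (hA : 0 < A)
    (hv : HarmonicOnNhd v (ball c r)) (hb : ∀ z ∈ ball c r, |v z| ≤ A) :
    ∃ a b : ℂ, ‖a‖ ≤ 200 * A / r ∧ ‖b‖ ≤ 200 * A / r ^ 2 ∧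
      (∀ z ∈ ball c (r / 2), |v z - v c - (a * (z - c)).re - (b * (z - c) ^ 2).re| ≤
        200 * A * (‖z - c‖ / r) ^ 3) ∧
      ∀ z ∈ ball c (r / 2), |v z - v c| ≤ 200 * A * (‖z - c‖ / r) := by
  have hc : c ∈ ball c r := mem_ball_self hr
  obtain ⟨F, hF, hFre⟩ := hv.exists_analyticOnNhd_ball_re_eq
  have hre : ∀ z ∈ ball c r, (F z - F c).re = v z - v c := fun z hz => by
    have h1 := hFre hz
    have h2 := hFre hc
    simp only at h1 h2
    simp [h1, h2]
  have hbc := norm_le_of_re_le (F := fun z => F z - F c) (M := 2 * A) (by positivity) hr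
    (hF.differentiableOn.sub_const _) (by simp) (fun z hz => by
      simp only [hre z hz]
      linarith [abs_le.1 (hb z hz), abs_le.1 (hb c hc)])
  have hlip : ∀ z ∈ ball c (r / 2), ‖F z - F c‖ ≤ 8 * A * (‖z - c‖ / r) := by
    intro z hz
    have hz' : ‖z - c‖ < r / 2 := by simpa [dist_eq_norm] using hz
    have h1 := hbc z (ball_subset_ball (by linarith) hz)
    calc _ ≤ _ := h1
      _ ≤ 2 * (2 * A) * ‖z - c‖ / (r / 2) := by gcongr; linarith
      _ = _ := by field_simp; ring
  have hsm : ∀ z ∈ ball c (r / 2), ‖F z - F c‖ ≤ 4 * A := by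
    intro z hz
    have hz' : ‖z - c‖ < r / 2 := by simpa [dist_eq_norm] using hz
    have h3 : ‖z - c‖ / r ≤ 1 / 2 := by rw [div_le_iff₀ hr]; linarith
    calc _ ≤ _ := hlip z hz
      _ ≤ 8 * A * (1 / 2) := by gcongr
      _ = _ := by ring
  obtain ⟨a, b, ha, hb', hab⟩ := exists_taylor_two (F := fun z => F z - F c) (r := r / 2)
    (by positivity) ((hF.differentiableOn.mono (ball_subset_ball (by linarith))).sub_const _)
    (by simp) hsm
  refine ⟨a, b, ha.trans ?_, hb'.trans ?_, fun z hz => ?_, fun z hz => ?_⟩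
  · rw [div_div_eq_mul_div]; gcongr ?_ / _; linarith
  · rw [div_pow, div_div_eq_mul_div]; gcongr ?_ / _; linarith
  · have h1 := (Complex.abs_re_le_norm _).trans (hab z hz)
    simp only [Complex.sub_re (F z - F c - a * (z - c)), Complex.sub_re (F z - F c),
      hre z (ball_subset_ball (by linarith) hz)] at h1
    refine h1.trans ?_
    calc _ = 128 * A * (‖z - c‖ / r) ^ 3 := by field_simp; ring
      _ ≤ _ := by gcongr; norm_num
  · rw [← hre z (ball_subset_ball (by linarith) hz)]
    refine (Complex.abs_re_le_norm _).trans ((hlip z hz).trans ?_)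
    gcongr; norm_num

/-- A continuous function on `closure Ω` satisfying the comparison principle against harmonic
functions on all closed discs inside `Ω`. -/
def IsSubharm (Ω : Set ℂ) (u : ℂ → ℝ) : Prop :=
  ContinuousOn u (closure Ω) ∧ ∀ (c : ℂ) (r : ℝ), 0 < r → closedBall c r ⊆ Ω →
    ∀ h : ℂ → ℝ, HarmonicContOnCl h (ball c r) → (∀ z ∈ sphere c r, u z ≤ h z) →
      ∀ z ∈ closedBall c r, u z ≤ h z

theorem IsSubharm.of_hasLap {Ω : Set ℂ} {u : ℂ → ℝ} (hc : ContinuousOn u (closure Ω))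
    (hl : ∀ z ∈ Ω, ∃ l, 0 ≤ l ∧ HasLap u l z) : IsSubharm Ω u := by
  refine ⟨hc, fun c r hr hsub h hh hb z hz => ?_⟩
  rw [← closure_ball c hr.ne'] at hz hsub
  refine le_of_hasLap_le isOpen_ball isBounded_ball (hc.mono (hsub.trans subset_closure))
    hh.continuousOn (fun z hz => ?_) (fun z hz => ?_) z hz
  · obtain ⟨l, hl0, hlap⟩ := hl z (hsub (subset_closure hz))
    exact ⟨l, 0, hl0, hlap, HarmonicOnNhd.hasLap hh.1 hz⟩
  · rw [frontier_ball c hr.ne'] at hz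
    exact hb z hz

/-- Replacing a subharmonic function by its harmonic extension on a disc. -/
theorem IsSubharm.exists_lift {Ω : Set ℂ} {u : ℂ → ℝ} (hu : IsSubharm Ω u) {c : ℂ} {r : ℝ}
    (hr : 0 < r) (hsub : closedBall c r ⊆ Ω) :
    ∃ w : ℂ → ℝ, IsSubharm Ω w ∧ (∀ z, u z ≤ w z) ∧ (∀ z ∉ Ω, w z = u z) ∧
      HarmonicOnNhd w (ball c r) ∧
      ∀ H : ℂ → ℝ, ContinuousOn H (closure Ω) → HarmonicOnNhd H Ω → (∀ z ∈ Ω, u z ≤ H z) →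
        ∀ z ∈ Ω, w z ≤ H z := by
  classical
  have hsubc : closedBall c r ⊆ closure Ω := hsub.trans subset_closure
  obtain ⟨v, hv, hvb⟩ := exists_harmonicContOnCl_ball u hr
    (hu.1.mono (sphere_subset_closedBall.trans hsubc))
  have huv : ∀ z ∈ closedBall c r, u z ≤ v z :=
    hu.2 c r hr hsub v hv fun z hz => (hvb z hz).ge
  set w : ℂ → ℝ := fun z => if z ∈ closedBall c r then v z else u z
  have hwv : ∀ z ∈ closedBall c r, w z = v z := fun z hz => if_pos hz
  have hwu : ∀ z ∉ ball c r, w z = u z := by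
    intro z hz
    by_cases h : z ∈ closedBall c r
    · rw [hwv z h]
      exact hvb z (by rw [mem_sphere]; simp at hz h; linarith)
    · exact if_neg h
  have huw : ∀ z, u z ≤ w z := by
    intro z
    by_cases h : z ∈ closedBall c r
    · rw [hwv z h]; exact huv z h
    · exact (hwu z fun h' => h (ball_subset_closedBall h')).ge
  have hcont : ContinuousOn w (closure Ω) := by
    have h1 : ContinuousOn w (closedBall c r) := hv.continuousOn_ball.congr hwv
    have h2 : ContinuousOn w (closure Ω \ ball c r) :=
      (hu.1.mono sdiff_subset).congr fun z hz => hwu z hz.2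
    have hun : closure Ω = closedBall c r ∪ closure Ω \ ball c r := by
      ext z
      constructor
      · intro hz
        by_cases h : z ∈ ball c r
        · exact Or.inl (ball_subset_closedBall h)
        · exact Or.inr ⟨hz, h⟩
      · rintro (h | h)
        · exact hsubc h
        · exact h.1
    rw [hun]
    exact h1.union_of_isClosed h2 isClosed_closedBall (isClosed_closure.sdiff isOpen_ball)
  have hharm : HarmonicOnNhd w (ball c r) := by
    intro z hz
    refine (harmonicAt_congr_nhds ?_).2 (hv.1 z hz)
    filter_upwards [isOpen_ball.mem_nhds hz] with y hy using hwv y (ball_subset_closedBall hy)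
  refine ⟨w, ⟨hcont, fun c' r' hr' hsub' h hh hb => ?_⟩, huw, fun z hz => hwu z fun h =>
    hz (hsub (ball_subset_closedBall h)), hharm, fun H hHc hH hle z hz => ?_⟩
  · have hu' : ∀ z ∈ closedBall c' r', u z ≤ h z :=
      hu.2 c' r' hr' hsub' h hh fun z hz => (huw z).trans (hb z hz)
    intro z hz
    by_cases hzb : z ∈ ball c r
    · by_cases hzs : z ∈ sphere c' r'
      · exact hb z hzs
      have hzb' : z ∈ ball c' r' := by
        rw [mem_ball]
        exact lt_of_le_of_ne hz hzs
      have hcl : closure (ball c r ∩ ball c' r') ⊆ closedBall c r ∩ closedBall c' r' :=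
        closure_minimal (inter_subset_inter ball_subset_closedBall ball_subset_closedBall)
          (isClosed_closedBall.inter isClosed_closedBall)
      refine le_of_hasLap_le (isOpen_ball.inter isOpen_ball) (isBounded_ball.subset inter_subset_left)
        (hcont.mono (hcl.trans (inter_subset_left.trans hsubc)))
        (hh.continuousOn_ball.mono (hcl.trans inter_subset_right)) (fun y hy => ?_)
        (fun y hy => ?_) z (subset_closure ⟨hzb, hzb'⟩)
      · exact ⟨0, 0, le_rfl, HarmonicOnNhd.hasLap hharm hy.1, HarmonicOnNhd.hasLap hh.1 hy.2⟩
      · have hy' := hcl hy.1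
        by_cases hyb : y ∈ ball c r
        · refine hb y (le_antisymm hy'.2 ?_)
          by_contra! hlt
          exact hy.2 (by rw [(isOpen_ball.inter isOpen_ball).interior_eq]; exact ⟨hyb, hlt⟩)
        · rw [hwu y hyb]
          exact hu' y hy'.2
    · rw [hwu z hzb]
      exact hu' z hz
  · by_cases hzb : z ∈ closedBall c r
    · rw [← closure_ball c hr.ne'] at hzb hsub hsubc
      refine le_of_hasLap_le isOpen_ball isBounded_ball (hcont.mono hsubc) (hHc.mono hsubc)
        (fun y hy => ⟨0, 0, le_rfl, HarmonicOnNhd.hasLap hharm hy,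
          HarmonicOnNhd.hasLap hH (hsub (subset_closure hy))⟩) (fun y hy => ?_) z hzb
      rw [hwu y]
      · exact hle y (hsub (frontier_subset_closure hy))
      · rw [frontier_ball c hr.ne', mem_sphere] at hy
        rw [mem_ball, hy]
        exact lt_irrefl r
    · rw [hwu z fun h => hzb (ball_subset_closedBall h)]
      exact hle z hz

/-- A barrier at a boundary point. -/
def HasBarrier (Ω : Set ℂ) (x : ℂ) : Prop :=
  ∃ b : ℂ → ℝ, ContinuousOn b (closure Ω) ∧ HarmonicOnNhd b Ω ∧ b x = 0 ∧
    ∀ z ∈ closure Ω, z ≠ x → 0 < b z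

/-- Countably many discs with closure in `Ω` cover `Ω`. -/
theorem exists_disc_cover {Ω : Set ℂ} (hΩ : IsOpen Ω) :
    ∃ (c : ℕ → ℂ) (r : ℕ → ℝ), (∀ n, 0 < r n) ∧
      ∀ z ∈ Ω, ∃ n, z ∈ ball (c n) (r n) ∧ closedBall (c n) (r n) ⊆ Ω := by
  refine ⟨fun n => TopologicalSpace.denseSeq ℂ n.unpair.1, fun n => 1 / ((n.unpair.2 : ℝ) + 1),
    fun n => by positivity, fun z hz => ?_⟩
  obtain ⟨ε, hε, hball⟩ := Metric.isOpen_iff.1 hΩ z hz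
  obtain ⟨k, hk⟩ := exists_nat_one_div_lt (half_pos hε)
  obtain ⟨i, hi⟩ := (TopologicalSpace.denseRange_denseSeq ℂ).exists_dist_lt z
    (show (0 : ℝ) < 1 / ((k : ℝ) + 1) by positivity)
  refine ⟨Nat.pair i k, ?_, ?_⟩
  · simpa using hi
  · intro y hy
    simp only [Nat.unpair_pair, mem_closedBall] at hy
    apply hball
    rw [mem_ball]
    have := dist_triangle y (TopologicalSpace.denseSeq ℂ i) z
    rw [dist_comm (TopologicalSpace.denseSeq ℂ i)] at this
    linarith

/-- Poincaré's sweeping method: a subharmonic function can be replaced by a harmonic one with the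
same boundary values. -/
theorem exists_harmonic_of_isSubharm {Ω : Set ℂ} (hΩ : IsOpen Ω) (hb : Bornology.IsBounded Ω)
    (hbar : ∀ x ∈ frontier Ω, HasBarrier Ω x) {u₀ : ℂ → ℝ} (hu₀ : IsSubharm Ω u₀) :
    ∃ h : ℂ → ℝ, ContinuousOn h (closure Ω) ∧ HarmonicOnNhd h Ω ∧
      ∀ z ∈ frontier Ω, h z = u₀ z := by
  classical
  obtain ⟨c, r, hr, hcov⟩ := exists_disc_cover hΩ
  have hlift : ∀ (u : {u : ℂ → ℝ // IsSubharm Ω u}) (n : ℕ),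
      ∃ w : {u : ℂ → ℝ // IsSubharm Ω u}, (∀ z, u.1 z ≤ w.1 z) ∧ (∀ z ∉ Ω, w.1 z = u.1 z) ∧
      (closedBall (c n) (r n) ⊆ Ω → HarmonicOnNhd w.1 (ball (c n) (r n))) ∧
      ∀ H : ℂ → ℝ, ContinuousOn H (closure Ω) → HarmonicOnNhd H Ω → (∀ z ∈ Ω, u.1 z ≤ H z) →
        ∀ z ∈ Ω, w.1 z ≤ H z := by
    intro u n
    by_cases h : closedBall (c n) (r n) ⊆ Ω
    · obtain ⟨w, h1, h2, h3, h4, h5⟩ := u.2.exists_lift (hr n) h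
      exact ⟨⟨w, h1⟩, h2, h3, fun _ => h4, h5⟩
    · exact ⟨u, fun _ => le_rfl, fun _ _ => rfl, fun h' => absurd h' h, fun H _ _ hH => hH⟩
  choose L hL1 hL2 hL3 hL4 using hlift
  let U : ℕ → {u : ℂ → ℝ // IsSubharm Ω u} := fun n =>
    Nat.rec ⟨u₀, hu₀⟩ (fun n u => L u n.unpair.1) n
  have hU0 : (U 0).1 = u₀ := rfl
  have hUs : ∀ n, U (n + 1) = L (U n) n.unpair.1 := fun n => rfl
  have hmono : ∀ z, Monotone fun n => (U n).1 z := fun z =>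
    monotone_nat_of_le_succ fun n => by rw [hUs]; exact hL1 _ _ z
  have hout : ∀ n, ∀ z ∉ Ω, (U n).1 z = u₀ z := by
    intro n z hz
    induction n with
    | zero => rw [hU0]
    | succ n ih => rw [hUs, hL2 _ _ z hz, ih]
  have hmaj : ∀ H : ℂ → ℝ, ContinuousOn H (closure Ω) → HarmonicOnNhd H Ω →
      (∀ z ∈ Ω, u₀ z ≤ H z) → ∀ n, ∀ z ∈ Ω, (U n).1 z ≤ H z := by
    intro H h1 h2 h3 n
    induction n with
    | zero => exact h3
    | succ n ih => rw [hUs]; exact hL4 _ _ H h1 h2 ih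
  have hcomp : IsCompact (closure Ω) := hb.isCompact_closure
  obtain ⟨M, hM⟩ := hcomp.exists_bound_of_continuousOn hu₀.1
  have hM' : ∀ z ∈ closure Ω, |u₀ z| ≤ M := hM
  have hbd : ∀ n, ∀ z ∈ Ω, (U n).1 z ≤ M := hmaj (fun _ => M) continuousOn_const
    (harmonicOnNhd_const M) fun z hz => (abs_le.1 (hM' z (subset_closure hz))).2
  set h : ℂ → ℝ := fun z => ⨆ n, (U n).1 z
  have htend : ∀ z ∈ Ω, Tendsto (fun n => (U n).1 z) atTop (𝓝 (h z)) := fun z hz =>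
    tendsto_atTop_ciSup (hmono z) ⟨M, by rintro _ ⟨n, rfl⟩; exact hbd n z hz⟩
  have hleh : ∀ z ∈ Ω, ∀ n, (U n).1 z ≤ h z := fun z hz n =>
    (hmono z).ge_of_tendsto (htend z hz) n
  have hfr : ∀ z ∉ Ω, h z = u₀ z := fun z hz => by
    simp only [h, hout _ z hz, ciSup_const]
  have hharm : HarmonicOnNhd h Ω := by
    intro z hz
    obtain ⟨a, hza, hsub⟩ := hcov z hz
    have hsub' : ball (c a) (r a) ⊆ Ω := ball_subset_closedBall.trans hsub
    have hca := hsub' (mem_ball_self (hr a))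
    have hpm : StrictMono fun b => Nat.pair a b + 1 := fun b b' hbb =>
      Nat.succ_lt_succ (Nat.pair_lt_pair_right a hbb)
    have ht : ∀ z ∈ Ω, Tendsto (fun b => (U (Nat.pair a b + 1)).1 z) atTop (𝓝 (h z)) :=
      fun z hz => (htend z hz).comp hpm.tendsto_atTop
    refine harmonicOnNhd_of_tendsto (hr a) (V := fun b => (U (Nat.pair a b + 1)).1)
      (δ := fun b => h (c a) - (U (Nat.pair a b + 1)).1 (c a) + 1 / ((b : ℝ) + 1))
      (fun b => ?_) (fun b => ?_) ?_ (fun m n hmn y hy => ?_) (fun y hy => ht y (hsub' hy)) z hza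
    · have := hL3 (U (Nat.pair a b)) a hsub
      rw [hUs]
      simpa using this
    · have := hleh (c a) hca (Nat.pair a b + 1)
      have : (0 : ℝ) < 1 / ((b : ℝ) + 1) := by positivity
      linarith
    · have := ((ht (c a) hca).const_sub (h (c a))).add tendsto_one_div_add_atTop_nhds_zero_nat
      simpa using this
    · have h1 := hleh (c a) hca (Nat.pair a n + 1)
      have h2 := hmono y (hpm.monotone hmn)
      have : (0 : ℝ) < 1 / ((m : ℝ) + 1) := by positivity
      simp only at h2 ⊢
      linarith
  refine ⟨h, fun x hx => ?_, hharm, fun z hz => hfr z fun hz' => ?_⟩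
  · by_cases hxΩ : x ∈ Ω
    · exact (hharm x hxΩ).1.continuousAt.continuousWithinAt
    have hxf : x ∈ frontier Ω := by rw [hΩ.frontier_eq]; exact ⟨hx, hxΩ⟩
    obtain ⟨b, hbc, hbh, hb0, hbpos⟩ := hbar x hxf
    have hlow : ∀ z ∈ closure Ω, u₀ z ≤ h z := by
      intro z hz
      by_cases hzΩ : z ∈ Ω
      · exact hleh z hzΩ 0
      · exact (hfr z hzΩ).ge
    have hbnn : ∀ z ∈ closure Ω, 0 ≤ b z := by
      intro z hz
      by_cases hzx : z = x
      · rw [hzx, hb0]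
      · exact (hbpos z hz hzx).le
    rw [ContinuousWithinAt, hfr x hxΩ, Metric.tendsto_nhds]
    intro ε hε
    have hu0x : ∀ᶠ z in 𝓝[closure Ω] x, dist (u₀ z) (u₀ x) < ε / 3 :=
      Metric.tendsto_nhds.1 (hu₀.1 x hx) (ε / 3) (by positivity)
    obtain ⟨δ, hδ, hδu⟩ := Metric.mem_nhdsWithin_iff.1 hu0x
    obtain ⟨β, hβ, hβb⟩ : ∃ β > 0, ∀ z ∈ closure Ω \ ball x δ, β ≤ b z := by
      rcases (closure Ω \ ball x δ).eq_empty_or_nonempty with he | hne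
      · exact ⟨1, one_pos, by rw [he]; simp⟩
      · obtain ⟨y, hy, hymin⟩ := (hcomp.diff isOpen_ball).exists_isMinOn hne
          (hbc.mono sdiff_subset)
        refine ⟨b y, hbpos y hy.1 fun h => hy.2 (by rw [h]; exact mem_ball_self hδ), ?_⟩
        exact fun z hz => hymin hz
    have hM0 : 0 ≤ M := (abs_nonneg _).trans (hM' x hx)
    set C := 2 * M / β
    have hC0 : 0 ≤ C := by positivity
    have hCβ : C * β = 2 * M := by simp only [C]; field_simp
    have hup : ∀ z ∈ Ω, h z ≤ u₀ x + ε / 3 + C * b z := by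
      intro z hz
      refine le_of_tendsto' (htend z hz) fun n => ?_
      refine hmaj (fun z => u₀ x + ε / 3 + C * b z) (by fun_prop)
        (harmonicOnNhd_of_hasLap hΩ fun y hy => ((HasLap.const _).add
          ((HarmonicOnNhd.hasLap hbh hy).const_mul C)).congr_value (by simp)) (fun y hy => ?_) n z hz
      have hyc := subset_closure hy
      by_cases hyb : y ∈ ball x δ
      · have h1 : dist (u₀ y) (u₀ x) < ε / 3 := hδu ⟨hyb, hyc⟩
        rw [Real.dist_eq] at h1
        have := abs_lt.1 h1
        have := mul_nonneg hC0 (hbnn y hyc)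
        linarith
      · have h1 := hβb y ⟨hyc, hyb⟩
        have h2 : C * β ≤ C * b y := by gcongr
        have h3 := abs_le.1 (hM' y hyc)
        have h4 := abs_le.1 (hM' x hx)
        linarith
    have hbx : ∀ᶠ z in 𝓝[closure Ω] x, C * b z < ε / 3 := by
      have : Tendsto (fun z => C * b z) (𝓝[closure Ω] x) (𝓝 (C * b x)) := (hbc x hx).const_mul C
      rw [hb0, mul_zero] at this
      exact this.eventually (gt_mem_nhds (by positivity))
    filter_upwards [hu0x, hbx, self_mem_nhdsWithin] with z h1 h2 h3
    rw [Real.dist_eq, abs_lt] at h1 ⊢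
    have h4 := hlow z h3
    refine ⟨by linarith, ?_⟩
    by_cases hzΩ : z ∈ Ω
    · have := hup z hzΩ
      linarith
    · rw [hfr z hzΩ]; linarith
  · rw [hΩ.frontier_eq] at hz
    exact hz.2 hz'

/-- Solvability of the Dirichlet problem for the Laplace equation with `C²` data. -/
theorem exists_harmonic_dirichlet {Ω : Set ℂ} (hΩ : IsOpen Ω) (hb : Bornology.IsBounded Ω)
    (hbar : ∀ x ∈ frontier Ω, HasBarrier Ω x) {q : ℂ → ℝ} (hq : ContinuousOn q (closure Ω))
    {K : ℝ} (hK : ∀ z ∈ Ω, ∃ l, |l| ≤ K ∧ HasLap q l z) :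
    ∃ h : ℂ → ℝ, ContinuousOn h (closure Ω) ∧ HarmonicOnNhd h Ω ∧
      ∀ z ∈ frontier Ω, h z = q z := by
  rcases Ω.eq_empty_or_nonempty with rfl | ⟨x, hx⟩
  · exact ⟨0, by simp, fun x hx => absurd hx (notMem_empty x), by simp⟩
  have hK0 : 0 ≤ K := by
    obtain ⟨l, hl, _⟩ := hK x hx
    exact (abs_nonneg l).trans hl
  obtain ⟨h₁, a1, a2, a3⟩ := exists_harmonic_of_isSubharm hΩ hb hbar
    (u₀ := fun z => q z + K * ‖z‖ ^ 2) (IsSubharm.of_hasLap (by fun_prop) fun z hz => by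
      obtain ⟨l, hl, hlap⟩ := hK z hz
      refine ⟨l + K * 4, ?_, hlap.add (HasLap.norm_sq.const_mul K)⟩
      linarith [(abs_le.1 hl).1])
  obtain ⟨h₂, b1, b2, b3⟩ := exists_harmonic_of_isSubharm hΩ hb hbar
    (u₀ := fun z => K * ‖z‖ ^ 2) (IsSubharm.of_hasLap (by fun_prop) fun z hz =>
      ⟨K * 4, by positivity, HasLap.norm_sq.const_mul K⟩)
  exact ⟨fun z => h₁ z - h₂ z, a1.sub b1, a2.sub b2, fun z hz => by simp only [a3 z hz, b3 z hz]; ring⟩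

/-- An exterior disc touching only at `x` yields a barrier. -/
theorem HasBarrier.of_exterior_ball {Ω : Set ℂ} {x y : ℂ} {R : ℝ} (hR : 0 < R)
    (hx : ‖x - y‖ = R) (hext : ∀ z ∈ closure Ω, z ≠ x → R < ‖z - y‖) : HasBarrier Ω x := by
  have hpos : ∀ z ∈ closure Ω, 0 < ‖z - y‖ := by
    intro z hz
    by_cases h : z = x
    · rw [h, hx]; exact hR
    · exact hR.trans (hext z hz h)
  refine ⟨fun z => Real.log ‖z - y‖ - Real.log R, ?_, ?_, by simp [hx], fun z hz hzx =>
    sub_pos.2 (Real.log_lt_log hR (hext z hz hzx))⟩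
  · refine ContinuousOn.sub ?_ continuousOn_const
    exact ContinuousOn.log (by fun_prop) fun z hz => (hpos z hz).ne'
  · intro z hz
    have hne : z - y ≠ 0 := norm_pos_iff.1 (hpos z (subset_closure hz))
    exact (AnalyticAt.harmonicAt_log_norm (f := fun w => w - y) (by fun_prop) hne).sub
      (harmonicAt_const _)

/-- In the rotated coordinate `y` centred at the boundary point `x`, the domain `Ω` lies between
two parabolas and its boundary is a parabola up to a cubic error. -/
def BoundaryChart (Ω : Set ℂ) (K ρ : ℝ) (x : ℂ) : Prop :=
  ∃ (n : ℂ) (κ : ℝ), ‖n‖ = 1 ∧ |κ| ≤ K ∧ ∀ y : ℂ, ‖y‖ < ρ →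
    (x + n * y ∈ Ω → y.re ≤ K * ‖y‖ ^ 2) ∧ (y.re < -(K * ‖y‖ ^ 2) → x + n * y ∈ Ω) ∧
    (x + n * y ∈ frontier Ω → |y.re + κ / 2 * y.im ^ 2| ≤ K * ‖y‖ ^ 3)

theorem BoundaryChart.mono {Ω : Set ℂ} {K K' ρ ρ' : ℝ} {x : ℂ} (h : BoundaryChart Ω K ρ x)
    (hK : K ≤ K') (hρ : ρ' ≤ ρ) : BoundaryChart Ω K' ρ' x := by
  obtain ⟨n, κ, hn, hκ, H⟩ := h
  refine ⟨n, κ, hn, hκ.trans hK, fun y hy => ?_⟩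
  obtain ⟨h1, h2, h3⟩ := H y (hy.trans_le hρ)
  have e2 : K * ‖y‖ ^ 2 ≤ K' * ‖y‖ ^ 2 := by gcongr
  have e3 : K * ‖y‖ ^ 3 ≤ K' * ‖y‖ ^ 3 := by gcongr
  exact ⟨fun h => (h1 h).trans e2, fun h => h2 (by linarith), fun h => (h3 h).trans e3⟩

set_option maxSynthPendingDepth 3 in
/-- Second order Taylor expansion with a cubic remainder, uniformly near a point. -/
theorem exists_taylor_cubic {f : ℂ → ℝ} (hf : ContDiff ℝ 3 f) (x₀ : ℂ) :
    ∃ M, 0 < M ∧ ∀ x ∈ ball x₀ 1, ∀ h : ℂ, ‖h‖ < 1 →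
      |f (x + h) - f x - fderiv ℝ f x h - 1 / 2 * fderiv ℝ (fderiv ℝ f) x h h| ≤ M * ‖h‖ ^ 3 ∧
      ‖fderiv ℝ (fderiv ℝ f) x‖ ≤ M := by
  have h1 : ContDiff ℝ 2 (fderiv ℝ f) := hf.fderiv_right (by norm_num)
  have h2 : ContDiff ℝ 1 (fderiv ℝ (fderiv ℝ f)) := h1.fderiv_right (by norm_num)
  have h3 : Continuous (fderiv ℝ (fderiv ℝ (fderiv ℝ f))) := h2.continuous_fderiv (by norm_num)
  obtain ⟨M1, hM1⟩ := (isCompact_closedBall x₀ 2).exists_bound_of_continuousOn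
    (f := fderiv ℝ (fderiv ℝ (fderiv ℝ f))) h3.continuousOn
  obtain ⟨M2, hM2⟩ := (isCompact_closedBall x₀ 2).exists_bound_of_continuousOn
    h2.continuous.continuousOn
  have hM10 : 0 ≤ M1 := (norm_nonneg _).trans (hM1 x₀ (by simp))
  have hM20 : 0 ≤ M2 := (norm_nonneg _).trans (hM2 x₀ (by simp))
  refine ⟨M1 + M2 + 1, by positivity, fun x hx h hh => ⟨?_, ?_⟩⟩
  swap
  · refine (hM2 x (ball_subset_closedBall (ball_subset_ball (by norm_num) hx))).trans (by linarith)
  have hsub : ∀ y ∈ closedBall x ‖h‖, y ∈ closedBall x₀ 2 := fun y hy => by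
    rw [mem_closedBall] at *
    rw [mem_ball] at hx
    linarith [dist_triangle y x x₀]
  have hL : ∀ y ∈ closedBall x ‖h‖,
      ‖fderiv ℝ (fderiv ℝ f) y - fderiv ℝ (fderiv ℝ f) x‖ ≤ M1 * ‖h‖ := fun y hy => by
    have := (convex_closedBall x ‖h‖).norm_image_sub_le_of_norm_fderiv_le (𝕜 := ℝ)
      (f := fderiv ℝ (fderiv ℝ f)) (C := M1)
      (fun z _ => (h2.differentiable (by norm_num)) z) (fun z hz => hM1 z (hsub z hz))
      (mem_closedBall_self (norm_nonneg h)) hy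
    refine this.trans ?_
    rw [mem_closedBall, dist_eq_norm] at hy
    gcongr
  set H := fderiv ℝ (fderiv ℝ f) x with hH
  have hsymm : ∀ u v, H u v = H v u := by
    have := (hf.contDiffAt (x := x)).isSymmSndFDerivAt (by norm_num)
    exact fun u v => this u v
  have hD1 : ∀ y, HasFDerivAt (fun y => fderiv ℝ f y - H (y - x))
      (fderiv ℝ (fderiv ℝ f) y - H) y := fun y => by
    have a := ((h1.differentiable (by norm_num)) y).hasFDerivAt
    have b : HasFDerivAt (fun y => H (y - x)) H y := by
      exact H.hasFDerivAt.comp (f := fun y => y - x) y ((hasFDerivAt_id y).sub_const x)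
    exact a.sub b
  have hS1 : ∀ y ∈ closedBall x ‖h‖,
      ‖fderiv ℝ f y - fderiv ℝ f x - H (y - x)‖ ≤ M1 * ‖h‖ * ‖h‖ := fun y hy => by
    have := (convex_closedBall x ‖h‖).norm_image_sub_le_of_norm_hasFDerivWithin_le (𝕜 := ℝ)
      (C := M1 * ‖h‖) (fun z _ => (hD1 z).hasFDerivWithinAt) hL
      (mem_closedBall_self (norm_nonneg h)) hy
    rw [mem_closedBall, dist_eq_norm] at hy
    simp only [sub_self, map_zero, sub_zero] at this
    rw [show fderiv ℝ f y - fderiv ℝ f x - H (y - x) = fderiv ℝ f y - H (y - x) - fderiv ℝ f x by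
      abel]
    exact this.trans (by gcongr)
  have hD0 : ∀ y, HasFDerivAt (fun y => f y - fderiv ℝ f x (y - x) - 1 / 2 * H (y - x) (y - x))
      (fderiv ℝ f y - fderiv ℝ f x - H (y - x)) y := fun y => by
    have a := ((hf.differentiable (by norm_num)) y).hasFDerivAt
    have b : HasFDerivAt (fun y => fderiv ℝ f x (y - x)) (fderiv ℝ f x) y := by
      exact (fderiv ℝ f x).hasFDerivAt.comp (f := fun y => y - x) y ((hasFDerivAt_id y).sub_const x)
    have c : HasFDerivAt (fun y => H (y - x)) H y := by
      exact H.hasFDerivAt.comp (f := fun y => y - x) y ((hasFDerivAt_id y).sub_const x)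
    have d := (c.clm_apply ((hasFDerivAt_id y).sub_const x)).const_mul (1 / 2)
    refine ((a.sub b).sub d).congr_fderiv ?_
    ext v
    simp [hsymm v]
    ring
  have := (convex_closedBall x ‖h‖).norm_image_sub_le_of_norm_hasFDerivWithin_le (𝕜 := ℝ)
      (C := M1 * ‖h‖ * ‖h‖) (y := x + h) (fun z _ => (hD0 z).hasFDerivWithinAt) hS1
      (mem_closedBall_self (norm_nonneg h)) (by simp)
  simp only [sub_self, map_zero, sub_zero, add_sub_cancel_left, mul_zero, Real.norm_eq_abs] at this
  rw [show f (x + h) - f x - fderiv ℝ f x h - 1 / 2 * H h h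
    = f (x + h) - fderiv ℝ f x h - 1 / 2 * H h h - f x by ring]
  refine this.trans ?_
  have : 0 ≤ ‖h‖ ^ 3 := by positivity
  nlinarith

/-- A function with the expansion `y.re + Q y + O(‖y‖ ^ 3)` has a nearly parabolic zero set. -/
theorem parabola_of_expansion {a b b' c N F : ℝ} {y : ℂ} (hN0 : 0 < N) (ha1 : -N ≤ a ∧ a ≤ N)
    (hb1 : -N ≤ b ∧ b ≤ N) (hb1' : -N ≤ b' ∧ b' ≤ N) (hc1 : |c| ≤ N) (hy2 : ‖y‖ < 1 / 2)
    (hk : |F - y.re - 1 / 2 * (a * y.re ^ 2 + (b + b') * (y.re * y.im) + c * y.im ^ 2)|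
      ≤ N * ‖y‖ ^ 3) :
    (F < 0 → y.re ≤ (8 * N + 28 * N * N) * ‖y‖ ^ 2) ∧
    (y.re < -((8 * N + 28 * N * N) * ‖y‖ ^ 2) → F < 0) ∧
    (F = 0 → |y.re + c / 2 * y.im ^ 2| ≤ (8 * N + 28 * N * N) * ‖y‖ ^ 3) := by
  replace hk := abs_le.1 hk
  have hc2 := abs_le.1 hc1
  have hre := Complex.abs_re_le_norm y
  have him := Complex.abs_im_le_norm y
  have hnn : ‖y‖ ^ 2 = y.re ^ 2 + y.im ^ 2 := by
    rw [Complex.sq_norm, Complex.normSq_apply]; ring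
  set R := ‖y‖ with hR
  have hR0 : 0 ≤ R := norm_nonneg y
  have hR3 : R ^ 3 ≤ R ^ 2 / 2 := by nlinarith [sq_nonneg R]
  have hp1 : |y.re * y.im| ≤ |y.re| * R := by rw [abs_mul]; gcongr
  have hp1' : |y.re| * R ≤ R ^ 2 := by nlinarith
  have hquad : |1 / 2 * (a * y.re ^ 2 + (b + b') * (y.re * y.im))| ≤ 3 / 2 * N * (|y.re| * R) := by
    have e1 : |a * y.re ^ 2| ≤ N * (|y.re| * R) := by
      rw [abs_mul, abs_of_nonneg (sq_nonneg y.re), ← sq_abs, sq]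
      exact mul_le_mul (abs_le.2 ha1) (by gcongr) (by positivity) hN0.le
    have e2 : |(b + b') * (y.re * y.im)| ≤ 2 * N * (|y.re| * R) := by
      rw [abs_mul]
      exact mul_le_mul (abs_le.2 ⟨by linarith, by linarith⟩) hp1 (by positivity) (by positivity)
    rw [abs_mul, abs_of_nonneg (by norm_num : (0 : ℝ) ≤ 1 / 2)]
    linarith [abs_add_le (a * y.re ^ 2) ((b + b') * (y.re * y.im))]
  have hq2 := abs_le.1 hquad
  have hcc : |1 / 2 * (c * y.im ^ 2)| ≤ 1 / 2 * N * R ^ 2 := by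
    rw [abs_mul, abs_mul, abs_of_nonneg (by norm_num : (0 : ℝ) ≤ 1 / 2), abs_of_nonneg (sq_nonneg y.im),
      ← sq_abs y.im, mul_assoc]
    gcongr
  have hcc2 := abs_le.1 hcc
  have hP : 3 / 2 * N * (|y.re| * R) ≤ 3 / 2 * N * R ^ 2 := by gcongr
  have hNR : N * R ^ 3 ≤ N * (R ^ 2 / 2) := by gcongr
  have hNN : 0 ≤ N * N * R ^ 2 := by positivity
  have hNR2 : 0 ≤ N * R ^ 2 := by positivity
  clear_value R
  refine ⟨fun h3 => ?_, fun h3 => ?_, fun h3 => ?_⟩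
  · linarith
  · linarith
  · rw [h3] at hk
    have hre2 : |y.re| ≤ 4 * N * R ^ 2 := by
      rw [abs_le]
      constructor <;> linarith
    have hq3 : 3 / 2 * N * (|y.re| * R) ≤ 3 / 2 * N * (4 * N * R ^ 2 * R) := by gcongr
    have hR30 : 0 ≤ N * N * R ^ 3 := by positivity
    have hR31 : 0 ≤ N * R ^ 3 := by positivity
    have e : 3 / 2 * N * (4 * N * R ^ 2 * R) = 6 * (N * N * R ^ 3) := by ring
    rw [abs_le]
    constructor <;> linarith

theorem boundaryChart_of_levelSet {Ω U : Set ℂ} {f : ℂ → ℝ} (hO : IsOpen Ω) (hU : IsOpen U)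
    (hf : ContDiff ℝ 3 f) (hΩU : Ω ∩ U = {y ∈ U | f y < 0}) {x₀ : ℂ} (hx₀ : x₀ ∈ U)
    (hd : fderiv ℝ f x₀ ≠ 0) :
    ∃ K ρ r, 0 < ρ ∧ 0 < r ∧ ∀ x ∈ frontier Ω ∩ ball x₀ r, BoundaryChart Ω K ρ x := by
  obtain ⟨M, hM, HM⟩ := exists_taylor_cubic hf x₀
  obtain ⟨r₁, hr₁, hrU⟩ := Metric.isOpen_iff.1 hU x₀ hx₀
  let g : ℂ → ℂ := fun x => ⟨fderiv ℝ f x 1, fderiv ℝ f x Complex.I⟩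
  have hg : ∀ x h, fderiv ℝ f x h = (g x).re * h.re + (g x).im * h.im := fun x h => by
    have : h = h.re • (1 : ℂ) + h.im • Complex.I := by
      apply Complex.ext <;> simp
    conv_lhs => rw [this]
    simp only [map_add, map_smul, smul_eq_mul, g]
    ring
  have hgc : Continuous g := by
    have h1 := hf.continuous_fderiv (by norm_num)
    have : g = fun x => ((fderiv ℝ f x 1 : ℝ) : ℂ) + ((fderiv ℝ f x Complex.I : ℝ) : ℂ) * Complex.I :=
      by ext x; apply Complex.ext <;> simp [g]
    rw [this]
    fun_prop
  have hg0 : 0 < ‖g x₀‖ := by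
    rw [norm_pos_iff]
    intro h0
    apply hd
    ext h
    all_goals simp [hg, h0]
  obtain ⟨r₂, hr₂, hgr⟩ := Metric.continuousAt_iff.1 (hgc.norm.continuousAt (x := x₀)) (‖g x₀‖ / 2)
    (by positivity)
  set m := ‖g x₀‖ / 2 with hm
  have hm0 : 0 < m := by positivity
  set N := M / m with hN
  have hN0 : 0 < N := by positivity
  refine ⟨8 * N + 28 * N * N, min (r₁ / 2) (1/2), min (r₁ / 2) (min r₂ 1), by positivity,
    by positivity, ?_⟩
  rintro x ⟨hxF, hxb⟩
  rw [mem_ball] at hxb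
  have b1 : dist x x₀ < r₁ / 2 := hxb.trans_le (min_le_left _ _)
  have b2 : dist x x₀ < r₂ := hxb.trans_le ((min_le_right _ _).trans (min_le_left _ _))
  have b3 : dist x x₀ < 1 := hxb.trans_le ((min_le_right _ _).trans (min_le_right _ _))
  have hgx : m ≤ ‖g x‖ := by
    have := hgr b2
    rw [Real.dist_eq] at this
    linarith [(abs_lt.1 this).1]
  have hgx0 : 0 < ‖g x‖ := hm0.trans_le hgx
  -- level set description of the frontier
  have hfr : ∀ z ∈ frontier Ω, z ∈ U → f z = 0 := fun z hz hzU => by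
    apply le_antisymm
    · by_contra! hpos
      have hev : ∀ᶠ w in 𝓝 z, w ∈ U ∧ 0 < f w :=
        (show ∀ᶠ w in 𝓝 z, w ∈ U from hU.mem_nhds hzU).and (hf.continuous.continuousAt.eventually (lt_mem_nhds hpos))
      obtain ⟨w, ⟨hw1, hw2⟩, hw3⟩ := (mem_closure_iff_nhds.1 (frontier_subset_closure hz)) _ hev
      have : w ∈ {y ∈ U | f y < 0} := hΩU ▸ ⟨hw3, hw1⟩
      linarith [this.2]
    · by_contra! hneg
      have : z ∈ Ω ∩ U := hΩU ▸ ⟨hzU, hneg⟩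
      rw [hO.frontier_eq] at hz
      exact hz.2 this.1
  have hxU : x ∈ U := hrU (by rw [mem_ball]; linarith)
  have hfx := hfr x hxF hxU
  set n : ℂ := g x / ‖g x‖ with hn
  have hn1 : ‖n‖ = 1 := by
    rw [hn, norm_div, Complex.norm_real, norm_norm, div_self hgx0.ne']
  set H := fderiv ℝ (fderiv ℝ f) x with hH
  have hHM : ‖H‖ ≤ M := (HM x (by rwa [mem_ball]) 0 (by simp)).2
  have hB : ∀ u v : ℂ, ‖u‖ = 1 → ‖v‖ = 1 → |H u v / ‖g x‖| ≤ N := fun u v hu hv => by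
    rw [abs_div, abs_of_pos hgx0, hN]
    have : |H u v| ≤ ‖H‖ * ‖u‖ * ‖v‖ := H.le_opNorm₂ u v
    rw [hu, hv, mul_one, mul_one] at this
    exact div_le_div₀ hM.le (this.trans hHM) hm0 hgx
  have hnI : ‖n * Complex.I‖ = 1 := by rw [norm_mul, hn1, Complex.norm_I, mul_one]
  set a := H n n / ‖g x‖ with ha
  set b := H n (n * Complex.I) / ‖g x‖ with hb
  set b' := H (n * Complex.I) n / ‖g x‖ with hb'
  set c := H (n * Complex.I) (n * Complex.I) / ‖g x‖ with hc
  have ha1 := abs_le.1 (hB n n hn1 hn1)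
  have hb1 := abs_le.1 (hB n _ hn1 hnI)
  have hb1' := abs_le.1 (hB _ n hnI hn1)
  have hc1 := hB _ _ hnI hnI
  rw [← ha] at ha1
  rw [← hb] at hb1
  rw [← hb'] at hb1'
  rw [← hc] at hc1
  have hkey : ∀ y : ℂ, ‖y‖ < 1 → |f (x + n * y) / ‖g x‖ - y.re -
      1 / 2 * (a * y.re ^ 2 + (b + b') * (y.re * y.im) + c * y.im ^ 2)| ≤ N * ‖y‖ ^ 3 := by
    intro y hy
    have h1 := (HM x (by rwa [mem_ball]) (n * y) (by rwa [norm_mul, hn1, one_mul])).1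
    rw [hfx, norm_mul, hn1, one_mul, sub_zero] at h1
    have e1 : fderiv ℝ f x (n * y) = ‖g x‖ * y.re := by
      rw [hg]
      have hh : (g x).re ^ 2 + (g x).im ^ 2 = ‖g x‖ ^ 2 := by
        rw [Complex.sq_norm, Complex.normSq_apply]; ring
      have r1 : n.re = (g x).re / ‖g x‖ := by simp [hn]
      have r2 : n.im = (g x).im / ‖g x‖ := by simp [hn]
      rw [Complex.mul_re, Complex.mul_im, r1, r2]
      field_simp
      linear_combination y.re * hh
    have e2 : H (n * y) (n * y) = ‖g x‖ * (a * y.re ^ 2 + (b + b') * (y.re * y.im) + c * y.im ^ 2) := by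
      have : n * y = y.re • n + y.im • (n * Complex.I) := by
        conv_lhs => rw [← Complex.re_add_im y]
        simp only [Complex.real_smul]
        ring
      rw [this]
      simp only [map_add, map_smul, _root_.add_apply, _root_.smul_apply, smul_eq_mul, ha, hb, hb', hc]
      field_simp
      ring
    rw [← hH, e1, e2] at h1
    have h2 : f (x + n * y) / ‖g x‖ - y.re -
      1 / 2 * (a * y.re ^ 2 + (b + b') * (y.re * y.im) + c * y.im ^ 2) =
      (f (x + n * y) - ‖g x‖ * y.re -
      1 / 2 * (‖g x‖ * (a * y.re ^ 2 + (b + b') * (y.re * y.im) + c * y.im ^ 2))) / ‖g x‖ := by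
      field_simp
    rw [h2, abs_div, abs_of_pos hgx0, hN, div_le_iff₀ hgx0]
    refine h1.trans ?_
    rw [div_mul_eq_mul_div, div_mul_eq_mul_div, le_div_iff₀ hm0]
    gcongr
  refine ⟨n, c, hn1, hc1.trans (by nlinarith), fun y hy => ?_⟩
  have hy1 : ‖y‖ < r₁ / 2 := hy.trans_le (min_le_left _ _)
  have hy2 : ‖y‖ < 1 / 2 := hy.trans_le (min_le_right _ _)
  have hzU : x + n * y ∈ U := hrU (by
    rw [mem_ball, dist_eq_norm]
    calc ‖x + n * y - x₀‖ = ‖(x - x₀) + n * y‖ := by ring_nf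
      _ ≤ ‖x - x₀‖ + ‖n * y‖ := norm_add_le _ _
      _ < r₁ / 2 + r₁ / 2 := by
        rw [norm_mul, hn1, one_mul]
        exact add_lt_add (by rwa [← dist_eq_norm]) hy1
      _ = r₁ := by ring)
  obtain ⟨p1, p2, p3⟩ := parabola_of_expansion hN0 ha1 hb1 hb1' hc1 hy2 (hkey y (by linarith))
  refine ⟨fun h => p1 ?_, fun h => ?_, fun h => p3 ?_⟩
  · have : x + n * y ∈ {y ∈ U | f y < 0} := hΩU ▸ ⟨h, hzU⟩
    exact div_neg_of_neg_of_pos this.2 hgx0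
  · have h4 : f (x + n * y) < 0 := by
      by_contra! h5
      exact absurd (div_nonneg h5 hgx0.le) (not_le.2 (p2 h))
    have : x + n * y ∈ Ω ∩ U := hΩU ▸ ⟨hzU, h4⟩
    exact this.1
  · rw [hfr _ h hzU, zero_div]

theorem exists_uniform_boundaryChart {Ω : Set ℂ} (hO : IsOpen Ω) (hb : Bornology.IsBounded Ω)
    (h : ∀ x ∈ frontier Ω, ∃ (U : Set ℂ) (f : ℂ → ℝ), IsOpen U ∧ x ∈ U ∧ ContDiff ℝ 3 f ∧
      (∀ y ∈ U, fderiv ℝ f y ≠ 0) ∧ Ω ∩ U = {y ∈ U | f y < 0}) :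
    ∃ K ρ, 1 ≤ K ∧ 0 < ρ ∧ ∀ x ∈ frontier Ω, BoundaryChart Ω K ρ x := by
  have hc : IsCompact (frontier Ω) :=
    Metric.isCompact_of_isClosed_isBounded isClosed_frontier
      (hb.closure.subset frontier_subset_closure)
  refine hc.induction_on (p := fun s => ∃ K ρ, 1 ≤ K ∧ 0 < ρ ∧ ∀ x ∈ s, BoundaryChart Ω K ρ x)
    ⟨1, 1, le_rfl, one_pos, by simp⟩ ?_ ?_ ?_
  · rintro s t hst ⟨K, ρ, hK, hρ, H⟩
    exact ⟨K, ρ, hK, hρ, fun x hx => H x (hst hx)⟩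
  · rintro s t ⟨K, ρ, hK, hρ, H⟩ ⟨K', ρ', hK', hρ', H'⟩
    refine ⟨max K K', min ρ ρ', hK.trans (le_max_left _ _), lt_min hρ hρ', ?_⟩
    rintro x (hx | hx)
    · exact (H x hx).mono (le_max_left _ _) (min_le_left _ _)
    · exact (H' x hx).mono (le_max_right _ _) (min_le_right _ _)
  · intro x hx
    obtain ⟨U, f, hU, hxU, hf, hd, hΩ⟩ := h x hx
    obtain ⟨K, ρ, r, hρ, hr, H⟩ := boundaryChart_of_levelSet hO hU hf hΩ hxU (hd x hxU)
    exact ⟨frontier Ω ∩ ball x r, inter_mem_nhdsWithin _ (ball_mem_nhds x hr),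
      max K 1, ρ, le_max_right _ _, hρ, fun y hy => (H y hy).mono (le_max_left _ _) le_rfl⟩

/-- The exterior ball condition coming from a boundary chart. -/
theorem BoundaryChart.exterior_ball {Ω : Set ℂ} {K ρ R : ℝ} {x : ℂ} (h : BoundaryChart Ω K ρ x)
    (hR : 0 < R) (hRK : 4 * K * R ≤ 1) (hRρ : 4 * R ≤ ρ) :
    ∃ y, ‖x - y‖ = R ∧ ∀ z ∈ closure Ω, z ≠ x → R < ‖z - y‖ := by
  obtain ⟨n, κ, hn, hκ, H⟩ := h
  have hn0 : n ≠ 0 := by rw [← norm_pos_iff, hn]; exact one_pos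
  refine ⟨x + n * R, by simp [hn, abs_of_pos hR], fun z hz hzx => ?_⟩
  set y := (z - x) / n with hy
  have hzy : z = x + n * y := by rw [hy, mul_div_cancel₀ _ hn0]; ring
  have hy0 : 0 < ‖y‖ := by
    rw [norm_pos_iff, hy]
    exact div_ne_zero (sub_ne_zero.2 hzx) hn0
  have hnorm : ‖z - (x + n * R)‖ = ‖y - R‖ := by
    rw [hzy, show x + n * y - (x + n * R) = n * (y - R) by ring, norm_mul, hn, one_mul]
  rw [hnorm]
  by_cases hyρ : ‖y‖ < ρ
  · have hle : y.re ≤ K * ‖y‖ ^ 2 := by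
      have hcl : z ∈ closure (Ω ∩ {w | ‖(w - x) / n‖ < ρ}) := by
        refine mem_closure_iff_nhds.2 fun t ht => ?_
        have hop : {w : ℂ | ‖(w - x) / n‖ < ρ} ∈ 𝓝 z :=
          (isOpen_lt (by fun_prop) continuous_const).mem_nhds hyρ
        obtain ⟨w, hw1, hw2⟩ := mem_closure_iff_nhds.1 hz _ (inter_mem ht hop)
        exact ⟨w, hw1.1, hw2, hw1.2⟩
      have hcc : IsClosed {w : ℂ | ((w - x) / n).re ≤ K * ‖(w - x) / n‖ ^ 2} :=
        isClosed_le (Complex.continuous_re.comp (by fun_prop)) (by fun_prop)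
      refine closure_minimal ?_ hcc hcl
      rintro w ⟨hw1, hw2⟩
      refine (H _ hw2).1 ?_
      rwa [mul_div_cancel₀ _ hn0, add_sub_cancel]
    have h2 : R ^ 2 < ‖y - R‖ ^ 2 := by
      have e1 : ‖y‖ ^ 2 = y.re ^ 2 + y.im ^ 2 := by
        rw [Complex.sq_norm, Complex.normSq_apply]; ring
      have e2 : ‖y - R‖ ^ 2 = (y.re - R) ^ 2 + y.im ^ 2 := by
        rw [Complex.sq_norm, Complex.normSq_apply]; simp; ring
      have : 0 < ‖y‖ ^ 2 := by positivity
      nlinarith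
    exact lt_of_pow_lt_pow_left₀ 2 (norm_nonneg _) h2
  · have := norm_sub_norm_le y R
    rw [Complex.norm_real, Real.norm_of_nonneg hR.le] at this
    linarith [not_lt.1 hyρ]

theorem abs_sub_le_of_hasLap {D : Set ℂ} (hD : IsOpen D) (hD1 : D ⊆ closedBall 0 1) {v V : ℂ → ℝ}
    {ε η : ℝ} (hη : 0 ≤ η) (hv : ContinuousOn v (closure D)) (hV : ContinuousOn V (closure D))
    (hl : ∀ z ∈ D, (∃ l, |l| ≤ η ∧ HasLap v l z) ∧ HasLap V 0 z)
    (hb : ∀ z ∈ frontier D, |v z - V z| ≤ ε) : ∀ z ∈ closure D, |v z - V z| ≤ ε + η := by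
  have hcl : closure D ⊆ closedBall 0 1 := closure_minimal hD1 isClosed_closedBall
  have hbd : Bornology.IsBounded D := isBounded_closedBall.subset hD1
  have hq : ∀ z ∈ frontier D, 0 ≤ η * (1 - ‖z‖ ^ 2) := fun z hz => by
    have := mem_closedBall_zero_iff.1 (hcl (frontier_subset_closure hz))
    refine mul_nonneg hη ?_
    nlinarith [norm_nonneg z]
  have hB : ∀ z, HasLap (fun w => (ε + η) - η * ‖w‖ ^ 2) (-(4 * η)) z := fun z =>
    ((HasLap.const _).sub (HasLap.norm_sq.const_mul η)).congr_value (by ring)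
  have hBc : Continuous (fun w : ℂ => (ε + η) - η * ‖w‖ ^ 2) := by fun_prop
  have h1 := le_of_hasLap_le hD hbd hv (hV.add hBc.continuousOn) (fun z hz => by
    obtain ⟨⟨l, hl1, hl2⟩, hl3⟩ := hl z hz
    exact ⟨l, _, by linarith [(abs_le.1 hl1).1], hl2, hl3.add (hB z)⟩) (fun z hz => by
    simp only [Pi.add_apply]
    linarith [(abs_le.1 (hb z hz)).2, hq z hz])
  have h2 := le_of_hasLap_le hD hbd (hV.sub hBc.continuousOn) hv (fun z hz => by
    obtain ⟨⟨l, hl1, hl2⟩, hl3⟩ := hl z hz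
    exact ⟨_, l, by linarith [(abs_le.1 hl1).2], hl3.sub (hB z), hl2⟩) (fun z hz => by
    simp only [Pi.sub_apply]
    linarith [(abs_le.1 (hb z hz)).1, hq z hz])
  intro z hz
  have e1 := h1 z hz
  have e2 := h2 z hz
  have e3 : 0 ≤ η * ‖z‖ ^ 2 := by positivity
  simp only [Pi.add_apply, Pi.sub_apply] at e1 e2
  rw [abs_le]
  constructor <;> linarith

/-- Quadratic approximation in a disc of functions with small Laplacian. -/
theorem disc_step {v : ℂ → ℝ} {η : ℝ} (hη : 0 ≤ η) (hv : ContinuousOn v (closedBall 0 1))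
    (h1 : ∀ z ∈ closedBall (0 : ℂ) 1, |v z| ≤ 1)
    (hl : ∀ z ∈ ball (0 : ℂ) 1, ∃ l, |l| ≤ η ∧ HasLap v l z) :
    ∃ (q : ℝ) (a b : ℂ), ∀ z ∈ ball (0 : ℂ) (1 / 2),
      |v z - q - (a * z).re - (b * z ^ 2).re| ≤ η + 200 * ‖z‖ ^ 3 := by
  obtain ⟨V, hV, hVb⟩ := exists_harmonicContOnCl_ball v (c := 0) one_pos
    (hv.mono sphere_subset_closedBall)
  have hcl : closure (ball (0 : ℂ) 1) = closedBall 0 1 := closure_ball _ one_ne_zero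
  have hfr : frontier (ball (0 : ℂ) 1) = sphere 0 1 := frontier_ball _ one_ne_zero
  have hVL : ∀ z ∈ ball (0 : ℂ) 1, HasLap V 0 z := fun z hz =>
    HarmonicOnNhd.hasLap hV.harmonicOnNhd hz
  have hVc := hV.continuousOn
  have hV1 : ∀ z ∈ closure (ball (0 : ℂ) 1), |0 - V z| ≤ 1 + 0 :=
    abs_sub_le_of_hasLap isOpen_ball ball_subset_closedBall le_rfl continuousOn_const hVc
      (fun z hz => ⟨⟨0, by simp, HasLap.const 0⟩, hVL z hz⟩) (fun z hz => by
        rw [hfr] at hz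
        rw [zero_sub, abs_neg, hVb z hz]
        exact h1 z (sphere_subset_closedBall hz))
  have hcmp := abs_sub_le_of_hasLap isOpen_ball ball_subset_closedBall hη (hcl ▸ hv) hVc
    (fun z hz => ⟨hl z hz, hVL z hz⟩) (ε := 0) (fun z hz => by
      rw [hfr] at hz
      rw [hVb z hz, sub_self, abs_zero])
  obtain ⟨a, b, -, -, hT, -⟩ := harmonic_taylor one_pos one_pos hV.harmonicOnNhd (fun z hz => by
    simpa using hV1 z (subset_closure hz))
  refine ⟨V 0, a, b, fun z hz => ?_⟩
  have e1 := hT z hz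
  simp only [sub_zero, div_one, mul_one] at e1
  have e2 := hcmp z (subset_closure (ball_subset_ball (by norm_num) hz))
  rw [zero_add] at e2
  calc |v z - V 0 - (a * z).re - (b * z ^ 2).re|
      = |(v z - V z) + (V z - V 0 - (a * z).re - (b * z ^ 2).re)| := by ring_nf
    _ ≤ _ := (abs_add_le _ _).trans (add_le_add e2 e1)

/-- Soft thresholding. -/
def softThreshold (ε x : ℝ) : ℝ := max (x - ε) 0 + min (x + ε) 0

theorem softThreshold_of_abs_le {ε x : ℝ} (h : |x| ≤ ε) : softThreshold ε x = 0 := by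
  obtain ⟨h1, h2⟩ := abs_le.1 h
  rw [softThreshold, max_eq_right (by linarith), min_eq_right (by linarith), add_zero]

theorem abs_softThreshold_sub_le {ε : ℝ} (hε : 0 ≤ ε) (x : ℝ) : |softThreshold ε x - x| ≤ ε := by
  rw [softThreshold, abs_le]
  rcases max_cases (x - ε) 0 with h | h <;> rcases min_cases (x + ε) 0 with h' | h' <;>
    constructor <;> linarith

theorem abs_softThreshold_le {ε : ℝ} (hε : 0 ≤ ε) (x : ℝ) : |softThreshold ε x| ≤ |x| := by
  rw [softThreshold]
  rcases max_cases (x - ε) 0 with h | h <;> rcases min_cases (x + ε) 0 with h' | h' <;>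
    rw [abs_le] <;> constructor <;>
    linarith [neg_abs_le x, le_abs_self x, abs_nonneg x]

/-- Quadratic approximation in a half disc of functions with small Laplacian that are small on the
flat part of the boundary. -/
theorem half_disc_step {v : ℂ → ℝ} {η ε r : ℝ} (hη : 0 ≤ η) (hε : 0 ≤ ε) (hr : 0 < r) (hr1 : r ≤ 1)
    (hv : ContinuousOn v (closedBall 0 r ∩ {z | z.re ≤ 0}))
    (h1 : ∀ z ∈ closedBall (0 : ℂ) r, z.re ≤ 0 → |v z| ≤ 1)
    (h0 : ∀ z ∈ closedBall (0 : ℂ) r, z.re = 0 → |v z| ≤ ε)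
    (hl : ∀ z ∈ ball (0 : ℂ) r, z.re < 0 → ∃ l, |l| ≤ η ∧ HasLap v l z) :
    ∃ α β : ℝ, |α| ≤ 200 / r ∧ |β| ≤ 400 / r ^ 2 ∧ ∀ z ∈ ball (0 : ℂ) (r / 2), z.re < 0 →
      |v z - α * z.re - β * (z.re * z.im)| ≤ ε + η + 200 * (‖z‖ / r) ^ 3 := by
  classical
  let R : ℂ → ℂ := fun z => -(starRingEnd ℂ) z
  have hRn : ∀ z, ‖R z‖ = ‖z‖ := fun z => by simp [R]
  have hRre : ∀ z, (R z).re = -z.re := fun z => by simp [R]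
  have hRim : ∀ z, (R z).im = z.im := fun z => by simp [R]
  have hRR : ∀ z, R (R z) = z := fun z => by simp [R]
  have hRc : Continuous R := by fun_prop
  have hTc : Continuous (softThreshold ε) := by unfold softThreshold; fun_prop
  let b : ℂ → ℝ := fun z => if z.re ≤ 0 then softThreshold ε (v z) else -softThreshold ε (v (R z))
  have hsub : ∀ z ∈ sphere (0 : ℂ) r, z ∈ closedBall (0 : ℂ) r := fun z hz =>
    sphere_subset_closedBall hz
  have hRcl : ∀ z ∈ closedBall (0 : ℂ) r, R z ∈ closedBall (0 : ℂ) r := fun z hz => by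
    rw [mem_closedBall_zero_iff] at *; rwa [hRn]
  have hbc : ContinuousOn b (sphere 0 r) := by
    refine ContinuousOn.if ?_ ?_ ?_
    · rintro z ⟨hz, hz0⟩
      rw [Complex.frontier_setOfPred_re_le] at hz0
      have hz0 : z.re = 0 := hz0
      rw [softThreshold_of_abs_le (h0 z (hsub z hz) hz0),
        softThreshold_of_abs_le (h0 _ (hRcl z (hsub z hz)) (by rw [hRre, hz0, neg_zero])), neg_zero]
    · refine hTc.comp_continuousOn (hv.mono ?_)
      rintro z ⟨hz, hz0⟩
      rw [IsClosed.closure_eq (isClosed_le Complex.continuous_re continuous_const)] at hz0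
      exact ⟨hsub z hz, hz0⟩
    · refine (hTc.comp_continuousOn (hv.comp hRc.continuousOn ?_)).neg
      rintro z ⟨hz, hz0⟩
      have : {a : ℂ | ¬a.re ≤ 0} = {a | 0 < a.re} := by ext; simp
      rw [this, Complex.closure_setOfPred_lt_re] at hz0
      exact ⟨hRcl z (hsub z hz), by simpa [hRre] using hz0⟩
  have hbR : ∀ z ∈ sphere (0 : ℂ) r, b (R z) = -b z := fun z hz => by
    have hcb := hsub z hz
    simp only [b, hRre, hRR]
    rcases lt_trichotomy z.re 0 with h | h | h
    · rw [if_neg (by linarith), if_pos h.le]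
    · rw [if_pos (by linarith), if_pos h.le,
        softThreshold_of_abs_le (h0 z hcb h),
        softThreshold_of_abs_le (h0 _ (hRcl z hcb) (by rw [hRre, h, neg_zero])), neg_zero]
    · rw [if_pos (by linarith), if_neg (by linarith), neg_neg]
  have hb1 : ∀ z ∈ sphere (0 : ℂ) r, |b z| ≤ 1 := fun z hz => by
    have hcb := hsub z hz
    simp only [b]
    split_ifs with h
    · exact (abs_softThreshold_le hε _).trans (h1 z hcb h)
    · rw [abs_neg]
      exact (abs_softThreshold_le hε _).trans (h1 _ (hRcl z hcb) (by rw [hRre]; linarith))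
  obtain ⟨W, hW, hWb⟩ := exists_harmonicContOnCl_ball b hr hbc
  have hWL : ∀ z ∈ ball (0 : ℂ) r, HasLap W 0 z := fun z hz =>
    HarmonicOnNhd.hasLap hW.harmonicOnNhd hz
  have hcl : closure (ball (0 : ℂ) r) = closedBall 0 r := closure_ball _ hr.ne'
  have hfr : frontier (ball (0 : ℂ) r) = sphere 0 r := frontier_ball _ hr.ne'
  have hWc : ContinuousOn W (closedBall 0 r) := hcl ▸ hW.continuousOn
  have hRb : ∀ z ∈ ball (0 : ℂ) r, R z ∈ ball (0 : ℂ) r := fun z hz => by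
    rw [mem_ball_zero_iff] at *; rwa [hRn]
  let V : ℂ → ℝ := fun z => 1 / 2 * (W z - W (R z))
  have hVL : ∀ z ∈ ball (0 : ℂ) r, HasLap V 0 z := fun z hz =>
    (((hWL z hz).sub (HasLap.comp_reflect (hWL _ (hRb z hz)))).const_mul (1 / 2)).congr_value
      (by norm_num)
  have hVc : ContinuousOn V (closedBall 0 r) :=
    (hWc.sub (hWc.comp hRc.continuousOn hRcl)).const_mul (1 / 2)
  have hVb : ∀ z ∈ sphere (0 : ℂ) r, V z = b z := fun z hz => by
    have : R z ∈ sphere (0 : ℂ) r := by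
      rw [mem_sphere_zero_iff_norm] at *; rwa [hRn]
    simp only [V]
    rw [hWb z hz, hWb _ this, hbR z hz]
    ring
  have hVodd : ∀ z, V (R z) = -V z := fun z => by
    simp only [V, hRR]; ring
  have hrb : ball (0 : ℂ) r ⊆ closedBall 0 1 :=
    ball_subset_closedBall.trans (closedBall_subset_closedBall hr1)
  have hV1 : ∀ z ∈ closure (ball (0 : ℂ) r), |0 - V z| ≤ 1 + 0 :=
    abs_sub_le_of_hasLap isOpen_ball hrb le_rfl continuousOn_const (hcl ▸ hVc)
      (fun z hz => ⟨⟨0, by simp, HasLap.const 0⟩, hVL z hz⟩) (fun z hz => by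
        rw [hfr] at hz
        rw [zero_sub, abs_neg, hVb z hz]
        exact hb1 z hz)
  have hhalf : IsOpen {z : ℂ | z.re < 0} := isOpen_lt Complex.continuous_re continuous_const
  have hDcl : closure (ball (0 : ℂ) r ∩ {z | z.re < 0}) ⊆ closedBall 0 r ∩ {z | z.re ≤ 0} :=
    closure_minimal (fun z hz => ⟨ball_subset_closedBall hz.1, (show z.re < 0 from hz.2).le⟩)
      (isClosed_closedBall.inter (isClosed_le Complex.continuous_re continuous_const))
  have hcmp := abs_sub_le_of_hasLap (D := ball (0 : ℂ) r ∩ {z | z.re < 0})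
    (isOpen_ball.inter hhalf) (inter_subset_left.trans hrb) hη (hv.mono hDcl)
    (hVc.mono (hDcl.trans inter_subset_left))
    (fun z hz => ⟨hl z hz.1 hz.2, hVL z hz.1⟩) (ε := ε) (fun z hz => by
      have hz1 := hDcl (frontier_subset_closure hz)
      have hz2 : z ∉ ball (0 : ℂ) r ∩ {z | z.re < 0} := by
        rw [(isOpen_ball.inter hhalf).frontier_eq] at hz
        exact hz.2
      by_cases hz3 : z.re < 0
      · have hz4 : z ∈ sphere (0 : ℂ) r := by
          rw [mem_sphere]
          exact le_antisymm hz1.1 (not_lt.1 fun h => hz2 ⟨h, hz3⟩)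
        rw [hVb z hz4]
        simp only [b]
        rw [if_pos hz3.le, abs_sub_comm]
        exact abs_softThreshold_sub_le hε _
      · have hz4 : z.re = 0 := le_antisymm hz1.2 (not_lt.1 hz3)
        have hz5 : R z = z := by
          apply Complex.ext
          · rw [hRre, hz4, neg_zero]
          · rw [hRim]
        have : V z = 0 := by
          have := hVodd z
          rw [hz5] at this
          linarith
        rw [this, sub_zero]
        exact h0 z hz1.1 hz4)
  obtain ⟨a, b, ha, hb, hT, -⟩ := harmonic_taylor hr one_pos
    (harmonicOnNhd_of_hasLap isOpen_ball hVL) (fun z hz => by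
    simpa using hV1 z (subset_closure hz))
  have hV0 : V 0 = 0 := by
    have := hVodd 0
    rw [show R 0 = 0 by simp [R]] at this
    linarith
  refine ⟨a.re, -2 * b.im, (Complex.abs_re_le_norm a).trans (by simpa using ha), ?_,
    fun z hz hz0 => ?_⟩
  · rw [abs_mul, abs_neg, abs_of_pos (by norm_num : (0 : ℝ) < 2)]
    have := (Complex.abs_im_le_norm b).trans hb
    calc 2 * |b.im| ≤ 2 * (200 * 1 / r ^ 2) := by gcongr
      _ = _ := by ring
  have hRz : R z ∈ ball (0 : ℂ) (r / 2) := by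
    rw [mem_ball_zero_iff] at *; rwa [hRn]
  have e1 := abs_le.1 (hT z hz)
  have e2 := abs_le.1 (hT (R z) hRz)
  have e3 := abs_le.1 (hcmp z (subset_closure ⟨ball_subset_ball (by linarith) hz, hz0⟩))
  rw [hVodd] at e2
  simp only [hV0, sub_zero, sq, Complex.mul_re, Complex.mul_im, hRre, hRim, hRn, mul_one] at e1 e2
  rw [abs_le]
  constructor <;> nlinarith

/-- Linear growth away from a nearly flat piece of the boundary. -/
theorem flat_barrier {D : Set ℂ} (hD : IsOpen D) {v : ℂ → ℝ} {η : ℝ} (hη : 0 ≤ η)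
    (hη1 : η ≤ 1 / 10) (hflat : ∀ z ∈ D ∩ ball 0 1, z.re ≤ η)
    (hv : ContinuousOn v (closure D ∩ ball 0 1)) (h1 : ∀ z ∈ D ∩ ball 0 1, |v z| ≤ 1)
    (hb : ∀ z ∈ frontier D ∩ ball 0 1, |v z| ≤ η)
    (hl : ∀ z ∈ D ∩ ball 0 1, ∃ l, |l| ≤ η ∧ HasLap v l z) :
    ∀ z ∈ D ∩ ball 0 (1 / 2), |v z| ≤ η + 64 * (η - z.re) := by
  rintro z₀ ⟨hz₀D, hz₀⟩
  rw [mem_ball_zero_iff] at hz₀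
  have hre₀ := abs_lt.1 ((Complex.abs_re_le_norm z₀).trans_lt hz₀)
  have him₀ := abs_lt.1 ((Complex.abs_im_le_norm z₀).trans_lt hz₀)
  have hre₁ := hflat z₀ ⟨hz₀D, mem_ball_zero_iff.2 (by linarith)⟩
  let S : Set ℂ := {z | z₀.im - 1 / 4 < z.im} ∩ {z | z.im < z₀.im + 1 / 4} ∩ {z | -1 / 2 < z.re} ∩
    {z | z.re < 1 / 5}
  have hS : IsOpen S := (((isOpen_lt continuous_const Complex.continuous_im).inter
    (isOpen_lt Complex.continuous_im continuous_const)).inter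
    (isOpen_lt continuous_const Complex.continuous_re)).inter
    (isOpen_lt Complex.continuous_re continuous_const)
  have hmemS : ∀ z, z ∈ S ↔ ((z₀.im - 1 / 4 < z.im ∧ z.im < z₀.im + 1 / 4) ∧ -1 / 2 < z.re) ∧
    z.re < 1 / 5 := fun z => Iff.rfl
  have hball : ∀ z : ℂ, z₀.im - 1 / 4 ≤ z.im → z.im ≤ z₀.im + 1 / 4 → -1 / 2 ≤ z.re →
      z.re ≤ 1 / 5 → z ∈ ball (0 : ℂ) 1 := fun z a b c d => by
    rw [mem_ball_zero_iff]
    have e : ‖z‖ ^ 2 = z.re ^ 2 + z.im ^ 2 := by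
      rw [Complex.sq_norm, Complex.normSq_apply]; ring
    have : ‖z‖ ^ 2 < 1 ^ 2 := by nlinarith
    exact lt_of_pow_lt_pow_left₀ 2 (by norm_num) this
  have hcS : ∀ z ∈ closure (D ∩ S), ((((z₀.im - 1 / 4 ≤ z.im ∧ z.im ≤ z₀.im + 1 / 4) ∧
      -1 / 2 ≤ z.re) ∧ z.re ≤ η) ∧ z ∈ closure D) ∧ z ∈ ball (0 : ℂ) 1 := by
    have hc : closure (D ∩ S) ⊆ {z | z₀.im - 1 / 4 ≤ z.im} ∩ {z | z.im ≤ z₀.im + 1 / 4} ∩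
        {z | -1 / 2 ≤ z.re} ∩ {z | z.re ≤ η} ∩ closure D := by
      refine subset_inter (closure_minimal ?_ ?_) (closure_mono inter_subset_left)
      · rintro z ⟨hz, hzS⟩
        obtain ⟨⟨⟨h1, h2⟩, h3⟩, h4⟩ := (hmemS z).1 hzS
        exact ⟨⟨⟨h1.le, h2.le⟩, h3.le⟩, hflat z ⟨hz, hball z h1.le h2.le h3.le h4.le⟩⟩
      · exact (((isClosed_le continuous_const Complex.continuous_im).inter
          (isClosed_le Complex.continuous_im continuous_const)).inter
          (isClosed_le continuous_const Complex.continuous_re)).inter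
          (isClosed_le Complex.continuous_re continuous_const)
    intro z hz
    obtain ⟨⟨⟨⟨h1, h2⟩, h3⟩, h4⟩, h5⟩ := hc hz
    have h4' : z.re ≤ η := h4
    exact ⟨⟨⟨⟨⟨h1, h2⟩, h3⟩, h4⟩, h5⟩, hball z h1 h2 h3 (by linarith)⟩
  have hDS1 : ∀ z ∈ D ∩ S, z ∈ D ∩ ball 0 1 := fun z hz => ⟨hz.1, (hcS z (subset_closure hz)).2⟩
  have hvc : ContinuousOn v (closure (D ∩ S)) :=
    hv.mono fun z hz => ⟨(hcS z hz).1.2, (hcS z hz).2⟩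
  have hv1 : ∀ z ∈ closure (D ∩ S), |v z| ≤ 1 := fun z hz => by
    have := hvc.abs.mono (subset_refl _)
    refine (isClosed_Iic (a := (1 : ℝ))).closure_subset_iff.2 ?_
      (this.image_closure (mem_image_of_mem _ hz))
    rintro _ ⟨w, hw, rfl⟩
    exact h1 w (hDS1 w hw)
  have hbd : Bornology.IsBounded (D ∩ S) :=
    isBounded_ball.subset fun z hz => (hcS z (subset_closure hz)).2
  let w : ℂ → ℝ := fun z => η + 16 * (z.im - z₀.im) ^ 2 - 17 * (η - z.re) ^ 2 + 64 * (η - z.re)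
  have hw : ∀ z, HasLap w (-2) z := fun z => by
    have h := (((HasLap.im_sq (z := z)).const_mul 16).sub
      ((HasLap.im (z := z)).const_mul (32 * z₀.im))).sub
      ((HasLap.re_sq (z := z)).const_mul 17) |>.add ((HasLap.re (z := z)).const_mul (34 * η - 64))
      |>.add (HasLap.const (η + 16 * z₀.im ^ 2 - 17 * η ^ 2 + 64 * η))
    refine (h.congr (Eventually.of_forall fun y => ?_)).congr_value (by norm_num)
    simp only [w]
    ring
  have hwc : Continuous w := by fun_prop
  have hfr : ∀ z ∈ frontier (D ∩ S), |v z| ≤ w z := fun z hz => by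
    have hzc := frontier_subset_closure hz
    obtain ⟨⟨⟨⟨⟨g1, g2⟩, g3⟩, g4⟩, g5⟩, g6⟩ := hcS z hzc
    have hnot : z ∉ D ∩ S := by
      rw [(hD.inter hS).frontier_eq] at hz
      exact hz.2
    by_cases hzD : z ∈ D
    · refine (hv1 z hzc).trans ?_
      simp only [w]
      have hns : ¬ (((z₀.im - 1 / 4 < z.im ∧ z.im < z₀.im + 1 / 4) ∧ -1 / 2 < z.re) ∧
        z.re < 1 / 5) := fun h => hnot ⟨hzD, (hmemS z).2 h⟩
      have hcase : (z.im - z₀.im) ^ 2 = (1 / 4) ^ 2 ∨ z.re = -1 / 2 := by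
        by_contra! hne
        apply hns
        refine ⟨⟨⟨lt_of_le_of_ne g1 fun h => hne.1 ?_, lt_of_le_of_ne g2 fun h => hne.1 ?_⟩,
          lt_of_le_of_ne g3 (Ne.symm hne.2)⟩, by linarith⟩
        · rw [← h]; ring
        · rw [h]; ring
      rcases hcase with h | h
      · rw [h]; nlinarith
      · rw [h]; nlinarith [sq_nonneg (z.im - z₀.im)]
    · have hzF : z ∈ frontier D := by
        rw [hD.frontier_eq]
        exact ⟨g5, hzD⟩
      refine (hb z ⟨hzF, g6⟩).trans ?_
      simp only [w]
      nlinarith [sq_nonneg (z.im - z₀.im)]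
  have k1 := le_of_hasLap_le (hD.inter hS) hbd hvc hwc.continuousOn (fun z hz => by
    obtain ⟨l, hl1, hl2⟩ := hl z (hDS1 z hz)
    exact ⟨l, -2, by linarith [(abs_le.1 hl1).1], hl2, hw z⟩)
    (fun z hz => (le_abs_self _).trans (hfr z hz))
  have k2 := le_of_hasLap_le (hD.inter hS) hbd hvc.neg hwc.continuousOn (fun z hz => by
    obtain ⟨l, hl1, hl2⟩ := hl z (hDS1 z hz)
    exact ⟨-l, -2, by linarith [(abs_le.1 hl1).2], hl2.neg, hw z⟩)
    (fun z hz => (neg_le_abs _).trans (hfr z hz))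
  have hz₀S : z₀ ∈ closure (D ∩ S) := subset_closure ⟨hz₀D, (hmemS z₀).2
    ⟨⟨⟨by linarith, by linarith⟩, by linarith⟩, by linarith⟩⟩
  have e1 := k1 z₀ hz₀S
  have e2 := k2 z₀ hz₀S
  simp only [Pi.neg_apply, w, sub_self] at e1 e2
  rw [abs_le]
  constructor <;> nlinarith [sq_nonneg (η - z₀.re)]

/-- One step of the approximation by quadratics at a nearly flat boundary point. -/
theorem boundary_step {D : Set ℂ} (hD : IsOpen D) {v : ℂ → ℝ} {η : ℝ} (hη : 0 < η)
    (hη1 : η ≤ 1 / 1000) (hflat : ∀ z ∈ D ∩ ball 0 1, z.re ≤ η)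
    (hin : ∀ z ∈ ball (0 : ℂ) 1, z.re < -η → z ∈ D)
    (hv : ContinuousOn v (closure D ∩ ball 0 1)) (h1 : ∀ z ∈ D ∩ ball 0 1, |v z| ≤ 1)
    (hb : ∀ z ∈ frontier D ∩ ball 0 1, |v z| ≤ η)
    (hl : ∀ z ∈ D ∩ ball 0 1, ∃ l, |l| ≤ η ∧ HasLap v l z) :
    ∃ a b : ℝ, |a| ≤ 2000 ∧ |b| ≤ 2000 ∧ ∀ z ∈ D ∩ ball 0 (1 / 10),
      |v z - a * z.re - b * (z.re * z.im)| ≤ 6000 * η + 2200 * (‖z‖ + 2 * η) ^ 3 := by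
  have hbar := flat_barrier hD hη.le (by linarith) hflat hv h1 hb hl
  let T : ℂ → ℂ := fun z => ((-(2 * η) : ℝ) : ℂ) + 1 * z
  have hTre : ∀ z, (T z).re = z.re - 2 * η := fun z => by simp [T]; ring
  have hTim : ∀ z, (T z).im = z.im := fun z => by simp [T]
  have hTn : ∀ z, ‖T z‖ ≤ ‖z‖ + 2 * η := fun z => by
    refine (norm_add_le _ _).trans ?_
    rw [Complex.norm_real, Real.norm_eq_abs, abs_neg, abs_of_pos (by positivity), one_mul]
    linarith
  have hTc : Continuous T := by fun_prop
  have hTb : ∀ z ∈ closedBall (0 : ℂ) (9 / 20), T z ∈ ball (0 : ℂ) (1 / 2) := fun z hz => by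
    rw [mem_closedBall_zero_iff] at hz
    rw [mem_ball_zero_iff]
    linarith [hTn z]
  have hTb1 : ∀ z ∈ closedBall (0 : ℂ) (9 / 20), T z ∈ ball (0 : ℂ) 1 := fun z hz =>
    ball_subset_ball (by norm_num) (hTb z hz)
  have hTD : ∀ z ∈ closedBall (0 : ℂ) (9 / 20), z.re ≤ 0 → T z ∈ D := fun z hz hz0 =>
    hin _ (hTb1 z hz) (by rw [hTre]; linarith)
  obtain ⟨α, β, hα, hβ, H⟩ := half_disc_step (v := fun z => v (T z)) (η := η) (ε := 193 * η)
    (r := 9 / 20) hη.le (by positivity) (by norm_num) (by norm_num)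
    (hv.comp hTc.continuousOn fun z hz => ⟨subset_closure (hTD z hz.1 hz.2), hTb1 z hz.1⟩)
    (fun z hz hz0 => h1 _ ⟨hTD z hz hz0, hTb1 z hz⟩)
    (fun z hz hz0 => (hbar _ ⟨hTD z hz hz0.le, hTb z hz⟩).trans (by rw [hTre, hz0]; linarith))
    (fun z hz hz0 => by
      obtain ⟨l, hl1, hl2⟩ := hl (T z) ⟨hTD z (ball_subset_closedBall hz) hz0.le,
        hTb1 z (ball_subset_closedBall hz)⟩
      refine ⟨l, hl1, (hl2.comp_affine _ 1).congr_value (by simp)⟩)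
  have hα' : |α| ≤ 450 := hα.trans (by norm_num)
  have hβ' : |β| ≤ 2000 := hβ.trans (by norm_num)
  refine ⟨α, β, hα'.trans (by norm_num), hβ', fun z hz => ?_⟩
  have hzn : ‖z‖ < 1 / 10 := mem_ball_zero_iff.1 hz.2
  have him : |z.im| ≤ 1 / 10 := (Complex.abs_im_le_norm z).trans hzn.le
  have hR : 0 ≤ (‖z‖ + 2 * η) ^ 3 := by positivity
  by_cases hre : z.re < -(2 * η)
  · let y : ℂ := ((2 * η : ℝ) : ℂ) + z
    have hyre : y.re = z.re + 2 * η := by simp [y]; ring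
    have hyim : y.im = z.im := by simp [y]
    have hyn : ‖y‖ ≤ ‖z‖ + 2 * η := by
      refine (norm_add_le _ _).trans ?_
      rw [Complex.norm_real, Real.norm_eq_abs, abs_of_pos (by positivity)]
      linarith
    have hTy : T y = z := by
      simp only [T, y]; push_cast; ring
    have := H y (by rw [mem_ball_zero_iff]; linarith) (by rw [hyre]; linarith)
    simp only [hTy, hyre, hyim] at this
    have e1 : |α * (2 * η) + β * (2 * η * z.im)| ≤ 450 * (2 * η) + 2000 * (2 * η * (1 / 10)) := by
      refine (abs_add_le _ _).trans ?_
      rw [abs_mul α, abs_mul β, abs_mul (2 * η), abs_of_pos (by positivity : 0 < 2 * η)]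
      gcongr
    have e2 : 200 * (‖y‖ / (9 / 20)) ^ 3 ≤ 2200 * (‖z‖ + 2 * η) ^ 3 := by
      have : ‖y‖ ^ 3 ≤ (‖z‖ + 2 * η) ^ 3 := by gcongr
      calc 200 * (‖y‖ / (9 / 20)) ^ 3 = 200 * (20 / 9) ^ 3 * ‖y‖ ^ 3 := by ring
        _ ≤ _ := by nlinarith [norm_nonneg y, pow_nonneg (norm_nonneg y) 3]
    calc |v z - α * z.re - β * (z.re * z.im)|
        = |(v z - α * (z.re + 2 * η) - β * ((z.re + 2 * η) * z.im)) +
          (α * (2 * η) + β * (2 * η * z.im))| := by ring_nf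
      _ ≤ (193 * η + η + 200 * (‖y‖ / (9 / 20)) ^ 3) +
        (450 * (2 * η) + 2000 * (2 * η * (1 / 10))) := (abs_add_le _ _).trans (add_le_add this e1)
      _ ≤ _ := by linarith
  · have hz2 := hflat z ⟨hz.1, ball_subset_ball (by norm_num) hz.2⟩
    have hre2 : |z.re| ≤ 2 * η := abs_le.2 ⟨by linarith, by linarith⟩
    have e0 := hbar z ⟨hz.1, ball_subset_ball (by norm_num) hz.2⟩
    have e1 : |α * z.re| ≤ 450 * (2 * η) := by rw [abs_mul]; gcongr
    have e2 : |β * (z.re * z.im)| ≤ 2000 * (2 * η * (1 / 10)) := by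
      rw [abs_mul, abs_mul]; gcongr
    refine (abs_sub _ _).trans ?_
    refine (add_le_add (abs_sub _ _) le_rfl).trans ?_
    linarith

/-- `P` is a real polynomial of degree at most two on the plane with Laplacian `l`. -/
def IsQuad (P : ℂ → ℝ) (l : ℝ) : Prop :=
  ∃ (q : ℝ) (a b : ℂ), ∀ z, P z = q + (a * z).re + (b * z ^ 2).re + l / 4 * ‖z‖ ^ 2

namespace IsQuad

variable {P Q : ℂ → ℝ} {l m : ℝ}

theorem add (hP : IsQuad P l) (hQ : IsQuad Q m) : IsQuad (fun z => P z + Q z) (l + m) := by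
  obtain ⟨q, a, b, h⟩ := hP
  obtain ⟨q', a', b', h'⟩ := hQ
  refine ⟨q + q', a + a', b + b', fun z => ?_⟩
  simp only [h, h', add_mul, Complex.add_re]
  ring

theorem const_mul (c : ℝ) (hP : IsQuad P l) : IsQuad (fun z => c * P z) (c * l) := by
  obtain ⟨q, a, b, h⟩ := hP
  refine ⟨c * q, c * a, c * b, fun z => ?_⟩
  simp only [h, mul_assoc, Complex.re_ofReal_mul]
  ring

theorem congr_value (hP : IsQuad P l) (h : l = m) : IsQuad P m := h ▸ hP

theorem sub (hP : IsQuad P l) (hQ : IsQuad Q m) : IsQuad (fun z => P z - Q z) (l - m) := by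
  have := hP.add (hQ.const_mul (-1))
  simpa [sub_eq_add_neg] using this

theorem const (c : ℝ) : IsQuad (fun _ => c) 0 := ⟨c, 0, 0, fun z => by simp⟩

theorem norm_sq : IsQuad (fun z => ‖z‖ ^ 2) 4 := ⟨0, 0, 0, fun z => by simp⟩

theorem re_mul (a : ℂ) : IsQuad (fun z => (a * z).re) 0 := ⟨0, a, 0, fun z => by simp⟩

theorem re_mul_sq (b : ℂ) : IsQuad (fun z => (b * z ^ 2).re) 0 := ⟨0, 0, b, fun z => by simp⟩

theorem comp_affine (c m : ℂ) (hP : IsQuad P l) :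
    IsQuad (fun z => P (c + m * z)) (‖m‖ ^ 2 * l) := by
  obtain ⟨q, a, b, h⟩ := hP
  refine ⟨q + (a * c).re + (b * c ^ 2).re + l / 4 * ‖c‖ ^ 2,
    a * m + 2 * b * c * m + (l / 2 : ℝ) * (starRingEnd ℂ c * m), b * m ^ 2, fun z => ?_⟩
  have : ‖c + m * z‖ ^ 2 = ‖c‖ ^ 2 + 2 * (starRingEnd ℂ c * m * z).re + ‖m‖ ^ 2 * ‖z‖ ^ 2 := by
    simp only [Complex.sq_norm, Complex.normSq_apply, Complex.add_re, Complex.add_im,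
      Complex.mul_re, Complex.mul_im, Complex.conj_re, Complex.conj_im]
    ring
  show P (c + m * z) = _
  rw [h, this]
  have e1 : a * (c + m * z) = a * c + a * m * z := by ring
  have e2 : b * (c + m * z) ^ 2 = b * c ^ 2 + 2 * b * c * m * z + b * m ^ 2 * z ^ 2 := by ring
  have e3 : (a * m + 2 * b * c * m + (l / 2 : ℝ) * (starRingEnd ℂ c * m)) * z =
    a * m * z + 2 * b * c * m * z + (l / 2 : ℝ) * (starRingEnd ℂ c * m * z) := by ring
  rw [e1, e2, e3]
  simp only [Complex.add_re, Complex.re_ofReal_mul]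
  ring

theorem hasLap (hP : IsQuad P l) (z : ℂ) : HasLap P l z := by
  obtain ⟨q, a, b, h⟩ := hP
  have e := (((HasLap.const (z := z) q).add ((HasLap.re.const_mul a.re).sub
    (HasLap.im.const_mul a.im))).add ((((HasLap.re_sq.sub HasLap.im_sq).const_mul b.re)).sub
    (HasLap.re_mul_im.const_mul (2 * b.im)))).add (HasLap.norm_sq.const_mul (l / 4))
  refine (e.congr (Eventually.of_forall fun y => ?_)).congr_value (by ring)
  rw [h]
  simp only [sq, Complex.mul_re, Complex.mul_im]
  ring

theorem continuous (hP : IsQuad P l) : Continuous P := by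
  obtain ⟨q, a, b, h⟩ := hP
  rw [show P = _ from funext h]
  fun_prop

end IsQuad

/-- The quadratic polynomials used at a boundary point with curvature `κ`. -/
def boundaryQuad (κ f₀ c e : ℝ) (z : ℂ) : ℝ :=
  c * (z.re + κ / 2 * (z.im ^ 2 - z.re ^ 2)) + e * (z.re * z.im) - f₀ / 2 * z.re ^ 2

theorem isQuad_boundaryQuad (κ f₀ c e : ℝ) : IsQuad (boundaryQuad κ f₀ c e) (-f₀) := by
  refine ⟨0, c, ⟨-(c * κ / 2) - f₀ / 4, -e / 2⟩, fun z => ?_⟩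
  rw [Complex.sq_norm, Complex.normSq_apply, boundaryQuad]
  simp only [sq, Complex.mul_re, Complex.mul_im, Complex.ofReal_re, Complex.ofReal_im]
  ring

theorem abs_boundaryQuad_le {κ f₀ c e K : ℝ} {z : ℂ} (hK : 1 ≤ K) (hκ : |κ| ≤ K) (hz : ‖z‖ ≤ 1)
    (h : |z.re + κ / 2 * z.im ^ 2| ≤ K * ‖z‖ ^ 3) :
    |boundaryQuad κ f₀ c e z| ≤ K ^ 2 * (2 * |c| + 2 * |e| + |f₀|) * ‖z‖ ^ 3 := by
  have hre := Complex.abs_re_le_norm z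
  have him := Complex.abs_im_le_norm z
  set R := ‖z‖
  have hR : 0 ≤ R := norm_nonneg z
  have him2 : z.im ^ 2 ≤ R ^ 2 := by rw [← sq_abs]; gcongr
  have hκ2 : |κ / 2 * z.im ^ 2| ≤ K / 2 * R ^ 2 := by
    rw [abs_mul, abs_div, abs_two, abs_of_nonneg (sq_nonneg z.im)]
    gcongr
  have hre2 : |z.re| ≤ 2 * K * R ^ 2 := by
    have h3 : K * R ^ 3 ≤ K * R ^ 2 := by
      gcongr 1
      · nlinarith [sq_nonneg R]
    have : |z.re| ≤ |z.re + κ / 2 * z.im ^ 2| + |κ / 2 * z.im ^ 2| := by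
      calc |z.re| = |(z.re + κ / 2 * z.im ^ 2) - κ / 2 * z.im ^ 2| := by ring_nf
        _ ≤ _ := abs_sub _ _
    nlinarith [sq_nonneg R]
  have hre3 : z.re ^ 2 ≤ 2 * K * R ^ 3 := by
    rw [← sq_abs, sq]
    calc |z.re| * |z.re| ≤ (2 * K * R ^ 2) * R := by gcongr
      _ = _ := by ring
  have b1 : |c * (z.re + κ / 2 * (z.im ^ 2 - z.re ^ 2))| ≤ |c| * (2 * K ^ 2 * R ^ 3) := by
    rw [abs_mul]
    gcongr
    have : |κ / 2 * z.re ^ 2| ≤ K / 2 * (2 * K * R ^ 3) := by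
      rw [abs_mul, abs_div, abs_two, abs_of_nonneg (sq_nonneg z.re)]
      gcongr
    have hRR : K * R ^ 3 ≤ K ^ 2 * R ^ 3 := by
      gcongr
      nlinarith
    calc |z.re + κ / 2 * (z.im ^ 2 - z.re ^ 2)| = |(z.re + κ / 2 * z.im ^ 2) - κ / 2 * z.re ^ 2| := by
          ring_nf
      _ ≤ K * R ^ 3 + K / 2 * (2 * K * R ^ 3) := (abs_sub _ _).trans (add_le_add h this)
      _ ≤ _ := by linarith
  have hKK : K ≤ K ^ 2 := by nlinarith
  have hR3 : 0 ≤ R ^ 3 := by positivity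
  have b2 : |e * (z.re * z.im)| ≤ |e| * (2 * K ^ 2 * R ^ 3) := by
    rw [abs_mul, abs_mul]
    refine mul_le_mul_of_nonneg_left ?_ (abs_nonneg e)
    calc |z.re| * |z.im| ≤ (2 * K * R ^ 2) * R := by gcongr
      _ = 2 * K * R ^ 3 := by ring
      _ ≤ _ := by gcongr
  have b3 : |f₀ / 2 * z.re ^ 2| ≤ |f₀| * (K ^ 2 * R ^ 3) := by
    rw [abs_mul, abs_div, abs_two, abs_of_nonneg (sq_nonneg z.re)]
    calc |f₀| / 2 * z.re ^ 2 ≤ |f₀| / 2 * (2 * K * R ^ 3) := by gcongr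
      _ = |f₀| * (K * R ^ 3) := by ring
      _ ≤ _ := by gcongr
  calc |boundaryQuad κ f₀ c e z| ≤ _ := (abs_sub _ _).trans (add_le_add (abs_add_le _ _) le_rfl)
    _ ≤ _ := add_le_add (add_le_add b1 b2) b3
    _ = _ := by ring

theorem boundary_iterate {D : Set ℂ} (hD : IsOpen D) {u f : ℂ → ℝ} {K κ f₀ c e A ρ a s η : ℝ}
    (hK : 1 ≤ K) (hκ : |κ| ≤ K) (hη : 0 < η) (hη1 : η ≤ 1 / 1000) (hρ : 0 < ρ) (hρ1 : ρ ≤ 1)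
    (ha : 0 < a) (hs : 0 < s) (hs1 : s ^ 2 ≤ 1 / 10)
    (hsη : 6000 * η + 2200 * (s ^ 2 + 2 * η) ^ 3 ≤ 1 / 2 * s ^ 5)
    (hchart : ∀ y : ℂ, ‖y‖ < ρ → (y ∈ D → y.re ≤ K * ‖y‖ ^ 2) ∧
      (y.re < -(K * ‖y‖ ^ 2) → y ∈ D) ∧ (y ∈ frontier D → |y.re + κ / 2 * y.im ^ 2| ≤ K * ‖y‖ ^ 3))
    (hKρ : K * ρ ≤ η) (hKs : 2000 * K * ρ ≤ s) (hA : A * ρ ^ 3 ≤ η * a)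
    (hce : K ^ 2 * (2 * |c| + 2 * |e| + |f₀|) * ρ ^ 3 ≤ η * a)
    (hu : ContinuousOn u (closure D)) (hu0 : ∀ z ∈ frontier D, u z = 0)
    (hl : ∀ z ∈ D, HasLap u (-f z) z) (hA0 : 0 ≤ A) (hf : ∀ z ∈ D, |f z - f₀| ≤ A * ‖z‖)
    (h1 : ∀ z ∈ D, ‖z‖ < ρ → |u z - boundaryQuad κ f₀ c e z| ≤ a) :
    ∃ c' e', |c' - c| ≤ 2000 * a / ρ ∧ |e' - e| ≤ 2000 * a / ρ ^ 2 ∧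
      ∀ z ∈ D, ‖z‖ < ρ * s ^ 2 → |u z - boundaryQuad κ f₀ c' e' z| ≤ s ^ 5 * a := by
  have hρ0 : (ρ : ℂ) ≠ 0 := by exact_mod_cast hρ.ne'
  let H : ℂ ≃ₜ ℂ := Homeomorph.mulLeft₀ (ρ : ℂ) hρ0
  have hHz : ∀ z, H z = ρ * z := fun z => rfl
  have hHn : ∀ z, ‖H z‖ = ρ * ‖z‖ := fun z => by
    rw [hHz, norm_mul, Complex.norm_real, Real.norm_of_nonneg hρ.le]
  have hHre : ∀ z, (H z).re = ρ * z.re := fun z => by rw [hHz]; simp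
  have hHim : ∀ z, (H z).im = ρ * z.im := fun z => by rw [hHz]; simp
  have hball : ∀ z ∈ ball (0 : ℂ) 1, ‖H z‖ < ρ := fun z hz => by
    rw [hHn]
    have := mem_ball_zero_iff.1 hz
    nlinarith
  have hq : ∀ z ∈ ball (0 : ℂ) 1, K * ‖H z‖ ^ 2 ≤ η * ρ := fun z hz => by
    have := hball z hz
    calc K * ‖H z‖ ^ 2 ≤ K * ρ ^ 2 := by gcongr
      _ = K * ρ * ρ := by ring
      _ ≤ _ := by gcongr
  let P := boundaryQuad κ f₀ c e
  have hP : IsQuad P (-f₀) := isQuad_boundaryQuad _ _ _ _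
  let v : ℂ → ℝ := fun z => 1 / a * (u (H z) - P (H z))
  have hvabs : ∀ z, |v z| = 1 / a * |u (H z) - P (H z)| := fun z => by
    simp only [v]
    rw [abs_mul, abs_of_pos (by positivity)]
  have hflat : ∀ z ∈ H ⁻¹' D ∩ ball 0 1, z.re ≤ η := fun z hz => by
    have := (hchart _ (hball z hz.2)).1 hz.1
    have h2 := hq z hz.2
    rw [hHre] at this
    by_contra! h3
    nlinarith
  obtain ⟨α, β, hα, hβ, hstep⟩ := boundary_step (D := H ⁻¹' D) (v := v)
    (hD.preimage H.continuous) hη hη1 hflat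
    (fun z hz hz0 => (hchart _ (hball z hz)).2.1 (by rw [hHre]; nlinarith [hq z hz]))
    (by
      rw [← H.preimage_closure]
      refine ContinuousOn.mono ?_ inter_subset_left
      exact continuousOn_const.mul ((hu.comp H.continuous.continuousOn fun z hz => hz).sub
        (hP.continuous.comp H.continuous).continuousOn))
    (fun z hz => by
      rw [hvabs, one_div, inv_mul_le_iff₀ ha, mul_one]
      exact h1 _ hz.1 (hball z hz.2))
    (fun z hz => by
      rw [← H.preimage_frontier] at hz
      have hzρ := hball z hz.2
      rw [hvabs, one_div, inv_mul_le_iff₀ ha, hu0 _ hz.1, zero_sub, abs_neg, mul_comm]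
      refine (abs_boundaryQuad_le hK hκ (by linarith) ((hchart _ hzρ).2.2 hz.1)).trans ?_
      refine le_trans ?_ hce
      gcongr)
    (fun z hz => by
      refine ⟨1 / a * (ρ ^ 2 * (-f (H z) - -f₀)), ?_, ?_⟩
      · have hzρ := hball z hz.2
        rw [abs_mul, abs_mul, abs_of_pos (by positivity : 0 < 1 / a), one_div, inv_mul_le_iff₀ ha,
          abs_of_nonneg (by positivity : 0 ≤ ρ ^ 2), mul_comm a]
        refine le_trans ?_ hA
        have : |-f (H z) - -f₀| ≤ A * ρ := by
          rw [show -f (H z) - -f₀ = -(f (H z) - f₀) by ring, abs_neg]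
          exact (hf _ hz.1).trans (by gcongr)
        calc ρ ^ 2 * |-f (H z) - -f₀| ≤ ρ ^ 2 * (A * ρ) := by gcongr
          _ = _ := by ring
      · have := ((hl _ hz.1).sub (hP.hasLap (H z)))
        have h2 := HasLap.comp_affine (z := z) 0 ρ (u := fun w => u w - P w)
          (l := -f (H z) - -f₀) (by rw [zero_add]; exact this)
        simp only [zero_add, Complex.norm_real, Real.norm_of_nonneg hρ.le] at h2
        exact h2.const_mul (1 / a))
  refine ⟨c + a * α / ρ, e + a * β / ρ ^ 2, ?_, ?_, fun z hz hzn => ?_⟩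
  · rw [add_sub_cancel_left, abs_div, abs_mul, abs_of_pos ha, abs_of_pos hρ]
    rw [mul_comm a]
    gcongr
  · rw [add_sub_cancel_left, abs_div, abs_mul, abs_of_pos ha, abs_of_pos (by positivity : 0 < ρ ^ 2)]
    rw [mul_comm a]
    gcongr
  · set y : ℂ := H.symm z with hy
    have hHy : H y = z := H.apply_symm_apply z
    have hyn : ρ * ‖y‖ = ‖z‖ := by rw [← hHn, hHy]
    have hys : ‖y‖ < s ^ 2 := by
      rw [← hyn] at hzn
      exact lt_of_mul_lt_mul_left hzn hρ.le
    have h3 := hstep y ⟨by rw [mem_preimage, hHy]; exact hz, mem_ball_zero_iff.2 (by linarith)⟩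
    have hzre : z.re = ρ * y.re := by rw [← hHre, hHy]
    have hzim : z.im = ρ * y.im := by rw [← hHim, hHy]
    have h4 : 6000 * η + 2200 * (‖y‖ + 2 * η) ^ 3 ≤ 1 / 2 * s ^ 5 := by
      refine le_trans ?_ hsη
      gcongr
    have h5 : |a * α / ρ * (κ / 2 * (z.im ^ 2 - z.re ^ 2))| ≤ a * (1 / 2 * s ^ 5) := by
      have e1 : |y.im ^ 2 - y.re ^ 2| ≤ s ^ 4 := by
        have : ‖y‖ ^ 2 = y.re ^ 2 + y.im ^ 2 := by
          rw [Complex.sq_norm, Complex.normSq_apply]; ring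
        have h6 : ‖y‖ ^ 2 ≤ (s ^ 2) ^ 2 := by gcongr
        rw [abs_le]
        constructor <;> nlinarith [sq_nonneg y.re, sq_nonneg y.im]
      have e2 : a * α / ρ * (κ / 2 * (z.im ^ 2 - z.re ^ 2)) =
          a * (α * κ * ρ / 2 * (y.im ^ 2 - y.re ^ 2)) := by
        rw [hzre, hzim]
        field_simp
      rw [e2, abs_mul, abs_of_pos ha]
      gcongr
      rw [abs_mul, abs_div, abs_mul, abs_mul, abs_two, abs_of_pos hρ]
      calc |α| * |κ| * ρ / 2 * |y.im ^ 2 - y.re ^ 2| ≤ 2000 * K * ρ / 2 * s ^ 4 := by gcongr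
        _ ≤ s / 2 * s ^ 4 := by gcongr
        _ = _ := by ring
    have h6 : u z - boundaryQuad κ f₀ (c + a * α / ρ) (e + a * β / ρ ^ 2) z =
        a * (v y - α * y.re - β * (y.re * y.im)) - a * α / ρ * (κ / 2 * (z.im ^ 2 - z.re ^ 2)) := by
      simp only [v, hHy, P, boundaryQuad]
      rw [hzre, hzim]
      field_simp
      ring
    rw [h6]
    refine (abs_sub _ _).trans ?_
    rw [abs_mul, abs_of_pos ha]
    calc a * |v y - α * y.re - β * (y.re * y.im)| + |a * α / ρ * (κ / 2 * (z.im ^ 2 - z.re ^ 2))|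
        ≤ a * (1 / 2 * s ^ 5) + a * (1 / 2 * s ^ 5) := by
          gcongr
          exact h3.trans h4
      _ = _ := by ring

theorem exists_pow_scale {r s σ : ℝ} (hr : 0 < r) (hs : 0 < s) (hs1 : s < 1) (hσ : 0 < σ)
    (hσr : σ ≤ r) : ∃ k : ℕ, σ ≤ r * s ^ k ∧ s ^ k ≤ σ / (r * s) := by
  obtain ⟨k, h1, h2⟩ := exists_nat_pow_near_of_lt_one (x := σ / r) (by positivity)
    ((div_le_one hr).2 hσr) hs hs1
  refine ⟨k, ?_, ?_⟩
  · rwa [div_le_iff₀ hr, mul_comm] at h2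
  · rw [le_div_iff₀ (by positivity)]
    rw [lt_div_iff₀ hr, pow_succ] at h1
    nlinarith

set_option maxHeartbeats 1600000 in
theorem boundary_expansion {K ρ : ℝ} (hK : 1 ≤ K) (hρ : 0 < ρ) : ∃ C, 0 < C ∧
    ∀ (D : Set ℂ) (u f : ℂ → ℝ) (κ f₀ A : ℝ), IsOpen D → |κ| ≤ K → 0 < A → |f₀| ≤ A →
      (∀ y : ℂ, ‖y‖ < ρ → (y ∈ D → y.re ≤ K * ‖y‖ ^ 2) ∧ (y.re < -(K * ‖y‖ ^ 2) → y ∈ D) ∧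
        (y ∈ frontier D → |y.re + κ / 2 * y.im ^ 2| ≤ K * ‖y‖ ^ 3)) →
      ContinuousOn u (closure D) → (∀ z ∈ D, |u z| ≤ A) → (∀ z ∈ frontier D, u z = 0) →
      (∀ z ∈ D, HasLap u (-f z) z) → (∀ z ∈ D, |f z - f₀| ≤ A * ‖z‖) →
      ∀ σ, 0 < σ → σ ≤ 1 → ∃ P, IsQuad P (-f₀) ∧ ∀ z ∈ D, ‖z‖ < σ ^ 2 →
        |u z - P z| ≤ C * A * σ ^ 5 := by
  obtain ⟨s, hs, hs1, η, hη, hη1, hsη⟩ : ∃ s : ℝ, 0 < s ∧ s ≤ 1 / 10 ∧ ∃ η : ℝ, 0 < η ∧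
      η ≤ 1 / 1000 ∧ 6000 * η + 2200 * (s ^ 2 + 2 * η) ^ 3 ≤ 1 / 2 * s ^ 5 :=
    ⟨1 / 10 ^ 5, by norm_num, by norm_num, 1 / 10 ^ 30, by norm_num, by norm_num, by norm_num⟩
  obtain ⟨r, hr, hr1, hrρ, hrK⟩ : ∃ r : ℝ, 0 < r ∧ r ≤ 1 ∧ r ^ 2 ≤ ρ ∧
      K ^ 2 * 40000 * r ^ 2 ≤ η * s := by
    have hc : ContinuousAt (fun r : ℝ => K ^ 2 * 40000 * r ^ 2) 0 := by fun_prop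
    have hd : ContinuousAt (fun r : ℝ => r ^ 2) 0 := by fun_prop
    have h1 : ∀ᶠ r in 𝓝 (0 : ℝ), K ^ 2 * 40000 * r ^ 2 < η * s :=
      hc.eventually_lt continuousAt_const (by simp; positivity)
    have h2 : ∀ᶠ r in 𝓝 (0 : ℝ), r ^ 2 < ρ :=
      hd.eventually_lt continuousAt_const (by simpa using hρ)
    have h3 : ∀ᶠ r in 𝓝 (0 : ℝ), r < 1 := eventually_lt_nhds one_pos
    have h4 := nhdsWithin_le_nhds (s := Ioi (0 : ℝ)) ((h1.and h2).and h3)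
    obtain ⟨r, ⟨⟨a, b⟩, c⟩, d⟩ := (Filter.Eventually.and h4 self_mem_nhdsWithin).exists
    exact ⟨r, d, c.le, b.le, a.le⟩
  have hs2 : s ≤ 1 := by linarith
  have hr2 : 0 < r ^ 2 := by positivity
  have hKK : K ≤ K ^ 2 := by nlinarith
  refine ⟨2 / (r * s) ^ 5, by positivity, ?_⟩
  intro D u f κ f₀ A hD hκ hA hf0 hchart hu huA hu0 hl hf σ hσ hσ1
  have key : ∀ k : ℕ, ∃ c e : ℝ, |c| ≤ 8000 * A / r ^ 4 * (1 - (1 / 2) ^ k) ∧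
      |e| ≤ 8000 * A / r ^ 4 * (1 - (1 / 2) ^ k) ∧
      ∀ z ∈ D, ‖z‖ < r ^ 2 * (s ^ k) ^ 2 →
        |u z - boundaryQuad κ f₀ c e z| ≤ 2 * A * (s ^ k) ^ 5 := by
    intro k
    induction k with
    | zero =>
      refine ⟨0, 0, by simp, by simp, fun z hz hzr => ?_⟩
      simp only [pow_zero, one_pow, mul_one] at hzr ⊢
      have h1 : z.re ^ 2 ≤ 1 := by
        have : |z.re| ≤ 1 := (Complex.abs_re_le_norm z).trans (by nlinarith)
        rw [← sq_abs]
        nlinarith [abs_nonneg z.re]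
      simp only [boundaryQuad, zero_mul, zero_add, zero_sub, sub_neg_eq_add]
      refine (abs_add_le _ _).trans ?_
      rw [abs_mul, abs_div, abs_two, abs_of_nonneg (sq_nonneg z.re)]
      have : |f₀| / 2 * z.re ^ 2 ≤ A / 2 * 1 := by gcongr
      linarith [huA z hz]
    | succ k ih =>
      obtain ⟨c, e, hc, he, hk⟩ := ih
      set t := s ^ k with ht
      have ht0 : 0 < t := by positivity
      have ht1 : t ≤ 1 := pow_le_one₀ hs.le hs2
      have hth : t ≤ (1 / 2) ^ k := by
        rw [ht]
        gcongr
        linarith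
      have hp0 : (0 : ℝ) < (1 / 2) ^ k := by positivity
      have ht2 : t ^ 2 ≤ 1 := pow_le_one₀ ht0.le ht1
      have hb : 8000 * A / r ^ 4 * (1 - (1 / 2) ^ k) ≤ 8000 * A / r ^ 4 := by
        have : 0 ≤ 8000 * A / r ^ 4 := by positivity
        nlinarith
      have hr41 : r ^ 4 ≤ 1 := pow_le_one₀ hr.le hr1
      have hAr : A ≤ A / r ^ 4 := by
        rw [le_div_iff₀ (by positivity)]
        nlinarith
      have hrt : r ^ 2 * t ^ 2 ≤ r ^ 2 := by nlinarith
      obtain ⟨c', e', hc', he', hk'⟩ := boundary_iterate (ρ := r ^ 2 * t ^ 2) (a := 2 * A * t ^ 5)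
        (s := s) (A := A) (c := c) (e := e) (f₀ := f₀) hD hK hκ hη hη1 (by positivity)
        (hrt.trans (by nlinarith)) (by positivity) hs (by nlinarith) hsη
        (fun y hy => hchart y (by linarith))
        (by
          calc K * (r ^ 2 * t ^ 2) ≤ K ^ 2 * r ^ 2 := by gcongr
            _ ≤ K ^ 2 * 40000 * r ^ 2 := by nlinarith [mul_pos (by positivity : 0 < K ^ 2) hr2]
            _ ≤ η * s := hrK
            _ ≤ η := by nlinarith)
        (by
          calc 2000 * K * (r ^ 2 * t ^ 2) ≤ 2000 * K ^ 2 * r ^ 2 := by gcongr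
            _ ≤ K ^ 2 * 40000 * r ^ 2 := by nlinarith [mul_pos (by positivity : 0 < K ^ 2) hr2]
            _ ≤ η * s := hrK
            _ ≤ s := by nlinarith)
        (by
          have h1 : r ^ 2 ≤ η := by
            nlinarith [mul_pos (by positivity : 0 < K ^ 2) hr2, one_le_pow₀ (n := 2) hK]
          calc A * (r ^ 2 * t ^ 2) ^ 3 = A * (r ^ 2 * (r ^ 4 * t) * t ^ 5) := by ring
            _ ≤ A * (η * (1 * 1) * t ^ 5) := by gcongr
            _ ≤ η * (2 * A * t ^ 5) := by nlinarith [show 0 < A * η * t ^ 5 by positivity])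
        (by
          calc K ^ 2 * (2 * |c| + 2 * |e| + |f₀|) * (r ^ 2 * t ^ 2) ^ 3
              ≤ K ^ 2 * (2 * (8000 * A / r ^ 4) + 2 * (8000 * A / r ^ 4) + A / r ^ 4) *
                (r ^ 2 * t ^ 2) ^ 3 := by
                have h1 := hc.trans hb
                have h2 := he.trans hb
                have h3 := hf0.trans hAr
                gcongr
            _ = K ^ 2 * 32001 * r ^ 2 * (A * t ^ 5 * t) := by
                field_simp
                ring
            _ ≤ K ^ 2 * 40000 * r ^ 2 * (A * t ^ 5 * 1) := by
                gcongr
                norm_num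
            _ ≤ η * s * (A * t ^ 5 * 1) := by gcongr
            _ ≤ η * 1 * (A * t ^ 5 * 2) := by
                gcongr
                norm_num
            _ = _ := by ring)
        hu hu0 hl hA.le hf hk
      have hg : 4000 * A * t / r ^ 4 ≤ 8000 * A / r ^ 4 * ((1 / 2) ^ k - (1 / 2) ^ (k + 1)) := by
        rw [pow_succ (1 / 2 : ℝ) k]
        have h5 : 8000 * A / r ^ 4 * ((1 / 2) ^ k - (1 / 2) ^ k * (1 / 2)) =
          4000 * A * (1 / 2) ^ k / r ^ 4 := by ring
        rw [h5]
        gcongr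
      refine ⟨c', e', ?_, ?_, fun z hz hzr => ?_⟩
      · have h4 : 2000 * (2 * A * t ^ 5) / (r ^ 2 * t ^ 2) ≤ 4000 * A * t / r ^ 4 := by
          rw [div_le_div_iff₀ (by positivity) (by positivity)]
          calc 2000 * (2 * A * t ^ 5) * r ^ 4 = 4000 * A * t * (r ^ 2 * t ^ 2) * (r ^ 2 * t ^ 2) := by
                ring
            _ ≤ 4000 * A * t * (r ^ 2 * t ^ 2) * 1 := by
                gcongr
                nlinarith
            _ = _ := by ring
        calc |c'| = |(c' - c) + c| := by ring_nf
          _ ≤ |c' - c| + |c| := abs_add_le _ _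
          _ ≤ 8000 * A / r ^ 4 * ((1 / 2) ^ k - (1 / 2) ^ (k + 1)) +
              8000 * A / r ^ 4 * (1 - (1 / 2) ^ k) := add_le_add (hc'.trans (h4.trans hg)) hc
          _ = _ := by ring
      · have h4 : 2000 * (2 * A * t ^ 5) / (r ^ 2 * t ^ 2) ^ 2 = 4000 * A * t / r ^ 4 := by
          field_simp
          ring
        calc |e'| = |(e' - e) + e| := by ring_nf
          _ ≤ |e' - e| + |e| := abs_add_le _ _
          _ ≤ 8000 * A / r ^ 4 * ((1 / 2) ^ k - (1 / 2) ^ (k + 1)) +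
              8000 * A / r ^ 4 * (1 - (1 / 2) ^ k) :=
              add_le_add (he'.trans (h4.le.trans hg)) he
          _ = _ := by ring
      · have h6 := hk' z hz (by rw [pow_succ s k] at hzr; convert hzr using 1; ring)
        convert h6 using 1
        rw [pow_succ s k]
        ring
  rcases le_or_gt σ r with hσr | hσr
  · obtain ⟨k, h1, h2⟩ := exists_pow_scale hr hs (by linarith) hσ hσr
    obtain ⟨c, e, -, -, h⟩ := key k
    refine ⟨boundaryQuad κ f₀ c e, isQuad_boundaryQuad _ _ _ _, fun z hz hzσ => ?_⟩
    refine (h z hz (hzσ.trans_le ?_)).trans ?_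
    · rw [← mul_pow]
      gcongr
    · calc 2 * A * (s ^ k) ^ 5 ≤ 2 * A * (σ / (r * s)) ^ 5 := by gcongr
        _ = _ := by rw [div_pow]; ring
  · refine ⟨fun z => -f₀ / 4 * ‖z‖ ^ 2, (IsQuad.norm_sq.const_mul _).congr_value (by ring),
      fun z hz hzσ => ?_⟩
    have hz1 : ‖z‖ ^ 2 ≤ 1 := pow_le_one₀ (norm_nonneg z) (by nlinarith)
    have h1 : |u z - -f₀ / 4 * ‖z‖ ^ 2| ≤ 2 * A := by
      refine (abs_sub _ _).trans ?_
      rw [abs_mul, abs_div, abs_neg, abs_of_nonneg (sq_nonneg ‖z‖), abs_of_pos (four_pos (α := ℝ))]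
      have : |f₀| / 4 * ‖z‖ ^ 2 ≤ A / 4 * 1 := by gcongr
      linarith [huA z hz]
    have h2 : 1 ≤ (σ / (r * s)) ^ 5 := by
      refine one_le_pow₀ ?_
      rw [one_le_div (by positivity)]
      nlinarith
    calc _ ≤ 2 * A := h1
      _ ≤ 2 * A * (σ / (r * s)) ^ 5 := by nlinarith
      _ = _ := by rw [div_pow]; ring

theorem disc_expansion : ∃ C, 0 < C ∧ ∀ (v g : ℂ → ℝ) (A : ℝ), 0 < A →
    ContinuousOn v (closedBall 0 1) → (∀ z ∈ closedBall (0 : ℂ) 1, |v z| ≤ A) →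
    (∀ z ∈ ball (0 : ℂ) 1, HasLap v (g z) z ∧ |g z| ≤ A * ‖z‖) →
    ∀ σ, 0 < σ → σ ≤ 1 → ∃ P, IsQuad P 0 ∧ ∀ z : ℂ, ‖z‖ < σ ^ 2 →
      |v z - P z| ≤ C * A * σ ^ 5 := by
  set s : ℝ := 1 / 400 with hs
  have hs0 : 0 < s := by norm_num [hs]
  refine ⟨1 / (s * s) ^ 5, by positivity, fun v g A hA hv hvA hg σ hσ hσ1 => ?_⟩
  have key : ∀ k : ℕ, ∃ P, IsQuad P 0 ∧ ∀ z : ℂ, ‖z‖ ≤ s ^ 2 * (s ^ k) ^ 2 →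
      |v z - P z| ≤ A * (s ^ k) ^ 5 := by
    intro k
    induction k with
    | zero =>
      refine ⟨fun _ => 0, IsQuad.const 0, fun z hz => ?_⟩
      simp only [pow_zero, one_pow, mul_one, sub_zero] at hz ⊢
      exact hvA z (mem_closedBall_zero_iff.2 (hz.trans (by norm_num [hs])))
    | succ k ih =>
      obtain ⟨P, hP, hk⟩ := ih
      set t := s ^ k with ht
      have ht0 : 0 < t := by positivity
      have ht1 : t ≤ 1 := pow_le_one₀ hs0.le (by norm_num [hs])
      set ρ := s ^ 2 * t ^ 2 with hρ
      have hρ0 : 0 < ρ := by positivity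
      have hρ1 : ρ ≤ 1 := by
        rw [hρ, ← mul_pow]
        exact pow_le_one₀ (by positivity) (by nlinarith [show s ≤ 1 by norm_num [hs]])
      have hn : ∀ z : ℂ, ‖(ρ : ℂ) * z‖ = ρ * ‖z‖ := fun z => by
        rw [norm_mul, Complex.norm_real, Real.norm_of_nonneg hρ0.le]
      have ha : 0 < A * t ^ 5 := by positivity
      obtain ⟨q, a, b, h⟩ := disc_step (η := s ^ 6)
        (v := fun z => 1 / (A * t ^ 5) * (v (ρ * z) - P (ρ * z))) (by positivity)
        (continuousOn_const.mul ((hv.comp (by fun_prop) fun z hz => by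
            rw [mem_closedBall_zero_iff] at hz ⊢
            rw [hn]
            nlinarith [norm_nonneg z]).sub
          (hP.continuous.comp (by fun_prop)).continuousOn))
        (fun z hz => by
          rw [mem_closedBall_zero_iff] at hz
          rw [abs_mul, abs_of_pos (by positivity), one_div, inv_mul_le_iff₀ ha, mul_one]
          exact hk _ (by rw [hn]; nlinarith))
        (fun z hz => by
          rw [mem_ball_zero_iff] at hz
          have hz1 : (ρ : ℂ) * z ∈ ball (0 : ℂ) 1 := by
            rw [mem_ball_zero_iff, hn]
            nlinarith
          obtain ⟨h1, h2⟩ := hg _ hz1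
          refine ⟨1 / (A * t ^ 5) * (ρ ^ 2 * (g (ρ * z) - 0)), ?_, ?_⟩
          · rw [abs_mul, abs_of_pos (by positivity), one_div, inv_mul_le_iff₀ ha, abs_mul, sub_zero,
              abs_of_pos (by positivity : 0 < ρ ^ 2)]
            rw [hn] at h2
            calc ρ ^ 2 * |g (ρ * z)| ≤ ρ ^ 2 * (A * (ρ * 1)) := by
                  have := h2.trans (by gcongr : A * (ρ * ‖z‖) ≤ A * (ρ * 1))
                  gcongr
              _ = A * t ^ 5 * s ^ 6 * t := by rw [hρ]; ring
              _ ≤ A * t ^ 5 * s ^ 6 * 1 := by gcongr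
              _ = _ := mul_one _
          · have h3 := HasLap.comp_affine (z := z) 0 ρ (u := fun w => v w - P w)
              (l := g (ρ * z) - 0) (by rw [zero_add]; exact h1.sub (hP.hasLap _))
            simp only [zero_add, Complex.norm_real, Real.norm_of_nonneg hρ0.le] at h3
            exact h3.const_mul _)
      have hQ : IsQuad (fun w : ℂ => q + (a * w).re + (b * w ^ 2).re) 0 :=
        (((IsQuad.const q).add (IsQuad.re_mul a)).add (IsQuad.re_mul_sq b)).congr_value (by ring)
      have hρC : (ρ : ℂ) ≠ 0 := by exact_mod_cast hρ0.ne'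
      refine ⟨fun z => P z + A * t ^ 5 *
        (q + (a * (0 + (ρ : ℂ)⁻¹ * z)).re + (b * (0 + (ρ : ℂ)⁻¹ * z) ^ 2).re), ?_, fun z hz => ?_⟩
      · exact (hP.add ((hQ.comp_affine 0 _).const_mul _)).congr_value (by ring)
      · set y := (ρ : ℂ)⁻¹ * z with hy
        have hzy : (ρ : ℂ) * y = z := by rw [hy, mul_inv_cancel_left₀ hρC]
        have hyn : ‖y‖ ≤ s ^ 2 := by
          have h5 := hn y
          rw [hzy] at h5
          rw [h5, pow_succ s k, ← ht] at hz
          have : ρ * ‖y‖ ≤ ρ * s ^ 2 := by rw [hρ] at hz ⊢; linarith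
          exact le_of_mul_le_mul_left this hρ0
        have h4 := h y (mem_ball_zero_iff.2 (lt_of_le_of_lt hyn (by norm_num [hs])))
        simp only [hzy] at h4
        have h6 : v z - (P z + A * t ^ 5 * (q + (a * (0 + y)).re + (b * (0 + y) ^ 2).re)) =
            A * t ^ 5 * (1 / (A * t ^ 5) * (v z - P z) - q - (a * y).re - (b * y ^ 2).re) := by
          rw [zero_add]
          field_simp
          ring
        rw [h6, abs_mul, abs_of_pos ha, pow_succ s k, ← ht]
        calc A * t ^ 5 * _ ≤ A * t ^ 5 * (s ^ 6 + 200 * (s ^ 2) ^ 3) := by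
              refine mul_le_mul_of_nonneg_left (h4.trans ?_) ha.le
              gcongr
          _ ≤ A * t ^ 5 * s ^ 5 := by
              refine mul_le_mul_of_nonneg_left ?_ ha.le
              norm_num [hs]
          _ = _ := by ring
  rcases le_or_gt σ s with hσr | hσr
  · obtain ⟨k, h1, h2⟩ := exists_pow_scale hs0 hs0 (by norm_num [hs]) hσ hσr
    obtain ⟨P, hP, h⟩ := key k
    refine ⟨P, hP, fun z hzσ => ?_⟩
    refine (h z (hzσ.le.trans ?_)).trans ?_
    · rw [← mul_pow]
      gcongr
    · calc A * (s ^ k) ^ 5 ≤ A * (σ / (s * s)) ^ 5 := by gcongr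
        _ = _ := by rw [div_pow]; ring
  · refine ⟨fun z => 0, IsQuad.const 0, fun z hzσ => ?_⟩
    rw [sub_zero]
    have h2 : 1 ≤ (σ / (s * s)) ^ 5 := by
      refine one_le_pow₀ ?_
      rw [one_le_div (by positivity)]
      nlinarith [show s ≤ 1 by norm_num [hs]]
    calc _ ≤ A := hvA z (mem_closedBall_zero_iff.2 (by nlinarith))
      _ ≤ A * (σ / (s * s)) ^ 5 := by nlinarith
      _ = _ := by rw [div_pow]; ring

theorem BoundaryChart.expansion {K ρ : ℝ} (hK : 1 ≤ K) (hρ : 0 < ρ) : ∃ C, 0 < C ∧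
    ∀ (Ω : Set ℂ) (u f : ℂ → ℝ) (x : ℂ) (A : ℝ), IsOpen Ω → BoundaryChart Ω K ρ x → 0 < A →
      |f x| ≤ A → ContinuousOn u (closure Ω) → (∀ z ∈ Ω, |u z| ≤ A) →
      (∀ z ∈ frontier Ω, u z = 0) → (∀ z ∈ Ω, HasLap u (-f z) z) →
      (∀ z ∈ Ω, |f z - f x| ≤ A * ‖z - x‖) →
      ∀ σ, 0 < σ → σ ≤ 1 → ∃ P, IsQuad P (-f x) ∧ ∀ z ∈ Ω, ‖z - x‖ < σ ^ 2 →
        |u z - P z| ≤ C * A * σ ^ 5 := by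
  obtain ⟨C, hC, h⟩ := boundary_expansion hK hρ
  refine ⟨C, hC, fun Ω u f x A hΩ hch hA hfx hu huA hu0 hl hf σ hσ hσ1 => ?_⟩
  obtain ⟨n, κ, hn, hκ, hy⟩ := hch
  have hn0 : n ≠ 0 := by rintro rfl; simp at hn
  let H : ℂ ≃ₜ ℂ := (Homeomorph.mulLeft₀ n hn0).trans (Homeomorph.addLeft x)
  have hH : ∀ y, H y = x + n * y := fun y => rfl
  obtain ⟨P, hP, hPz⟩ := h (H ⁻¹' Ω) (fun y => u (H y)) (fun y => f (H y)) κ (f x) A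
    (hΩ.preimage H.continuous) hκ hA hfx
    (fun y hyρ => ⟨fun hD => (hy y hyρ).1 hD, fun hD => (hy y hyρ).2.1 hD,
      fun hD => (hy y hyρ).2.2 (by rwa [← H.preimage_frontier] at hD)⟩)
    (by
      rw [← H.preimage_closure]
      exact hu.comp H.continuous.continuousOn fun z hz => hz)
    (fun z hz => huA _ hz)
    (fun z hz => hu0 _ (by rwa [← H.preimage_frontier] at hz))
    (fun z hz => by
      have := HasLap.comp_affine (z := z) x n (u := u) (hl _ hz)
      simpa [hn, hH] using this)
    (fun z hz => by
      have := hf _ hz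
      simpa [hn, hH] using this) σ hσ hσ1
  refine ⟨fun z => P (-(n⁻¹ * x) + n⁻¹ * z),
    (hP.comp_affine _ _).congr_value (by simp [hn]), fun z hz hzσ => ?_⟩
  have e1 : H (n⁻¹ * (z - x)) = z := by rw [hH, mul_inv_cancel_left₀ hn0]; ring
  have e2 : n⁻¹ * (z - x) = -(n⁻¹ * x) + n⁻¹ * z := by ring
  have := hPz (n⁻¹ * (z - x)) (by rw [mem_preimage, e1]; exact hz)
    (by rw [norm_mul, norm_inv, hn, inv_one, one_mul]; exact hzσ)
  simp only [e1] at this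
  rwa [e2] at this

/-- At every scale `σ`, the function `u` is approximated near `x` on `S` by a quadratic polynomial
with Laplacian close to `-f x`. -/
def QuadApprox (S : Set ℂ) (u f : ℂ → ℝ) (C : ℝ) (x : ℂ) : Prop :=
  ∀ σ, 0 < σ → σ ≤ 1 → ∃ P l, IsQuad P l ∧ |l + f x| ≤ C * σ ∧
    ∀ z ∈ S, ‖z - x‖ < σ ^ 2 → |u z - P z| ≤ C * σ ^ 5

theorem ball_subset_of_disjoint_frontier {Ω : Set ℂ} {x : ℂ} {d : ℝ} (hx : x ∈ Ω)
    (h : ∀ y ∈ frontier Ω, d ≤ ‖x - y‖) : ball x d ⊆ Ω := by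
  rcases le_or_gt d 0 with hd | hd
  · rw [ball_eq_empty.2 hd]
    exact empty_subset _
  have hno : ∀ w ∈ ball x d, w ∉ frontier Ω := fun w hw hwf => by
    have := h w hwf
    rw [mem_ball, dist_comm, dist_eq_norm] at hw
    linarith
  by_contra hne
  obtain ⟨y, hy, hyΩ⟩ := not_subset.1 hne
  obtain ⟨w, -, hw1, hw2⟩ := (convex_ball x d).isPreconnected (interior Ω) (closure Ω)ᶜ
    isOpen_interior isClosed_closure.isOpen_compl
    (fun w hw => or_iff_not_imp_left.2 fun hwi hwc => hno w hw ⟨hwc, hwi⟩)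
    ⟨x, mem_ball_self hd, by_contra fun hi => hno x (mem_ball_self hd) ⟨subset_closure hx, hi⟩⟩
    ⟨y, hy, fun hyc => hno y hy ⟨hyc, fun hi => hyΩ (interior_subset hi)⟩⟩
  exact hw2 (subset_closure (interior_subset hw1))

theorem quadApprox_interior : ∃ C, 0 < C ∧ ∀ (Ω : Set ℂ) (u f : ℂ → ℝ) (x : ℂ) (A B τ : ℝ),
    x ∈ Ω → 0 < A → 1 ≤ B → 0 < τ → τ ≤ 1 → ball x (τ ^ 2) ⊆ Ω → ContinuousOn u (closure Ω) →
    (∀ z ∈ Ω, HasLap u (-f z) z) → (∀ z ∈ Ω, |f z - f x| ≤ A * ‖z - x‖) →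
    (∀ σ, τ ≤ σ → σ ≤ 1 → ∃ P l, IsQuad P l ∧ |l + f x| ≤ B * A * σ ∧
      ∀ z ∈ Ω, ‖z - x‖ < σ ^ 2 → |u z - P z| ≤ B * A * σ ^ 5) →
    QuadApprox Ω u f (C * B * A) x := by
  obtain ⟨C, hC, hdisc⟩ := disc_expansion
  refine ⟨2 * C + 1, by positivity, fun Ω u f x A B τ hxΩ hA hB hτ hτ1 hsub hu hl hf h => ?_⟩
  intro σ hσ hσ1
  rcases le_or_gt τ σ with hτσ | hτσ
  · obtain ⟨P, l, hP, h1, h2⟩ := h σ hτσ hσ1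
    have : B * A ≤ (2 * C + 1) * B * A := by
      nlinarith [show 0 < C * B * A by positivity]
    refine ⟨P, l, hP, h1.trans (by gcongr), fun z hz hzσ => (h2 z hz hzσ).trans (by gcongr)⟩
  obtain ⟨P, l, hP, hl1, hPz⟩ := h τ le_rfl hτ1
  let Q : ℂ → ℝ := fun z => P z + (-f x - l) / 4 * ‖-x + 1 * z‖ ^ 2
  have hQ : IsQuad Q (-f x) :=
    (hP.add ((IsQuad.norm_sq.comp_affine (-x) 1).const_mul _)).congr_value (by simp)
  have hτ2 : 0 < τ ^ 2 := by positivity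
  have hcb : closedBall x (τ ^ 2) ⊆ closure Ω := by
    rw [← closure_ball x hτ2.ne']
    exact closure_mono hsub
  have huQ : ∀ z ∈ ball x (τ ^ 2), |u z - Q z| ≤ 2 * B * A * τ ^ 5 := fun z hz => by
    have hz' : ‖z - x‖ < τ ^ 2 := by rwa [mem_ball, dist_eq_norm] at hz
    have e : u z - Q z = (u z - P z) + (l + f x) / 4 * ‖z - x‖ ^ 2 := by
      simp only [Q]
      rw [show -x + 1 * z = z - x by ring]
      ring
    rw [e]
    refine (abs_add_le _ _).trans ?_
    rw [abs_mul, abs_div, abs_of_pos (four_pos (α := ℝ)), abs_of_nonneg (sq_nonneg ‖z - x‖)]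
    have h1 : |l + f x| / 4 * ‖z - x‖ ^ 2 ≤ B * A * τ / 4 * (τ ^ 2) ^ 2 := by gcongr
    have h2 := hPz z (hsub hz) hz'
    have h3 : 0 < B * A * τ ^ 5 := by positivity
    calc _ ≤ B * A * τ ^ 5 + B * A * τ / 4 * (τ ^ 2) ^ 2 := add_le_add h2 h1
      _ = B * A * τ ^ 5 + B * A * τ ^ 5 / 4 := by ring
      _ ≤ _ := by linarith
  have huQc : ContinuousOn (fun z => u z - Q z) (closedBall x (τ ^ 2)) :=
    (hu.mono hcb).sub hQ.continuous.continuousOn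
  have huQ' : ∀ z ∈ closedBall x (τ ^ 2), |u z - Q z| ≤ 2 * B * A * τ ^ 5 := fun z hz => by
    rw [← closure_ball x hτ2.ne'] at hz huQc
    exact le_on_closure (f := fun z => |u z - Q z|) huQ huQc.abs continuousOn_const hz
  have hτC : ((τ ^ 2 : ℝ) : ℂ) ≠ 0 := by exact_mod_cast hτ2.ne'
  have hn : ∀ z : ℂ, ‖((τ ^ 2 : ℝ) : ℂ) * z‖ = τ ^ 2 * ‖z‖ := fun z => by
    rw [norm_mul, Complex.norm_real, Real.norm_of_nonneg hτ2.le]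
  obtain ⟨P', hP', hd⟩ := hdisc (fun y => u (x + (τ ^ 2 : ℝ) * y) - Q (x + (τ ^ 2 : ℝ) * y))
    (fun y => (τ ^ 2) ^ 2 * (-f (x + (τ ^ 2 : ℝ) * y) - -f x)) (2 * B * A * τ ^ 5) (by positivity)
    (huQc.comp (f := fun y : ℂ => x + (τ ^ 2 : ℝ) * y) (by fun_prop) fun y hy => by
      rw [mem_closedBall_zero_iff] at hy
      rw [mem_closedBall, dist_eq_norm, add_sub_cancel_left, hn]
      nlinarith)
    (fun y hy => huQ' _ (by
      rw [mem_closedBall_zero_iff] at hy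
      rw [mem_closedBall, dist_eq_norm, add_sub_cancel_left, hn]
      nlinarith))
    (fun y hy => by
      have hz : x + (τ ^ 2 : ℝ) * y ∈ Ω := hsub (by
        rw [mem_ball_zero_iff] at hy
        rw [mem_ball, dist_eq_norm, add_sub_cancel_left, hn]
        nlinarith)
      constructor
      · have := HasLap.comp_affine (z := y) x ((τ ^ 2 : ℝ) : ℂ) (u := fun w => u w - Q w)
          ((hl _ hz).sub (hQ.hasLap _))
        rwa [Complex.norm_real, Real.norm_of_nonneg hτ2.le] at this
      · have h1 := hf _ hz
        rw [add_sub_cancel_left, hn] at h1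
        rw [abs_mul, abs_of_pos (by positivity),
          show ∀ a b : ℝ, -a - -b = -(a - b) from fun a b => by ring, abs_neg]
        calc _ ≤ (τ ^ 2) ^ 2 * (A * (τ ^ 2 * ‖y‖)) := by gcongr
          _ = A * τ ^ 5 * ‖y‖ * τ := by ring
          _ ≤ A * τ ^ 5 * ‖y‖ * (2 * B) := by gcongr; linarith
          _ = _ := by ring)
    (σ / τ) (by positivity) ((div_le_one hτ).2 hτσ.le)
  refine ⟨fun z => Q z + P' (-(((τ ^ 2 : ℝ) : ℂ)⁻¹ * x) + ((τ ^ 2 : ℝ) : ℂ)⁻¹ * z), -f x,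
    (hQ.add (hP'.comp_affine _ _)).congr_value (by ring), ?_, fun z hz hzσ => ?_⟩
  · rw [neg_add_cancel, abs_zero]
    positivity
  · set y : ℂ := ((τ ^ 2 : ℝ) : ℂ)⁻¹ * (z - x) with hy
    have e1 : ((τ ^ 2 : ℝ) : ℂ) * y = z - x := by rw [hy, mul_inv_cancel_left₀ hτC]
    have e2 : -(((τ ^ 2 : ℝ) : ℂ)⁻¹ * x) + ((τ ^ 2 : ℝ) : ℂ)⁻¹ * z = y := by rw [hy]; ring
    have h1 := hd y (by
      have := hn y
      rw [e1] at this
      rw [div_pow, lt_div_iff₀ hτ2]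
      linarith)
    simp only [e1, add_sub_cancel] at h1
    simp only [e2, ← sub_sub]
    refine h1.trans ?_
    have h3 : 0 < B * A * σ ^ 5 := by positivity
    calc C * (2 * B * A * τ ^ 5) * (σ / τ) ^ 5 = 2 * C * B * A * σ ^ 5 := by
          field_simp
      _ ≤ _ := by nlinarith

theorem exists_quadApprox {Ω : Set ℂ} {K ρ : ℝ} (hΩ : IsOpen Ω) (hb : Bornology.IsBounded Ω)
    (hK : 1 ≤ K) (hρ : 0 < ρ) (hch : ∀ x ∈ frontier Ω, BoundaryChart Ω K ρ x) :
    ∃ C, 0 < C ∧ ∀ (u f : ℂ → ℝ) (A : ℝ), 0 < A → ContinuousOn u (closure Ω) →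
      (∀ z ∈ Ω, |u z| ≤ A) → (∀ z ∈ frontier Ω, u z = 0) → (∀ z ∈ Ω, HasLap u (-f z) z) →
      (∀ z ∈ closure Ω, |f z| ≤ A) →
      (∀ z ∈ closure Ω, ∀ w ∈ closure Ω, |f z - f w| ≤ A * ‖z - w‖) →
      ∀ x ∈ closure Ω, QuadApprox (closure Ω) u f (C * A) x := by
  obtain ⟨C₁, hC₁, hbd⟩ := BoundaryChart.expansion hK hρ
  obtain ⟨C₂, hC₂, hin⟩ := quadApprox_interior
  set B := 32 * C₁ + 32 with hB
  refine ⟨C₁ + C₂ * B, by positivity, fun u f A hA hu huA hu0 hl hf hfL x hx => ?_⟩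
  suffices h : QuadApprox Ω u f ((C₁ + C₂ * B) * A) x by
    intro σ hσ hσ1
    obtain ⟨P, l, hP, h1, h2⟩ := h σ hσ hσ1
    refine ⟨P, l, hP, h1, fun z hz hzσ => ?_⟩
    have hzc : z ∈ closure (ball x (σ ^ 2) ∩ Ω) :=
      isOpen_ball.inter_closure ⟨by rwa [mem_ball, dist_eq_norm], hz⟩
    refine le_on_closure (f := fun z => |u z - P z|) (s := ball x (σ ^ 2) ∩ Ω) (fun w hw => ?_)
      ((hu.sub hP.continuous.continuousOn).abs.mono (closure_mono inter_subset_right))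
      continuousOn_const hzc
    exact h2 w hw.2 (by simpa [dist_eq_norm] using hw.1)
  have hsub := subset_closure (s := Ω)
  by_cases hxf : x ∈ frontier Ω
  · intro σ hσ hσ1
    obtain ⟨P, hP, h⟩ := hbd Ω u f x A hΩ (hch x hxf) hA (hf x hx) hu huA hu0 hl
      (fun z hz => hfL z (hsub hz) x hx) σ hσ hσ1
    refine ⟨P, _, hP, by rw [neg_add_cancel, abs_zero]; positivity, fun z hz hzσ =>
      (h z hz hzσ).trans ?_⟩
    gcongr
    nlinarith [mul_pos hC₂ (show 0 < B by positivity)]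
  have hxΩ : x ∈ Ω := by
    by_contra hne
    exact hxf ⟨hx, by rwa [hΩ.interior_eq]⟩
  have hmain : QuadApprox Ω u f (C₂ * B * A) x := by
    have hlarge : ∀ σ : ℝ, 1 / 2 ≤ σ → ∃ P l, IsQuad P l ∧ |l + f x| ≤ B * A * σ ∧
        ∀ z ∈ Ω, ‖z - x‖ < σ ^ 2 → |u z - P z| ≤ B * A * σ ^ 5 := by
      intro σ hσ
      refine ⟨fun _ => 0, 0, IsQuad.const 0, ?_, fun z hz _ => ?_⟩
      · rw [zero_add]
        calc |f x| ≤ A := hf x hx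
          _ ≤ B * A * (1 / 2) := by nlinarith [mul_pos hC₁ hA]
          _ ≤ _ := by gcongr
      · rw [sub_zero]
        calc |u z| ≤ A := huA z hz
          _ ≤ B * A * (1 / 2) ^ 5 := by nlinarith [mul_pos hC₁ hA]
          _ ≤ _ := by gcongr
    by_cases hfar : ∀ y ∈ frontier Ω, (1 / 2) ^ 2 ≤ ‖x - y‖
    · exact hin Ω u f x A B (1 / 2) hxΩ hA (by linarith) (by norm_num) (by norm_num)
        (ball_subset_of_disjoint_frontier hxΩ hfar) hu hl
        (fun z hz => hfL z (hsub hz) x hx) (fun σ hσ _ => hlarge σ hσ)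
    · push Not at hfar
      obtain ⟨y, hy, hxy⟩ := hfar
      have hcomp : IsCompact (frontier Ω) :=
        Metric.isCompact_of_isClosed_isBounded isClosed_frontier (hb.closure.subset frontier_subset_closure)
      obtain ⟨x₀, hx₀, hmin⟩ := hcomp.exists_isMinOn ⟨y, hy⟩
        (f := fun y => ‖x - y‖) (by fun_prop)
      have hd0 : 0 < ‖x - x₀‖ := by
        rw [norm_pos_iff, sub_ne_zero]
        rintro rfl
        exact hxf hx₀
      have hd1 : ‖x - x₀‖ < (1 / 2) ^ 2 := (hmin hy).trans_lt hxy
      set τ := √‖x - x₀‖ with hτ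
      have hτ2 : τ ^ 2 = ‖x - x₀‖ := Real.sq_sqrt hd0.le
      have hτ0 : 0 < τ := Real.sqrt_pos.2 hd0
      have hτ1 : τ ≤ 1 / 2 := by
        rw [hτ, Real.sqrt_le_left (by norm_num)]
        exact hd1.le
      refine hin Ω u f x A B τ hxΩ hA (by linarith) hτ0 (by linarith)
        (ball_subset_of_disjoint_frontier hxΩ fun w hw => by rw [hτ2]; exact hmin hw) hu hl
        (fun z hz => hfL z (hsub hz) x hx) fun σ hσ hσ1 => ?_
      rcases le_or_gt (1 / 2) σ with h2 | h2
      · exact hlarge σ h2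
      have hσ0 : 0 < σ := hτ0.trans_le hσ
      have hx₀c := frontier_subset_closure hx₀
      obtain ⟨P, hP, h⟩ := hbd Ω u f x₀ A hΩ (hch x₀ hx₀) hA (hf x₀ hx₀c) hu huA hu0 hl
        (fun z hz => hfL z (hsub hz) x₀ hx₀c) (2 * σ) (by positivity) (by linarith)
      have hτσ : τ ^ 2 ≤ σ ^ 2 := by gcongr
      refine ⟨P, _, hP, ?_, fun z hz hzσ => (h z hz ?_).trans ?_⟩
      · rw [neg_add_eq_sub]
        calc |f x - f x₀| ≤ A * ‖x - x₀‖ := hfL x hx x₀ hx₀c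
          _ = A * τ ^ 2 := by rw [hτ2]
          _ ≤ A * σ := by
            gcongr
            nlinarith
          _ ≤ _ := by nlinarith [mul_pos hA hσ0, mul_pos hC₁ (mul_pos hA hσ0)]
      · calc ‖z - x₀‖ = ‖(z - x) + (x - x₀)‖ := by ring_nf
          _ ≤ ‖z - x‖ + ‖x - x₀‖ := norm_add_le _ _
          _ < (2 * σ) ^ 2 := by nlinarith [sq_nonneg σ]
      · have : 0 < A * σ ^ 5 := by positivity
        rw [hB]
        nlinarith
  intro σ hσ hσ1
  obtain ⟨P, l, hP, h1, h2⟩ := hmain σ hσ hσ1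
  have : C₂ * B * A ≤ (C₁ + C₂ * B) * A := by nlinarith [mul_pos hC₁ hA]
  exact ⟨P, l, hP, h1.trans (by gcongr), fun z hz hzσ => (h2 z hz hzσ).trans (by gcongr)⟩

/-- `f` is `C²` and its derivatives up to order two at `x` are bounded by `b`. -/
def DerivBound (f : ℂ → ℝ) (x : ℂ) (b : ℝ) : Prop :=
  ContDiff ℝ 2 f ∧ ∀ i ≤ 2, ‖iteratedFDeriv ℝ i f x‖ ≤ b

namespace DerivBound

variable {f g : ℂ → ℝ} {x : ℂ} {a b : ℝ}

theorem nonneg (hf : DerivBound f x a) : 0 ≤ a := (norm_nonneg _).trans (hf.2 0 (by norm_num))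

theorem mono (hf : DerivBound f x a) (h : a ≤ b) : DerivBound f x b :=
  ⟨hf.1, fun i hi => (hf.2 i hi).trans h⟩

theorem add (hf : DerivBound f x a) (hg : DerivBound g x b) :
    DerivBound (fun y => f y + g y) x (a + b) := by
  refine ⟨hf.1.add hg.1, fun i hi => ?_⟩
  have hi2 : ((i : ℕ) : WithTop ℕ∞) ≤ 2 := by exact_mod_cast hi
  have := iteratedFDeriv_add_apply (x := x) (hf.1.contDiffAt.of_le hi2) (hg.1.contDiffAt.of_le hi2)
  rw [show (fun y => f y + g y) = f + g from rfl, this]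
  exact (norm_add_le _ _).trans (add_le_add (hf.2 i hi) (hg.2 i hi))

theorem const_mul (c : ℝ) (hf : DerivBound f x a) : DerivBound (fun y => c * f y) x (|c| * a) := by
  refine ⟨contDiff_const.mul hf.1, fun i hi => ?_⟩
  have hi2 : ((i : ℕ) : WithTop ℕ∞) ≤ 2 := by exact_mod_cast hi
  have := iteratedFDeriv_const_smul_apply (x := x) (a := c) (hf.1.contDiffAt.of_le hi2)
  rw [show (fun y => c * f y) = c • f from rfl, this, norm_smul, Real.norm_eq_abs]
  exact mul_le_mul_of_nonneg_left (hf.2 i hi) (abs_nonneg c)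

theorem sub (hf : DerivBound f x a) (hg : DerivBound g x b) :
    DerivBound (fun y => f y - g y) x (a + b) := by
  have := hf.add (hg.const_mul (-1))
  simpa [sub_eq_add_neg] using this

theorem mul (hf : DerivBound f x a) (hg : DerivBound g x b) :
    DerivBound (fun y => f y * g y) x (4 * a * b) := by
  refine ⟨hf.1.mul hg.1, fun i hi => ?_⟩
  have hi2 : ((i : ℕ) : WithTop ℕ∞) ≤ 2 := by exact_mod_cast hi
  have ha := hf.nonneg
  have hb := hg.nonneg
  refine (norm_iteratedFDeriv_mul_le hf.1 hg.1 x hi2).trans ?_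
  calc _ ≤ ∑ j ∈ Finset.range (i + 1), (i.choose j : ℝ) * (a * b) := by
        refine Finset.sum_le_sum fun j hj => ?_
        rw [mul_assoc]
        have h1 := hf.2 j (by have := Finset.mem_range.1 hj; omega)
        have h2 := hg.2 (i - j) (by omega)
        gcongr
    _ = 2 ^ i * (a * b) := by
        rw [← Finset.sum_mul]
        congr 1
        exact_mod_cast Nat.sum_range_choose i
    _ ≤ 2 ^ 2 * (a * b) := by
        gcongr
        norm_num
    _ = _ := by ring

theorem const (c : ℝ) : DerivBound (fun _ => c) x |c| := by
  refine ⟨contDiff_const, fun i hi => ?_⟩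
  rcases eq_or_ne i 0 with rfl | h
  · rw [norm_iteratedFDeriv_zero, Real.norm_eq_abs]
  · rw [iteratedFDeriv_const_of_ne h]
    simp

theorem clm (L : ℂ →L[ℝ] ℝ) (hL : ‖L‖ ≤ 1) : DerivBound (fun y => L y) x (‖x‖ + 1) := by
  refine ⟨L.contDiff, fun i hi => ?_⟩
  have h1 : ‖L x‖ ≤ ‖x‖ := (L.le_opNorm x).trans (by nlinarith [norm_nonneg x])
  have h2 : (fderiv ℝ fun y => L y) = fun _ => L := funext fun y => L.fderiv
  have h0 := norm_nonneg x
  interval_cases i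
  · rw [norm_iteratedFDeriv_zero]
    linarith
  · rw [← norm_iteratedFDeriv_fderiv, norm_iteratedFDeriv_zero, h2]
    linarith
  · rw [← norm_iteratedFDeriv_fderiv, h2, iteratedFDeriv_const_of_ne one_ne_zero]
    simp
    linarith

theorem comp_smul {c : ℝ} (hf : DerivBound f (c • x) a) :
    DerivBound (fun y => f (c • y)) x ((1 + |c|) ^ 2 * a) := by
  refine ⟨hf.1.comp (contDiff_const_smul c), fun i hi => ?_⟩
  have hi2 : ((i : ℕ) : WithTop ℕ∞) ≤ 2 := by exact_mod_cast hi
  rw [iteratedFDeriv_comp_const_smul c (hf.1.of_le hi2), norm_smul, norm_pow, Real.norm_eq_abs]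
  have h3 : |c| ^ i ≤ (1 + |c|) ^ 2 :=
    (pow_le_pow_left₀ (abs_nonneg c) (by linarith) i).trans
      (pow_le_pow_right₀ (by linarith [abs_nonneg c]) hi)
  exact mul_le_mul h3 (hf.2 i hi) (norm_nonneg _) (by positivity)

theorem comp_add {y : ℂ} (hf : DerivBound f (y + x) a) : DerivBound (fun w => f (y + w)) x a := by
  refine ⟨hf.1.comp (contDiff_const.add contDiff_id), fun i hi => ?_⟩
  rw [iteratedFDeriv_comp_add_left']
  exact hf.2 i hi

theorem congr (hf : DerivBound f x a) (hg : ContDiff ℝ 2 g) (h : g =ᶠ[𝓝 x] f) :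
    DerivBound g x a := by
  refine ⟨hg, fun i hi => ?_⟩
  rw [(h.iteratedFDeriv ℝ i).eq_of_nhds]
  exact hf.2 i hi

theorem sum {ι : Type*} {F : ι → ℂ → ℝ} {B : ι → ℝ} (s : Finset ι)
    (h : ∀ m ∈ s, DerivBound (F m) x (B m)) :
    DerivBound (fun y => ∑ m ∈ s, F m y) x (∑ m ∈ s, B m) := by
  classical
  induction s using Finset.induction_on with
  | empty => simpa using DerivBound.const (x := x) 0
  | insert m s hm ih =>
    simp only [Finset.sum_insert hm]
    exact (h m (Finset.mem_insert_self m s)).add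
      (ih fun k hk => h k (Finset.mem_insert_of_mem hk))

end DerivBound

set_option maxHeartbeats 1000000 in
theorem IsQuad.exists_derivBound_aux {c R : ℝ} (hc : 0 < c) (hR : 0 ≤ R) : ∃ B, 0 < B ∧
    ∀ (Q : ℂ → ℝ) (l M : ℝ), IsQuad Q l → (∀ w ∈ ball (0 : ℂ) c, |Q w| ≤ M) →
      ∀ w, ‖w‖ ≤ R → DerivBound Q w (B * M) := by
  set t := c / 2 with ht
  have ht0 : 0 < t := by positivity
  set S := 4 * (R + 1) * (R + 1) with hS
  refine ⟨1 + 4 / t * (R + 1) + 20 / t ^ 2 * S, by positivity, fun Q l M hQ hM w hw => ?_⟩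
  have hM0 : 0 ≤ M := (abs_nonneg _).trans (hM 0 (mem_ball_self hc))
  obtain ⟨q, a, b, h⟩ := hQ
  have hre : DerivBound (fun z => z.re) w (R + 1) :=
    (DerivBound.clm Complex.reCLM (ContinuousLinearMap.opNorm_le_bound _ zero_le_one fun x => by
      simpa using Complex.abs_re_le_norm x)).mono (by linarith)
  have him : DerivBound (fun z => z.im) w (R + 1) :=
    (DerivBound.clm Complex.imCLM (ContinuousLinearMap.opNorm_le_bound _ zero_le_one fun x => by
      simpa using Complex.abs_im_le_norm x)).mono (by linarith)
  have hn : ∀ z : ℂ, ‖z‖ ^ 2 = z.re * z.re + z.im * z.im := fun z => by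
    rw [Complex.sq_norm, Complex.normSq_apply]
  have hv : ∀ z : ℂ, Q z = q + (a.re * z.re - a.im * z.im) + (b.re * (z.re * z.re - z.im * z.im) -
      2 * b.im * (z.re * z.im)) + l / 4 * (z.re * z.re + z.im * z.im) := fun z => by
    rw [h, hn]
    simp only [sq, Complex.mul_re, Complex.mul_im]
    ring
  have val : ∀ z : ℂ, ‖z‖ ^ 2 ≤ t ^ 2 → |Q z| ≤ M := fun z hz => hM z (by
    rw [mem_ball_zero_iff]
    have := (pow_le_pow_iff_left₀ (norm_nonneg z) ht0.le two_ne_zero).1 hz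
    linarith)
  have v0 := abs_le.1 (val 0 (by simp; positivity))
  have v1 := abs_le.1 (val ⟨t, 0⟩ (by rw [hn]; simp; nlinarith))
  have v2 := abs_le.1 (val ⟨-t, 0⟩ (by rw [hn]; simp; nlinarith))
  have v3 := abs_le.1 (val ⟨0, t⟩ (by rw [hn]; simp; nlinarith))
  have v4 := abs_le.1 (val ⟨0, -t⟩ (by rw [hn]; simp; nlinarith))
  have v5 := abs_le.1 (val ⟨t / 2, t / 2⟩ (by rw [hn]; simp; nlinarith))
  have v6 := abs_le.1 (val ⟨-(t / 2), -(t / 2)⟩ (by rw [hn]; simp; nlinarith))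
  have v7 := abs_le.1 (val ⟨t / 2, -(t / 2)⟩ (by rw [hn]; simp; nlinarith))
  have v8 := abs_le.1 (val ⟨-(t / 2), t / 2⟩ (by rw [hn]; simp; nlinarith))
  rw [hv] at v0 v1 v2 v3 v4 v5 v6 v7 v8
  simp only [Complex.zero_re, Complex.zero_im] at v0 v1 v2 v3 v4 v5 v6 v7 v8
  have ht2 : 0 < t ^ 2 := by positivity
  have bq : |q| ≤ M := abs_le.2 ⟨by linarith, by linarith⟩
  have ba1 : |a.re| ≤ M / t := by
    rw [le_div_iff₀ ht0, ← abs_of_pos ht0, ← abs_mul, abs_le]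
    constructor <;> linarith
  have ba2 : |a.im| ≤ M / t := by
    rw [le_div_iff₀ ht0, ← abs_of_pos ht0, ← abs_mul, abs_le]
    constructor <;> linarith
  have bl : |l / 4| ≤ 2 * M / t ^ 2 := by
    rw [le_div_iff₀ ht2, ← abs_of_pos ht2, ← abs_mul, abs_le]
    constructor <;> linarith
  have bb1 : |b.re| ≤ M / t ^ 2 := by
    rw [le_div_iff₀ ht2, ← abs_of_pos ht2, ← abs_mul, abs_le]
    constructor <;> linarith
  have bb2 : |2 * b.im| ≤ 4 * M / t ^ 2 := by
    rw [le_div_iff₀ ht2, ← abs_of_pos ht2, ← abs_mul, abs_le]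
    constructor <;> linarith
  have D := (((DerivBound.const (x := w) q).add ((hre.const_mul a.re).sub (him.const_mul a.im))).add
    ((((hre.mul hre).sub (him.mul him)).const_mul b.re).sub
      ((hre.mul him).const_mul (2 * b.im)))).add (((hre.mul hre).add (him.mul him)).const_mul (l / 4))
  rw [show Q = _ from funext hv]
  refine D.mono ?_
  rw [← hS]
  have hS0 : 0 ≤ S := by positivity
  have hSS : 0 ≤ S + S := by positivity
  have hR1 : 0 ≤ R + 1 := by positivity
  calc _ ≤ M + (M / t * (R + 1) + M / t * (R + 1)) +
        (M / t ^ 2 * (S + S) + 4 * M / t ^ 2 * S) + 2 * M / t ^ 2 * (S + S) :=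
        add_le_add (add_le_add (add_le_add bq (add_le_add (mul_le_mul_of_nonneg_right ba1 hR1)
          (mul_le_mul_of_nonneg_right ba2 hR1)))
          (add_le_add (mul_le_mul_of_nonneg_right bb1 hSS) (mul_le_mul_of_nonneg_right bb2 hS0)))
          (mul_le_mul_of_nonneg_right bl hSS)
    _ ≤ (1 + 4 / t * (R + 1) + 20 / t ^ 2 * S) * M := by
      have e1 : 0 ≤ M / t * (R + 1) := by positivity
      have e2 : 0 ≤ M / t ^ 2 * S := by positivity
      have e3 : (1 + 4 / t * (R + 1) + 20 / t ^ 2 * S) * M =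
        M + 4 * (M / t * (R + 1)) + 20 * (M / t ^ 2 * S) := by ring
      rw [e3]
      have e4 : 4 * M / t ^ 2 * S = 4 * (M / t ^ 2 * S) := by ring
      have e5 : 2 * M / t ^ 2 * (S + S) = 4 * (M / t ^ 2 * S) := by ring
      rw [e4, e5]
      linarith

theorem IsQuad.exists_derivBound {c R : ℝ} (hc : 0 < c) (hR : 0 ≤ R) : ∃ B, 0 < B ∧
    ∀ (Q : ℂ → ℝ) (l M : ℝ) (y : ℂ), IsQuad Q l → (∀ w ∈ ball y c, |Q w| ≤ M) →
      ∀ w, ‖w - y‖ ≤ R → DerivBound Q w (B * M) := by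
  obtain ⟨B, hB, h⟩ := IsQuad.exists_derivBound_aux hc hR
  refine ⟨B, hB, fun Q l M y hQ hM w hw => ?_⟩
  have h1 := h (fun z => Q (y + 1 * z)) _ M (hQ.comp_affine y 1)
    (fun z hz => hM _ (by simpa [dist_eq_norm] using hz)) (w - y) hw
  have h2 := DerivBound.comp_add (f := fun z => Q (y + 1 * z)) (y := -y) (x := w)
    (by rwa [neg_add_eq_sub])
  simpa using h2

/-- A smooth bump whose integer translates sum to one. -/
def latticeBump₁ (t : ℝ) : ℝ := Real.smoothTransition (t + 1) - Real.smoothTransition t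

/-- A smooth bump on the plane whose translates along the integer lattice sum to one. -/
def latticeBump (z : ℂ) : ℝ := latticeBump₁ z.re * latticeBump₁ z.im

/-- The lattice point with the given coordinates. -/
def latticePt (m : ℤ × ℤ) : ℂ := ⟨m.1, m.2⟩

theorem latticeBump₁_eq_zero {t : ℝ} (h : 1 ≤ |t|) : latticeBump₁ t = 0 := by
  rcases le_abs.1 h with h | h
  · rw [latticeBump₁, Real.smoothTransition.one_of_one_le (by linarith),
      Real.smoothTransition.one_of_one_le h, sub_self]
  · rw [latticeBump₁, Real.smoothTransition.zero_of_nonpos (by linarith),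
      Real.smoothTransition.zero_of_nonpos (by linarith), sub_self]

theorem latticeBump₁_nonneg (t : ℝ) : 0 ≤ latticeBump₁ t := by
  rw [latticeBump₁, sub_nonneg]
  exact Real.smoothTransition.monotone (by linarith)

theorem latticeBump_nonneg (z : ℂ) : 0 ≤ latticeBump z :=
  mul_nonneg (latticeBump₁_nonneg _) (latticeBump₁_nonneg _)

theorem latticeBump_eq_zero {z : ℂ} (h : 3 / 2 ≤ ‖z‖) : latticeBump z = 0 := by
  have h1 : ‖z‖ ^ 2 = z.re ^ 2 + z.im ^ 2 := by rw [Complex.sq_norm, Complex.normSq_apply]; ring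
  rcases le_or_gt 1 |z.re| with h2 | h2
  · rw [latticeBump, latticeBump₁_eq_zero h2, zero_mul]
  · rw [latticeBump, latticeBump₁_eq_zero (t := z.im), mul_zero]
    by_contra! h3
    have := (sq_lt_one_iff_abs_lt_one _).2 h2
    have := (sq_lt_one_iff_abs_lt_one _).2 h3
    nlinarith

theorem contDiff_latticeBump : ContDiff ℝ 2 latticeBump := by
  have h : ContDiff ℝ 2 latticeBump₁ :=
    (Real.smoothTransition.contDiff.comp (contDiff_id.add contDiff_const)).sub
      Real.smoothTransition.contDiff
  exact (h.comp Complex.reCLM.contDiff).mul (h.comp Complex.imCLM.contDiff)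

theorem exists_derivBound_latticeBump : ∃ B, 0 < B ∧ ∀ x, DerivBound latticeBump x B := by
  have hcs : HasCompactSupport latticeBump :=
    HasCompactSupport.intro (isCompact_closedBall 0 (3 / 2)) fun z hz => latticeBump_eq_zero (by
      rw [mem_closedBall_zero_iff] at hz
      linarith)
  have h : ∀ i ≤ 2, ∃ B, ∀ x, ‖iteratedFDeriv ℝ i latticeBump x‖ ≤ B := fun i hi =>
    (contDiff_latticeBump.continuous_iteratedFDeriv (m := i)
      (by exact_mod_cast hi)).bounded_above_of_compact_support (hcs.iteratedFDeriv i)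
  obtain ⟨B0, h0⟩ := h 0 (by norm_num)
  obtain ⟨B1, h1⟩ := h 1 (by norm_num)
  obtain ⟨B2, h2⟩ := h 2 (by norm_num)
  refine ⟨1 + |B0| + |B1| + |B2|, by positivity, fun x => ⟨contDiff_latticeBump, fun i hi => ?_⟩⟩
  have a0 := le_abs_self B0
  have a1 := le_abs_self B1
  have a2 := le_abs_self B2
  have p0 := abs_nonneg B0
  have p1 := abs_nonneg B1
  have p2 := abs_nonneg B2
  interval_cases i
  · linarith [h0 x]
  · linarith [h1 x]
  · linarith [h2 x]

theorem latticeBump₁_floor (t : ℝ) :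
    latticeBump₁ (t - ⌊t⌋) + latticeBump₁ (t - (⌊t⌋ + 1 : ℤ)) = 1 := by
  have h1 := Int.floor_le t
  have h2 := Int.lt_floor_add_one t
  push_cast
  rw [latticeBump₁, latticeBump₁, Real.smoothTransition.one_of_one_le (by linarith),
    Real.smoothTransition.zero_of_nonpos (x := t - (⌊t⌋ + 1)) (by linarith)]
  ring_nf

theorem latticeBump₁_eq_zero_of_notMem {t : ℝ} {n : ℤ} (h : n ≠ ⌊t⌋) (h' : n ≠ ⌊t⌋ + 1) :
    latticeBump₁ (t - n) = 0 := by
  refine latticeBump₁_eq_zero ?_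
  have h1 := Int.floor_le t
  have h2 := Int.lt_floor_add_one t
  rcases lt_or_gt_of_ne h with h3 | h3
  · have : (n : ℝ) + 1 ≤ ⌊t⌋ := by exact_mod_cast h3
    exact le_abs.2 (Or.inl (by linarith))
  · have : (⌊t⌋ : ℝ) + 2 ≤ n := by
      have : ⌊t⌋ + 2 ≤ n := by omega
      exact_mod_cast this
    exact le_abs.2 (Or.inr (by linarith))

theorem sum_latticeBump {w : ℂ} {s : Finset (ℤ × ℤ)}
    (hs : ∀ m, ‖w - latticePt m‖ < 2 → m ∈ s) : ∑ m ∈ s, latticeBump (w - latticePt m) = 1 := by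
  have hterm : ∀ m : ℤ × ℤ, latticeBump (w - latticePt m) =
    latticeBump₁ (w.re - m.1) * latticeBump₁ (w.im - m.2) := fun m => by
      simp [latticeBump, latticePt]
  set T : Finset (ℤ × ℤ) := {⌊w.re⌋, ⌊w.re⌋ + 1} ×ˢ {⌊w.im⌋, ⌊w.im⌋ + 1} with hT
  have hzero : ∀ m, m ∉ T → latticeBump (w - latticePt m) = 0 := by
    intro m hm
    simp only [hT, Finset.mem_product, Finset.mem_insert, Finset.mem_singleton, not_and_or,
      not_or] at hm
    rw [hterm]
    rcases hm with hm | hm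
    · rw [latticeBump₁_eq_zero_of_notMem hm.1 hm.2, zero_mul]
    · rw [latticeBump₁_eq_zero_of_notMem hm.1 hm.2, mul_zero]
  have hzero' : ∀ m, m ∉ s → latticeBump (w - latticePt m) = 0 := by
    intro m hm
    refine latticeBump_eq_zero ?_
    by_contra! h
    exact hm (hs m (by linarith))
  calc ∑ m ∈ s, latticeBump (w - latticePt m) = ∑ m ∈ s ∪ T, latticeBump (w - latticePt m) :=
        Finset.sum_subset Finset.subset_union_left fun m _ hm => hzero' m hm
    _ = ∑ m ∈ T, latticeBump (w - latticePt m) :=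
        (Finset.sum_subset Finset.subset_union_right fun m _ hm => hzero m hm).symm
    _ = 1 := by
      simp only [hterm, hT]
      rw [Finset.sum_product]
      simp only [← Finset.mul_sum]
      rw [← Finset.sum_mul, Finset.sum_pair (by simp), Finset.sum_pair (by simp),
        latticeBump₁_floor, latticeBump₁_floor, one_mul]

theorem sum_le_of_lattice_support {w : ℂ} {s : Finset (ℤ × ℤ)} {F : ℤ × ℤ → ℝ} {B : ℝ}
    (hB : 0 ≤ B) (hF : ∀ m ∈ s, F m ≤ B) (h0 : ∀ m ∈ s, 2 ≤ ‖w - latticePt m‖ → F m = 0) :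
    ∑ m ∈ s, F m ≤ 25 * B := by
  classical
  set T : Finset (ℤ × ℤ) :=
    Finset.Icc (⌊w.re⌋ - 2) (⌊w.re⌋ + 2) ×ˢ Finset.Icc (⌊w.im⌋ - 2) (⌊w.im⌋ + 2) with hT
  have aux : ∀ (t : ℝ) (n : ℤ), |t - n| < 2 → n ∈ Finset.Icc (⌊t⌋ - 2) (⌊t⌋ + 2) := by
    intro t n h
    rw [abs_lt] at h
    have h1 := Int.floor_le t
    have h2 := Int.lt_floor_add_one t
    rw [Finset.mem_Icc]
    constructor
    · have : (⌊t⌋ : ℝ) - 2 < n + 1 := by linarith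
      have : ⌊t⌋ - 2 < n + 1 := by exact_mod_cast this
      omega
    · have : (n : ℝ) < ⌊t⌋ + 3 := by linarith
      have : n < ⌊t⌋ + 3 := by exact_mod_cast this
      omega
  have hmem : ∀ m, ‖w - latticePt m‖ < 2 → m ∈ T := by
    intro m hm
    rw [hT, Finset.mem_product]
    refine ⟨aux _ _ (lt_of_le_of_lt ?_ hm), aux _ _ (lt_of_le_of_lt ?_ hm)⟩
    · simpa [latticePt] using Complex.abs_re_le_norm (w - latticePt m)
    · simpa [latticePt] using Complex.abs_im_le_norm (w - latticePt m)
  calc ∑ m ∈ s, F m = ∑ m ∈ s ∩ T, F m := by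
        refine (Finset.sum_subset Finset.inter_subset_left fun m hm hmT => h0 m hm ?_).symm
        by_contra! h
        exact hmT (Finset.mem_inter.2 ⟨hm, hmem m h⟩)
    _ ≤ (s ∩ T).card • B :=
        Finset.sum_le_card_nsmul _ _ _ fun m hm => hF m (Finset.mem_inter.1 hm).1
    _ ≤ 25 * B := by
        rw [nsmul_eq_mul]
        gcongr
        have h1 : (s ∩ T).card ≤ T.card := Finset.card_le_card Finset.inter_subset_right
        have h2 : T.card = 25 := by
          have e : ∀ a : ℤ, (a + 2 + 1 - (a - 2)).toNat = 5 := fun a => by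
            rw [show a + 2 + 1 - (a - 2) = 5 by ring]
            rfl
          rw [hT, Finset.card_product, Int.card_Icc, Int.card_Icc, e, e]
        exact_mod_cast h1.trans h2.le

theorem IsQuad.contDiff {P : ℂ → ℝ} {l : ℝ} (hP : IsQuad P l) : ContDiff ℝ 2 P :=
  contDiff_iff_contDiffAt.2 fun z => (hP.hasLap z).1

theorem exists_derivBound_bump_mul {c : ℝ} (hc : 0 < c) : ∃ B, 0 < B ∧
    ∀ (a b : ℂ) (Q : ℂ → ℝ) (l A : ℝ), 0 ≤ A → IsQuad Q l →
      (‖a - (1 / 4 : ℝ) • b‖ < 4 → ∃ y, ‖y - a‖ ≤ 20 ∧ ∀ z ∈ ball y c, |Q z| ≤ A) → ∀ w,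
        DerivBound (fun w => latticeBump (w - a) * (latticeBump ((4 : ℝ) • w - b) * Q w)) w (B * A) ∧
        (2 ≤ ‖w - a‖ ∨ 2 ≤ ‖(4 : ℝ) • w - b‖ →
          DerivBound (fun w => latticeBump (w - a) * (latticeBump ((4 : ℝ) • w - b) * Q w)) w 0) := by
  obtain ⟨B₁, hB₁, h₁⟩ := exists_derivBound_latticeBump
  obtain ⟨B₂, hB₂, h₂⟩ := IsQuad.exists_derivBound hc (R := 30) (by norm_num)
  have hG : ∀ (b w : ℂ), DerivBound (fun w => latticeBump (w - b)) w B₁ := fun b w => by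
    have := DerivBound.comp_add (y := -b) (x := w) (h₁ _)
    simpa [neg_add_eq_sub] using this
  refine ⟨4 * B₁ * (4 * ((1 + |4|) ^ 2 * B₁) * B₂), by positivity,
    fun a b Q l A hA hQ hy w => ?_⟩
  have hsm : ContDiff ℝ 2
      (fun w => latticeBump (w - a) * (latticeBump ((4 : ℝ) • w - b) * Q w)) :=
    (contDiff_latticeBump.comp (contDiff_id.sub contDiff_const)).mul
      ((contDiff_latticeBump.comp ((contDiff_const_smul _).sub contDiff_const)).mul hQ.contDiff)
  have hfar : 2 ≤ ‖w - a‖ ∨ 2 ≤ ‖(4 : ℝ) • w - b‖ →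
      DerivBound (fun w => latticeBump (w - a) * (latticeBump ((4 : ℝ) • w - b) * Q w)) w 0 := by
    intro h
    have h0 := DerivBound.const (x := w) 0
    rw [abs_zero] at h0
    refine h0.congr hsm ?_
    rcases h with h | h
    · have : ∀ᶠ v in 𝓝 w, 3 / 2 < ‖v - a‖ :=
        (continuous_id.sub continuous_const).norm.continuousAt.eventually_const_lt
          (lt_of_lt_of_le (by norm_num) h)
      filter_upwards [this] with v hv
      rw [latticeBump_eq_zero hv.le, zero_mul]
    · have : ∀ᶠ v in 𝓝 w, 3 / 2 < ‖(4 : ℝ) • v - b‖ :=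
        ((continuous_const_smul (4 : ℝ)).sub continuous_const).norm.continuousAt.eventually_const_lt
          (lt_of_lt_of_le (by norm_num) h)
      filter_upwards [this] with v hv
      rw [latticeBump_eq_zero hv.le, zero_mul, mul_zero]
  refine ⟨?_, hfar⟩
  by_cases h : 2 ≤ ‖w - a‖ ∨ 2 ≤ ‖(4 : ℝ) • w - b‖
  · exact (hfar h).mono (by positivity)
  · push Not at h
    have e : w - (1 / 4 : ℝ) • b = (1 / 4 : ℝ) • ((4 : ℝ) • w - b) := by
      rw [smul_sub, smul_smul]; norm_num
    have h3 : ‖w - (1 / 4 : ℝ) • b‖ < 1 / 2 := by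
      rw [e, norm_smul, Real.norm_eq_abs, abs_of_pos (by norm_num)]
      linarith [h.2]
    obtain ⟨y, hya, hyA⟩ := hy (by
      have := norm_sub_le (w - (1 / 4 : ℝ) • b) (w - a)
      rw [sub_sub_sub_cancel_left] at this
      linarith [h.1])
    have hwy : ‖w - y‖ ≤ 30 := by
      have := norm_sub_le (w - a) (y - a)
      rw [sub_sub_sub_cancel_right] at this
      linarith [h.1]
    have d2 : DerivBound (fun w => latticeBump ((4 : ℝ) • w - b)) w ((1 + |4|) ^ 2 * B₁) :=
      DerivBound.comp_smul (f := fun w => latticeBump (w - b)) (hG b _)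
    have := (hG a w).mul (d2.mul (h₂ Q l A y hQ hyA w hwy))
    exact this.mono (le_of_eq (by ring))

theorem exists_derivBound_glue {c : ℝ} (hc : 0 < c) : ∃ B, 0 < B ∧
    ∀ (h A : ℝ) (M M' : Finset (ℤ × ℤ)) (P P' : ℤ × ℤ → ℂ → ℝ) (l l' : ℤ × ℤ → ℝ),
      0 < h → 0 ≤ A → (∀ m, IsQuad (P m) (l m)) → (∀ m, IsQuad (P' m) (l' m)) →
      (∀ m ∈ M, ∀ m' ∈ M', ‖h • latticePt m - (h / 4) • latticePt m'‖ < 4 * h →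
        ∃ y, ‖y - h • latticePt m‖ ≤ 20 * h ∧ ∀ z ∈ ball y (c * h), |P' m' z - P m z| ≤ A) →
      ∀ x, DerivBound (fun x => ∑ m ∈ M, ∑ m' ∈ M', latticeBump (h⁻¹ • x - latticePt m) *
        (latticeBump ((4 : ℝ) • (h⁻¹ • x) - latticePt m') * (P' m' x - P m x))) x
        ((1 + |h⁻¹|) ^ 2 * (B * A)) := by
  obtain ⟨B, hB, hb⟩ := exists_derivBound_bump_mul hc
  refine ⟨25 * (25 * B), by positivity, fun h A M M' P P' l l' hh hA hP hP' hy x => ?_⟩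
  set T : ℂ → ℝ := fun w => ∑ m ∈ M, ∑ m' ∈ M', latticeBump (w - latticePt m) *
    (latticeBump ((4 : ℝ) • w - latticePt m') *
      (P' m' (0 + (h : ℂ) * w) - P m (0 + (h : ℂ) * w))) with hT
  have key : ∀ w, DerivBound T w (25 * (25 * B) * A) := by
    intro w
    classical
    have h1 : ∀ m ∈ M, ∀ m' ∈ M', DerivBound (fun w => latticeBump (w - latticePt m) *
        (latticeBump ((4 : ℝ) • w - latticePt m') *
        (P' m' (0 + (h : ℂ) * w) - P m (0 + (h : ℂ) * w)))) w
        (if ‖w - latticePt m‖ < 2 ∧ ‖(4 : ℝ) • w - latticePt m'‖ < 2 then B * A else 0) := by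
      intro m hm m' hm'
      obtain ⟨g1, g2⟩ := hb (latticePt m) (latticePt m')
        (fun w => P' m' (0 + (h : ℂ) * w) - P m (0 + (h : ℂ) * w)) _ A hA
        (((hP' m').comp_affine 0 h).sub ((hP m).comp_affine 0 h)) (by
          intro hn
          obtain ⟨y, hy1, hy2⟩ := hy m hm m' hm' (by
            have e : h • latticePt m - (h / 4) • latticePt m' =
              h • (latticePt m - (1 / 4 : ℝ) • latticePt m') := by
                rw [smul_sub, smul_smul]; ring_nf
            rw [e, norm_smul, Real.norm_eq_abs, abs_of_pos hh]
            nlinarith)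
          refine ⟨h⁻¹ • y, ?_, fun z hz => hy2 _ ?_⟩
          · have e : h⁻¹ • y - latticePt m = h⁻¹ • (y - h • latticePt m) := by
              rw [smul_sub, smul_smul, inv_mul_cancel₀ hh.ne', one_smul]
            rw [e, norm_smul, norm_inv, Real.norm_eq_abs, abs_of_pos hh, inv_mul_le_iff₀ hh]
            linarith
          · rw [mem_ball, dist_eq_norm] at hz ⊢
            have e : 0 + (h : ℂ) * z - y = h • (z - h⁻¹ • y) := by
              rw [smul_sub, smul_smul, mul_inv_cancel₀ hh.ne', one_smul, zero_add,
                Complex.real_smul]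
            rw [e, norm_smul, Real.norm_eq_abs, abs_of_pos hh]
            nlinarith) w
      split_ifs with hif
      · exact g1
      · rw [not_and_or, not_lt, not_lt] at hif
        exact g2 hif
    refine (DerivBound.sum M fun m hm => DerivBound.sum M' fun m' hm' => h1 m hm m' hm').mono ?_
    rw [mul_assoc, mul_assoc]
    refine sum_le_of_lattice_support (w := w) (by positivity) (fun m _ => ?_) fun m _ hm => ?_
    · refine sum_le_of_lattice_support (w := (4 : ℝ) • w) (by positivity) (fun m' _ => ?_)
        fun m' _ hm' => ?_
      · split_ifs
        · exact le_rfl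
        · positivity
      · rw [if_neg fun h => not_lt.2 hm' h.2]
    · exact Finset.sum_eq_zero fun m' _ => by rw [if_neg fun h => not_lt.2 hm h.1]
  have := DerivBound.comp_smul (c := h⁻¹) (x := x) (key _)
  have e : ∀ x : ℂ, 0 + (h : ℂ) * (h⁻¹ • x) = x := fun x => by
    rw [zero_add, ← Complex.real_smul, smul_smul, mul_inv_cancel₀ hh.ne', one_smul]
  simpa only [hT, e] using this

theorem exists_finset_lattice {S : Set ℂ} (hS : Bornology.IsBounded S) {h : ℝ} (hh : 0 < h) :
    ∃ M : Finset (ℤ × ℤ), ∀ m, m ∈ M ↔ ∃ s ∈ S, ‖s - h • latticePt m‖ < 4 * h := by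
  have hfin : {m : ℤ × ℤ | ∃ s ∈ S, ‖s - h • latticePt m‖ < 4 * h}.Finite := by
    obtain ⟨R, hR⟩ := hS.exists_norm_le
    set N := ⌈(R + 4 * h) / h⌉ with hN
    have hle : (R + 4 * h) / h ≤ N := Int.le_ceil _
    rw [div_le_iff₀ hh] at hle
    refine (((Finset.Icc (-N) N) ×ˢ (Finset.Icc (-N) N)).finite_toSet).subset ?_
    rintro m ⟨s, hs, hm⟩
    have h1 : ‖h • latticePt m‖ ≤ N * h := by
      have := norm_sub_le s (s - h • latticePt m)
      rw [sub_sub_cancel] at this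
      linarith [hR s hs]
    rw [norm_smul, Real.norm_eq_abs, abs_of_pos hh, mul_comm, mul_le_mul_iff_left₀ hh] at h1
    have h2 : |(m.1 : ℝ)| ≤ N := (Complex.abs_re_le_norm (latticePt m)).trans h1
    have h3 : |(m.2 : ℝ)| ≤ N := (Complex.abs_im_le_norm (latticePt m)).trans h1
    rw [abs_le] at h2 h3
    simp only [Finset.coe_product, Finset.coe_Icc, Set.mem_prod, Set.mem_Icc]
    exact ⟨⟨by exact_mod_cast h2.1, by exact_mod_cast h2.2⟩,
      ⟨by exact_mod_cast h3.1, by exact_mod_cast h3.2⟩⟩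
  exact ⟨hfin.toFinset, fun m => by simp⟩

set_option maxHeartbeats 1000000 in
theorem exists_contDiff_extension {S : Set ℂ} {u f : ℂ → ℝ} {C c : ℝ} (hS : Bornology.IsBounded S)
    (hC : 0 ≤ C) (hc : 0 < c)
    (hfat : ∀ x ∈ S, ∀ h, 0 < h → h ≤ 1 → ∃ y, ball y (c * h) ⊆ S ∩ ball x h)
    (hQ : ∀ x ∈ S, QuadApprox S u f C x) : ∃ E : ℂ → ℝ, ContDiff ℝ 2 E ∧ ∀ x ∈ S, E x = u x := by
  classical
  set σ : ℕ → ℝ := fun k => (1 / 2) ^ k with hσ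
  set h : ℕ → ℝ := fun k => σ k ^ 2 / 40 with hh
  have hσ0 : ∀ k, 0 < σ k := fun k => by positivity
  have hσ1 : ∀ k, σ k ≤ 1 := fun k => pow_le_one₀ (by norm_num) (by norm_num)
  have hσs : ∀ k, σ (k + 1) = σ k / 2 := fun k => by simp only [hσ, pow_succ]; ring
  have hh0 : ∀ k, 0 < h k := fun k => by have := hσ0 k; positivity
  have hh1 : ∀ k, h k ≤ 1 := fun k => by
    have := hσ1 k
    have := hσ0 k
    simp only [hh]
    nlinarith
  have hhs : ∀ k, h (k + 1) = h k / 4 := fun k => by simp only [hh, hσs]; ring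
  have hhσ : ∀ k, σ k ^ 2 = 40 * h k := fun k => by simp only [hh]; ring
  choose M hM using fun k => exists_finset_lattice hS (hh0 k)
  have hP : ∀ k m, ∃ (s : ℂ) (P : ℂ → ℝ) (l : ℝ), IsQuad P l ∧ (m ∈ M k → s ∈ S ∧
      ‖s - h k • latticePt m‖ < 4 * h k ∧
      ∀ z ∈ S, ‖z - s‖ < σ k ^ 2 → |u z - P z| ≤ C * σ k ^ 5) := by
    intro k m
    by_cases hm : m ∈ M k
    · obtain ⟨s, hs, hsm⟩ := (hM k m).1 hm
      obtain ⟨P, l, hPq, -, hPa⟩ := hQ s hs (σ k) (hσ0 k) (hσ1 k)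
      exact ⟨s, P, l, hPq, fun _ => ⟨hs, hsm, hPa⟩⟩
    · exact ⟨0, fun _ => 0, 0, IsQuad.const 0, fun hm' => absurd hm' hm⟩
  choose s P l hPq hPM using hP
  obtain ⟨B, hB, hglue⟩ := exists_derivBound_glue hc
  set U : ℕ → ℂ → ℝ := fun k x =>
    ∑ m ∈ M k, latticeBump ((h k)⁻¹ • x - latticePt m) * P k m x with hU
  set D : ℕ → ℂ → ℝ := fun k x => ∑ m ∈ M k, ∑ m' ∈ M (k + 1),
    latticeBump ((h k)⁻¹ • x - latticePt m) * (latticeBump ((4 : ℝ) • ((h k)⁻¹ • x) - latticePt m') *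
      (P (k + 1) m' x - P k m x)) with hD
  have hDb : ∀ k x, DerivBound (D k) x ((1 + |(h k)⁻¹|) ^ 2 * (B * (2 * C * σ k ^ 5))) := by
    intro k x
    refine hglue (h k) (2 * C * σ k ^ 5) (M k) (M (k + 1)) (P k) (P (k + 1)) (l k) (l (k + 1))
      (hh0 k) (by have := hσ0 k; positivity) (hPq k) (hPq (k + 1)) (fun m hm m' hm' hn => ?_) x
    obtain ⟨a1, a2, a3⟩ := hPM k m hm
    obtain ⟨b1, b2, b3⟩ := hPM (k + 1) m' hm'
    rw [hhs] at b2
    have hk := hh0 k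
    have e1 : ‖s k m - s (k + 1) m'‖ < 9 * h k := by
      have t1 := norm_add_le (s k m - h k • latticePt m) (h k • latticePt m - (h k / 4) • latticePt m')
      have t2 := norm_sub_le (s k m - h k • latticePt m +
        (h k • latticePt m - (h k / 4) • latticePt m')) (s (k + 1) m' - (h k / 4) • latticePt m')
      rw [sub_add_sub_cancel, sub_sub_sub_cancel_right] at t2
      rw [sub_add_sub_cancel] at t1
      linarith
    obtain ⟨y, hy⟩ := hfat _ a1 (h k) hk (hh1 k)
    have hy0 : y ∈ S ∩ ball (s k m) (h k) := hy (mem_ball_self (by positivity))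
    refine ⟨y, ?_, fun z hz => ?_⟩
    · have := norm_add_le (y - s k m) (s k m - h k • latticePt m)
      rw [sub_add_sub_cancel] at this
      have := mem_ball_iff_norm.1 hy0.2
      linarith
    · have hzS := hy hz
      have z1 := mem_ball_iff_norm.1 hzS.2
      have z2 : ‖z - s (k + 1) m'‖ < 10 * h k := by
        have := norm_add_le (z - s k m) (s k m - s (k + 1) m')
        rw [sub_add_sub_cancel] at this
        linarith
      have c1 := a3 z hzS.1 (by rw [hhσ]; linarith)
      have c2 := b3 z hzS.1 (by rw [hhσ, hhs]; linarith)
      have c3 : C * σ (k + 1) ^ 5 ≤ C * σ k ^ 5 := by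
        gcongr
        rw [hσs]
        linarith [hσ0 k]
      rw [abs_le] at c1 c2 ⊢
      constructor <;> linarith
  have hDb' : ∀ k x, DerivBound (D k) x (3362 * B * C * σ k) := by
    intro k x
    refine (hDb k x).mono ?_
    have hk := hσ0 k
    have e1 : (1 + |(h k)⁻¹|) ≤ 41 * (σ k ^ 2)⁻¹ := by
      rw [abs_of_pos (inv_pos.2 (hh0 k))]
      have : 1 ≤ (σ k ^ 2)⁻¹ := (one_le_inv₀ (by positivity)).2 (pow_le_one₀ hk.le (hσ1 k))
      have e : (h k)⁻¹ = 40 * (σ k ^ 2)⁻¹ := by simp only [hh]; field_simp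
      rw [e]
      linarith
    calc (1 + |(h k)⁻¹|) ^ 2 * (B * (2 * C * σ k ^ 5))
        ≤ (41 * (σ k ^ 2)⁻¹) ^ 2 * (B * (2 * C * σ k ^ 5)) := by gcongr
      _ = 3362 * B * C * σ k := by field_simp; ring
  have hUs : ContDiff ℝ 2 (U 0) := by
    refine ContDiff.sum fun m _ => ContDiff.mul ?_ (hPq 0 m).contDiff
    exact contDiff_latticeBump.comp ((contDiff_const_smul _).sub contDiff_const)
  have hEs : ContDiff ℝ 2 fun x => ∑' k, D k x := by
    refine contDiff_tsum (N := 2) (v := fun _ k => 3362 * B * C * σ k) (fun k => (hDb' k 0).1)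
      (fun _ _ => ?_) fun j k x hj => (hDb' k x).2 j (by exact_mod_cast hj)
    exact (summable_geometric_of_lt_one (by norm_num) (by norm_num)).mul_left _
  have hone : ∀ k, ∀ x ∈ S, ∑ m ∈ M k, latticeBump ((h k)⁻¹ • x - latticePt m) = 1 := by
    intro k x hx
    refine sum_latticeBump fun m hm => (hM k m).2 ⟨x, hx, ?_⟩
    have e : x - h k • latticePt m = h k • ((h k)⁻¹ • x - latticePt m) := by
      rw [smul_sub, smul_smul, mul_inv_cancel₀ (hh0 k).ne', one_smul]
    rw [e, norm_smul, Real.norm_eq_abs, abs_of_pos (hh0 k)]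
    nlinarith [hh0 k]
  have hUD : ∀ k, ∀ x ∈ S, D k x = U (k + 1) x - U k x := by
    intro k x hx
    have e4 : (4 : ℝ) • ((h k)⁻¹ • x) = (h (k + 1))⁻¹ • x := by
      rw [smul_smul, hhs]
      congr 1
      have := (hh0 k).ne'
      field_simp
    simp only [hD, hU, e4]
    simp only [← Finset.mul_sum, mul_sub, Finset.sum_sub_distrib]
    rw [← Finset.sum_mul, hone k x hx, one_mul]
    congr 1
    refine Finset.sum_congr rfl fun m _ => ?_
    rw [← Finset.sum_mul, hone (k + 1) x hx, one_mul]
  have hUu : ∀ k, ∀ x ∈ S, |U k x - u x| ≤ C * σ k ^ 5 := by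
    intro k x hx
    have hk := hh0 k
    have e : U k x - u x =
        ∑ m ∈ M k, latticeBump ((h k)⁻¹ • x - latticePt m) * (P k m x - u x) := by
      simp only [mul_sub, Finset.sum_sub_distrib, ← Finset.sum_mul, hone k x hx, one_mul, hU]
    rw [e]
    calc _ ≤ ∑ m ∈ M k, latticeBump ((h k)⁻¹ • x - latticePt m) * (C * σ k ^ 5) := by
          refine (Finset.abs_sum_le_sum_abs _ _).trans (Finset.sum_le_sum fun m hm => ?_)
          rw [abs_mul, abs_of_nonneg (latticeBump_nonneg _)]
          rcases le_or_gt (3 / 2) ‖(h k)⁻¹ • x - latticePt m‖ with hf | hf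
          · rw [latticeBump_eq_zero hf, zero_mul, zero_mul]
          · refine mul_le_mul_of_nonneg_left ?_ (latticeBump_nonneg _)
            obtain ⟨a1, a2, a3⟩ := hPM k m hm
            rw [abs_sub_comm]
            refine a3 x hx ?_
            have e : x - h k • latticePt m = h k • ((h k)⁻¹ • x - latticePt m) := by
              rw [smul_sub, smul_smul, mul_inv_cancel₀ hk.ne', one_smul]
            have e2 : ‖x - h k • latticePt m‖ ≤ 3 / 2 * h k := by
              rw [e, norm_smul, Real.norm_eq_abs, abs_of_pos hk]
              nlinarith
            have := norm_sub_le (x - h k • latticePt m) (s k m - h k • latticePt m)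
            rw [sub_sub_sub_cancel_right] at this
            rw [hhσ]
            linarith
      _ = C * σ k ^ 5 := by rw [← Finset.sum_mul, hone k x hx, one_mul]
  refine ⟨fun x => U 0 x + ∑' k, D k x, hUs.add hEs, fun x hx => ?_⟩
  have hsum : Summable fun k => D k x := by
    refine Summable.of_norm_bounded (g := fun k => 3362 * B * C * σ k)
      ((summable_geometric_of_lt_one (by norm_num) (by norm_num)).mul_left _) fun k => ?_
    have := (hDb' k x).2 0 (by norm_num)
    rwa [norm_iteratedFDeriv_zero] at this
  have hlim : Tendsto (fun n => U n x) atTop (𝓝 (u x)) := by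
    rw [tendsto_iff_norm_sub_tendsto_zero]
    refine squeeze_zero (fun n => norm_nonneg _) (fun n => hUu n x hx) ?_
    have : Tendsto σ atTop (𝓝 0) := tendsto_pow_atTop_nhds_zero_of_lt_one (by norm_num) (by norm_num)
    simpa using (this.pow 5).const_mul C
  have h2 : Tendsto (fun n => ∑ k ∈ Finset.range n, D k x) atTop (𝓝 (u x - U 0 x)) := by
    have : (fun n => ∑ k ∈ Finset.range n, D k x) = fun n => U n x - U 0 x := by
      funext n
      rw [← Finset.sum_range_sub (fun k => U k x)]
      exact Finset.sum_congr rfl fun k _ => hUD k x hx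
    rw [this]
    exact hlim.sub_const _
  have h3 := tendsto_nhds_unique hsum.hasSum.tendsto_sum_nat h2
  show U 0 x + ∑' k, D k x = u x
  rw [h3]
  ring

theorem QuadApprox.neg {S : Set ℂ} {u f : ℂ → ℝ} {C : ℝ} {x : ℂ} (h : QuadApprox S u f C x) :
    QuadApprox S (fun z => -u z) (fun z => -f z) C x := by
  intro σ h0 h1
  obtain ⟨P, l, hP, hl, hu⟩ := h σ h0 h1
  refine ⟨fun z => -1 * P z, -1 * l, hP.const_mul (-1), ?_, fun z hz hzx => ?_⟩
  · rw [← abs_neg]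
    convert hl using 2
    ring
  · rw [← abs_neg]
    convert hu z hz hzx using 2
    ring

theorem QuadApprox.of_approx {S : Set ℂ} {u f : ℂ → ℝ} {C : ℝ} {x : ℂ}
    (h : ∀ ε > 0, ∃ u' f', (∀ z ∈ S, |u z - u' z| ≤ ε) ∧ |f x - f' x| ≤ ε ∧
      QuadApprox S u' f' C x) : QuadApprox S u f (C + 1) x := by
  intro σ h0 h1
  obtain ⟨u', f', hu, hf, hq⟩ := h (σ ^ 5) (by positivity)
  obtain ⟨P, l, hP, hl, hP'⟩ := hq σ h0 h1
  have h5 : σ ^ 5 ≤ σ := by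
    have := pow_le_pow_of_le_one h0.le h1 (show 1 ≤ 5 by norm_num)
    rwa [pow_one] at this
  refine ⟨P, l, hP, ?_, fun z hz hzx => ?_⟩
  · have := abs_add_le (l + f' x) (f x - f' x)
    rw [add_add_sub_cancel] at this
    linarith
  · have := abs_add_le (u z - u' z) (u' z - P z)
    rw [sub_add_sub_cancel] at this
    linarith [hu z hz, hP' z hz hzx]

theorem continuous_laplacian {E : ℂ → ℝ} (hE : ContDiff ℝ 2 E) : Continuous (Δ E) := by
  rw [laplacian_eq_iteratedFDeriv_complexPlane]
  have h := hE.continuous_iteratedFDeriv (m := 2) le_rfl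
  exact ((ContinuousMultilinearMap.apply ℝ (fun _ : Fin 2 => ℂ) ℝ _).continuous.comp h).add
    ((ContinuousMultilinearMap.apply ℝ (fun _ : Fin 2 => ℂ) ℝ _).continuous.comp h)

theorem laplacian_le_of_quadApprox {S : Set ℂ} {u f E : ℂ → ℝ} {C : ℝ} {x : ℂ} (hC : 0 < C)
    (hE : ContDiff ℝ 2 E) (hEu : ∀ z ∈ S, E z = u z) (hx : x ∈ interior S)
    (hQ : QuadApprox S u f C x) : (Δ E) x ≤ -f x := by
  by_contra! hlt
  set κ := ((Δ E) x + f x) / 2 with hκ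
  have hκ0 : 0 < κ := by rw [hκ]; linarith
  have hcont : ∀ᶠ z in 𝓝 x, (Δ E) x - κ / 2 < (Δ E) z :=
    (continuous_laplacian hE).continuousAt.eventually_const_lt (by linarith)
  obtain ⟨r, hr, hrS⟩ := Metric.mem_nhds_iff.1
    (Filter.inter_mem hcont (mem_interior_iff_mem_nhds.1 hx))
  obtain ⟨σ, hσ0, hσ⟩ := exists_between (show 0 < min (min 1 r) (κ / (64 * C)) by positivity)
  obtain ⟨⟨hσ1, hσr⟩, hσκ⟩ := by simpa only [lt_min_iff] using hσ
  rw [lt_div_iff₀ (by positivity)] at hσκ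
  obtain ⟨P, l, hP, hl, hPu⟩ := hQ σ hσ0 hσ1.le
  set t := σ ^ 2 / 2 with ht
  have ht0 : 0 < t := by positivity
  have hσ2 : σ ^ 2 ≤ σ := by nlinarith
  have htr : t < r := by nlinarith
  set v : ℂ → ℝ := fun z => P z + (C * σ ^ 5 + κ / 4 * (‖-x + 1 * z‖ ^ 2 - t ^ 2)) with hv
  have hvl : ∀ z, HasLap v (l + κ) z := fun z =>
    ((hP.hasLap z).add ((HasLap.const (C * σ ^ 5)).add
      (((HasLap.norm_sq.comp_affine (-x) 1).sub (HasLap.const (t ^ 2))).const_mul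
        (κ / 4)))).congr_value (by rw [norm_one]; ring)
  have hvc : Continuous v := continuous_iff_continuousAt.2 fun z => (hvl z).continuousAt
  have hball : ∀ z ∈ closedBall x t, z ∈ S ∧ (Δ E) x - κ / 2 < (Δ E) z := fun z hz =>
    have := hrS (closedBall_subset_ball htr hz)
    ⟨this.2, this.1⟩
  have hmax := le_of_hasLap_le (D := ball x t) isOpen_ball isBounded_ball (u := E) (v := v)
    hE.continuous.continuousOn hvc.continuousOn (fun z hz => by
      refine ⟨(Δ E) z, l + κ, ?_, ⟨hE.contDiffAt, rfl⟩, hvl z⟩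
      have h1 := (hball z (ball_subset_closedBall hz)).2
      have h2 := (abs_le.1 hl).2
      linarith) (fun z hz => by
      rw [frontier_ball x ht0.ne'] at hz
      have hz' : ‖-x + 1 * z‖ = t := by
        rw [one_mul, neg_add_eq_sub]
        exact mem_sphere_iff_norm.1 hz
      have hzS := (hball z (sphere_subset_closedBall hz)).1
      have h3 := hPu z hzS (by
        rw [mem_sphere_iff_norm.1 hz, ht]
        linarith [pow_pos hσ0 2])
      rw [hEu z hzS]
      simp only [hv, hz', sub_self, mul_zero]
      linarith [(abs_le.1 h3).2]) x (subset_closure (mem_ball_self ht0))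
  have hxS := interior_subset hx
  have h4 := hPu x hxS (by rw [sub_self, norm_zero]; positivity)
  rw [hEu x hxS] at hmax
  simp only [hv, one_mul, neg_add_cancel, norm_zero] at hmax
  have h5 := (abs_le.1 h4).1
  have h6 : κ / 4 * t ^ 2 ≤ 2 * (C * σ ^ 5) := by nlinarith
  have h7 : σ ^ 4 * κ ≤ σ ^ 4 * (32 * C * σ) := by
    rw [ht] at h6
    nlinarith
  have h8 := le_of_mul_le_mul_left h7 (by positivity)
  nlinarith

theorem hasLap_of_quadApprox {S : Set ℂ} {u f E : ℂ → ℝ} {C : ℝ} {x : ℂ} (hC : 0 < C)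
    (hE : ContDiff ℝ 2 E) (hEu : ∀ z ∈ S, E z = u z) (hx : x ∈ interior S)
    (hQ : QuadApprox S u f C x) : HasLap E (-f x) x := by
  refine ⟨hE.contDiffAt, le_antisymm (laplacian_le_of_quadApprox hC hE hEu hx hQ) ?_⟩
  have h1 := laplacian_le_of_quadApprox hC hE.neg (fun z hz => by simp [hEu z hz]) hx hQ.neg
  have h2 : (Δ fun z => -E z) x = -(Δ E) x :=
    ((HasLap.neg (f := E) (z := x) ⟨hE.contDiffAt, rfl⟩)).2
  rw [h2] at h1
  linarith

theorem exists_ball_subset_of_boundaryChart {Ω : Set ℂ} {K ρ : ℝ} (hΩ : IsOpen Ω) (hK : 1 ≤ K)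
    (hρ : 0 < ρ) (hch : ∀ x ∈ frontier Ω, BoundaryChart Ω K ρ x) : ∃ c, 0 < c ∧
      ∀ x ∈ closure Ω, ∀ h, 0 < h → h ≤ 1 → ∃ y, ball y (c * h) ⊆ closure Ω ∩ ball x h := by
  set δ := min (1 / (2 * K)) ρ with hδ
  have hδ0 : 0 < δ := by positivity
  have hδK : δ * (2 * K) ≤ 1 := by
    rw [← le_div_iff₀ (by positivity)]
    exact min_le_left _ _
  have hδρ : δ ≤ ρ := min_le_right _ _
  have hδ1 : δ ≤ 1 / 2 := by nlinarith
  refine ⟨δ / 8, by positivity, fun x hx h h0 h1 => ?_⟩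
  set r := δ * h with hr
  have hr0 : 0 < r := by positivity
  have hrδ : r ≤ δ := by nlinarith
  have hrh : r ≤ h := by nlinarith
  have e : δ / 8 * h = r / 8 := by rw [hr]; ring
  rw [e]
  by_cases hd : ∀ y ∈ frontier Ω, r / 8 ≤ ‖x - y‖
  · have hxΩ : x ∈ Ω := by
      by_contra hn
      have := hd x ⟨hx, by rwa [hΩ.interior_eq]⟩
      rw [sub_self, norm_zero] at this
      linarith
    exact ⟨x, subset_inter ((ball_subset_of_disjoint_frontier hxΩ hd).trans subset_closure)
      (ball_subset_ball (by linarith))⟩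
  · push Not at hd
    obtain ⟨b, hb, hxb⟩ := hd
    obtain ⟨n, κ, hn, -, hy⟩ := hch b hb
    refine ⟨b + n * (-(r / 2) : ℝ), fun z hz => ?_⟩
    have hn0 : n ≠ 0 := by rw [← norm_ne_zero_iff, hn]; norm_num
    set w := n⁻¹ * (z - b) with hw
    have hzw : z = b + n * w := by rw [hw, mul_inv_cancel_left₀ hn0]; ring
    have hwn : ‖w - (-(r / 2) : ℝ)‖ < r / 8 := by
      rw [mem_ball_iff_norm, hzw, add_sub_add_left_eq_sub, ← mul_sub, norm_mul, hn, one_mul] at hz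
      exact hz
    have hre : w.re < -(3 * r / 8) := by
      have := (le_abs_self _).trans (Complex.abs_re_le_norm (w - (-(r / 2) : ℝ)))
      rw [Complex.sub_re, Complex.ofReal_re] at this
      linarith
    have hwr : ‖w‖ < 5 * r / 8 := by
      have h1 := norm_add_le (w - (-(r / 2) : ℝ)) ((-(r / 2) : ℝ) : ℂ)
      rw [sub_add_cancel, Complex.norm_real, norm_neg, Real.norm_eq_abs,
        abs_of_pos (by positivity)] at h1
      linarith
    refine ⟨subset_closure ?_, ?_⟩
    · rw [hzw]
      refine (hy w (by linarith)).2.1 ?_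
      have hw2 : ‖w‖ ^ 2 ≤ (5 * r / 8) ^ 2 := by gcongr
      have : K * ‖w‖ ^ 2 ≤ K * (5 * r / 8) ^ 2 := by gcongr
      have : K * r * r ≤ 1 / 2 * r := by
        refine mul_le_mul_of_nonneg_right ?_ hr0.le
        nlinarith
      nlinarith
    · rw [mem_ball_iff_norm]
      have h2 : ‖z - b‖ = ‖w‖ := by rw [hzw, add_sub_cancel_left, norm_mul, hn, one_mul]
      have h3 := norm_sub_le (z - b) (x - b)
      rw [sub_sub_sub_cancel_right] at h3
      linarith

theorem HasLap.log_norm_sq_add {ε : ℝ} (hε : 0 < ε) (z : ℂ) :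
    HasLap (fun w => Real.log (‖w‖ ^ 2 + ε ^ 2)) (4 * ε ^ 2 / (‖z‖ ^ 2 + ε ^ 2) ^ 2) z := by
  have hn : ∀ w : ℂ, ‖w‖ ^ 2 = w.re ^ 2 + w.im ^ 2 := fun w => by
    rw [Complex.sq_norm, Complex.normSq_apply]; ring
  have hpos : ∀ a b : ℝ, a ^ 2 + b ^ 2 + ε ^ 2 ≠ 0 := fun a b => by positivity
  have hsm : ContDiffAt ℝ 2 (fun w : ℂ => Real.log (‖w‖ ^ 2 + ε ^ 2)) z :=
    ContDiffAt.log ((contDiff_norm_sq ℝ).contDiffAt.add contDiffAt_const) (by positivity)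
  have d1 : ∀ a b t : ℝ, HasDerivAt (fun t : ℝ => Real.log ((a + t) ^ 2 + b ^ 2 + ε ^ 2))
      (2 * (a + t) / ((a + t) ^ 2 + b ^ 2 + ε ^ 2)) t := fun a b t => by
    have h1 := ((((hasDerivAt_id t).const_add a).pow 2).add_const (b ^ 2)).add_const (ε ^ 2)
    have := h1.log (hpos _ _)
    simpa using this
  have d2 : ∀ a b : ℝ, HasDerivAt (fun t : ℝ => 2 * (a + t) / ((a + t) ^ 2 + b ^ 2 + ε ^ 2))
      ((2 * (a ^ 2 + b ^ 2 + ε ^ 2) - 2 * a * (2 * a)) / (a ^ 2 + b ^ 2 + ε ^ 2) ^ 2) 0 :=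
    fun a b => by
    have h1 := ((((hasDerivAt_id (0 : ℝ)).const_add a).pow 2).add_const (b ^ 2)).add_const (ε ^ 2)
    have := (((hasDerivAt_id (0 : ℝ)).const_add a).const_mul 2).div h1 (hpos _ _)
    have e : (fun t : ℝ => 2 * (a + t) / ((a + t) ^ 2 + b ^ 2 + ε ^ 2)) =
      (fun y => 2 * (a + y)) / fun x => (a + x) ^ 2 + b ^ 2 + ε ^ 2 := rfl
    rw [e]
    simpa using this
  have h := HasLap.of_lines hsm (g := fun t => 2 * (z.re + t) / ((z.re + t) ^ 2 + z.im ^ 2 + ε ^ 2))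
    (k := fun t => 2 * (z.im + t) / ((z.im + t) ^ 2 + z.re ^ 2 + ε ^ 2))
    (Eventually.of_forall fun t => by simpa [hn] using d1 z.re z.im t) (d2 z.re z.im)
    (Eventually.of_forall fun t => by
      have := d1 z.im z.re t
      simpa [hn, add_comm (z.re ^ 2)] using this) (d2 z.im z.re)
  refine h.congr_value ?_
  rw [hn, add_comm (z.im ^ 2), ← add_div]
  congr 1
  ring

theorem fderiv_convolution_apply {g W : ℂ → ℝ} (hg : LocallyIntegrable g) (hW : ContDiff ℝ 1 W)
    (hc : HasCompactSupport W) (x e : ℂ) :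
    fderiv ℝ (convolution g W (ContinuousLinearMap.mul ℝ ℝ) volume) x e =
      convolution g (fun y => fderiv ℝ W y e) (ContinuousLinearMap.mul ℝ ℝ) volume x := by
  rw [(hc.hasFDerivAt_convolution_right (ContinuousLinearMap.mul ℝ ℝ) hg hW x).fderiv]
  exact convolution_precompR_apply _ hg (hc.fderiv ℝ) (hW.continuous_fderiv one_ne_zero) x e

theorem iteratedFDeriv_two_eq_fderiv_fderiv {f : ℂ → ℝ} (hf : ContDiff ℝ 2 f) (x e : ℂ) :
    iteratedFDeriv ℝ 2 f x ![e, e] = fderiv ℝ (fun y => fderiv ℝ f y e) x e := by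
  rw [iteratedFDeriv_two_apply]
  have h : DifferentiableAt ℝ (fderiv ℝ f) x :=
    (hf.fderiv_right (m := 1) (by norm_num)).differentiable (by simp) x
  rw [fderiv_clm_apply h (by fun_prop)]
  simp

theorem hasLap_convolution {g W : ℂ → ℝ} (hg : LocallyIntegrable g) (hW : ContDiff ℝ 2 W)
    (hc : HasCompactSupport W) (x : ℂ) :
    HasLap (convolution g W (ContinuousLinearMap.mul ℝ ℝ) volume)
      (∫ y, g y * (Δ W) (x - y)) x := by
  have hs : ContDiff ℝ 2 (convolution g W (ContinuousLinearMap.mul ℝ ℝ) volume) :=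
    hc.contDiff_convolution_right _ hg hW
  refine ⟨hs.contDiffAt, ?_⟩
  have hfd : ∀ e : ℂ, ContDiff ℝ 1 fun y => fderiv ℝ W y e := fun e =>
    (hW.fderiv_right (m := 1) (by norm_num)).clm_apply contDiff_const
  have hcs : ∀ e : ℂ, HasCompactSupport fun y => fderiv ℝ W y e := fun e => hc.fderiv_apply ℝ e
  have hcs2 : ∀ e : ℂ, HasCompactSupport fun y => fderiv ℝ (fun y => fderiv ℝ W y e) y e :=
    fun e => (hcs e).fderiv_apply ℝ e
  have key : ∀ e : ℂ,
      iteratedFDeriv ℝ 2 (convolution g W (ContinuousLinearMap.mul ℝ ℝ) volume) x ![e, e] =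
        convolution g (fun y => fderiv ℝ (fun y => fderiv ℝ W y e) y e)
          (ContinuousLinearMap.mul ℝ ℝ) volume x := fun e => by
    rw [iteratedFDeriv_two_eq_fderiv_fderiv hs]
    have : (fun y => fderiv ℝ (convolution g W (ContinuousLinearMap.mul ℝ ℝ) volume) y e) =
        convolution g (fun y => fderiv ℝ W y e) (ContinuousLinearMap.mul ℝ ℝ) volume :=
      funext fun y => fderiv_convolution_apply hg (hW.of_le (by norm_num)) hc y e
    rw [this, fderiv_convolution_apply hg (hfd e) (hcs e)]
  rw [laplacian_eq_iteratedFDeriv_complexPlane]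
  simp only [key]
  rw [convolution, convolution, ← integral_add]
  · refine integral_congr_ae (Eventually.of_forall fun y => ?_)
    simp only [ContinuousLinearMap.mul_apply']
    rw [laplacian_eq_iteratedFDeriv_complexPlane]
    simp only [iteratedFDeriv_two_eq_fderiv_fderiv hW]
    ring
  · exact (hcs2 1).convolutionExists_right (ContinuousLinearMap.mul ℝ ℝ) hg
      (((hfd 1).continuous_fderiv one_ne_zero).clm_apply continuous_const) x
  · exact (hcs2 Complex.I).convolutionExists_right (ContinuousLinearMap.mul ℝ ℝ) hg
      (((hfd Complex.I).continuous_fderiv one_ne_zero).clm_apply continuous_const) x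

theorem hasLap_integral_mul_log {g : ℂ → ℝ} {R ε : ℝ} (hg : Integrable g)
    (hR : ∀ y, R < ‖y‖ → g y = 0) (hε : 0 < ε) (x : ℂ) :
    HasLap (fun x => ∫ y, g y * Real.log (‖x - y‖ ^ 2 + ε ^ 2))
      (∫ y, g y * (4 * ε ^ 2 / (‖x - y‖ ^ 2 + ε ^ 2) ^ 2)) x := by
  let χ : ContDiffBump (0 : ℂ) := ⟨‖x‖ + |R| + 2, ‖x‖ + |R| + 3, by positivity, by linarith⟩
  set V : ℂ → ℝ := fun w => Real.log (‖w‖ ^ 2 + ε ^ 2) with hV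
  have hVs : ContDiff ℝ 2 V := contDiff_iff_contDiffAt.2 fun z => (HasLap.log_norm_sq_add hε z).1
  set W : ℂ → ℝ := fun w => χ w * V w with hW
  have hWs : ContDiff ℝ 2 W := χ.contDiff.mul hVs
  have hWc : HasCompactSupport W := χ.hasCompactSupport.mul_right
  have hWV : ∀ w, ‖w‖ < ‖x‖ + |R| + 2 → W =ᶠ[𝓝 w] V := fun w hw => by
    have : ∀ᶠ v : ℂ in 𝓝 w, ‖v‖ < ‖x‖ + |R| + 2 := continuous_norm.continuousAt.eventually_lt_const hw
    filter_upwards [this] with v hv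
    simp only [hW]
    rw [χ.one_of_mem_closedBall (by rw [mem_closedBall_zero_iff]; exact hv.le), one_mul]
  have hle : ∀ y z : ℂ, g y ≠ 0 → ‖z - x‖ < 1 → ‖z - y‖ < ‖x‖ + |R| + 2 := fun y z hy hz => by
    have h1 : ‖y‖ ≤ |R| := by
      by_contra! h
      exact hy (hR y ((le_abs_self R).trans_lt h))
    have h2 := norm_sub_le z y
    have h3 := norm_add_le (z - x) x
    rw [sub_add_cancel] at h3
    linarith
  have h := hasLap_convolution hg.locallyIntegrable hWs hWc x
  refine (h.congr ?_).congr_value ?_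
  · filter_upwards [ball_mem_nhds x one_pos] with z hz
    rw [convolution]
    refine integral_congr_ae (Eventually.of_forall fun y => ?_)
    simp only [ContinuousLinearMap.mul_apply']
    by_cases hy : g y = 0
    · simp [hy]
    · rw [(hWV (z - y) (hle y z hy (mem_ball_iff_norm.1 hz))).eq_of_nhds]
  · refine integral_congr_ae (Eventually.of_forall fun y => ?_)
    by_cases hy : g y = 0
    · simp [hy]
    · simp only []
      rw [(laplacian_congr_nhds (hWV (x - y) (hle y x hy (by simp)))).eq_of_nhds,
        (HasLap.log_norm_sq_add hε (x - y)).2]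

/-- The Laplacian of `log (‖w‖² + ε²)`, an unnormalised approximate identity. -/
def logKernel (ε : ℝ) (w : ℂ) : ℝ := 4 * ε ^ 2 / (‖w‖ ^ 2 + ε ^ 2) ^ 2

theorem logKernel_nonneg (ε : ℝ) (w : ℂ) : 0 ≤ logKernel ε w := by
  unfold logKernel
  positivity

theorem continuous_logKernel {ε : ℝ} (hε : 0 < ε) : Continuous (logKernel ε) := by
  unfold logKernel
  exact continuous_const.div (by fun_prop) fun w => by positivity

theorem exists_logKernel_moments : ∃ a b, 0 < a ∧ 0 < b ∧ ∀ ε, 0 < ε →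
    Integrable (logKernel ε) ∧ ∫ w, logKernel ε w = a ∧
    Integrable (fun w => ‖w‖ * logKernel ε w) ∧ ∫ w, ‖w‖ * logKernel ε w ≤ ε * b := by
  have hfr : (Module.finrank ℝ ℂ : ℝ) < 3 := by rw [Complex.finrank_real_complex]; norm_num
  have hdom : Integrable (fun w : ℂ => (1 + ‖w‖) ^ (-(3 : ℝ))) := integrable_one_add_norm hfr
  have hpw : ∀ w : ℂ, (1 + ‖w‖) ^ (-(3 : ℝ)) = ((1 + ‖w‖) ^ 3)⁻¹ := fun w => by
    rw [Real.rpow_neg (by positivity)]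
    norm_cast
  have hle : ∀ w : ℂ, (1 + ‖w‖) * logKernel 1 w ≤ 16 * (1 + ‖w‖) ^ (-(3 : ℝ)) := fun w => by
    have h0 := norm_nonneg w
    rw [hpw, logKernel, one_pow, mul_one, ← mul_div_assoc, ← div_eq_mul_inv,
      div_le_div_iff₀ (by positivity) (by positivity)]
    have h1 : (1 + ‖w‖) ^ 2 ≤ 2 * (‖w‖ ^ 2 + 1) := by nlinarith [sq_nonneg (‖w‖ - 1)]
    have h2 : ((1 + ‖w‖) ^ 2) ^ 2 ≤ (2 * (‖w‖ ^ 2 + 1)) ^ 2 := by gcongr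
    nlinarith
  have h1c := continuous_logKernel one_pos
  have hi : Integrable (fun w : ℂ => (1 + ‖w‖) * logKernel 1 w) := by
    refine (hdom.const_mul 16).mono' (by fun_prop) (Eventually.of_forall fun w => ?_)
    rw [Real.norm_of_nonneg (mul_nonneg (by positivity) (logKernel_nonneg 1 w))]
    exact hle w
  have hi0 : Integrable (logKernel 1) := by
    refine hi.mono' h1c.aestronglyMeasurable (Eventually.of_forall fun w => ?_)
    rw [Real.norm_of_nonneg (logKernel_nonneg 1 w)]
    nlinarith [norm_nonneg w, logKernel_nonneg 1 w]
  have hi1 : Integrable (fun w : ℂ => ‖w‖ * logKernel 1 w) := by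
    refine hi.mono' (by fun_prop) (Eventually.of_forall fun w => ?_)
    rw [Real.norm_of_nonneg (mul_nonneg (norm_nonneg _) (logKernel_nonneg 1 w))]
    nlinarith [norm_nonneg w, logKernel_nonneg 1 w]
  have hscale : ∀ ε : ℝ, 0 < ε → ∀ w, logKernel ε w = (ε ^ 2)⁻¹ * logKernel 1 (ε⁻¹ • w) := by
    intro ε hε w
    rw [logKernel, logKernel, norm_smul, norm_inv, Real.norm_eq_abs, abs_of_pos hε]
    field_simp
  have hpos : 0 < ∫ w, logKernel 1 w := by
    refine (integral_pos_iff_support_of_nonneg (logKernel_nonneg 1) hi0).2 ?_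
    have : Function.support (logKernel 1) = univ := by
      ext w
      simp only [Function.mem_support, mem_univ, iff_true, logKernel]
      positivity
    rw [this]
    simp
  refine ⟨∫ w, logKernel 1 w, (∫ w : ℂ, ‖w‖ * logKernel 1 w) + 1, hpos, ?_, fun ε hε => ?_⟩
  · have : 0 ≤ ∫ w : ℂ, ‖w‖ * logKernel 1 w :=
      integral_nonneg fun w => mul_nonneg (norm_nonneg _) (logKernel_nonneg 1 w)
    linarith
  · have hε' : ε⁻¹ ≠ 0 := inv_ne_zero hε.ne'
    have e2 : ∀ w : ℂ, ‖w‖ * logKernel ε w =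
        ε⁻¹ * (‖ε⁻¹ • w‖ * logKernel 1 (ε⁻¹ • w)) := fun w => by
      rw [hscale ε hε, norm_smul, norm_inv, Real.norm_eq_abs, abs_of_pos hε]
      field_simp
    refine ⟨?_, ?_, ?_, ?_⟩
    · rw [show logKernel ε = _ from funext (hscale ε hε)]
      exact (hi0.comp_smul hε').const_mul _
    · simp only [hscale ε hε]
      rw [integral_const_mul, Measure.integral_comp_inv_smul, Complex.finrank_real_complex,
        smul_eq_mul, abs_of_pos (by positivity), inv_mul_cancel_left₀ (by positivity)]
    · simp only [e2]
      exact (hi1.comp_smul hε').const_mul _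
    · simp only [e2]
      rw [integral_const_mul, Measure.integral_comp_inv_smul volume
        (fun w : ℂ => ‖w‖ * logKernel 1 w), Complex.finrank_real_complex,
        smul_eq_mul, abs_of_pos (by positivity)]
      have : ε⁻¹ * (ε ^ 2 * ∫ w : ℂ, ‖w‖ * logKernel 1 w) = ε * ∫ w : ℂ, ‖w‖ * logKernel 1 w := by
        field_simp
      rw [this]
      linarith

theorem integrable_mul_logKernel {g : ℂ → ℝ} {A ε : ℝ} (hK : Integrable (logKernel ε)) (hg : AEStronglyMeasurable g) (hA : ∀ y, |g y| ≤ A) (x : ℂ) :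
    Integrable (fun y => g y * logKernel ε (x - y)) :=
  (hK.comp_sub_left x).bdd_mul hg (Eventually.of_forall hA)

theorem abs_integral_mul_logKernel_sub_le {g : ℂ → ℝ} {A L a b ε : ℝ} {x : ℂ}
    (hK : Integrable (logKernel ε)) (hKa : ∫ w, logKernel ε w = a)
    (hK1 : Integrable (fun w => ‖w‖ * logKernel ε w)) (hKb : ∫ w, ‖w‖ * logKernel ε w ≤ ε * b)
    (hg : AEStronglyMeasurable g) (hA : ∀ y, |g y| ≤ A) (hL : 0 ≤ L)
    (hgL : ∀ y, |g y - g x| ≤ L * ‖x - y‖) :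
    |(∫ y, g y * logKernel ε (x - y)) - a * g x| ≤ L * (ε * b) := by
  have h1 : ∫ y, logKernel ε (x - y) = a := by rw [integral_sub_left_eq_self (logKernel ε)]; exact hKa
  have h2 : ∫ y, ‖x - y‖ * logKernel ε (x - y) ≤ ε * b := by
    rw [integral_sub_left_eq_self (fun w => ‖w‖ * logKernel ε w)]; exact hKb
  have e : (∫ y, g y * logKernel ε (x - y)) - a * g x =
      ∫ y, (g y - g x) * logKernel ε (x - y) := by
    simp only [sub_mul]
    rw [integral_sub (integrable_mul_logKernel hK hg hA x) ((hK.comp_sub_left x).const_mul _),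
      integral_const_mul, h1, mul_comm a]
  rw [e]
  calc |∫ y, (g y - g x) * logKernel ε (x - y)|
      ≤ ∫ y, L * (‖x - y‖ * logKernel ε (x - y)) := by
        rw [← Real.norm_eq_abs]
        refine norm_integral_le_of_norm_le ((hK1.comp_sub_left x).const_mul L)
          (Eventually.of_forall fun y => ?_)
        rw [norm_mul, Real.norm_eq_abs, Real.norm_of_nonneg (logKernel_nonneg _ _), ← mul_assoc]
        exact mul_le_mul_of_nonneg_right (hgL y) (logKernel_nonneg _ _)
    _ ≤ L * (ε * b) := by
        rw [integral_const_mul]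
        exact mul_le_mul_of_nonneg_left h2 hL

theorem abs_integral_mul_logKernel_le {g : ℂ → ℝ} {A a ε : ℝ}
    (hK : Integrable (logKernel ε)) (hKa : ∫ w, logKernel ε w = a) (hA : ∀ y, |g y| ≤ A) (x : ℂ) :
    |∫ y, g y * logKernel ε (x - y)| ≤ A * a := by
  calc |∫ y, g y * logKernel ε (x - y)| ≤ ∫ y, A * logKernel ε (x - y) := by
        rw [← Real.norm_eq_abs]
        refine norm_integral_le_of_norm_le ((hK.comp_sub_left x).const_mul A)
          (Eventually.of_forall fun y => ?_)
        rw [norm_mul, Real.norm_eq_abs, Real.norm_of_nonneg (logKernel_nonneg _ _)]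
        exact mul_le_mul_of_nonneg_right (hA y) (logKernel_nonneg _ _)
    _ = A * a := by
        rw [integral_const_mul, integral_sub_left_eq_self (logKernel ε), hKa]

theorem integral_mul_logKernel_lipschitz {g : ℂ → ℝ} {A L a ε : ℝ}
    (hK : Integrable (logKernel ε)) (hKa : ∫ w, logKernel ε w = a)
    (hg : Continuous g) (hA : ∀ y, |g y| ≤ A) (hgL : ∀ y z, |g y - g z| ≤ L * ‖y - z‖) (x z : ℂ) :
    |(∫ y, g y * logKernel ε (x - y)) - ∫ y, g y * logKernel ε (z - y)| ≤ L * a * ‖x - z‖ := by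
  have e : ∀ x, ∫ y, g y * logKernel ε (x - y) = ∫ y, g (x - y) * logKernel ε y := fun x => by
    rw [← integral_sub_left_eq_self _ volume x]
    simp only [sub_sub_cancel]
  have hi : ∀ x, Integrable (fun y => g (x - y) * logKernel ε y) := fun x =>
    hK.bdd_mul (by fun_prop) (Eventually.of_forall fun y => hA (x - y))
  rw [e, e, ← integral_sub (hi x) (hi z)]
  calc _ ≤ ∫ y, L * ‖x - z‖ * logKernel ε y := by
        rw [← Real.norm_eq_abs]
        refine norm_integral_le_of_norm_le (hK.const_mul _) (Eventually.of_forall fun y => ?_)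
        rw [← sub_mul, norm_mul, Real.norm_eq_abs, Real.norm_of_nonneg (logKernel_nonneg _ _)]
        have := hgL (x - y) (z - y)
        rw [sub_sub_sub_cancel_right] at this
        exact mul_le_mul_of_nonneg_right this (logKernel_nonneg _ _)
    _ = L * a * ‖x - z‖ := by
        rw [integral_const_mul, hKa]
        ring

/-- A bounded function with bounded Laplacian is controlled by its boundary values. -/
theorem abs_le_of_abs_hasLap_le {D : Set ℂ} {u : ℂ → ℝ} {M R ε : ℝ} (hD : IsOpen D)
    (hR : closure D ⊆ closedBall 0 R) (hM : 0 ≤ M) (hu : ContinuousOn u (closure D))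
    (hl : ∀ z ∈ D, ∃ l, |l| ≤ M ∧ HasLap u l z) (hb : ∀ z ∈ frontier D, |u z| ≤ ε) :
    ∀ z ∈ closure D, |u z| ≤ ε + M * R ^ 2 / 4 := by
  have hbd : Bornology.IsBounded D := isBounded_closedBall.subset (subset_closure.trans hR)
  have hv : ∀ z : ℂ, HasLap (fun w : ℂ => ε + M / 4 * R ^ 2 - M / 4 * ‖w‖ ^ 2) (-M) z := fun z =>
    ((HasLap.const (ε + M / 4 * R ^ 2)).sub (HasLap.norm_sq.const_mul (M / 4))).congr_value (by ring)
  have hvc : Continuous fun w : ℂ => ε + M / 4 * R ^ 2 - M / 4 * ‖w‖ ^ 2 := by fun_prop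
  have hsq : ∀ z ∈ closure D, 0 ≤ M / 4 * R ^ 2 - M / 4 * ‖z‖ ^ 2 := fun z hz => by
    have h1 : ‖z‖ ≤ R := by simpa using hR hz
    have h2 : ‖z‖ ^ 2 ≤ R ^ 2 := by gcongr
    nlinarith
  have hfr := frontier_subset_closure (s := D)
  have key : ∀ v : ℂ → ℝ, ContinuousOn v (closure D) →
      (∀ z ∈ D, ∃ l, |l| ≤ M ∧ HasLap v l z) → (∀ z ∈ frontier D, |v z| ≤ ε) →
      ∀ z ∈ closure D, v z ≤ ε + M * R ^ 2 / 4 := by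
    intro v hvc' hvl hvb z hz
    have := le_of_hasLap_le hD hbd hvc' hvc.continuousOn (fun w hw => by
      obtain ⟨l, hl, hlap⟩ := hvl w hw
      exact ⟨l, -M, (abs_le.1 hl).1, hlap, hv w⟩) (fun w hw => by
      have := (abs_le.1 (hvb w hw)).2
      have := hsq w (hfr hw)
      linarith) z hz
    have := mul_nonneg (div_nonneg hM (by norm_num : (0:ℝ) ≤ 4)) (sq_nonneg ‖z‖)
    linarith
  intro z hz
  refine abs_le.2 ⟨?_, key u hu hl hb z hz⟩
  have := key (-u) hu.neg (fun w hw => by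
    obtain ⟨l, hl, hlap⟩ := hl w hw
    exact ⟨-l, by rwa [abs_neg], hlap.neg⟩) (fun w hw => by
    rw [Pi.neg_apply, abs_neg]
    exact hb w hw) z hz
  rw [Pi.neg_apply] at this
  linarith

theorem BoundaryChart.hasBarrier {Ω : Set ℂ} {K ρ : ℝ} {x : ℂ} (hK : 1 ≤ K) (hρ : 0 < ρ)
    (h : BoundaryChart Ω K ρ x) : HasBarrier Ω x := by
  have hR : 0 < min (1 / (4 * K)) (ρ / 4) := by positivity
  obtain ⟨y, hy, hext⟩ := h.exterior_ball hR (by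
    have := min_le_left (1 / (4 * K)) (ρ / 4)
    rw [le_div_iff₀ (by positivity)] at this
    linarith) (by linarith [min_le_right (1 / (4 * K)) (ρ / 4)])
  exact HasBarrier.of_exterior_ball hR hy hext

/-- A Lipschitz function on a bounded set extends to a compactly supported Lipschitz function. -/
theorem exists_lipschitz_extension {S : Set ℂ} {f : ℂ → ℝ} {L : ℝ} (hS : Bornology.IsBounded S)
    (hL : 0 ≤ L) (hf : ∀ z ∈ S, ∀ w ∈ S, |f z - f w| ≤ L * ‖z - w‖) :
    ∃ (g : ℂ → ℝ) (A L' R : ℝ), 0 < A ∧ 0 < L' ∧ (∀ z ∈ S, g z = f z) ∧ (∀ z, |g z| ≤ A) ∧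
      (∀ y z, |g y - g z| ≤ L' * ‖y - z‖) ∧ ∀ y, R < ‖y‖ → g y = 0 := by
  have hlip : LipschitzOnWith L.toNNReal f S := LipschitzOnWith.of_dist_le_mul fun z hz w hw => by
    rw [Real.dist_eq, dist_eq_norm, Real.coe_toNNReal L hL]
    exact hf z hz w hw
  obtain ⟨F, hF, hFe⟩ := hlip.extend_real
  obtain ⟨R, hR⟩ := hS.subset_closedBall (0 : ℂ)
  obtain ⟨R, hR0, hR⟩ : ∃ R, 0 < R ∧ S ⊆ closedBall (0 : ℂ) R :=
    ⟨max R 1, by positivity, hR.trans (closedBall_subset_closedBall (le_max_left _ _))⟩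
  have hFb : ∀ z ∈ S, |f z| ≤ |F 0| + L * R := fun z hz => by
    have h1 := hF.dist_le_mul z 0
    rw [Real.dist_eq, dist_eq_norm, Real.coe_toNNReal L hL, sub_zero] at h1
    have h2 : ‖z‖ ≤ R := by simpa using hR hz
    have h3 : L * ‖z‖ ≤ L * R := by gcongr
    rw [hFe hz]
    have h4 := abs_sub_abs_le_abs_sub (F z) (F 0)
    linarith
  set A := |F 0| + L * R + R with hA
  have hA0 : 0 < A := by positivity
  have hbl : LipschitzWith 1 fun x : ℂ => max (A - ‖x‖) 0 := by
    have h1 : LipschitzWith 1 fun x : ℂ => A - ‖x‖ := by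
      simpa using (LipschitzWith.const (α := ℂ) A).sub lipschitzWith_one_norm
    exact h1.max_const 0
  have hgl := (hF.min hbl).max hbl.neg
  refine ⟨fun x => max (min (F x) (max (A - ‖x‖) 0)) (-max (A - ‖x‖) 0), A,
    (max (max L.toNNReal 1) 1 : NNReal), A, hA0, ?_, ?_, ?_, ?_, ?_⟩
  · exact NNReal.coe_pos.2 (lt_max_of_lt_right one_pos)
  · intro z hz
    have h2 : ‖z‖ ≤ R := by simpa using hR hz
    have h1 : |f z| ≤ A - ‖z‖ := by linarith [hFb z hz]
    have h3 := abs_le.1 h1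
    simp only
    rw [← hFe hz, max_eq_left (by linarith [abs_nonneg (f z)] : (0 : ℝ) ≤ A - ‖z‖),
      min_eq_left h3.2, max_eq_left h3.1]
  · intro z
    have h1 : max (A - ‖z‖) 0 ≤ A := max_le (by linarith [norm_nonneg z]) hA0.le
    have h2 : 0 ≤ max (A - ‖z‖) 0 := le_max_right _ _
    refine abs_le.2 ⟨(neg_le_neg h1).trans (le_max_right _ _), max_le ?_ (by linarith)⟩
    exact (min_le_right _ _).trans h1
  · intro y z
    have := hgl.dist_le_mul y z
    rwa [Real.dist_eq, dist_eq_norm] at this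
  · intro y hy
    simp only
    rw [max_eq_right (by linarith : A - ‖y‖ ≤ 0)]
    simp

/-- Solvability of the Poisson problem with a mollified right-hand side. -/
theorem exists_poisson_mollified {Ω : Set ℂ} {g : ℂ → ℝ} {A L R : ℝ} (hΩ : IsOpen Ω)
    (hb : Bornology.IsBounded Ω) (hbar : ∀ x ∈ frontier Ω, HasBarrier Ω x) (hL : 0 < L)
    (hA : ∀ z, |g z| ≤ A) (hgL : ∀ y z, |g y - g z| ≤ L * ‖y - z‖)
    (hR : ∀ y, R < ‖y‖ → g y = 0) :
    ∃ C, 0 < C ∧ ∀ ε, 0 < ε → ∃ u f : ℂ → ℝ, ContinuousOn u (closure Ω) ∧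
      (∀ z ∈ frontier Ω, u z = 0) ∧ (∀ z ∈ Ω, HasLap u (-f z) z) ∧ (∀ z, |f z| ≤ A) ∧
      (∀ y z, |f y - f z| ≤ L * ‖y - z‖) ∧ ∀ z, |f z - g z| ≤ C * ε := by
  obtain ⟨a, b, ha, hb0, hm⟩ := exists_logKernel_moments
  refine ⟨L * b / a, by positivity, fun ε hε => ?_⟩
  obtain ⟨hK, hKa, hK1, hKb⟩ := hm ε hε
  have hgc : Continuous g := by
    refine (LipschitzWith.of_dist_le_mul (K := L.toNNReal) fun y z => ?_).continuous
    rw [Real.dist_eq, dist_eq_norm, Real.coe_toNNReal L hL.le]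
    exact hgL y z
  have hgs : HasCompactSupport g := by
    refine HasCompactSupport.intro (isCompact_closedBall (0 : ℂ) R) fun y hy => hR y ?_
    simpa using hy
  have hgi : Integrable g := hgc.integrable_of_hasCompactSupport hgs
  have hlap := fun x => (hasLap_integral_mul_log hgi hR hε x).const_mul (-(1 / a))
  set v : ℂ → ℝ := fun x => -(1 / a) * ∫ y, g y * Real.log (‖x - y‖ ^ 2 + ε ^ 2) with hv
  set f : ℂ → ℝ := fun x => 1 / a * ∫ y, g y * logKernel ε (x - y) with hf
  have hvl : ∀ z, HasLap v (-f z) z := fun z => (hlap z).congr_value (by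
    simp only [hf, logKernel]; ring)
  have hfA : ∀ z, |f z| ≤ A := fun z => by
    have h1 := abs_integral_mul_logKernel_le hK hKa hA z
    rw [hf, abs_mul, abs_of_pos (by positivity : 0 < 1 / a)]
    calc _ ≤ 1 / a * (A * a) := by gcongr
      _ = A := by field_simp
  have hvc : Continuous v := continuous_iff_continuousAt.2 fun z => (hvl z).continuousAt
  obtain ⟨h, hhc, hhh, hhf⟩ := exists_harmonic_dirichlet hΩ hb hbar hvc.continuousOn
    (K := A) fun z _ => ⟨-f z, by rw [abs_neg]; exact hfA z, hvl z⟩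
  refine ⟨fun z => v z - h z, f, hvc.continuousOn.sub hhc, fun z hz => ?_, fun z hz => ?_, hfA,
    fun y z => ?_, fun z => ?_⟩
  · simp only [hhf z hz, sub_self]
  · exact ((hvl z).sub (HarmonicOnNhd.hasLap hhh hz)).congr_value (sub_zero _)
  · have h1 := integral_mul_logKernel_lipschitz hK hKa hgc hA hgL y z
    rw [hf, ← mul_sub, abs_mul, abs_of_pos (by positivity : 0 < 1 / a)]
    calc _ ≤ 1 / a * (L * a * ‖y - z‖) := by gcongr
      _ = L * ‖y - z‖ := by field_simp
  · have h1 := abs_integral_mul_logKernel_sub_le (x := z) hK hKa hK1 hKb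
      hgc.aestronglyMeasurable hA hL.le fun y => by rw [norm_sub_rev]; exact hgL y z
    have e : f z - g z = 1 / a * ((∫ y, g y * logKernel ε (z - y)) - a * g z) := by
      rw [hf]; field_simp
    rw [e, abs_mul, abs_of_pos (by positivity : 0 < 1 / a)]
    calc _ ≤ 1 / a * (L * (ε * b)) := by gcongr
      _ = L * b / a * ε := by ring

/-- Classical solvability of the Poisson problem, with solutions of class `C²` up to the
boundary, for Lipschitz right-hand sides. -/
theorem exists_contDiff_poisson {Ω : Set ℂ} {K ρ L : ℝ} {f : ℂ → ℝ} (hΩ : IsOpen Ω)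
    (hb : Bornology.IsBounded Ω) (hK : 1 ≤ K) (hρ : 0 < ρ)
    (hch : ∀ x ∈ frontier Ω, BoundaryChart Ω K ρ x) (hL : 0 ≤ L)
    (hf : ∀ z ∈ closure Ω, ∀ w ∈ closure Ω, |f z - f w| ≤ L * ‖z - w‖) :
    ∃ ψ : ℂ → ℝ, ContDiff ℝ 2 ψ ∧ (∀ z ∈ Ω, HasLap ψ (-f z) z) ∧ ∀ z ∈ frontier Ω, ψ z = 0 := by
  have hbc := hb.closure
  have hbar := fun x hx => (hch x hx).hasBarrier hK hρ
  obtain ⟨g, A, L', R, hA, hL', hgf, hgA, hgL, hgR⟩ := exists_lipschitz_extension hbc hL hf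
  obtain ⟨C, hC, hsol⟩ := exists_poisson_mollified hΩ hb hbar hL' hgA hgL hgR
  choose! u F hu hu0 hul hFA hFL hFg using hsol
  obtain ⟨D, hD⟩ := hbc.subset_closedBall (0 : ℂ)
  have hdiff : ∀ ε δ, 0 < ε → 0 < δ → ∀ z ∈ closure Ω,
      |u ε z - u δ z| ≤ (C * ε + C * δ) * D ^ 2 / 4 := by
    intro ε δ hε hδ z hz
    have := abs_le_of_abs_hasLap_le (ε := 0) hΩ hD (by positivity : 0 ≤ C * ε + C * δ)
      ((hu ε hε).sub (hu δ hδ)) (fun w hw => ⟨_, ?_, (hul ε hε w hw).sub (hul δ hδ w hw)⟩)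
      (fun w hw => by simp [hu0 ε hε w hw, hu0 δ hδ w hw]) z hz
    · simpa using this
    · rw [show -F ε w - -F δ w = (F δ w - g w) - (F ε w - g w) by ring]
      refine (abs_sub _ _).trans ?_
      linarith [hFg ε hε w, hFg δ hδ w]
  set e : ℕ → ℝ := fun n => 1 / ((n : ℝ) + 1) with he
  have he0 : ∀ n, 0 < e n := fun n => by positivity
  have het : Tendsto e atTop (𝓝 0) := tendsto_one_div_add_atTop_nhds_zero_nat
  have hlim : ∀ z ∈ closure Ω, ∃ l, Tendsto (fun n => u (e n) z) atTop (𝓝 l) := by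
    intro z hz
    refine cauchySeq_tendsto_of_complete (cauchySeq_of_le_tendsto_0
      (fun n => (C * e n + C * e n) * D ^ 2 / 4) (fun n m N hn hm => ?_) ?_)
    · rw [Real.dist_eq]
      refine (hdiff _ _ (he0 n) (he0 m) z hz).trans ?_
      have hmono : ∀ k, N ≤ k → e k ≤ e N := fun k hk => by
        simp only [he]
        gcongr
      have := hmono n hn
      have := hmono m hm
      gcongr
    · simpa using (((het.const_mul C).add (het.const_mul C)).mul_const (D ^ 2)).div_const 4
  choose! ψ hψ using hlim
  have hψu : ∀ ε, 0 < ε → ∀ z ∈ closure Ω, |ψ z - u ε z| ≤ C * ε * D ^ 2 / 4 := by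
    intro ε hε z hz
    have h1 := (hψ z hz).sub_const (u ε z) |>.abs
    have h2 : Tendsto (fun n => (C * e n + C * ε) * D ^ 2 / 4) atTop (𝓝 (C * ε * D ^ 2 / 4)) := by
      simpa using (((het.const_mul C).add_const (C * ε)).mul_const (D ^ 2)).div_const 4
    exact le_of_tendsto_of_tendsto' h1 h2 fun n => hdiff _ _ (he0 n) hε z hz
  have hψ0 : ∀ z ∈ frontier Ω, ψ z = 0 := fun z hz => by
    refine tendsto_nhds_unique (hψ z (frontier_subset_closure hz)) ?_
    simp only [fun n => hu0 (e n) (he0 n) z hz]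
    exact tendsto_const_nhds
  obtain ⟨Q, hQ, hquad⟩ := exists_quadApprox hΩ hb hK hρ hch
  set B := max (max A L') (A * D ^ 2 / 4) with hB
  have hB0 : 0 < B := lt_max_of_lt_left (lt_max_of_lt_left hA)
  have hquad' : ∀ ε, 0 < ε → ∀ x ∈ closure Ω, QuadApprox (closure Ω) (u ε) (F ε) (Q * B) x := by
    intro ε hε
    refine hquad (u ε) (F ε) B hB0 (hu ε hε) (fun z hz => ?_) (hu0 ε hε) (hul ε hε)
      (fun z _ => (hFA ε hε z).trans ((le_max_left _ _).trans (le_max_left _ _)))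
      (fun z _ w _ => (hFL ε hε z w).trans ?_)
    · have := abs_le_of_abs_hasLap_le (ε := 0) hΩ hD hA.le (hu ε hε) (fun w hw =>
        ⟨_, by rw [abs_neg]; exact hFA ε hε w, hul ε hε w hw⟩)
        (fun w hw => by simp [hu0 ε hε w hw]) z (subset_closure hz)
      rw [zero_add] at this
      exact this.trans (le_max_right _ _)
    · gcongr
      exact (le_max_right _ _).trans (le_max_left _ _)
  have hψQ : ∀ x ∈ closure Ω, QuadApprox (closure Ω) ψ f (Q * B + 1) x := by
    intro x hx
    refine QuadApprox.of_approx fun η hη => ?_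
    obtain ⟨ε, hε, h1⟩ : ∃ ε, 0 < ε ∧ (C * D ^ 2 / 4 + C) * ε ≤ η := by
      refine ⟨η / (C * D ^ 2 / 4 + C), by positivity, ?_⟩
      rw [mul_div_cancel₀ _ (by positivity)]
    have h2 : 0 ≤ C * D ^ 2 / 4 * ε := by positivity
    have h3 : 0 ≤ C * ε := by positivity
    refine ⟨u ε, F ε, fun z hz => (hψu ε hε z hz).trans (by linarith), ?_, hquad' ε hε x hx⟩
    rw [← hgf x hx, abs_sub_comm]
    exact (hFg ε hε x).trans (by linarith)
  obtain ⟨c, hc, hfat⟩ := exists_ball_subset_of_boundaryChart hΩ hK hρ hch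
  obtain ⟨E, hE, hEψ⟩ := exists_contDiff_extension hbc (by positivity) hc hfat hψQ
  refine ⟨E, hE, fun z hz => ?_, fun z hz => ?_⟩
  · have hzc := subset_closure hz
    exact hasLap_of_quadApprox (by positivity) hE hEψ
      (interior_maximal subset_closure hΩ hz) (hψQ z hzc)
  · rw [hEψ z (frontier_subset_closure hz), hψ0 z hz]

/-- A linear bound near a boundary point admitting an exterior ball. -/
theorem le_mul_of_exterior_ball {Ω : Set ℂ} {u : ℂ → ℝ} {M D R : ℝ} {x y : ℂ} (hΩ : IsOpen Ω)
    (hb : Bornology.IsBounded Ω) (hR : 0 < R) (hx : ‖x - y‖ = R)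
    (hext : ∀ z ∈ closure Ω, R ≤ ‖z - y‖) (hD : ∀ z ∈ closure Ω, ‖z - y‖ ≤ D) (hM : 0 ≤ M)
    (hu : ContinuousOn u (closure Ω)) (hu0 : ∀ z ∈ frontier Ω, u z = 0)
    (hl : ∀ z ∈ Ω, ∃ l, |l| ≤ M ∧ HasLap u l z) :
    ∀ z ∈ closure Ω, u z ≤ M * (D ^ 2 / (2 * R)) * ‖z - x‖ := by
  set v : ℂ → ℝ := fun z => M * (D ^ 2 / 2 * (Real.log ‖z - y‖ - Real.log R) -
    1 / 4 * (‖z - y‖ ^ 2 - R ^ 2)) with hv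
  have hpos : ∀ z ∈ closure Ω, 0 < ‖z - y‖ := fun z hz => hR.trans_le (hext z hz)
  have hvl : ∀ z ∈ Ω, HasLap v (-M) z := by
    intro z hz
    have h1 : HasLap (fun w : ℂ => ‖w - y‖ ^ 2) 4 z :=
      ((HasLap.comp_affine (-y) 1 (HasLap.norm_sq)).congr (Eventually.of_forall fun w => by
        simp only [one_mul, neg_add_eq_sub])).congr_value (by simp)
    have h2 := HasLap.log_norm (sub_ne_zero.1 (norm_pos_iff.1 (hpos z (subset_closure hz))))
    exact ((((h2.sub (HasLap.const (Real.log R))).const_mul (D ^ 2 / 2)).sub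
      ((h1.sub (HasLap.const (R ^ 2))).const_mul (1 / 4))).const_mul M).congr_value (by ring)
  have hvc : ContinuousOn v (closure Ω) := by
    have : ContinuousOn (fun z : ℂ => Real.log ‖z - y‖) (closure Ω) :=
      ContinuousOn.log (by fun_prop) fun z hz => (hpos z hz).ne'
    fun_prop
  have hv0 : ∀ z ∈ closure Ω, 0 ≤ v z := by
    intro z hz
    have hzp := hpos z hz
    have h1 : 1 - R ^ 2 / ‖z - y‖ ^ 2 ≤ 2 * (Real.log ‖z - y‖ - Real.log R) := by
      have := Real.one_sub_inv_le_log_of_pos (x := ‖z - y‖ ^ 2 / R ^ 2) (by positivity)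
      rw [inv_div, Real.log_div (by positivity) (by positivity), Real.log_pow, Real.log_pow] at this
      push_cast at this
      linarith
    have h2 : ‖z - y‖ ^ 2 ≤ D ^ 2 := by
      have := hD z hz
      gcongr
    have h3 : R ^ 2 ≤ ‖z - y‖ ^ 2 := by
      have := hext z hz
      gcongr
    have h4 : ‖z - y‖ ^ 2 - R ^ 2 ≤ D ^ 2 * (1 - R ^ 2 / ‖z - y‖ ^ 2) := by
      have e : ‖z - y‖ ^ 2 - R ^ 2 = ‖z - y‖ ^ 2 * (1 - R ^ 2 / ‖z - y‖ ^ 2) := by field_simp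
      rw [e]
      refine mul_le_mul_of_nonneg_right h2 (sub_nonneg.2 ?_)
      rwa [div_le_one (by positivity)]
    have h5 := mul_le_mul_of_nonneg_left h1 (sq_nonneg D)
    exact mul_nonneg hM (by linarith)
  intro z hz
  have h1 : u z ≤ v z := le_of_hasLap_le hΩ hb hu hvc (fun w hw => by
    obtain ⟨l, hl, h⟩ := hl w hw
    exact ⟨l, -M, (abs_le.1 hl).1, h, hvl w hw⟩)
    (fun w hw => by rw [hu0 w hw]; exact hv0 w (frontier_subset_closure hw)) z hz
  refine h1.trans ?_
  rw [hv, mul_assoc]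
  refine mul_le_mul_of_nonneg_left ?_ hM
  have hzp := hpos z hz
  have h3 : R ^ 2 ≤ ‖z - y‖ ^ 2 := by
    have := hext z hz
    gcongr
  have h2 : Real.log ‖z - y‖ - Real.log R ≤ ‖z - x‖ / R := by
    have h5 := Real.log_le_sub_one_of_pos (div_pos hzp hR)
    rw [Real.log_div hzp.ne' hR.ne'] at h5
    have h6 : ‖z - y‖ ≤ ‖z - x‖ + R := by
      rw [← hx]; exact norm_sub_le_norm_sub_add_norm_sub z x y
    refine h5.trans ?_
    rw [div_sub_one hR.ne']
    gcongr
    linarith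
  have h4 : D ^ 2 / (2 * R) * ‖z - x‖ = D ^ 2 / 2 * (‖z - x‖ / R) := by field_simp
  have h5 := mul_le_mul_of_nonneg_left h2 (by positivity : 0 ≤ D ^ 2 / 2)
  rw [h4]
  linarith

/-- A difference estimate on the unit disc obtained by odd reflection. -/
theorem sub_le_of_hasLap_disc {u : ℂ → ℝ} {S M t : ℝ} (hM : 0 ≤ M)
    (hu : ContinuousOn u (closedBall 0 1)) (hS : ∀ z ∈ closedBall (0 : ℂ) 1, |u z| ≤ S)
    (hl : ∀ z ∈ ball (0 : ℂ) 1, ∃ l, |l| ≤ M ∧ HasLap u l z) (ht : 0 < t) (ht1 : t < 1) :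
    u t - u (-t) ≤ (4 * S + M) * t := by
  set D : Set ℂ := ball 0 1 ∩ {z | 0 < z.re} with hD
  have hDo : IsOpen D := isOpen_ball.inter (isOpen_lt continuous_const Complex.continuous_re)
  have hDc : closure D ⊆ closedBall 0 1 ∩ {z | 0 ≤ z.re} :=
    closure_minimal (fun z hz => ⟨ball_subset_closedBall hz.1, le_of_lt (show 0 < z.re from hz.2)⟩)
      (isClosed_closedBall.inter (isClosed_le continuous_const Complex.continuous_re))
  have hS0 : 0 ≤ S := (abs_nonneg _).trans (hS 0 (by simp))
  have hr : ∀ z : ℂ, ‖-(starRingEnd ℂ) z‖ = ‖z‖ := fun z => by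
    rw [norm_neg, RCLike.norm_conj]
  have hrc : ContinuousOn (fun z => u (-(starRingEnd ℂ) z)) (closedBall 0 1) :=
    hu.comp (by fun_prop) fun z hz => by simpa [hr] using hz
  have h := le_of_hasLap_le (D := D) (u := fun z => u z - u (-(starRingEnd ℂ) z))
    (v := fun z => 2 * S * (‖z‖ ^ 2 + 2 * z.re - 2 * z.re ^ 2) + M * (z.re - z.re ^ 2))
    hDo (isBounded_ball.subset inter_subset_left)
    ((hu.sub hrc).mono (hDc.trans inter_subset_left)) (by fun_prop) (fun z hz => by
      obtain ⟨l, hl1, h1⟩ := hl z hz.1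
      obtain ⟨m, hm1, h2⟩ := hl (-(starRingEnd ℂ) z) (by simpa [hr] using hz.1)
      refine ⟨l - m, 2 * S * (4 + 2 * 0 - 2 * 2) + M * (0 - 2), ?_, h1.sub h2.comp_reflect,
        (((HasLap.norm_sq.add (HasLap.re.const_mul 2)).sub
        (HasLap.re_sq.const_mul 2)).const_mul (2 * S)).add
        ((HasLap.re.sub HasLap.re_sq).const_mul M)⟩
      linarith [abs_le.1 hl1, abs_le.1 hm1]) (fun z hz => by
      have hzc := hDc (frontier_subset_closure hz)
      have hre : 0 ≤ z.re := hzc.2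
      have hz1 : ‖z‖ ≤ 1 := by simpa using hzc.1
      have hre1 : z.re ≤ 1 := (Complex.re_le_norm z).trans hz1
      have h0 : 0 ≤ z.re - z.re ^ 2 := by nlinarith
      have h1 : 0 ≤ M * (z.re - z.re ^ 2) := mul_nonneg hM h0
      rcases hre.eq_or_lt with h2 | h2
      · have e : -(starRingEnd ℂ) z = z := by
          apply Complex.ext <;> simp [← h2]
        simp only [e, sub_self]
        rw [← h2]
        simp only [mul_zero, add_zero, zero_pow two_ne_zero, sub_zero]
        positivity
      · have h3 : ‖z‖ = 1 := by
          refine le_antisymm hz1 (not_lt.1 fun h4 => ?_)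
          have : z ∈ D := ⟨by simpa using h4, h2⟩
          exact (hDo.frontier_eq ▸ hz).2 this
        have h5 := abs_le.1 (hS z hzc.1)
        have h6 := abs_le.1 (hS (-(starRingEnd ℂ) z) (by simpa [hr] using hz1))
        rw [h3]
        have h7 := mul_nonneg hS0 h0
        nlinarith) t (subset_closure ⟨by simpa [abs_of_pos ht] using ht1, by simpa using ht⟩)
  simp only [Complex.conj_ofReal, Complex.ofReal_re, Complex.norm_real, Real.norm_eq_abs,
    sq_abs] at h
  have h7 := mul_nonneg hS0 (sq_nonneg t)
  have h8 := mul_nonneg hM (sq_nonneg t)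
  nlinarith

theorem abs_sub_le_of_hasLap_disc {u : ℂ → ℝ} {S M t : ℝ} (hM : 0 ≤ M)
    (hu : ContinuousOn u (closedBall 0 1)) (hS : ∀ z ∈ closedBall (0 : ℂ) 1, |u z| ≤ S)
    (hl : ∀ z ∈ ball (0 : ℂ) 1, ∃ l, |l| ≤ M ∧ HasLap u l z) (ht : 0 < t) (ht1 : t < 1) :
    |u t - u (-t)| ≤ (4 * S + M) * t := by
  refine abs_le.2 ⟨?_, sub_le_of_hasLap_disc hM hu hS hl ht ht1⟩
  have := sub_le_of_hasLap_disc (u := -u) hM hu.neg (fun z hz => by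
    rw [Pi.neg_apply, abs_neg]; exact hS z hz) (fun z hz => by
    obtain ⟨l, h1, h2⟩ := hl z hz
    exact ⟨-l, by rwa [abs_neg], h2.neg⟩) ht ht1
  simp only [Pi.neg_apply] at this
  linarith

/-- Interior Lipschitz estimate. -/
theorem abs_sub_le_of_hasLap_ball {u : ℂ → ℝ} {S M d : ℝ} {z w : ℂ} (hM : 0 ≤ M) (hd : 0 < d)
    (hS : ∀ y ∈ ball z d, |u y| ≤ S) (hl : ∀ y ∈ ball z d, ∃ l, |l| ≤ M ∧ HasLap u l y)
    (hw : ‖w - z‖ < d / 2) : |u w - u z| ≤ (4 * S / d + M * d) * ‖w - z‖ := by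
  rcases eq_or_ne w z with rfl | hne
  · simp
  have hwz : 0 < ‖w - z‖ := norm_pos_iff.2 (sub_ne_zero.2 hne)
  set c : ℂ := (w + z) / 2 with hc
  set m : ℂ := (d / 2 / ‖w - z‖ : ℝ) * (w - z) with hm
  have hmn : ‖m‖ = d / 2 := by
    rw [hm, norm_mul, Complex.norm_real, Real.norm_of_nonneg (by positivity)]
    field_simp
  have hcz : ‖c - z‖ = ‖w - z‖ / 2 := by
    rw [hc, show (w + z) / 2 - z = (w - z) / 2 by ring, norm_div]
    simp
  have hin : ∀ y ∈ closedBall (0 : ℂ) 1, c + m * y ∈ ball z d := by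
    intro y hy
    have hy1 : ‖y‖ ≤ 1 := by simpa using hy
    rw [mem_ball_iff_norm, show c + m * y - z = (c - z) + m * y by ring]
    refine (norm_add_le _ _).trans_lt ?_
    rw [norm_mul, hmn, hcz]
    nlinarith
  set t : ℝ := ‖w - z‖ / d with ht
  have hmt : m * t = (w - z) / 2 := by
    have h1 : (‖w - z‖ : ℂ) ≠ 0 := by exact_mod_cast hwz.ne'
    have h2 : (d : ℂ) ≠ 0 := by exact_mod_cast hd.ne'
    rw [hm, ht]
    push_cast
    field_simp
  have key := abs_sub_le_of_hasLap_disc (u := fun y => u (c + m * y)) (S := S)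
    (M := (d / 2) ^ 2 * M) (t := t) (by positivity) (fun y hy => by
      obtain ⟨l, -, h⟩ := hl _ (hin y hy)
      exact (h.comp_affine c m).continuousAt.continuousWithinAt)
    (fun y hy => hS _ (hin y hy)) (fun y hy => by
      obtain ⟨l, h1, h⟩ := hl _ (hin y (ball_subset_closedBall hy))
      refine ⟨_, ?_, h.comp_affine c m⟩
      rw [hmn, abs_mul, abs_of_nonneg (by positivity)]
      gcongr) (by positivity) (by rw [ht, div_lt_one hd]; linarith)
  simp only [mul_neg, hmt] at key
  rw [show c + (w - z) / 2 = w by rw [hc]; ring, show c + -((w - z) / 2) = z by rw [hc]; ring] at key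
  refine key.trans ?_
  have e : (4 * S + (d / 2) ^ 2 * M) * t = (4 * S / d + M * d / 4) * ‖w - z‖ := by
    rw [ht]; field_simp; ring
  rw [e]
  have : 0 ≤ M * d := by positivity
  gcongr
  linarith

/-- Global Lipschitz estimate for the Poisson problem with bounded right-hand side. -/
theorem exists_lipschitz_bound {Ω : Set ℂ} {K ρ : ℝ} (hΩ : IsOpen Ω)
    (hb : Bornology.IsBounded Ω) (hK : 1 ≤ K) (hρ : 0 < ρ)
    (hch : ∀ x ∈ frontier Ω, BoundaryChart Ω K ρ x) :
    ∃ C, 0 < C ∧ ∀ (u : ℂ → ℝ) (M : ℝ), 0 ≤ M → ContinuousOn u (closure Ω) →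
      (∀ z ∈ frontier Ω, u z = 0) → (∀ z ∈ Ω, ∃ l, |l| ≤ M ∧ HasLap u l z) →
      ∀ z ∈ closure Ω, ∀ w ∈ closure Ω, |u z - u w| ≤ C * M * ‖z - w‖ := by
  obtain ⟨D, hD⟩ := hb.closure.subset_closedBall (0 : ℂ)
  have hR : 0 < min (1 / (4 * K)) (ρ / 4) := by positivity
  set R := min (1 / (4 * K)) (ρ / 4)
  have hR1 : 4 * K * R ≤ 1 := by
    have := min_le_left (1 / (4 * K)) (ρ / 4)
    rw [le_div_iff₀ (by positivity)] at this
    linarith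
  have hR2 : 4 * R ≤ ρ := by linarith [min_le_right (1 / (4 * K)) (ρ / 4)]
  set B := (2 * |D| + R) ^ 2 / (2 * R) with hB
  have hB0 : 0 < B := by positivity
  have hbd : ∀ (u : ℂ → ℝ) (M : ℝ), 0 ≤ M → ContinuousOn u (closure Ω) →
      (∀ z ∈ frontier Ω, u z = 0) → (∀ z ∈ Ω, ∃ l, |l| ≤ M ∧ HasLap u l z) →
      ∀ z ∈ closure Ω, ∀ x ∈ frontier Ω, |u z| ≤ M * B * ‖z - x‖ := by
    intro u M hM hu hu0 hl z hz x hx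
    obtain ⟨y, hy, hext⟩ := (hch x hx).exterior_ball hR hR1 hR2
    have hext' : ∀ w ∈ closure Ω, R ≤ ‖w - y‖ := fun w hw => by
      rcases eq_or_ne w x with rfl | h
      · exact hy.ge
      · exact (hext w hw h).le
    have hDy : ∀ w ∈ closure Ω, ‖w - y‖ ≤ 2 * |D| + R := fun w hw => by
      have h1 : ‖w‖ ≤ D := by simpa using hD hw
      have h2 : ‖x‖ ≤ D := by simpa using hD (frontier_subset_closure hx)
      calc ‖w - y‖ ≤ ‖w - x‖ + ‖x - y‖ := norm_sub_le_norm_sub_add_norm_sub w x y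
        _ ≤ ‖w‖ + ‖x‖ + R := by rw [hy]; gcongr; exact norm_sub_le w x
        _ ≤ _ := by linarith [le_abs_self D]
    refine abs_le.2 ⟨?_, le_mul_of_exterior_ball hΩ hb hR hy hext' hDy hM hu hu0 hl z hz⟩
    have := le_mul_of_exterior_ball (u := -u) hΩ hb hR hy hext' hDy hM hu.neg
      (fun w hw => by simp [hu0 w hw]) (fun w hw => by
        obtain ⟨l, h1, h2⟩ := hl w hw
        exact ⟨-l, by rwa [abs_neg], h2.neg⟩) z hz
    rw [Pi.neg_apply] at this
    linarith
  refine ⟨8 * B + 2 * |D| + 1, by positivity, fun u M hM hu hu0 hl z hz w hw => ?_⟩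
  have hu' := hbd u M hM hu hu0 hl
  have hMB : 0 ≤ M * B := by positivity
  have near : ∀ z ∈ closure Ω, ∀ w ∈ closure Ω, ∀ d, IsLeast ((fun x => ‖z - x‖) '' frontier Ω) d →
      ‖w - z‖ < d / 2 → |u w - u z| ≤ (8 * B + 2 * |D| + 1) * M * ‖w - z‖ := by
    rintro z hz w hw d ⟨⟨x, hx, rfl⟩, hmin⟩ hwz
    have hd : 0 < ‖z - x‖ := by linarith [norm_nonneg (w - z)]
    have hzΩ : z ∈ Ω := by
      by_contra h
      have : z ∈ frontier Ω := by rw [hΩ.frontier_eq]; exact ⟨hz, h⟩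
      have := hmin ⟨z, this, rfl⟩
      simp only [sub_self, norm_zero] at this
      linarith
    have hball : ball z ‖z - x‖ ⊆ Ω :=
      ball_subset_of_disjoint_frontier hzΩ fun y hy => hmin ⟨y, hy, rfl⟩
    have h1 := abs_sub_le_of_hasLap_ball (S := M * B * (2 * ‖z - x‖)) hM hd (fun y hy => ?_)
      (fun y hy => hl y (hball hy)) hwz
    · refine h1.trans ?_
      gcongr
      have e : 4 * (M * B * (2 * ‖z - x‖)) / ‖z - x‖ = 8 * B * M := by field_simp; ring
      have h2 : ‖z - x‖ ≤ 2 * |D| := by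
        have h1 : ‖z‖ ≤ D := by simpa using hD hz
        have h2 : ‖x‖ ≤ D := by simpa using hD (frontier_subset_closure hx)
        linarith [norm_sub_le z x, le_abs_self D]
      rw [e]
      have := mul_le_mul_of_nonneg_left h2 hM
      linarith
    · refine (hu' y (subset_closure (hball hy)) x hx).trans ?_
      have h2 := mem_ball_iff_norm.1 hy
      have h3 := norm_sub_le_norm_sub_add_norm_sub y z x
      gcongr
      linarith
  rcases (frontier Ω).eq_empty_or_nonempty with hemp | hne
  · have hcl : closure Ω = Ω := by
      rw [closure_eq_self_union_frontier, hemp, union_empty]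
    exfalso
    have hclo : IsClopen Ω := ⟨hcl ▸ isClosed_closure, hΩ⟩
    rcases isClopen_iff.1 hclo with h | h
    · rw [h] at hz; simp at hz
    · rw [h] at hb
      exact NormedSpace.unbounded_univ ℝ ℂ hb
  · have hcomp : IsCompact (frontier Ω) :=
      hb.closure.isCompact_closure.of_isClosed_subset isClosed_frontier
        (frontier_subset_closure.trans subset_closure)
    have hleast : ∀ z : ℂ, ∃ d, IsLeast ((fun x => ‖z - x‖) '' frontier Ω) d := fun z =>
      (hcomp.image (by fun_prop)).exists_isLeast (hne.image _)
    obtain ⟨d, hd⟩ := hleast z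
    obtain ⟨e, he⟩ := hleast w
    by_cases h1 : ‖w - z‖ < d / 2
    · rw [abs_sub_comm, norm_sub_rev]
      exact near z hz w hw d hd h1
    by_cases h2 : ‖z - w‖ < e / 2
    · exact near w hw z hz e he h2
    push Not at h1 h2
    obtain ⟨⟨x, hx, rfl⟩, -⟩ := hd
    obtain ⟨⟨y, hy, rfl⟩, -⟩ := he
    rw [norm_sub_rev] at h1
    simp only at h1 h2
    have h3 := hu' z hz x hx
    have h4 := hu' w hw y hy
    have h5 := abs_sub (u z) (u w)
    have h6 : M * B * ‖z - x‖ ≤ M * B * (2 * ‖z - w‖) := by gcongr; linarith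
    have h7 : M * B * ‖w - y‖ ≤ M * B * (2 * ‖z - w‖) := by gcongr; linarith
    have h8 : 0 ≤ (4 * B + 2 * |D| + 1) * M * ‖z - w‖ := by positivity
    linarith

theorem integrable_indicator_ball_inv_norm (r : ℝ) :
    Integrable ((ball (0 : ℂ) r).indicator fun w => ‖w‖⁻¹) := by
  rw [integrable_indicator_iff measurableSet_ball]
  refine integrableOn_ball_of_norm_le_rpow (C := 1) (α := 1) (by simp) (by simp)
    (Eventually.of_forall fun w => ?_) measurable_norm.inv.aestronglyMeasurable
  rw [norm_inv, norm_norm, one_mul, Real.rpow_neg_one]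

/-- Comparison of the regularised logarithmic kernel with an integrable kernel. -/
theorem log_sub_log_le {D s ε : ℝ} (hs : 0 < s) (hsD : s ≤ D) (hε : 0 < ε) :
    0 ≤ Real.log (D ^ 2 + ε ^ 2) - Real.log (s ^ 2 + ε ^ 2) ∧
    (Real.log (D ^ 2 + ε ^ 2) - Real.log (s ^ 2 + ε ^ 2)) ^ 2 ≤ 16 * D * s⁻¹ := by
  have hD : 0 < D := hs.trans_le hsD
  have h0 : 0 ≤ Real.log (D ^ 2 + ε ^ 2) - Real.log (s ^ 2 + ε ^ 2) :=
    sub_nonneg.2 (Real.log_le_log (by positivity) (by gcongr))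
  refine ⟨h0, ?_⟩
  have h1 : Real.log (D ^ 2 + ε ^ 2) - Real.log (s ^ 2 + ε ^ 2) ≤ 4 * √(D / s) := by
    have h2 : (D ^ 2 + ε ^ 2) / (s ^ 2 + ε ^ 2) ≤ (√(D / s)) ^ 4 := by
      rw [show 4 = 2 * 2 by norm_num, pow_mul, Real.sq_sqrt (by positivity), div_pow,
        div_le_div_iff₀ (by positivity) (by positivity)]
      have : s ^ 2 ≤ D ^ 2 := by gcongr
      nlinarith [mul_le_mul_of_nonneg_right this (sq_nonneg ε)]
    rw [← Real.log_div (by positivity) (by positivity)]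
    refine (Real.log_le_log (by positivity) h2).trans ?_
    rw [Real.log_pow]
    have := Real.log_le_sub_one_of_pos (show 0 < √(D / s) by positivity)
    push_cast
    linarith
  calc _ ≤ (4 * √(D / s)) ^ 2 := by gcongr
    _ = 16 * D * s⁻¹ := by rw [mul_pow, Real.sq_sqrt (by positivity)]; ring

/-- A bound for the solution of the Poisson problem in terms of the `L²` norm of the right-hand
side. -/
theorem exists_sup_bound {Ω : Set ℂ} (hΩ : IsOpen Ω) (hb : Bornology.IsBounded Ω) :
    ∃ C, 0 < C ∧ ∀ (u f : ℂ → ℝ) (L : ℝ), 0 ≤ L → ContinuousOn u (closure Ω) →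
      (∀ z ∈ frontier Ω, u z = 0) → (∀ z ∈ Ω, HasLap u (-f z) z) → (∀ z ∈ Ω, 0 ≤ f z) →
      (∀ z ∈ closure Ω, ∀ w ∈ closure Ω, |f z - f w| ≤ L * ‖z - w‖) →
      ∀ z ∈ closure Ω, u z ≤ C * (1 + ∫ y in Ω, f y ^ 2) := by
  obtain ⟨a, b, ha, hb0, hm⟩ := exists_logKernel_moments
  obtain ⟨R, hR⟩ := hb.closure.subset_closedBall (0 : ℂ)
  have hn : ∀ z ∈ closure Ω, ‖z‖ ≤ |R| := fun z hz =>
    (mem_closedBall_zero_iff.1 (hR hz)).trans (le_abs_self R)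
  set D := 2 * |R| with hD
  have hDn : ∀ z ∈ closure Ω, ∀ w ∈ closure Ω, ‖z - w‖ ≤ D := fun z hz w hw => by
    linarith [norm_sub_le z w, hn z hz, hn w hw]
  set k : ℂ → ℝ := (ball (0 : ℂ) (D + 1)).indicator fun w => ‖w‖⁻¹ with hk
  have hki := integrable_indicator_ball_inv_norm (D + 1)
  rw [← hk] at hki
  have hk0 : ∀ w, 0 ≤ k w := fun w => indicator_nonneg (fun _ _ => by positivity) w
  set J := ∫ w, k w with hJ
  have hJ0 : 0 ≤ J := integral_nonneg hk0
  have hD0 : 0 ≤ D := by positivity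
  refine ⟨1 / a * (1 / 2 + 8 * D * J), by positivity,
    fun u f L hL hu hu0 hul hf0 hfL z hz => ?_⟩
  obtain ⟨F, A, L', R', hA, hL', hFf, hFA, hFL, -⟩ := exists_lipschitz_extension hb.closure hL hfL
  have hFc : Continuous F := by
    refine (LipschitzWith.of_dist_le_mul (K := L'.toNNReal) fun y z => ?_).continuous
    rw [Real.dist_eq, dist_eq_norm, Real.coe_toNNReal L' hL'.le]
    exact hFL y z
  have hΩm : volume Ω ≠ ⊤ := hb.measure_lt_top.ne
  have hfin : IsFiniteMeasure (volume.restrict Ω) := ⟨by simpa using hb.measure_lt_top⟩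
  have hFi : IntegrableOn F Ω := by
    refine Measure.integrableOn_of_bounded (M := A) hΩm hFc.aestronglyMeasurable
      (Eventually.of_forall hFA)
  have hF2i : IntegrableOn (fun y => F y ^ 2) Ω := by
    refine Measure.integrableOn_of_bounded (M := A ^ 2) hΩm (by fun_prop)
      (Eventually.of_forall fun y => ?_)
    rw [norm_pow]
    have := hFA y
    gcongr
    exact this
  have hF0 : ∀ y ∈ Ω, 0 ≤ F y := fun y hy => by rw [hFf y (subset_closure hy)]; exact hf0 y hy
  have h_int : ∫ y in Ω, f y ^ 2 = ∫ y in Ω, F y ^ 2 :=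
    setIntegral_congr_fun hΩ.measurableSet fun y hy => by
      simp only [hFf y (subset_closure hy)]
  rw [h_int]
  set g : ℂ → ℝ := Ω.indicator F with hg
  have hgA : ∀ y, |g y| ≤ A := fun y => by
    by_cases hy : y ∈ Ω
    · rw [hg, indicator_of_mem hy]; exact hFA y
    · rw [hg, indicator_of_notMem hy, abs_zero]; exact hA.le
  have hgi : Integrable g := (integrable_indicator_iff hΩ.measurableSet).2 hFi
  have hgR : ∀ y, |R| < ‖y‖ → g y = 0 := fun y hy =>
    indicator_of_notMem (fun h => (hn y (subset_closure h)).not_gt hy) F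
  have hgmul : ∀ h : ℂ → ℝ, ∫ y, g y * h y = ∫ y in Ω, F y * h y := fun h => by
    rw [← integral_indicator hΩ.measurableSet]
    congr 1 with y
    rw [hg, ← indicator_mul_left]
  set v : ℝ → ℂ → ℝ := fun ε x => 1 / a * (Real.log (D ^ 2 + ε ^ 2) * (∫ y, g y) -
    ∫ y, g y * Real.log (‖x - y‖ ^ 2 + ε ^ 2)) with hv
  have hvl : ∀ ε, 0 < ε → ∀ x, HasLap (v ε) (-(1 / a * ∫ y, g y * logKernel ε (x - y))) x :=
    fun ε hε x => (((HasLap.const _).sub (hasLap_integral_mul_log hgi hgR hε x)).const_mul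
      (1 / a)).congr_value (by simp only [logKernel]; ring)
  have hvb : ∀ ε, 0 < ε → ∀ x ∈ closure Ω, 0 ≤ v ε x ∧
      v ε x ≤ 1 / a * (1 / 2 + 8 * D * J) * (1 + ∫ y in Ω, F y ^ 2) := by
    intro ε hε x hx
    have hli : IntegrableOn (fun y => F y * Real.log (‖x - y‖ ^ 2 + ε ^ 2)) Ω := by
      have hc : Continuous fun y : ℂ => F y * Real.log (‖x - y‖ ^ 2 + ε ^ 2) :=
        hFc.mul (Continuous.log (by fun_prop) fun y => by positivity)
      exact (hc.continuousOn.integrableOn_compact hb.isCompact_closure).mono_set subset_closure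
    have e : v ε x = 1 / a * ∫ y in Ω, F y *
        (Real.log (D ^ 2 + ε ^ 2) - Real.log (‖x - y‖ ^ 2 + ε ^ 2)) := by
      simp only [hv, mul_sub]
      rw [hgmul, integral_sub (hFi.mul_const _) hli, integral_mul_const, hg,
        integral_indicator hΩ.measurableSet]
      ring
    have hne : ∀ᵐ y ∂volume.restrict Ω, y ∈ Ω ∧ y ≠ x := by
      filter_upwards [ae_restrict_mem hΩ.measurableSet,
        ae_restrict_of_ae (Measure.ae_ne volume x)] with y h1 h2 using ⟨h1, h2⟩
    have hpos : ∀ y ∈ Ω, y ≠ x → 0 < ‖x - y‖ ∧ ‖x - y‖ ≤ D := fun y hy hne =>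
      ⟨norm_pos_iff.2 (sub_ne_zero.2 hne.symm), hDn x hx y (subset_closure hy)⟩
    rw [e]
    refine ⟨mul_nonneg (by positivity) (integral_nonneg_of_ae ?_), ?_⟩
    · filter_upwards [hne] with y hy
      obtain ⟨h1, h2⟩ := hpos y hy.1 hy.2
      exact mul_nonneg (hF0 y hy.1) (log_sub_log_le h1 h2 hε).1
    have hkx : Integrable (fun y => k (x - y)) := hki.comp_sub_left x
    have h3 : ∫ y in Ω, F y * (Real.log (D ^ 2 + ε ^ 2) - Real.log (‖x - y‖ ^ 2 + ε ^ 2)) ≤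
        ∫ y in Ω, (1 / 2 * F y ^ 2 + 8 * D * k (x - y)) := by
      refine integral_mono_ae ?_ ((hF2i.const_mul _).add (hkx.integrableOn.const_mul _)) ?_
      · simp only [mul_sub]
        exact (hFi.mul_const _).sub hli
      · filter_upwards [hne] with y hy
        obtain ⟨h1, h2⟩ := hpos y hy.1 hy.2
        have h4 := (log_sub_log_le h1 h2 hε).2
        have h5 : k (x - y) = ‖x - y‖⁻¹ := indicator_of_mem (by
          rw [mem_ball_zero_iff]; linarith) _
        rw [h5]
        nlinarith [sq_nonneg (F y - (Real.log (D ^ 2 + ε ^ 2) - Real.log (‖x - y‖ ^ 2 + ε ^ 2)))]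
    have h4 : ∫ y in Ω, k (x - y) ≤ J := by
      rw [hJ, ← integral_sub_left_eq_self k volume x]
      exact setIntegral_le_integral hkx (Eventually.of_forall fun y => hk0 _)
    rw [integral_add (hF2i.const_mul _) (hkx.integrableOn.const_mul _), integral_const_mul,
      integral_const_mul] at h3
    have h5 : 0 ≤ ∫ y in Ω, F y ^ 2 := integral_nonneg fun y => sq_nonneg _
    have h6 := mul_le_mul_of_nonneg_left h4 (by positivity : 0 ≤ 8 * D)
    rw [mul_assoc]
    refine mul_le_mul_of_nonneg_left (h3.trans ?_) (by positivity)
    have : 0 ≤ 8 * D * J * ∫ y in Ω, F y ^ 2 := by positivity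
    linarith
  refine le_of_forall_pos_le_add fun η hη => ?_
  have hvz := hvb
  set D' := Ω ∩ {x | η / 2 < u x} with hD'
  have hD'o : IsOpen D' := (hu.mono subset_closure).isOpen_inter_preimage hΩ isOpen_Ioi
  have hD'c : closure D' ⊆ Ω := by
    have h1 : closure D' ⊆ closure Ω ∩ u ⁻¹' Ici (η / 2) :=
      closure_minimal (fun x hx => ⟨subset_closure hx.1, le_of_lt (show η / 2 < u x from hx.2)⟩)
        (hu.preimage_isClosed_of_isClosed isClosed_closure isClosed_Ici)
    intro x hx
    by_contra h
    have h2 := h1 hx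
    have h3 := hu0 x (by rw [hΩ.frontier_eq]; exact ⟨h2.1, h⟩)
    have h4 : η / 2 ≤ u x := h2.2
    linarith
  have hD'b := hb.subset (show D' ⊆ Ω from inter_subset_left)
  obtain ⟨d, hd, hdΩ⟩ := hD'b.isCompact_closure.exists_thickening_subset_open hΩ hD'c
  set M := L' + A / d with hM
  have hgL : ∀ x ∈ D', ∀ y, |g y - g x| ≤ M * ‖x - y‖ := by
    intro x hx y
    rw [hg, indicator_of_mem hx.1]
    by_cases hy : y ∈ Ω
    · rw [indicator_of_mem hy, norm_sub_rev]
      refine (hFL y x).trans ?_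
      have : 0 ≤ A / d := by positivity
      gcongr
      linarith
    · rw [indicator_of_notMem hy, zero_sub, abs_neg]
      have h1 : d ≤ ‖x - y‖ := by
        by_contra h
        push Not at h
        exact hy (hdΩ (mem_thickening_iff.2 ⟨x, subset_closure hx, by
          rwa [dist_comm, dist_eq_norm]⟩))
      have h2 : A ≤ A / d * ‖x - y‖ := by
        rw [div_mul_eq_mul_div, le_div_iff₀ hd]
        gcongr
      have h3 : 0 ≤ L' * ‖x - y‖ := by positivity
      rw [hM, add_mul]
      linarith [hFA x]
  obtain ⟨ε, hε, hεη⟩ : ∃ ε, 0 < ε ∧ M * (ε * b) / a * |R| ^ 2 / 4 ≤ η / 2 := by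
    have hq : 0 < M * b / a * |R| ^ 2 / 4 + 1 := by positivity
    refine ⟨η / 2 / (M * b / a * |R| ^ 2 / 4 + 1), by positivity, ?_⟩
    have e : ∀ ε, M * (ε * b) / a * |R| ^ 2 / 4 = ε * (M * b / a * |R| ^ 2 / 4) := fun ε => by ring
    rw [e, div_mul_eq_mul_div, div_le_iff₀ hq]
    nlinarith
  obtain ⟨hK, hKa, hK1, hKb⟩ := hm ε hε
  set κ := M * (ε * b) / a with hκ
  have hκ0 : 0 ≤ κ := by positivity
  have hrad : ∀ x ∈ closure Ω, 0 ≤ κ / 4 * (|R| ^ 2 - ‖x‖ ^ 2) := fun x hx => by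
    have h1 := hn x hx
    have h2 : ‖x‖ ^ 2 ≤ |R| ^ 2 := by gcongr
    exact mul_nonneg (by positivity) (sub_nonneg.2 h2)
  by_cases hzD : z ∈ D'
  · have h := le_of_hasLap_le (D := D') (u := u)
      (v := fun x => η / 2 + v ε x + κ / 4 * (|R| ^ 2 - ‖x‖ ^ 2)) hD'o hD'b
      (hu.mono (closure_mono inter_subset_left))
      (by
        have : Continuous (v ε) := continuous_iff_continuousAt.2 fun x => (hvl ε hε x).continuousAt
        fun_prop)
      (fun x hx => ⟨_, _, ?_, hul x hx.1, ((HasLap.const (η / 2)).add (hvl ε hε x)).add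
        (((HasLap.const (|R| ^ 2)).sub HasLap.norm_sq).const_mul (κ / 4))⟩) (fun x hx => ?_)
      z (subset_closure hzD)
    · have h1 := (hvb ε hε z hz).2
      have h2 : κ / 4 * (|R| ^ 2 - ‖z‖ ^ 2) ≤ κ * |R| ^ 2 / 4 := by
        have : 0 ≤ κ / 4 * ‖z‖ ^ 2 := by positivity
        linarith
      linarith
    · have h1 := abs_integral_mul_logKernel_sub_le hK hKa hK1 hKb hgi.aestronglyMeasurable hgA
        (by positivity : 0 ≤ M) (hgL x hx)
      have h2 := (abs_le.1 h1).1
      have h3 : g x = f x := by rw [hg, indicator_of_mem hx.1, hFf x (subset_closure hx.1)]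
      rw [h3] at h2
      have h4 : f x - κ ≤ 1 / a * ∫ y, g y * logKernel ε (x - y) := by
        rw [hκ, one_div, ← div_eq_inv_mul, le_div_iff₀ ha, sub_mul, div_mul_cancel₀ _ ha.ne']
        linarith
      linarith
    · have hxc : x ∈ closure Ω := subset_closure (hD'c (frontier_subset_closure hx))
      have h1 : u x ≤ η / 2 := by
        by_contra h
        push Not at h
        exact (hD'o.frontier_eq ▸ hx).2 ⟨hD'c (frontier_subset_closure hx), h⟩
      have := hrad x hxc
      have := (hvb ε hε x hxc).1
      linarith
  · have h1 : u z ≤ η / 2 := by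
      by_cases hzΩ : z ∈ Ω
      · by_contra h
        push Not at h
        exact hzD ⟨hzΩ, h⟩
      · rw [hu0 z (by rw [hΩ.frontier_eq]; exact ⟨hz, hzΩ⟩)]
        positivity
    have h2 := (hvb ε hε z hz).1.trans (hvb ε hε z hz).2
    linarith

open scoped Convolution

/-- Smooth `C¹`-approximation of a compactly supported function inside an open set. -/
theorem exists_contDiff_near {N : ℕ} {w : EuclideanSpace ℝ (Fin N) → ℝ}
    {Ω : Set (EuclideanSpace ℝ (Fin N))} (hΩ : IsOpen Ω) (hw : ContDiff ℝ 1 w)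
    (hc : HasCompactSupport w) (hs : tsupport w ⊆ Ω) {ε : ℝ} (hε : 0 < ε) :
    ∃ W, ContDiff ℝ (⊤ : ℕ∞) W ∧ HasCompactSupport W ∧ tsupport W ⊆ Ω ∧
      (∀ x, |W x - w x| ≤ ε) ∧ ∀ x, ‖fderiv ℝ W x - fderiv ℝ w x‖ ≤ ε := by
  obtain ⟨d, hd, hdΩ⟩ := hc.isCompact.exists_cthickening_subset_open hΩ hs
  have hfc := hw.continuous_fderiv one_ne_zero
  have hu1 := hc.uniformContinuous_of_continuous hw.continuous
  have hu2 := (hc.fderiv ℝ).uniformContinuous_of_continuous hfc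
  obtain ⟨d1, hd1, h1⟩ := Metric.uniformContinuous_iff.1 hu1 ε hε
  obtain ⟨d2, hd2, h2⟩ := Metric.uniformContinuous_iff.1 hu2 ε hε
  set r := min d (min d1 d2) with hr
  have hr0 : 0 < r := by positivity
  let φ : ContDiffBump (0 : EuclideanSpace ℝ (Fin N)) := ⟨r / 2, r, by positivity, by linarith⟩
  have hφl : LocallyIntegrable (φ.normed volume) volume :=
    φ.continuous_normed.locallyIntegrable
  refine ⟨φ.normed volume ⋆[ContinuousLinearMap.lsmul ℝ ℝ, volume] w,
    φ.hasCompactSupport_normed.contDiff_convolution_left _ φ.contDiff_normed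
      hw.continuous.locallyIntegrable,
    HasCompactSupport.convolution _ φ.hasCompactSupport_normed hc, ?_, fun x => ?_, fun x => ?_⟩
  · refine (closure_minimal ?_ isClosed_cthickening).trans hdΩ
    intro x hx
    obtain ⟨y, hy, z, hz, rfl⟩ := support_convolution_subset _ hx
    rw [φ.support_normed_eq] at hy
    refine thickening_subset_cthickening _ _ (mem_thickening_iff.2 ⟨z, subset_tsupport _ hz, ?_⟩)
    have : ‖y‖ < r := by simpa using hy
    rw [dist_eq_norm, add_sub_cancel_right]
    exact this.trans_le (min_le_left _ _)
  · rw [← Real.dist_eq]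
    exact φ.dist_normed_convolution_le hw.continuous.aestronglyMeasurable fun y hy =>
      (h1 ((mem_ball.1 hy).trans_le ((min_le_right _ _).trans (min_le_left _ _)))).le
  · have e : (ContinuousLinearMap.lsmul ℝ ℝ : ℝ →L[ℝ] ℝ →L[ℝ] ℝ).precompR
        (EuclideanSpace ℝ (Fin N)) = ContinuousLinearMap.lsmul ℝ ℝ := by
      ext; rfl
    rw [(hc.hasFDerivAt_convolution_right (ContinuousLinearMap.lsmul ℝ ℝ) hφl hw x).fderiv, e,
      ← dist_eq_norm]
    exact φ.dist_normed_convolution_le hfc.aestronglyMeasurable fun y hy =>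
      (h2 ((mem_ball.1 hy).trans_le ((min_le_right _ _).trans (min_le_right _ _)))).le

/-- Bounded convergence on a set of finite measure. -/
theorem tendsto_setIntegral_of_abs_le {X : Type*} [MeasurableSpace X] {μ : Measure X} {s : Set X}
    (hs : MeasurableSet s) (hμ : μ s ≠ ⊤) {F : ℕ → X → ℝ} {f : X → ℝ} {C : ℝ}
    (hm : ∀ n, AEStronglyMeasurable (F n) (μ.restrict s)) (hb : ∀ n, ∀ x ∈ s, |F n x| ≤ C)
    (h : ∀ x ∈ s, Tendsto (fun n => F n x) atTop (𝓝 (f x))) :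
    Tendsto (fun n => ∫ x in s, F n x ∂μ) atTop (𝓝 (∫ x in s, f x ∂μ)) :=
  tendsto_integral_of_dominated_convergence (fun _ => C) hm (integrableOn_const hμ)
    (fun n => (ae_restrict_iff' hs).2 (.of_forall fun x hx => by simpa using hb n x hx))
    ((ae_restrict_iff' hs).2 (.of_forall h))

theorem norm_gradient_eq {N : ℕ} (w : EuclideanSpace ℝ (Fin N) → ℝ)
    (x : EuclideanSpace ℝ (Fin N)) : ‖gradient w x‖ = ‖fderiv ℝ w x‖ :=
  LinearIsometryEquiv.norm_map _ _

theorem Lam_mul_le_of_smooth {N : ℕ} {Ω : Set (EuclideanSpace ℝ (Fin N))} {t : ℝ} (ht : 0 < t)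
    {W : EuclideanSpace ℝ (Fin N) → ℝ} (hW : ContDiff ℝ (⊤ : ℕ∞) W) (hc : HasCompactSupport W)
    (hs : tsupport W ⊆ Ω) :
    Lam Ω t * (∫ x in Ω, |W x| ^ t) ^ (2 / t) ≤ ∫ x in Ω, ‖fderiv ℝ W x‖ ^ 2 := by
  have h0 : 0 ≤ ∫ x in Ω, |W x| ^ t :=
    integral_nonneg fun x => Real.rpow_nonneg (abs_nonneg _) _
  rcases h0.eq_or_lt with h | h
  · rw [← h, Real.zero_rpow (by positivity), mul_zero]
    exact integral_nonneg fun x => sq_nonneg _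
  · rw [← le_div_iff₀ (Real.rpow_pos_of_pos h _)]
    refine csInf_le ⟨0, ?_⟩ ⟨W, hW, hc, hs, ?_, by simp_rw [norm_gradient_eq]⟩
    · rintro r ⟨w, -, -, -, -, rfl⟩
      refine div_nonneg (integral_nonneg fun x => sq_nonneg _) (Real.rpow_nonneg ?_ _)
      exact integral_nonneg fun x => Real.rpow_nonneg (abs_nonneg _) _
    · rintro rfl
      simp [Real.zero_rpow ht.ne'] at h

theorem Lam_mul_le_of_contDiff_one {N : ℕ} {Ω : Set (EuclideanSpace ℝ (Fin N))} {t : ℝ}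
    (hΩ : IsOpen Ω) (hb : Bornology.IsBounded Ω) (ht : 0 < t)
    {w : EuclideanSpace ℝ (Fin N) → ℝ} (hw : ContDiff ℝ 1 w) (hc : HasCompactSupport w)
    (hs : tsupport w ⊆ Ω) :
    Lam Ω t * (∫ x in Ω, |w x| ^ t) ^ (2 / t) ≤ ∫ x in Ω, ‖fderiv ℝ w x‖ ^ 2 := by
  choose W hW1 hW2 hW3 hW4 hW5 using fun n : ℕ =>
    exists_contDiff_near hΩ hw hc hs (ε := 1 / ((n : ℝ) + 1)) (by positivity)
  have hfc := hw.continuous_fderiv one_ne_zero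
  obtain ⟨A, hA⟩ := hw.continuous.bounded_above_of_compact_support hc
  obtain ⟨B, hB⟩ := hfc.bounded_above_of_compact_support (hc.fderiv ℝ)
  have hε1 : ∀ n : ℕ, 1 / ((n : ℝ) + 1) ≤ 1 := fun n => by
    rw [div_le_one (by positivity)]; linarith [n.cast_nonneg (α := ℝ)]
  have hlim := tendsto_one_div_add_atTop_nhds_zero_nat (𝕜 := ℝ)
  have hμ : volume Ω ≠ ⊤ := hb.measure_lt_top.ne
  have l1 : ∀ x, Tendsto (fun n => W n x) atTop (𝓝 (w x)) := fun x =>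
    tendsto_iff_dist_tendsto_zero.2 (squeeze_zero (fun n => dist_nonneg)
      (fun n => by rw [Real.dist_eq]; exact hW4 n x) hlim)
  have l2 : ∀ x, Tendsto (fun n => fderiv ℝ (W n) x) atTop (𝓝 (fderiv ℝ w x)) := fun x =>
    tendsto_iff_dist_tendsto_zero.2 (squeeze_zero (fun n => dist_nonneg)
      (fun n => by rw [dist_eq_norm]; exact hW5 n x) hlim)
  have t1 : Tendsto (fun n => ∫ x in Ω, |W n x| ^ t) atTop (𝓝 (∫ x in Ω, |w x| ^ t)) := by
    refine tendsto_setIntegral_of_abs_le hΩ.measurableSet hμ (C := (A + 1) ^ t)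
      (fun n => ((hW1 n).continuous.abs.rpow_const fun _ => .inr ht.le).aestronglyMeasurable)
      (fun n x _ => ?_) fun x _ => (l1 x).abs.rpow_const (.inr ht.le)
    rw [abs_of_nonneg (by positivity)]
    refine Real.rpow_le_rpow (abs_nonneg _) ?_ ht.le
    have h1 := abs_add_le (W n x - w x) (w x)
    rw [sub_add_cancel] at h1
    have h2 : |w x| ≤ A := hA x
    linarith [(hW4 n x).trans (hε1 n)]
  have t2 : Tendsto (fun n => ∫ x in Ω, ‖fderiv ℝ (W n) x‖ ^ 2) atTop
      (𝓝 (∫ x in Ω, ‖fderiv ℝ w x‖ ^ 2)) := by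
    refine tendsto_setIntegral_of_abs_le hΩ.measurableSet hμ (C := (B + 1) ^ 2)
      (fun n => (((hW1 n).continuous_fderiv (by simp)).norm.pow 2).aestronglyMeasurable)
      (fun n x _ => ?_) fun x _ => (l2 x).norm.pow 2
    rw [abs_of_nonneg (by positivity)]
    refine pow_le_pow_left₀ (norm_nonneg _) ?_ _
    have := norm_add_le (fderiv ℝ (W n) x - fderiv ℝ w x) (fderiv ℝ w x)
    rw [sub_add_cancel] at this
    linarith [hW5 n x, hε1 n, hB x]
  exact le_of_tendsto_of_tendsto' ((t1.rpow_const (.inr (by positivity))).const_mul _) t2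
    fun n => Lam_mul_le_of_smooth ht (hW1 n) (hW2 n) (hW3 n)

/-- A `C¹` truncation of the identity near zero. -/
theorem exists_truncation {δ : ℝ} (hδ : 0 < δ) : ∃ φ χ : ℝ → ℝ, Continuous χ ∧
    (∀ s, HasDerivAt φ (χ s) s) ∧ (∀ s, 0 ≤ χ s ∧ χ s ≤ 1) ∧ (∀ s, |s| ≤ δ → φ s = 0) ∧
    ∀ s, |φ s - s| ≤ 2 * δ := by
  let χ : ℝ → ℝ := fun r => min 1 (max 0 (|r| / δ - 1))
  have hχ : Continuous χ := by fun_prop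
  have h01 : ∀ s, 0 ≤ χ s ∧ χ s ≤ 1 := fun s =>
    ⟨le_min zero_le_one (le_max_left _ _), min_le_left _ _⟩
  have hz : ∀ s, |s| ≤ δ → χ s = 0 := fun s hs => by
    have : |s| / δ - 1 ≤ 0 := by rw [sub_nonpos, div_le_one hδ]; exact hs
    simp [χ, max_eq_left this]
  have ho : ∀ s, 2 * δ ≤ |s| → χ s = 1 := fun s hs => by
    have : 1 ≤ |s| / δ - 1 := by rw [le_sub_iff_add_le, le_div_iff₀ hδ]; linarith
    simp [χ, this]
  let φ : ℝ → ℝ := fun s => ∫ r in (0 : ℝ)..s, χ r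
  have hd : ∀ s, HasDerivAt φ (χ s) s := fun s =>
    intervalIntegral.integral_hasDerivAt_right (hχ.intervalIntegrable _ _)
      (hχ.stronglyMeasurableAtFilter _ _) hχ.continuousAt
  refine ⟨φ, χ, hχ, hd, h01, fun s hs => ?_, ?_⟩
  · refine (intervalIntegral.integral_congr (g := fun _ => 0) fun r hr => hz r ?_).trans (by simp)
    rcases le_total 0 s with h | h
    · rw [uIcc_of_le h] at hr
      rw [abs_of_nonneg h] at hs
      rw [abs_of_nonneg hr.1]
      exact hr.2.trans hs
    · rw [uIcc_of_ge h] at hr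
      rw [abs_of_nonpos h] at hs
      rw [abs_of_nonpos hr.2]
      linarith [hr.1]
  have hφ0 : φ 0 = 0 := intervalIntegral.integral_same
  have hm : Monotone φ := monotone_of_deriv_nonneg (fun s => (hd s).differentiableAt)
    fun s => by rw [(hd s).deriv]; exact (h01 s).1
  have hs : ∀ s, HasDerivAt (fun r => r - φ r) (1 - χ s) s := fun s => (hasDerivAt_id s).sub (hd s)
  have hm' : Monotone fun s => s - φ s := monotone_of_deriv_nonneg
    (fun s => (hs s).differentiableAt) fun s => by rw [(hs s).deriv]; linarith [(h01 s).2]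
  have hc1 : ∀ s, 2 * δ ≤ s → s - φ s ≤ 2 * δ := by
    intro s hs1
    have := (convex_Ici (2 * δ)).image_sub_le_mul_sub_of_deriv_le (f := fun r => r - φ r)
      (fun r _ => (hs r).continuousAt.continuousWithinAt)
      (fun r _ => (hs r).differentiableAt.differentiableWithinAt) (C := 0) (fun r hr => by
        rw [interior_Ici] at hr
        rw [(hs r).deriv, ho r (hr.out.le.trans (le_abs_self r)), sub_self])
      (2 * δ) self_mem_Ici s hs1 hs1
    have h2 := hm (by positivity : (0 : ℝ) ≤ 2 * δ)
    simp only [hφ0] at this h2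
    linarith
  have hc2 : ∀ s, s ≤ -(2 * δ) → -(2 * δ) ≤ s - φ s := by
    intro s hs1
    have := (convex_Iic (-(2 * δ))).image_sub_le_mul_sub_of_deriv_le (f := fun r => r - φ r)
      (fun r _ => (hs r).continuousAt.continuousWithinAt)
      (fun r _ => (hs r).differentiableAt.differentiableWithinAt) (C := 0) (fun r hr => by
        rw [interior_Iic] at hr
        rw [(hs r).deriv, ho r (by rw [abs_of_neg (by linarith [hr.out])]; linarith [hr.out]),
          sub_self])
      s hs1 (-(2 * δ)) self_mem_Iic hs1
    have h2 := hm (by linarith : -(2 * δ) ≤ (0 : ℝ))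
    simp only [hφ0] at this h2
    linarith
  have h0 : (fun s => s - φ s) 0 = 0 := by simp [hφ0]
  intro s
  rw [abs_sub_comm]
  rcases le_total 0 s with h | h
  · have h1 := hm' h
    rw [h0] at h1
    rw [abs_of_nonneg h1]
    rcases le_total (2 * δ) s with h2 | h2
    · exact hc1 s h2
    · have := hm h
      rw [hφ0] at this
      linarith
  · have h1 := hm' h
    rw [h0] at h1
    rw [abs_of_nonpos h1, neg_le]
    rcases le_total s (-(2 * δ)) with h2 | h2
    · exact hc2 s h2
    · have := hm h
      rw [hφ0] at this
      linarith

theorem norm_fderiv_sq_eq {N : ℕ} (w : EuclideanSpace ℝ (Fin N) → ℝ)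
    (x : EuclideanSpace ℝ (Fin N)) :
    ‖fderiv ℝ w x‖ ^ 2 = ∑ i : Fin N, fderiv ℝ w x (EuclideanSpace.single i 1) ^ 2 := by
  rw [← norm_gradient_eq, EuclideanSpace.real_norm_sq_eq]
  refine Finset.sum_congr rfl fun i _ => ?_
  have h := InnerProductSpace.toDual_symm_apply (𝕜 := ℝ) (x := EuclideanSpace.single i (1 : ℝ))
    (y := fderiv ℝ w x)
  rw [← h, EuclideanSpace.inner_single_right]
  simp [gradient]

theorem continuous_fderiv_apply_single {N : ℕ} {w : EuclideanSpace ℝ (Fin N) → ℝ}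
    (hw : ContDiff ℝ 1 w) (i : Fin N) :
    Continuous fun x => fderiv ℝ w x (EuclideanSpace.single i (1 : ℝ)) :=
  (hw.continuous_fderiv one_ne_zero).clm_apply continuous_const

theorem contDiff_fderiv_apply_single {N : ℕ} {z : EuclideanSpace ℝ (Fin N) → ℝ}
    (hz : ContDiff ℝ 2 z) (i : Fin N) :
    ContDiff ℝ 1 fun x => fderiv ℝ z x (EuclideanSpace.single i (1 : ℝ)) :=
  (hz.fderiv_right (by norm_num)).clm_apply contDiff_const

theorem continuous_lapl {N : ℕ} {z : EuclideanSpace ℝ (Fin N) → ℝ} (hz : ContDiff ℝ 2 z) :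
    Continuous (lapl z) :=
  continuous_finsetSum _ fun i _ =>
    continuous_fderiv_apply_single (contDiff_fderiv_apply_single hz i) i

/-- Green's formula against a compactly supported function. -/
theorem integral_mul_neg_lapl {N : ℕ} {w z : EuclideanSpace ℝ (Fin N) → ℝ}
    (hw : ContDiff ℝ 1 w) (hc : HasCompactSupport w) (hz : ContDiff ℝ 2 z) :
    ∫ x, w x * -lapl z x = ∫ x, ∑ i : Fin N, fderiv ℝ w x (EuclideanSpace.single i (1 : ℝ)) *
      fderiv ℝ z x (EuclideanSpace.single i (1 : ℝ)) := by
  have hg := fun i => contDiff_fderiv_apply_single hz i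
  have i1 : ∀ i : Fin N, Integrable fun x => fderiv ℝ w x (EuclideanSpace.single i (1 : ℝ)) *
      fderiv ℝ z x (EuclideanSpace.single i (1 : ℝ)) := fun i =>
    ((continuous_fderiv_apply_single hw i).mul (hg i).continuous).integrable_of_hasCompactSupport
      (hc.fderiv_apply ℝ _).mul_right
  have i2 : ∀ i : Fin N, Integrable fun x => w x *
      fderiv ℝ (fun y => fderiv ℝ z y (EuclideanSpace.single i (1 : ℝ))) x
        (EuclideanSpace.single i (1 : ℝ)) := fun i =>
    (hw.continuous.mul (continuous_fderiv_apply_single (hg i) i)).integrable_of_hasCompactSupport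
      hc.mul_right
  rw [integral_finsetSum _ fun i _ => i1 i]
  simp only [lapl, mul_neg, Finset.mul_sum]
  rw [integral_neg, integral_finsetSum _ fun i _ => i2 i, ← Finset.sum_neg_distrib]
  refine Finset.sum_congr rfl fun i _ => ?_
  rw [integral_mul_fderiv_eq_neg_fderiv_mul_of_integrable (i1 i) (i2 i)
    ((hw.continuous.mul (hg i).continuous).integrable_of_hasCompactSupport hc.mul_right)
    (fun x _ => hw.differentiable one_ne_zero x) fun x _ => (hg i).differentiable one_ne_zero x,
    neg_neg]

theorem Lam_mul_le_truncation {N : ℕ} {Ω : Set (EuclideanSpace ℝ (Fin N))} {t : ℝ}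
    (hΩ : IsOpen Ω) (hb : Bornology.IsBounded Ω) (ht : 0 < t)
    {z : EuclideanSpace ℝ (Fin N) → ℝ} (hz : ContDiff ℝ 2 z) (h0 : ∀ x ∈ frontier Ω, z x = 0)
    {δ : ℝ} (hδ : 0 < δ) {φ χ : ℝ → ℝ} (hχ : Continuous χ) (hφ : ∀ s, HasDerivAt φ (χ s) s)
    (h01 : ∀ s, 0 ≤ χ s ∧ χ s ≤ 1) (hφ0 : ∀ s, |s| ≤ δ → φ s = 0) :
    Lam Ω t * (∫ x in Ω, |φ (z x)| ^ t) ^ (2 / t) ≤ ∫ x in Ω, φ (z x) * -lapl z x := by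
  let w : EuclideanSpace ℝ (Fin N) → ℝ := Ω.indicator fun x => φ (z x)
  let K : Set (EuclideanSpace ℝ (Fin N)) := closure Ω ∩ {x | δ ≤ |z x|}
  have hK : IsCompact K := hb.isCompact_closure.inter_right
    (isClosed_le continuous_const hz.continuous.abs)
  have hKΩ : K ⊆ Ω := by
    rintro x ⟨hx, hx'⟩
    by_contra hn
    have := h0 x ⟨hx, by rwa [hΩ.interior_eq]⟩
    have hx'' : δ ≤ |z x| := hx'
    rw [this, abs_zero] at hx''
    linarith
  have hw0 : ∀ x, x ∉ K → w x = 0 := by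
    intro x hx
    by_cases h : x ∈ Ω
    · have : |z x| ≤ δ := by
        by_contra! hn
        exact hx ⟨subset_closure h, hn.le⟩
      simp [w, h, hφ0 _ this]
    · simp [w, h]
  have hev : ∀ x ∈ Ω, w =ᶠ[𝓝 x] fun y => φ (z y) := fun x hx =>
    (hΩ.eventually_mem hx).mono fun y hy => indicator_of_mem hy _
  have hev0 : ∀ x, x ∉ K → w =ᶠ[𝓝 x] fun _ => 0 := fun x hx =>
    (hK.isClosed.isOpen_compl.eventually_mem hx).mono fun y hy => hw0 y hy
  have hφC : ContDiff ℝ 1 φ := contDiff_one_iff_deriv.2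
    ⟨fun s => (hφ s).differentiableAt, by rwa [funext fun s => (hφ s).deriv]⟩
  have hw : ContDiff ℝ 1 w := contDiff_iff_contDiffAt.2 fun x => by
    by_cases h : x ∈ Ω
    · exact ((hφC.comp (hz.of_le (by norm_num))).contDiffAt).congr_of_eventuallyEq (hev x h)
    · exact contDiffAt_const.congr_of_eventuallyEq (hev0 x fun h' => h (hKΩ h'))
  have hc : HasCompactSupport w := .intro hK hw0
  have hs : tsupport w ⊆ Ω := (closure_minimal
    (Function.support_subset_iff'.2 hw0) hK.isClosed).trans hKΩ
  have hd : ∀ x ∈ Ω, fderiv ℝ w x = χ (z x) • fderiv ℝ z x := fun x hx => by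
    rw [(hev x hx).fderiv_eq]
    exact ((hφ (z x)).comp_hasFDerivAt x (hz.differentiable two_ne_zero x).hasFDerivAt).fderiv
  have hd0 : ∀ x, x ∉ Ω → fderiv ℝ w x = 0 := fun x hx => by
    rw [(hev0 x fun h' => hx (hKΩ h')).fderiv_eq]
    simp
  have hle : ∫ x in Ω, ‖fderiv ℝ w x‖ ^ 2 ≤ ∫ x, w x * -lapl z x := by
    rw [integral_mul_neg_lapl hw hc hz, setIntegral_eq_integral_of_forall_compl_eq_zero
      fun x hx => by rw [hd0 x hx]; simp]
    have hfc : HasCompactSupport fun x => ‖fderiv ℝ w x‖ ^ 2 := by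
      simp only [pow_two]
      exact (hc.fderiv ℝ).norm.mul_left
    have hfi : Integrable fun x => ‖fderiv ℝ w x‖ ^ 2 :=
      ((hw.continuous_fderiv one_ne_zero).norm.pow 2).integrable_of_hasCompactSupport hfc
    refine integral_mono hfi
      (integrable_finsetSum _ fun i _ => ((continuous_fderiv_apply_single hw i).mul
        (contDiff_fderiv_apply_single hz i).continuous).integrable_of_hasCompactSupport
        (hc.fderiv_apply ℝ _).mul_right) fun x => ?_
    simp only [norm_fderiv_sq_eq]
    refine Finset.sum_le_sum fun i _ => ?_
    by_cases h : x ∈ Ω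
    · simp only [hd x h, _root_.smul_apply, smul_eq_mul]
      have := h01 (z x)
      nlinarith [mul_nonneg this.1 (sub_nonneg.2 this.2),
        sq_nonneg (fderiv ℝ z x (EuclideanSpace.single i 1))]
    · simp [hd0 x h]
  have e1 : ∫ x in Ω, |w x| ^ t = ∫ x in Ω, |φ (z x)| ^ t :=
    setIntegral_congr_fun hΩ.measurableSet fun x hx => by simp [w, hx]
  have e2 : ∫ x, w x * -lapl z x = ∫ x in Ω, φ (z x) * -lapl z x := by
    rw [← setIntegral_eq_integral_of_forall_compl_eq_zero (s := Ω)
      fun x hx => by simp [w, hx]]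
    exact setIntegral_congr_fun hΩ.measurableSet fun x hx => by simp [w, hx]
  have := Lam_mul_le_of_contDiff_one hΩ hb ht hw hc hs
  rw [e1] at this
  exact (this.trans hle).trans_eq e2

/-- The variational inequality defining `Lam`, for functions vanishing on the boundary only. -/
theorem Lam_mul_le_integral_lapl {N : ℕ} {Ω : Set (EuclideanSpace ℝ (Fin N))} {t : ℝ}
    (hΩ : IsOpen Ω) (hb : Bornology.IsBounded Ω) (ht : 0 < t)
    {z : EuclideanSpace ℝ (Fin N) → ℝ} (hz : ContDiff ℝ 2 z) (h0 : ∀ x ∈ frontier Ω, z x = 0) :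
    Lam Ω t * (∫ x in Ω, |z x| ^ t) ^ (2 / t) ≤ ∫ x in Ω, z x * -lapl z x := by
  choose φ χ hχ hφ h01 hφ0 hφs using fun n : ℕ =>
    exists_truncation (δ := 1 / ((n : ℝ) + 1)) (by positivity)
  have hlim : Tendsto (fun n : ℕ => 2 * (1 / ((n : ℝ) + 1))) atTop (𝓝 0) := by
    simpa using (tendsto_one_div_add_atTop_nhds_zero_nat (𝕜 := ℝ)).const_mul 2
  have hε1 : ∀ n : ℕ, 2 * (1 / ((n : ℝ) + 1)) ≤ 2 := fun n => by
    have : 1 / ((n : ℝ) + 1) ≤ 1 := by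
      rw [div_le_one (by positivity)]; linarith [n.cast_nonneg (α := ℝ)]
    linarith
  have hμ : volume Ω ≠ ⊤ := hb.measure_lt_top.ne
  obtain ⟨A, hA⟩ := hb.isCompact_closure.exists_bound_of_continuousOn hz.continuous.continuousOn
  obtain ⟨B, hB⟩ := hb.isCompact_closure.exists_bound_of_continuousOn
    (continuous_lapl hz).continuousOn
  have hφc : ∀ n, Continuous (φ n) := fun n =>
    continuous_iff_continuousAt.2 fun s => (hφ n s).continuousAt
  have l1 : ∀ s, Tendsto (fun n => φ n s) atTop (𝓝 s) := fun s =>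
    tendsto_iff_dist_tendsto_zero.2 (squeeze_zero (fun n => dist_nonneg)
      (fun n => by rw [Real.dist_eq]; exact hφs n s) hlim)
  have hbd : ∀ n, ∀ x ∈ Ω, |φ n (z x)| ≤ A + 2 := fun n x hx => by
    have h1 := abs_add_le (φ n (z x) - z x) (z x)
    rw [sub_add_cancel] at h1
    have h2 : |z x| ≤ A := hA x (subset_closure hx)
    linarith [(hφs n (z x)).trans (hε1 n)]
  have t1 : Tendsto (fun n => ∫ x in Ω, |φ n (z x)| ^ t) atTop (𝓝 (∫ x in Ω, |z x| ^ t)) := by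
    refine tendsto_setIntegral_of_abs_le hΩ.measurableSet hμ (C := (A + 2) ^ t)
      (fun n => (((hφc n).comp hz.continuous).abs.rpow_const
        fun _ => .inr ht.le).aestronglyMeasurable)
      (fun n x hx => ?_) fun x _ => (l1 (z x)).abs.rpow_const (.inr ht.le)
    rw [abs_of_nonneg (by positivity)]
    exact Real.rpow_le_rpow (abs_nonneg _) (hbd n x hx) ht.le
  have t2 : Tendsto (fun n => ∫ x in Ω, φ n (z x) * -lapl z x) atTop
      (𝓝 (∫ x in Ω, z x * -lapl z x)) := by
    refine tendsto_setIntegral_of_abs_le hΩ.measurableSet hμ (C := (A + 2) * B)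
      (fun n => (((hφc n).comp hz.continuous).mul
        (continuous_lapl hz).neg).aestronglyMeasurable)
      (fun n x hx => ?_) fun x _ => (l1 (z x)).mul_const _
    rw [abs_mul, abs_neg]
    exact mul_le_mul (hbd n x hx) (hB x (subset_closure hx)) (abs_nonneg _)
      ((abs_nonneg _).trans (hbd n x hx))
  exact le_of_tendsto_of_tendsto' ((t1.rpow_const (.inr (by positivity))).const_mul _) t2
    fun n => Lam_mul_le_truncation hΩ hb ht hz h0 (by positivity) (hχ n) (hφ n) (h01 n) (hφ0 n)

/-- The `p`-th power of the positive part. -/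
def posPow (p s : ℝ) : ℝ := max s 0 ^ p

theorem posPow_nonneg (p s : ℝ) : 0 ≤ posPow p s := Real.rpow_nonneg (le_max_right _ _) _

theorem continuous_posPow {p : ℝ} (hp : 1 < p) : Continuous (posPow p) :=
  (continuous_id.max continuous_const).rpow_const fun _ => .inr (by linarith)

theorem posPow_mono {p : ℝ} (hp : 1 < p) : Monotone (posPow p) := fun _ _ h =>
  Real.rpow_le_rpow (le_max_right _ _) (max_le_max h le_rfl) (by linarith)

/-- Midpoint Hermite–Hadamard inequality for the concave power `q`. -/
theorem mul_sub_rpow_le {q m h : ℝ} (hq : 0 < q) (hq1 : q < 1) (hh : 0 ≤ h) (hm : h ≤ m) :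
    2 * q * h * m ^ (q - 1) ≤ (m + h) ^ q - (m - h) ^ q := by
  rcases hh.eq_or_lt with rfl | hh0
  · simp
  have hm0 : 0 < m := hh0.trans_le hm
  let g : ℝ → ℝ := fun s => (m + s) ^ q - (m - s) ^ q - 2 * q * s * m ^ (q - 1)
  have hd : ∀ s ∈ Ioo 0 m, HasDerivAt g
      (q * (m + s) ^ (q - 1) + q * (m - s) ^ (q - 1) - 2 * q * m ^ (q - 1)) s := by
    intro s hs
    have h1 : HasDerivAt (fun s => (m + s) ^ q) (1 * q * (m + s) ^ (q - 1)) s :=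
      ((hasDerivAt_id s).const_add m).rpow_const (.inl (by simp; linarith [hs.1]))
    have h2 : HasDerivAt (fun s => (m - s) ^ q) (-1 * q * (m - s) ^ (q - 1)) s :=
      ((hasDerivAt_id s).const_sub m).rpow_const (.inl (by simp; linarith [hs.2]))
    have h3 : HasDerivAt (fun s => 2 * q * s * m ^ (q - 1)) (2 * q * 1 * m ^ (q - 1)) s :=
      ((hasDerivAt_id s).const_mul (2 * q)).mul_const _
    exact ((h1.sub h2).sub h3).congr_deriv (by ring)
  have hmono : MonotoneOn g (Icc 0 m) := by
    refine monotoneOn_of_deriv_nonneg (convex_Icc _ _) ?_ ?_ ?_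
    · refine ContinuousOn.sub (ContinuousOn.sub ?_ ?_) (by fun_prop)
      · exact (continuousOn_const.add continuousOn_id).rpow_const fun _ _ => .inr hq.le
      · exact (continuousOn_const.sub continuousOn_id).rpow_const fun _ _ => .inr hq.le
    · rw [interior_Icc]
      exact fun s hs => (hd s hs).differentiableAt.differentiableWithinAt
    · rw [interior_Icc]
      intro s hs
      rw [(hd s hs).deriv]
      have p1 : 0 < m + s := by linarith [hs.1]
      have p2 : 0 < m - s := by linarith [hs.2]
      set A := (m + s) ^ ((q - 1) / 2)
      set B := (m - s) ^ ((q - 1) / 2)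
      have hA : (m + s) ^ (q - 1) = A ^ 2 := by
        rw [← Real.rpow_natCast, ← Real.rpow_mul p1.le]; norm_num
      have hB : (m - s) ^ (q - 1) = B ^ 2 := by
        rw [← Real.rpow_natCast, ← Real.rpow_mul p2.le]; norm_num
      have hC : m ^ (q - 1) ≤ A * B := by
        rw [← Real.mul_rpow p1.le p2.le]
        have : m ^ (q - 1) = (m ^ 2) ^ ((q - 1) / 2) := by
          rw [← Real.rpow_natCast, ← Real.rpow_mul hm0.le]; congr 1; push_cast; ring
        rw [this]
        exact Real.rpow_le_rpow_of_nonpos (mul_pos p1 p2) (by nlinarith [sq_nonneg s])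
          (by linarith)
      rw [hA, hB]
      nlinarith [mul_nonneg hq.le (sq_nonneg (A - B)), mul_le_mul_of_nonneg_left hC hq.le]
  have := hmono (left_mem_Icc.2 hm0.le) ⟨hh, hm⟩ hh
  simp only [g] at this
  simp at this
  linarith

theorem rpow_sub_rpow_le {p a b : ℝ} (hp : 1 < p) (hb : 0 ≤ b) (hab : b ≤ a) :
    a ^ p - b ^ p ≤ p * ((a ^ p + b ^ p) / 2) ^ ((p - 1) / p) * (a - b) := by
  have hp0 : 0 < p := by linarith
  have ha : 0 ≤ a := hb.trans hab
  have hle : b ^ p ≤ a ^ p := Real.rpow_le_rpow hb hab hp0.le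
  have hb' : 0 ≤ b ^ p := Real.rpow_nonneg hb _
  set m := (a ^ p + b ^ p) / 2 with hm
  rcases (by positivity : 0 ≤ m).eq_or_lt with h0 | h0
  · have h1 : a ^ p - b ^ p ≤ 0 := by linarith
    refine h1.trans (mul_nonneg (by positivity) (sub_nonneg.2 hab))
  have key := mul_sub_rpow_le (q := 1 / p) (m := m) (h := (a ^ p - b ^ p) / 2) (by positivity)
    (by rw [div_lt_one hp0]; exact hp) (by linarith) (by linarith)
  have e1 : m + (a ^ p - b ^ p) / 2 = a ^ p := by rw [hm]; ring
  have e2 : m - (a ^ p - b ^ p) / 2 = b ^ p := by rw [hm]; ring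
  rw [e1, e2, ← Real.rpow_mul ha, ← Real.rpow_mul hb, mul_one_div_cancel hp0.ne', Real.rpow_one,
    Real.rpow_one] at key
  have e3 : m ^ ((p - 1) / p) * m ^ (1 / p - 1) = 1 := by
    rw [← Real.rpow_add h0]
    have : (p - 1) / p + (1 / p - 1) = 0 := by field_simp; ring
    rw [this, Real.rpow_zero]
  have := mul_le_mul_of_nonneg_left key (by positivity : 0 ≤ p * m ^ ((p - 1) / p))
  refine le_trans (le_of_eq ?_) this
  have e4 : p * (1 / p) = 1 := mul_one_div_cancel hp0.ne'
  generalize m ^ ((p - 1) / p) = M₁ at *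
  generalize m ^ (1 / p - 1) = M₂ at *
  generalize 1 / p = q at *
  linear_combination (-(a ^ p - b ^ p) * M₁ * M₂) * e4 - (a ^ p - b ^ p) * e3

theorem posPow_sub_le {p a b : ℝ} (hp : 1 < p) (hab : b ≤ a) :
    posPow p a - posPow p b ≤
      p * ((posPow p a + posPow p b) / 2) ^ ((p - 1) / p) * (a - b) := by
  have h := rpow_sub_rpow_le hp (le_max_right b 0) (max_le_max hab (le_refl (0 : ℝ)))
  refine h.trans (mul_le_mul_of_nonneg_left ?_ ?_)
  · have := max_sub_max_le_max a 0 b 0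
    rwa [sub_zero, max_eq_left (sub_nonneg.2 hab)] at this
  · have := posPow_nonneg p a
    have := posPow_nonneg p b
    exact mul_nonneg (by linarith) (Real.rpow_nonneg (by unfold posPow at *; linarith) _)

/-- The secant slope of `posPow p` satisfies `0 ≤ V ≤ p * (mean)^((p-1)/p)`. -/
theorem slope_posPow_bounds {p : ℝ} (hp : 1 < p) (a b : ℝ) :
    0 ≤ (posPow p a - posPow p b) / (a - b) ∧ (posPow p a - posPow p b) / (a - b) ≤
      p * ((posPow p a + posPow p b) / 2) ^ ((p - 1) / p) := by
  have main : ∀ a b : ℝ, b ≤ a → 0 ≤ (posPow p a - posPow p b) / (a - b) ∧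
      (posPow p a - posPow p b) / (a - b) ≤
        p * ((posPow p a + posPow p b) / 2) ^ ((p - 1) / p) := by
    intro a b hab
    refine ⟨div_nonneg (sub_nonneg.2 (posPow_mono hp hab)) (sub_nonneg.2 hab), ?_⟩
    have h1 := posPow_nonneg p a
    have h2 := posPow_nonneg p b
    exact div_le_of_le_mul₀ (sub_nonneg.2 hab)
      (mul_nonneg (by linarith) (Real.rpow_nonneg (by linarith) _)) (posPow_sub_le hp hab)
  rcases le_total b a with h | h
  · exact main a b h
  · have := main b a h
    rwa [← neg_sub (posPow p a), ← neg_sub a, neg_div_neg_eq, add_comm] at this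

/-- Cauchy–Schwarz and Hölder estimate for the linearised nonlocal nonlinearity. -/
theorem abs_integral_posPow_sub_mul_le {X : Type*} [MeasurableSpace X] {μ : Measure X}
    [IsFiniteMeasure μ] {p lam a A : ℝ} (hp : 1 < p) (hlam : 0 ≤ lam) {u₁ u₂ w z : X → ℝ}
    (m₁ : AEStronglyMeasurable u₁ μ) (m₂ : AEStronglyMeasurable u₂ μ)
    (hw : MemLp w ⊤ μ) (hz : MemLp z ⊤ μ)
    (b₁ : ∀ᵐ x ∂μ, |u₁ x| ≤ A) (b₂ : ∀ᵐ x ∂μ, |u₂ x| ≤ A)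
    (i₁ : ∫ x, posPow p (u₁ x) ∂μ = 1) (i₂ : ∫ x, posPow p (u₂ x) ∂μ = 1)
    (hu : ∀ x, u₁ x - u₂ x = a + lam * w x) :
    |∫ x, (posPow p (u₁ x) - posPow p (u₂ x)) * z x ∂μ| ≤
      lam * p * (∫ x, |w x| ^ (2 * p) ∂μ) ^ (1 / (2 * p)) *
        (∫ x, |z x| ^ (2 * p) ∂μ) ^ (1 / (2 * p)) := by
  have hp0 : 0 < p := by linarith
  set V : X → ℝ := fun x => (posPow p (u₁ x) - posPow p (u₂ x)) / (u₁ x - u₂ x) with hV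
  set D : X → ℝ := fun x => a + lam * w x with hD
  have hVD : ∀ x, V x * D x = posPow p (u₁ x) - posPow p (u₂ x) := by
    intro x
    by_cases h : u₁ x - u₂ x = 0
    · rw [sub_eq_zero.1 h]; simp [hD, ← hu x, h]
    · simp only [hV, hD, ← hu x]; exact div_mul_cancel₀ _ h
  have hVb := fun x => slope_posPow_bounds hp (u₁ x) (u₂ x)
  have hc := continuous_posPow hp
  have mf₁ := hc.comp_aestronglyMeasurable m₁
  have mf₂ := hc.comp_aestronglyMeasurable m₂
  have mV : AEStronglyMeasurable V μ :=
    ((mf₁.aemeasurable.sub mf₂.aemeasurable).div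
      (m₁.aemeasurable.sub m₂.aemeasurable)).aestronglyMeasurable
  have hfA : ∀ s : ℝ, |s| ≤ A → posPow p s ≤ posPow p A := fun s hs =>
    posPow_mono hp ((le_abs_self s).trans hs)
  have hVt : MemLp V ⊤ μ := memLp_top_of_bound mV (p * (posPow p A) ^ ((p - 1) / p)) <| by
    filter_upwards [b₁, b₂] with x h1 h2
    rw [Real.norm_eq_abs, abs_of_nonneg (hVb x).1]
    refine (hVb x).2.trans ?_
    have := posPow_nonneg p (u₁ x)
    have := posPow_nonneg p (u₂ x)
    exact mul_le_mul_of_nonneg_left (Real.rpow_le_rpow (by linarith)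
      (by linarith [hfA _ h1, hfA _ h2]) (div_nonneg (by linarith) hp0.le)) hp0.le
  have hf₁ : MemLp (fun x => posPow p (u₁ x)) ⊤ μ := memLp_top_of_bound mf₁ (posPow p A) <| by
    filter_upwards [b₁] with x h1
    rw [Real.norm_eq_abs, abs_of_nonneg (posPow_nonneg _ _)]
    exact hfA _ h1
  have hf₂ : MemLp (fun x => posPow p (u₂ x)) ⊤ μ := memLp_top_of_bound mf₂ (posPow p A) <| by
    filter_upwards [b₂] with x h1
    rw [Real.norm_eq_abs, abs_of_nonneg (posPow_nonneg _ _)]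
    exact hfA _ h1
  have mul : ∀ {f g : X → ℝ}, MemLp f ⊤ μ → MemLp g ⊤ μ → MemLp (fun x => f x * g x) ⊤ μ :=
    fun hf hg => hg.mul hf
  have int : ∀ {f : X → ℝ}, MemLp f ⊤ μ → Integrable f μ := fun hf => hf.integrable le_top
  have hDt : MemLp D ⊤ μ := (memLp_const a).add (hw.const_mul lam)
  -- Hölder
  have hold : ∀ {g : X → ℝ}, MemLp g ⊤ μ → ∫ x, V x * (g x * g x) ∂μ ≤
      p * ((∫ x, |g x| ^ (2 * p) ∂μ) ^ (1 / (2 * p))) ^ 2 := by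
    intro g hg
    have hpq : (p / (p - 1)).HolderConjugate p := by
      have := (Real.HolderConjugate.conjExponent hp).symm
      rwa [Real.conjExponent] at this
    have h1 := integral_mul_le_Lp_mul_Lq_of_nonneg hpq (μ := μ) (f := V) (g := fun x => g x * g x)
      (.of_forall fun x => (hVb x).1) (.of_forall fun x => mul_self_nonneg _)
      (hVt.mono_exponent le_top) ((mul hg hg).mono_exponent le_top)
    have e1 : ∀ x, (g x * g x) ^ p = |g x| ^ (2 * p) := fun x => by
      rw [← abs_mul_abs_self, ← pow_two, ← Real.rpow_natCast, ← Real.rpow_mul (abs_nonneg _)]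
      norm_num
    have h2 : ∫ x, V x ^ (p / (p - 1)) ∂μ ≤ p ^ (p / (p - 1)) := by
      have h3 : ∫ x, p ^ (p / (p - 1)) * ((posPow p (u₁ x) + posPow p (u₂ x)) / 2) ∂μ =
          p ^ (p / (p - 1)) := by
        rw [integral_const_mul, integral_div, integral_add (int hf₁) (int hf₂), i₁, i₂]
        norm_num
      rw [← h3]
      refine integral_mono_of_nonneg (.of_forall fun x => Real.rpow_nonneg (hVb x).1 _)
        ((((int hf₁).add (int hf₂)).div_const 2).const_mul _) (.of_forall fun x => ?_)
      have q1 := posPow_nonneg p (u₁ x)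
      have q2 := posPow_nonneg p (u₂ x)
      have q0 : 0 ≤ (posPow p (u₁ x) + posPow p (u₂ x)) / 2 := by linarith
      have hpp : 0 < p / (p - 1) := div_pos hp0 (by linarith)
      refine (Real.rpow_le_rpow (hVb x).1 (hVb x).2 hpp.le).trans_eq ?_
      have : (p - 1) / p * (p / (p - 1)) = 1 := by
        have : p - 1 ≠ 0 := by linarith
        field_simp
      rw [Real.mul_rpow hp0.le (Real.rpow_nonneg q0 _), ← Real.rpow_mul q0, this, Real.rpow_one]
    simp only [e1] at h1
    have hn : 0 ≤ ∫ x, |g x| ^ (2 * p) ∂μ :=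
      integral_nonneg fun x => Real.rpow_nonneg (abs_nonneg _) _
    have e2 : ((∫ x, |g x| ^ (2 * p) ∂μ) ^ (1 / (2 * p))) ^ 2 =
        (∫ x, |g x| ^ (2 * p) ∂μ) ^ (1 / p) := by
      rw [← Real.rpow_natCast, ← Real.rpow_mul hn]
      congr 1
      push_cast
      field_simp
    rw [e2]
    refine h1.trans (mul_le_mul_of_nonneg_right ?_ (Real.rpow_nonneg hn _))
    have hpp : 0 < p / (p - 1) := div_pos hp0 (by linarith)
    refine (Real.rpow_le_rpow (integral_nonneg fun x => Real.rpow_nonneg (hVb x).1 _) h2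
      (by positivity)).trans_eq ?_
    rw [← Real.rpow_mul hp0.le, mul_one_div_cancel hpp.ne', Real.rpow_one]
  set Y := (∫ x, |w x| ^ (2 * p) ∂μ) ^ (1 / (2 * p))
  set Z := (∫ x, |z x| ^ (2 * p) ∂μ) ^ (1 / (2 * p))
  have hY : 0 ≤ Y := Real.rpow_nonneg
    (integral_nonneg fun x => Real.rpow_nonneg (abs_nonneg _) _) _
  have hZ : 0 ≤ Z := Real.rpow_nonneg
    (integral_nonneg fun x => Real.rpow_nonneg (abs_nonneg _) _) _
  -- the mean of `V * D` vanishes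
  have s0 : a * ∫ x, V x ∂μ + lam * ∫ x, V x * w x ∂μ = 0 := by
    rw [← integral_const_mul, ← integral_const_mul,
      ← integral_add ((int hVt).const_mul _) ((int (mul hVt hw)).const_mul _)]
    calc _ = ∫ x, posPow p (u₁ x) - posPow p (u₂ x) ∂μ :=
          integral_congr_ae (.of_forall fun x => by simp only [← hVD x, hD]; ring)
      _ = 0 := by rw [integral_sub (int hf₁) (int hf₂), i₁, i₂, sub_self]
  have s1 : ∫ x, V x * (D x * D x) ∂μ = a * (a * ∫ x, V x ∂μ) + 2 * (a * lam) * ∫ x, V x * w x ∂μ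
      + lam ^ 2 * ∫ x, V x * (w x * w x) ∂μ := by
    have hI : Integrable (fun x => a * a * V x + 2 * (a * lam) * (V x * w x)) μ :=
      ((int hVt).const_mul _).add ((int (mul hVt hw)).const_mul _)
    rw [← mul_assoc a, ← integral_const_mul, ← integral_const_mul, ← integral_const_mul,
      ← integral_add ((int hVt).const_mul _) ((int (mul hVt hw)).const_mul _),
      ← integral_add hI ((int (mul hVt (mul hw hw))).const_mul _)]
    exact integral_congr_ae (.of_forall fun x => by simp only [hD]; ring)
  have hV0 : 0 ≤ ∫ x, V x ∂μ := integral_nonneg fun x => (hVb x).1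
  have s2 : ∫ x, V x * (D x * D x) ∂μ ≤ lam ^ 2 * (p * Y ^ 2) := by
    have h1 := mul_le_mul_of_nonneg_left (hold hw) (sq_nonneg lam)
    have h2 : a * lam * ∫ x, V x * w x ∂μ = -(a * a * ∫ x, V x ∂μ) := by linear_combination a * s0
    have h3 := mul_nonneg (mul_self_nonneg a) hV0
    rw [s1]
    linarith
  have s3 : discrim (∫ x, V x * (z x * z x) ∂μ) (-(2 * ∫ x, V x * (D x * z x) ∂μ))
      (∫ x, V x * (D x * D x) ∂μ) ≤ 0 := by
    refine discrim_le_zero fun t => ?_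
    have : ∫ x, V x * (D x - t * z x) ^ 2 ∂μ = (∫ x, V x * (z x * z x) ∂μ) * (t * t) +
        -(2 * ∫ x, V x * (D x * z x) ∂μ) * t + ∫ x, V x * (D x * D x) ∂μ := by
      have e : (∫ x, V x * (z x * z x) ∂μ) * (t * t) + -(2 * ∫ x, V x * (D x * z x) ∂μ) * t +
          ∫ x, V x * (D x * D x) ∂μ = (t * t) * (∫ x, V x * (z x * z x) ∂μ) +
          (-2 * t) * ∫ x, V x * (D x * z x) ∂μ + ∫ x, V x * (D x * D x) ∂μ := by ring
      have hI : Integrable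
          (fun x => t * t * (V x * (z x * z x)) + -2 * t * (V x * (D x * z x))) μ :=
        ((int (mul hVt (mul hz hz))).const_mul _).add ((int (mul hVt (mul hDt hz))).const_mul _)
      rw [e, ← integral_const_mul, ← integral_const_mul,
        ← integral_add ((int (mul hVt (mul hz hz))).const_mul _)
          ((int (mul hVt (mul hDt hz))).const_mul _),
        ← integral_add hI (int (mul hVt (mul hDt hDt)))]
      exact integral_congr_ae (.of_forall fun x => by ring)
    rw [← this]
    exact integral_nonneg fun x => mul_nonneg (hVb x).1 (sq_nonneg _)
  have s4 : ∫ x, (posPow p (u₁ x) - posPow p (u₂ x)) * z x ∂μ = ∫ x, V x * (D x * z x) ∂μ :=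
    integral_congr_ae (.of_forall fun x => by simp only [← hVD x]; ring)
  rw [s4]
  refine abs_le_of_sq_le_sq ?_ (by positivity)
  rw [discrim] at s3
  have hzz : 0 ≤ ∫ x, V x * (z x * z x) ∂μ :=
    integral_nonneg fun x => mul_nonneg (hVb x).1 (mul_self_nonneg _)
  have := mul_le_mul s2 (hold hz) hzz (by positivity)
  nlinarith

/-- The standard isometry from `ℂ` to the Euclidean plane. -/
def toPlane : ℂ ≃ₗᵢ[ℝ] EuclideanSpace ℝ (Fin 2) := Complex.orthonormalBasisOneI.repr

theorem laplacian_comp_toPlane {u : EuclideanSpace ℝ (Fin 2) → ℝ} (hu : ContDiff ℝ 2 u) (z : ℂ) :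
    (Δ fun y => u (toPlane y)) z = lapl u (toPlane z) := by
  rw [laplacian_eq_iteratedFDeriv_orthonormalBasis _ Complex.orthonormalBasisOneI]
  refine Finset.sum_congr rfl fun i _ => ?_
  have h := (toPlane.toContinuousLinearEquiv : ℂ →L[ℝ] _).iteratedFDeriv_comp_right hu z
    (i := 2) le_rfl
  have h' : iteratedFDeriv ℝ 2 (fun y => u (toPlane y)) z = _ := h
  have hb : toPlane (Complex.orthonormalBasisOneI i) = EuclideanSpace.single i 1 :=
    Complex.orthonormalBasisOneI.repr_self i
  rw [h', ContinuousMultilinearMap.compContinuousLinearMap_apply, iteratedFDeriv_two_apply]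
  have hd : DifferentiableAt ℝ (fderiv ℝ u) (toPlane z) :=
    (hu.fderiv_right (m := 1) (by norm_num)).differentiable one_ne_zero _
  rw [fderiv_clm_apply hd (differentiableAt_const _)]
  simp only [Matrix.cons_val_zero, Matrix.cons_val_one]
  change fderiv ℝ (fderiv ℝ u) (toPlane z) (toPlane (Complex.orthonormalBasisOneI i))
    (toPlane (Complex.orthonormalBasisOneI i)) = _
  rw [hb]
  simp

theorem hasLap_comp_toPlane {u : EuclideanSpace ℝ (Fin 2) → ℝ} (hu : ContDiff ℝ 2 u) (z : ℂ) :
    HasLap (fun y => u (toPlane y)) (lapl u (toPlane z)) z :=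
  ⟨(hu.comp toPlane.contDiff).contDiffAt, laplacian_comp_toPlane hu z⟩

theorem preimage_closure_toPlane (s : Set (EuclideanSpace ℝ (Fin 2))) :
    closure (toPlane ⁻¹' s) = toPlane ⁻¹' closure s :=
  (toPlane.toHomeomorph.preimage_closure s).symm

theorem preimage_frontier_toPlane (s : Set (EuclideanSpace ℝ (Fin 2))) :
    frontier (toPlane ⁻¹' s) = toPlane ⁻¹' frontier s :=
  (toPlane.toHomeomorph.preimage_frontier s).symm

theorem isBounded_preimage_toPlane {s : Set (EuclideanSpace ℝ (Fin 2))}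
    (hs : Bornology.IsBounded s) : Bornology.IsBounded (toPlane ⁻¹' s) :=
  toPlane.isometry.antilipschitz.isBounded_preimage hs

theorem norm_toPlane_sub (z w : ℂ) : ‖toPlane z - toPlane w‖ = ‖z - w‖ := by
  rw [← map_sub, LinearIsometryEquiv.norm_map]

theorem IsC3Domain.exists_boundaryChart {Ω : Set (EuclideanSpace ℝ (Fin 2))}
    (hΩ : IsC3Domain Ω) :
    ∃ K ρ, 1 ≤ K ∧ 0 < ρ ∧ ∀ x ∈ frontier (toPlane ⁻¹' Ω), BoundaryChart (toPlane ⁻¹' Ω) K ρ x := by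
  refine exists_uniform_boundaryChart (hΩ.1.preimage toPlane.continuous)
    (isBounded_preimage_toPlane hΩ.2.2.1) fun x hx => ?_
  rw [preimage_frontier_toPlane] at hx
  obtain ⟨U, f, hU, hxU, hf, hf', he⟩ := hΩ.2.2.2 _ hx
  refine ⟨toPlane ⁻¹' U, fun y => f (toPlane y), hU.preimage toPlane.continuous, hxU,
    hf.comp toPlane.contDiff, fun y hy h0 => hf' _ hy ?_, ?_⟩
  · have h1 : HasFDerivAt (fun y => f (toPlane y)) ((fderiv ℝ f (toPlane y)).comp
        (toPlane.toContinuousLinearEquiv : ℂ →L[ℝ] _)) y :=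
      (hf.differentiable (by norm_num) _).hasFDerivAt.comp y
        toPlane.toContinuousLinearEquiv.hasFDerivAt
    rw [h1.fderiv] at h0
    ext v
    have := congrArg (fun l : ℂ →L[ℝ] ℝ => l (toPlane.symm v)) h0
    simpa using this
  · rw [← preimage_inter, he]
    rfl

theorem IsC3Domain.exists_poisson {Ω : Set (EuclideanSpace ℝ (Fin 2))} (hΩ : IsC3Domain Ω)
    {L : ℝ} {f : EuclideanSpace ℝ (Fin 2) → ℝ} (hL : 0 ≤ L)
    (hf : ∀ x ∈ closure Ω, ∀ y ∈ closure Ω, |f x - f y| ≤ L * ‖x - y‖) :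
    ∃ ψ, ContDiff ℝ 2 ψ ∧ (∀ x ∈ Ω, lapl ψ x = -f x) ∧ ∀ x ∈ frontier Ω, ψ x = 0 := by
  obtain ⟨K, ρ, hK, hρ, hch⟩ := hΩ.exists_boundaryChart
  obtain ⟨φ, h1, h2, h3⟩ := exists_contDiff_poisson (f := fun y => f (toPlane y))
    (hΩ.1.preimage toPlane.continuous) (isBounded_preimage_toPlane hΩ.2.2.1) hK hρ hch hL
    (by
      rw [preimage_closure_toPlane]
      intro z hz w hw
      rw [← norm_toPlane_sub]
      exact hf _ hz _ hw)
  have hC : ContDiff ℝ 2 fun x => φ (toPlane.symm x) := h1.comp toPlane.symm.contDiff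
  refine ⟨fun x => φ (toPlane.symm x), hC, fun x hx => ?_, fun x hx => ?_⟩
  · have h := laplacian_comp_toPlane hC (toPlane.symm x)
    simp only [LinearIsometryEquiv.symm_apply_apply, LinearIsometryEquiv.apply_symm_apply] at h
    rw [← h]
    have := (h2 (toPlane.symm x) (by simpa using hx)).2
    simpa using this
  · exact h3 _ (by rw [preimage_frontier_toPlane]; simpa using hx)

theorem IsC3Domain.exists_lipschitz_bound {Ω : Set (EuclideanSpace ℝ (Fin 2))}
    (hΩ : IsC3Domain Ω) :
    ∃ C, 0 < C ∧ ∀ (u : EuclideanSpace ℝ (Fin 2) → ℝ) (M : ℝ), 0 ≤ M → ContDiff ℝ 2 u →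
      (∀ x ∈ frontier Ω, u x = 0) → (∀ x ∈ Ω, |lapl u x| ≤ M) →
      ∀ x ∈ closure Ω, ∀ y ∈ closure Ω, |u x - u y| ≤ C * M * ‖x - y‖ := by
  obtain ⟨K, ρ, hK, hρ, hch⟩ := hΩ.exists_boundaryChart
  obtain ⟨C, hC, H⟩ := _root_.exists_lipschitz_bound (hΩ.1.preimage toPlane.continuous)
    (isBounded_preimage_toPlane hΩ.2.2.1) hK hρ hch
  rw [preimage_frontier_toPlane, preimage_closure_toPlane] at H
  refine ⟨C, hC, fun u M hM hu h0 hl x hx y hy => ?_⟩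
  have := H (fun z => u (toPlane z)) M hM (hu.continuous.comp toPlane.continuous).continuousOn
    (fun z hz => h0 _ hz) (fun z hz => ⟨_, hl _ hz, hasLap_comp_toPlane hu z⟩)
    (toPlane.symm x) (by simpa using hx) (toPlane.symm y) (by simpa using hy)
  rw [← norm_toPlane_sub] at this
  simpa using this

theorem IsC3Domain.exists_sup_bound {Ω : Set (EuclideanSpace ℝ (Fin 2))} (hΩ : IsC3Domain Ω) :
    ∃ C, 0 < C ∧ ∀ (u f : EuclideanSpace ℝ (Fin 2) → ℝ) (L : ℝ), 0 ≤ L → ContDiff ℝ 2 u →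
      (∀ x ∈ frontier Ω, u x = 0) → (∀ x ∈ Ω, lapl u x = -f x) → (∀ x ∈ Ω, 0 ≤ f x) →
      (∀ x ∈ closure Ω, ∀ y ∈ closure Ω, |f x - f y| ≤ L * ‖x - y‖) →
      ∀ x ∈ closure Ω, u x ≤ C * (1 + ∫ y in Ω, f y ^ 2) := by
  obtain ⟨C, hC, H⟩ := _root_.exists_sup_bound (hΩ.1.preimage toPlane.continuous)
    (isBounded_preimage_toPlane hΩ.2.2.1)
  rw [preimage_frontier_toPlane, preimage_closure_toPlane] at H
  refine ⟨C, hC, fun u f L hL hu h0 hl hf hfL x hx => ?_⟩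
  have := H (fun z => u (toPlane z)) (fun z => f (toPlane z)) L hL
    (hu.continuous.comp toPlane.continuous).continuousOn
    (fun z hz => h0 _ hz) (fun z hz => (hasLap_comp_toPlane hu z).congr_value (hl _ hz))
    (fun z hz => hf _ hz)
    (fun z hz w hw => by rw [← norm_toPlane_sub]; exact hfL _ hz _ hw)
    (toPlane.symm x) (by simpa using hx)
  rw [toPlane.measurePreserving.setIntegral_preimage_emb
    toPlane.toHomeomorph.measurableEmbedding (fun y => f y ^ 2)] at this
  simpa using this

theorem IsC3Domain.exists_abs_bound {Ω : Set (EuclideanSpace ℝ (Fin 2))} (hΩ : IsC3Domain Ω) :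
    ∃ C, 0 ≤ C ∧ ∀ (u : EuclideanSpace ℝ (Fin 2) → ℝ) (M : ℝ), 0 ≤ M → ContDiff ℝ 2 u →
      (∀ x ∈ frontier Ω, u x = 0) → (∀ x ∈ Ω, |lapl u x| ≤ M) →
      ∀ x ∈ closure Ω, |u x| ≤ C * M := by
  have hb := isBounded_preimage_toPlane hΩ.2.2.1
  obtain ⟨R, hR⟩ := hb.closure.subset_closedBall (0 : ℂ)
  refine ⟨R ^ 2 / 4, by positivity, fun u M hM hu h0 hl x hx => ?_⟩
  have H := abs_le_of_abs_hasLap_le (u := fun z => u (toPlane z)) (ε := 0)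
    (hΩ.1.preimage toPlane.continuous) hR hM
    (hu.continuous.comp toPlane.continuous).continuousOn
    (fun z hz => ⟨_, hl _ hz, hasLap_comp_toPlane hu z⟩)
  rw [preimage_frontier_toPlane, preimage_closure_toPlane] at H
  have := H (fun z hz => by rw [h0 _ hz, abs_zero]) (toPlane.symm x) (by simpa using hx)
  simp only [LinearIsometryEquiv.apply_symm_apply] at this
  linarith

theorem IsC3Domain.nonneg_of_lapl_nonpos {Ω : Set (EuclideanSpace ℝ (Fin 2))}
    (hΩ : IsC3Domain Ω) {u : EuclideanSpace ℝ (Fin 2) → ℝ} (hu : ContDiff ℝ 2 u)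
    (h0 : ∀ x ∈ frontier Ω, u x = 0) (hl : ∀ x ∈ Ω, lapl u x ≤ 0) :
    ∀ x ∈ closure Ω, 0 ≤ u x := by
  intro x hx
  have H := le_of_hasLap_le (u := fun _ => 0) (v := fun z => u (toPlane z))
    (hΩ.1.preimage toPlane.continuous) (isBounded_preimage_toPlane hΩ.2.2.1) continuousOn_const
    (hu.comp toPlane.contDiff).continuous.continuousOn
    (fun z hz => ⟨0, _, hl _ hz, HasLap.const 0, hasLap_comp_toPlane hu z⟩)
  rw [preimage_frontier_toPlane, preimage_closure_toPlane] at H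
  simpa using H (fun z hz => by rw [h0 _ hz]) (toPlane.symm x) (by simpa using hx)

theorem IsC3Domain.exists_ball_subset {Ω : Set (EuclideanSpace ℝ (Fin 2))} (hΩ : IsC3Domain Ω) :
    ∃ c, 0 < c ∧ ∀ x ∈ closure Ω, ∀ h, 0 < h → h ≤ 1 → ∃ y, ball y (c * h) ⊆ Ω ∩ ball x h := by
  obtain ⟨K, ρ, hK, hρ, hch⟩ := hΩ.exists_boundaryChart
  have hO := hΩ.1.preimage toPlane.continuous
  obtain ⟨c, hc, H⟩ := exists_ball_subset_of_boundaryChart hO hK hρ hch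
  refine ⟨c, hc, fun x hx h hh hh1 => ?_⟩
  obtain ⟨y, hy⟩ := H (toPlane.symm x) (by rw [preimage_closure_toPlane]; simpa using hx) h hh hh1
  have hsub : ball y (c * h) ⊆ toPlane ⁻¹' Ω := by
    intro q hq
    by_contra hn
    have hqf : q ∈ frontier (toPlane ⁻¹' Ω) := ⟨(hy hq).1, by rwa [hO.interior_eq]⟩
    have hK0 : 0 < K := by linarith
    obtain ⟨y', hy', hext⟩ := (hch q hqf).exterior_ball (R := min (1 / (4 * K)) (ρ / 4))
      (by positivity)
      (by
        have := mul_le_mul_of_nonneg_left (min_le_left (1 / (4 * K)) (ρ / 4))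
          (by positivity : 0 ≤ 4 * K)
        rwa [mul_one_div_cancel (by positivity)] at this)
      (by linarith [min_le_right (1 / (4 * K)) (ρ / 4)])
    set R := min (1 / (4 * K)) (ρ / 4)
    have hR : 0 < R := by positivity
    have hcont : Tendsto (fun t : ℝ => q + (t : ℂ) * (y' - q)) (𝓝[>] 0) (𝓝 q) := by
      have : Continuous fun t : ℝ => q + (t : ℂ) * (y' - q) := by fun_prop
      simpa using (this.tendsto 0).mono_left nhdsWithin_le_nhds
    have h1 : ∀ᶠ t : ℝ in 𝓝[>] 0, t < 1 := nhdsWithin_le_nhds (Iio_mem_nhds one_pos)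
    obtain ⟨t, ht1, ht2, ht3⟩ := ((hcont.eventually (isOpen_ball.mem_nhds hq)).and
      (h1.and self_mem_nhdsWithin)).exists
    have ht0 : 0 < t := ht3
    have hne : y' - q ≠ 0 := by
      rw [← norm_pos_iff, norm_sub_rev, hy']; exact hR
    have := hext _ (hy ht1).1 (by simpa [ht0.ne'] using hne)
    have e : q + (t : ℂ) * (y' - q) - y' = ((1 - t : ℝ) : ℂ) * (q - y') := by push_cast; ring
    rw [e, norm_mul, hy', Complex.norm_real, Real.norm_eq_abs, abs_of_pos (by linarith)] at this
    nlinarith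
  refine ⟨toPlane y, fun q hq => ?_⟩
  have hq' : toPlane.symm q ∈ ball y (c * h) := by
    rw [mem_ball, dist_eq_norm, ← norm_toPlane_sub]
    simpa [dist_eq_norm] using hq
  refine ⟨by simpa using hsub hq', ?_⟩
  have := (hy hq').2
  rw [mem_ball, dist_eq_norm, ← norm_toPlane_sub] at this
  simpa [dist_eq_norm] using this

theorem exists_abs_le_of_continuous {N : ℕ} {Ω : Set (EuclideanSpace ℝ (Fin N))}
    (hb : Bornology.IsBounded Ω) {f : EuclideanSpace ℝ (Fin N) → ℝ} (hf : Continuous f) :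
    ∃ C, 0 ≤ C ∧ ∀ x ∈ closure Ω, |f x| ≤ C := by
  obtain ⟨C, hC⟩ := hb.isCompact_closure.exists_bound_of_continuousOn hf.continuousOn
  exact ⟨max C 0, le_max_right _ _, fun x hx => (hC x hx).trans (le_max_left _ _)⟩

theorem memLp_top_restrict_of_continuous {N : ℕ} {Ω : Set (EuclideanSpace ℝ (Fin N))}
    (hΩ : IsOpen Ω) (hb : Bornology.IsBounded Ω) {f : EuclideanSpace ℝ (Fin N) → ℝ}
    (hf : Continuous f) : MemLp f ⊤ (volume.restrict Ω) := by
  obtain ⟨C, -, hC⟩ := exists_abs_le_of_continuous hb hf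
  exact memLp_top_of_bound hf.aestronglyMeasurable C
    (ae_restrict_of_forall_mem hΩ.measurableSet fun x hx => hC x (subset_closure hx))

theorem integrableOn_of_continuous_of_isBounded {N : ℕ} {Ω : Set (EuclideanSpace ℝ (Fin N))}
    (hb : Bornology.IsBounded Ω) {f : EuclideanSpace ℝ (Fin N) → ℝ}
    (hf : Continuous f) : IntegrableOn f Ω :=
  (hf.continuousOn.integrableOn_compact hb.isCompact_closure).mono_set subset_closure

theorem const_sub_le_of_integral_posPow_eq_one {N : ℕ} {Ω : Set (EuclideanSpace ℝ (Fin N))}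
    (hΩ : IsOpen Ω) (hb : Bornology.IsBounded Ω) {p α₁ α₂ s : ℝ} (hp : 1 < p)
    {v₁ v₂ : EuclideanSpace ℝ (Fin N) → ℝ} (c₁ : Continuous v₁) (c₂ : Continuous v₂)
    (i₁ : ∫ x in Ω, posPow p (α₁ + v₁ x) = 1) (i₂ : ∫ x in Ω, posPow p (α₂ + v₂ x) = 1)
    (h : ∀ x ∈ Ω, v₂ x - v₁ x ≤ s) : α₁ - α₂ ≤ s := by
  by_contra! hs
  have hf₁ : Continuous fun x => posPow p (α₁ + v₁ x) :=
    (continuous_posPow hp).comp (continuous_const.add c₁)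
  have hf₂ : Continuous fun x => posPow p (α₂ + v₂ x) :=
    (continuous_posPow hp).comp (continuous_const.add c₂)
  have I₁ := integrableOn_of_continuous_of_isBounded hb hf₁
  have I₂ := integrableOn_of_continuous_of_isBounded hb hf₂
  have hlt : ∀ x ∈ Ω, α₂ + v₂ x < α₁ + v₁ x := fun x hx => by linarith [h x hx]
  have h0 : ∫ x in Ω, (posPow p (α₁ + v₁ x) - posPow p (α₂ + v₂ x)) = 0 := by
    rw [integral_sub I₁ I₂, i₁, i₂, sub_self]
  have hae := (setIntegral_eq_zero_iff_of_nonneg_ae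
    (ae_restrict_of_forall_mem hΩ.measurableSet fun x hx =>
      sub_nonneg.2 (posPow_mono hp (hlt x hx).le)) (I₁.sub I₂)).1 h0
  have hz : ∫ x in Ω, posPow p (α₁ + v₁ x) = 0 := by
    refine integral_eq_zero_of_ae ?_
    filter_upwards [hae, ae_restrict_mem hΩ.measurableSet] with x hx hxΩ
    have hx' : posPow p (α₁ + v₁ x) - posPow p (α₂ + v₂ x) = 0 := hx
    have hl := hlt x hxΩ
    show max (α₁ + v₁ x) 0 ^ p = 0
    rcases le_or_gt (α₁ + v₁ x) 0 with hn | hn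
    · rw [max_eq_right hn, Real.zero_rpow (by linarith)]
    · have : posPow p (α₂ + v₂ x) < posPow p (α₁ + v₁ x) :=
        Real.rpow_lt_rpow (le_max_right _ _)
          (by rw [max_eq_left hn.le]; exact max_lt hl hn) (by linarith)
      linarith
  linarith

theorem abs_const_sub_le_of_integral_posPow_eq_one {N : ℕ}
    {Ω : Set (EuclideanSpace ℝ (Fin N))}
    (hΩ : IsOpen Ω) (hb : Bornology.IsBounded Ω) {p α₁ α₂ s : ℝ} (hp : 1 < p)
    {v₁ v₂ : EuclideanSpace ℝ (Fin N) → ℝ} (c₁ : Continuous v₁) (c₂ : Continuous v₂)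
    (i₁ : ∫ x in Ω, posPow p (α₁ + v₁ x) = 1) (i₂ : ∫ x in Ω, posPow p (α₂ + v₂ x) = 1)
    (h : ∀ x ∈ Ω, |v₁ x - v₂ x| ≤ s) : |α₁ - α₂| ≤ s := by
  refine abs_sub_le_iff.2 ⟨?_, ?_⟩
  · exact const_sub_le_of_integral_posPow_eq_one hΩ hb hp c₁ c₂ i₁ i₂
      fun x hx => (abs_sub_le_iff.1 (h x hx)).2
  · exact const_sub_le_of_integral_posPow_eq_one hΩ hb hp c₂ c₁ i₂ i₁
      fun x hx => (abs_sub_le_iff.1 (h x hx)).1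

theorem exists_integral_posPow_eq_one {N : ℕ} {Ω : Set (EuclideanSpace ℝ (Fin N))}
    (hΩ : IsOpen Ω) (hb : Bornology.IsBounded Ω) (hvol : volume Ω = 1) {p : ℝ} (hp : 1 < p)
    {v : EuclideanSpace ℝ (Fin N) → ℝ} (hv : Continuous v) :
    ∃ α, ∫ x in Ω, posPow p (α + v x) = 1 := by
  obtain ⟨A, hA, hvA⟩ := exists_abs_le_of_continuous hb hv
  have hvA' : ∀ x ∈ Ω, -A ≤ v x ∧ v x ≤ A := fun x hx => abs_le.1 (hvA x (subset_closure hx))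
  have hcont : ∀ α, Continuous fun x => posPow p (α + v x) := fun α =>
    (continuous_posPow hp).comp (continuous_const.add hv)
  have hG : ContinuousOn (fun α => ∫ x in Ω, posPow p (α + v x)) (Icc (-A) (1 + A)) := by
    refine continuousOn_of_dominated (bound := fun _ => posPow p (1 + A + A))
      (fun α _ => (hcont α).aestronglyMeasurable) ?_ ?_ ?_
    · intro α hα
      refine ae_restrict_of_forall_mem hΩ.measurableSet fun x hx => ?_
      rw [Real.norm_of_nonneg (posPow_nonneg _ _)]
      exact posPow_mono hp (add_le_add hα.2 (hvA' x hx).2)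
    · exact integrableOn_const (by simp [hvol])
    · exact ae_of_all _ fun x =>
        ((continuous_posPow hp).comp (continuous_id.add continuous_const)).continuousOn
  have hlo : ∫ x in Ω, posPow p (-A + v x) = 0 := by
    refine setIntegral_eq_zero_of_forall_eq_zero fun x hx => ?_
    show max (-A + v x) 0 ^ p = 0
    rw [max_eq_right (by linarith [(hvA' x hx).2]), Real.zero_rpow (by linarith)]
  have hhi : 1 ≤ ∫ x in Ω, posPow p (1 + A + v x) := by
    have h1 : ∫ _ in Ω, (1 : ℝ) = 1 := by simp [Measure.real, hvol]
    rw [← h1]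
    refine setIntegral_mono_on (integrableOn_const (by simp [hvol]))
      (integrableOn_of_continuous_of_isBounded hb (hcont _)) hΩ.measurableSet fun x hx => ?_
    have h2 : posPow p 1 = 1 := by simp [posPow]
    exact h2.symm.le.trans (posPow_mono hp (by linarith [(hvA' x hx).1]))
  obtain ⟨α, -, hα⟩ := intermediate_value_Icc (by linarith) hG
    (show (1 : ℝ) ∈ Icc _ _ from ⟨by simp only [hlo]; norm_num, hhi⟩)
  exact ⟨α, hα⟩

theorem abs_posPow_sub_le {p A a b : ℝ} (hp : 1 < p) (ha : a ≤ A) (hb : b ≤ A) :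
    |posPow p a - posPow p b| ≤ p * posPow p A ^ ((p - 1) / p) * |a - b| := by
  have key : ∀ {a b : ℝ}, b ≤ a → a ≤ A →
      |posPow p a - posPow p b| ≤ p * posPow p A ^ ((p - 1) / p) * |a - b| := by
    intro a b hab haA
    rw [abs_of_nonneg (sub_nonneg.2 (posPow_mono hp hab)), abs_of_nonneg (sub_nonneg.2 hab)]
    refine (posPow_sub_le hp hab).trans ?_
    have h1 := posPow_nonneg p a
    have h2 := posPow_nonneg p b
    have h3 := posPow_mono hp haA
    have h4 := posPow_mono hp hab
    have h5 : 0 ≤ (p - 1) / p := div_nonneg (by linarith) (by linarith)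
    gcongr
    linarith
  rcases le_total b a with h | h
  · exact key h ha
  · rw [abs_sub_comm, abs_sub_comm a]
    exact key h hb

theorem exists_lipschitz_on_closure {N : ℕ} {Ω : Set (EuclideanSpace ℝ (Fin N))}
    (hb : Bornology.IsBounded Ω) {u : EuclideanSpace ℝ (Fin N) → ℝ} (hu : ContDiff ℝ 2 u) :
    ∃ L, 0 ≤ L ∧ ∀ x ∈ closure Ω, ∀ y ∈ closure Ω, |u x - u y| ≤ L * ‖x - y‖ := by
  obtain ⟨R, hR⟩ := hb.subset_closedBall 0
  have hcl : closure Ω ⊆ closedBall 0 R := closure_minimal hR isClosed_closedBall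
  obtain ⟨L, hL⟩ := (isCompact_closedBall (0 : EuclideanSpace ℝ (Fin N)) R
    ).exists_bound_of_continuousOn (hu.continuous_fderiv two_ne_zero).continuousOn
  refine ⟨max L 0, le_max_right _ _, fun x hx y hy => ?_⟩
  exact (convex_closedBall _ _).norm_image_sub_le_of_norm_fderiv_le
    (fun z _ => hu.differentiable two_ne_zero z)
    (fun z hz => (hL z hz).trans (le_max_left _ _)) (hcl hy) (hcl hx)

/-- The norm of `L^{2p}(Ω)`. -/
def powNorm {N : ℕ} (Ω : Set (EuclideanSpace ℝ (Fin N))) (p : ℝ)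
    (z : EuclideanSpace ℝ (Fin N) → ℝ) : ℝ :=
  (∫ x in Ω, |z x| ^ (2 * p)) ^ (1 / (2 * p))

theorem powNorm_nonneg {N : ℕ} (Ω : Set (EuclideanSpace ℝ (Fin N))) (p : ℝ)
    (z : EuclideanSpace ℝ (Fin N) → ℝ) : 0 ≤ powNorm Ω p z :=
  Real.rpow_nonneg (integral_nonneg fun _ => Real.rpow_nonneg (abs_nonneg _) _) _

theorem powNorm_rpow {N : ℕ} (Ω : Set (EuclideanSpace ℝ (Fin N))) {p : ℝ} (hp : 1 < p)
    (z : EuclideanSpace ℝ (Fin N) → ℝ) :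
    powNorm Ω p z ^ (2 * p) = ∫ x in Ω, |z x| ^ (2 * p) := by
  rw [powNorm, ← Real.rpow_mul (integral_nonneg fun _ => Real.rpow_nonneg (abs_nonneg _) _),
    one_div_mul_cancel (by linarith), Real.rpow_one]

theorem powNorm_sq {N : ℕ} (Ω : Set (EuclideanSpace ℝ (Fin N))) (p : ℝ)
    (z : EuclideanSpace ℝ (Fin N) → ℝ) :
    powNorm Ω p z ^ 2 = (∫ x in Ω, |z x| ^ (2 * p)) ^ (2 / (2 * p)) := by
  rw [powNorm, ← Real.rpow_natCast,
    ← Real.rpow_mul (integral_nonneg fun _ => Real.rpow_nonneg (abs_nonneg _) _)]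
  congr 1
  push_cast
  ring

theorem powNorm_mono {N : ℕ} {Ω : Set (EuclideanSpace ℝ (Fin N))} (hΩ : IsOpen Ω)
    (hb : Bornology.IsBounded Ω) {p : ℝ} (hp : 1 < p) {f g : EuclideanSpace ℝ (Fin N) → ℝ}
    (hf : Continuous f) (hg : Continuous g) (h : ∀ x ∈ Ω, |f x| ≤ |g x|) :
    powNorm Ω p f ≤ powNorm Ω p g := by
  have hc : ∀ {f : EuclideanSpace ℝ (Fin N) → ℝ}, Continuous f →
      IntegrableOn (fun x => |f x| ^ (2 * p)) Ω := fun hf =>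
    integrableOn_of_continuous_of_isBounded hb
      (hf.abs.rpow_const fun _ => .inr (by linarith))
  refine Real.rpow_le_rpow (integral_nonneg fun _ => Real.rpow_nonneg (abs_nonneg _) _)
    (setIntegral_mono_on (hc hf) (hc hg) hΩ.measurableSet fun x hx => ?_) (by positivity)
  exact Real.rpow_le_rpow (abs_nonneg _) (h x hx) (by linarith)

theorem powNorm_const_mul {N : ℕ} (Ω : Set (EuclideanSpace ℝ (Fin N))) {p : ℝ} (hp : 1 < p)
    {c : ℝ} (hc : 0 ≤ c) (z : EuclideanSpace ℝ (Fin N) → ℝ) :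
    powNorm Ω p (fun x => c * z x) = c * powNorm Ω p z := by
  have h : ∀ x, |c * z x| ^ (2 * p) = c ^ (2 * p) * |z x| ^ (2 * p) := fun x => by
    rw [abs_mul, abs_of_nonneg hc, Real.mul_rpow hc (abs_nonneg _)]
  simp only [powNorm, h]
  rw [integral_const_mul, Real.mul_rpow (Real.rpow_nonneg hc _)
    (integral_nonneg fun _ => Real.rpow_nonneg (abs_nonneg _) _), ← Real.rpow_mul hc,
    mul_one_div_cancel (by linarith), Real.rpow_one]

theorem powNorm_one {N : ℕ} {Ω : Set (EuclideanSpace ℝ (Fin N))} (hvol : volume Ω = 1) (p : ℝ) :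
    powNorm Ω p (fun _ => 1) = 1 := by
  simp [powNorm, Measure.real, hvol]

theorem powNorm_add_le {N : ℕ} {Ω : Set (EuclideanSpace ℝ (Fin N))} (hΩ : IsOpen Ω)
    (hb : Bornology.IsBounded Ω) {p : ℝ} (hp : 1 < p) {f g : EuclideanSpace ℝ (Fin N) → ℝ}
    (hf : Continuous f) (hg : Continuous g) :
    powNorm Ω p (fun x => f x + g x) ≤ powNorm Ω p f + powNorm Ω p g := by
  have : Fact (volume Ω < ⊤) := ⟨hb.measure_lt_top⟩
  have h0 : 0 < 2 * p := by linarith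
  have hq : ∀ {f : EuclideanSpace ℝ (Fin N) → ℝ}, Continuous f →
      powNorm Ω p f = lpNorm f (ENNReal.ofReal (2 * p)) (volume.restrict Ω) := by
    intro f hf
    rw [lpNorm_eq_integral_norm_rpow_toReal (by simpa using by linarith) ENNReal.ofReal_ne_top
      hf.aestronglyMeasurable, ENNReal.toReal_ofReal h0.le, powNorm, one_div]
    rfl
  have hm := (memLp_top_restrict_of_continuous hΩ hb hf).mono_exponent
    (p := ENNReal.ofReal (2 * p)) le_top
  rw [hq hf, hq hg, hq (f := fun x => f x + g x) (hf.add hg)]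
  exact lpNorm_add_le hm (by rw [ENNReal.one_le_ofReal]; linarith)

theorem lapl_sub {N : ℕ} {u v : EuclideanSpace ℝ (Fin N) → ℝ} (hu : ContDiff ℝ 2 u)
    (hv : ContDiff ℝ 2 v) (x : EuclideanSpace ℝ (Fin N)) :
    lapl (fun y => u y - v y) x = lapl u x - lapl v x := by
  unfold lapl
  rw [← Finset.sum_sub_distrib]
  refine Finset.sum_congr rfl fun i _ => ?_
  have h : (fun y => fderiv ℝ (fun y => u y - v y) y (EuclideanSpace.single i (1 : ℝ))) =
      fun y => fderiv ℝ u y (EuclideanSpace.single i 1) -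
        fderiv ℝ v y (EuclideanSpace.single i 1) := by
    funext y
    rw [fderiv_fun_sub (hu.differentiable two_ne_zero y) (hv.differentiable two_ne_zero y)]
    rfl
  rw [h, fderiv_fun_sub
    ((contDiff_fderiv_apply_single hu i).differentiable one_ne_zero x)
    ((contDiff_fderiv_apply_single hv i).differentiable one_ne_zero x)]
  rfl

/-- Energy estimate for the difference of two solutions of the linear problem with nonlinear
right-hand sides. -/
theorem Lam_mul_powNorm_le {N : ℕ} {Ω : Set (EuclideanSpace ℝ (Fin N))} (hΩ : IsOpen Ω)
    (hb : Bornology.IsBounded Ω) {p lam : ℝ} (hp : 1 < p) (hlam : 0 ≤ lam) {α₁ α₂ : ℝ}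
    {v₁ v₂ z : EuclideanSpace ℝ (Fin N) → ℝ} (c₁ : Continuous v₁) (c₂ : Continuous v₂)
    (i₁ : ∫ x in Ω, posPow p (α₁ + lam * v₁ x) = 1)
    (i₂ : ∫ x in Ω, posPow p (α₂ + lam * v₂ x) = 1)
    (hz : ContDiff ℝ 2 z) (h0 : ∀ x ∈ frontier Ω, z x = 0)
    (hl : ∀ x ∈ Ω, lapl z x = -(posPow p (α₁ + lam * v₁ x) - posPow p (α₂ + lam * v₂ x))) :
    Lam Ω (2 * p) * powNorm Ω p z ≤ lam * p * powNorm Ω p (fun x => v₁ x - v₂ x) := by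
  have : IsFiniteMeasure (volume.restrict Ω) := ⟨by simpa using hb.measure_lt_top⟩
  have e₁ : Continuous fun x => α₁ + lam * v₁ x := by fun_prop
  have e₂ : Continuous fun x => α₂ + lam * v₂ x := by fun_prop
  obtain ⟨A₁, -, hA₁⟩ := exists_abs_le_of_continuous hb e₁
  obtain ⟨A₂, -, hA₂⟩ := exists_abs_le_of_continuous hb e₂
  have key := abs_integral_posPow_sub_mul_le (μ := volume.restrict Ω) (A := max A₁ A₂)
    (a := α₁ - α₂) (w := fun x => v₁ x - v₂ x) (z := z) hp hlam e₁.aestronglyMeasurable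
    e₂.aestronglyMeasurable (memLp_top_restrict_of_continuous hΩ hb (c₁.sub c₂))
    (memLp_top_restrict_of_continuous hΩ hb hz.continuous)
    (ae_restrict_of_forall_mem hΩ.measurableSet fun x hx =>
      (hA₁ x (subset_closure hx)).trans (le_max_left _ _))
    (ae_restrict_of_forall_mem hΩ.measurableSet fun x hx =>
      (hA₂ x (subset_closure hx)).trans (le_max_right _ _)) i₁ i₂ (fun x => by ring)
  have hE := Lam_mul_le_integral_lapl hΩ hb (by linarith : 0 < 2 * p) hz h0
  have hI : ∫ x in Ω, z x * -lapl z x =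
      ∫ x in Ω, (posPow p (α₁ + lam * v₁ x) - posPow p (α₂ + lam * v₂ x)) * z x :=
    setIntegral_congr_fun hΩ.measurableSet fun x hx => by
      simp only [hl x hx]; ring
  rw [hI, ← powNorm_sq] at hE
  have h1 : Lam Ω (2 * p) * powNorm Ω p z ^ 2 ≤
      lam * p * powNorm Ω p (fun x => v₁ x - v₂ x) * powNorm Ω p z :=
    hE.trans ((le_abs_self _).trans key)
  rcases (powNorm_nonneg Ω p z).eq_or_lt with h | h
  · rw [← h, mul_zero]
    exact mul_nonneg (mul_nonneg hlam (by linarith)) (powNorm_nonneg _ _ _)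
  · exact le_of_mul_le_mul_right (by linarith) h

/-- Interpolation between the Lipschitz seminorm and the `L^{2p}` norm. -/
theorem IsC3Domain.exists_interpolation {Ω : Set (EuclideanSpace ℝ (Fin 2))}
    (hΩ : IsC3Domain Ω) {p L : ℝ} (hp : 1 < p) (hL : 0 < L) :
    ∃ K, 0 ≤ K ∧ ∀ v : EuclideanSpace ℝ (Fin 2) → ℝ, Continuous v →
      (∀ x ∈ closure Ω, |v x| ≤ 2 * L) →
      (∀ x ∈ closure Ω, ∀ y ∈ closure Ω, |v x - v y| ≤ L * ‖x - y‖) →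
      ∀ x ∈ closure Ω, |v x| ≤ K * powNorm Ω p v ^ (p / (p + 1)) := by
  obtain ⟨c, hc, hball⟩ := hΩ.exists_ball_subset
  set ω := volume.real (ball (0 : EuclideanSpace ℝ (Fin 2)) 1) with hω
  have hω0 : 0 < ω := ENNReal.toReal_pos (measure_ball_pos _ _ one_pos).ne'
    measure_ball_lt_top.ne
  set k := 2⁻¹ ^ (2 * p) * ((c / (2 * L)) ^ 2 * ω) with hk
  have hk0 : 0 < k := by positivity
  have hp2 : 0 < 2 * p + 2 := by linarith
  refine ⟨k⁻¹ ^ (1 / (2 * p + 2)), by positivity, fun v hv hv2 hvL x hx => ?_⟩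
  have hN := powNorm_nonneg Ω p v
  rcases (abs_nonneg (v x)).eq_or_lt with h | hs
  · rw [← h]; positivity
  set s := |v x| with hsd
  have hcont : Continuous fun y => |v y| ^ (2 * p) :=
    hv.abs.rpow_const fun _ => .inr (by linarith)
  obtain ⟨y, hy⟩ := hball x hx (s / (2 * L)) (by positivity)
    ((div_le_one (by positivity)).2 (hv2 x hx))
  have hlow : ∀ t ∈ ball y (c * (s / (2 * L))), (s / 2) ^ (2 * p) ≤ |v t| ^ (2 * p) := by
    intro t ht
    have ht' := hy ht
    refine Real.rpow_le_rpow (by positivity) ?_ (by linarith)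
    have h1 := hvL x hx t (subset_closure ht'.1)
    have h2 : ‖x - t‖ ≤ s / (2 * L) := by
      rw [← dist_eq_norm, dist_comm]; exact (mem_ball.1 ht'.2).le
    have h3 : L * ‖x - t‖ ≤ s / 2 :=
      (mul_le_mul_of_nonneg_left h2 hL.le).trans (le_of_eq (by field_simp))
    have h4 := abs_sub_abs_le_abs_sub (v x) (v t)
    linarith
  have hvolb : volume.real (ball y (c * (s / (2 * L)))) = (c * (s / (2 * L))) ^ 2 * ω := by
    have h0 : 0 ≤ c * (s / (2 * L)) := by positivity
    rw [Measure.real, Measure.addHaar_ball _ _ h0, ENNReal.toReal_mul,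
      ENNReal.toReal_ofReal (by positivity), finrank_euclideanSpace, Fintype.card_fin]
    rfl
  have h_int := integrableOn_of_continuous_of_isBounded hΩ.2.2.1 hcont
  have h1 : (s / 2) ^ (2 * p) * ((c * (s / (2 * L))) ^ 2 * ω) ≤ powNorm Ω p v ^ (2 * p) := by
    rw [powNorm_rpow Ω hp, ← hvolb]
    have h2 : ∫ _ in ball y (c * (s / (2 * L))), (s / 2) ^ (2 * p) =
        (s / 2) ^ (2 * p) * volume.real (ball y (c * (s / (2 * L)))) := by
      rw [setIntegral_const, smul_eq_mul, mul_comm]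
    rw [← h2]
    have hsub : ball y (c * (s / (2 * L))) ⊆ Ω := fun t ht => (hy ht).1
    refine (setIntegral_mono_on (integrableOn_const measure_ball_lt_top.ne)
      (h_int.mono_set hsub) measurableSet_ball hlow).trans ?_
    exact setIntegral_mono_set h_int
      (ae_of_all _ fun _ => Real.rpow_nonneg (abs_nonneg _) _) hsub.eventuallyLE
  have h2 : s ^ (2 * p + 2) ≤ k⁻¹ * powNorm Ω p v ^ (2 * p) := by
    rw [inv_mul_eq_div, le_div_iff₀ hk0]
    refine le_trans (le_of_eq ?_) h1
    have h3 : s ^ (2 : ℝ) = s ^ 2 := Real.rpow_natCast s 2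
    rw [Real.rpow_add hs, h3, div_eq_mul_inv s 2, Real.mul_rpow hs.le (by norm_num), hk]
    ring
  have h3 := Real.rpow_le_rpow (by positivity) h2 (by positivity : 0 ≤ 1 / (2 * p + 2))
  rw [← Real.rpow_mul hs.le, mul_one_div_cancel hp2.ne', Real.rpow_one,
    Real.mul_rpow (by positivity) (by positivity), ← Real.rpow_mul hN] at h3
  have h4 : 2 * p * (1 / (2 * p + 2)) = p / (p + 1) := by field_simp
  rwa [h4] at h3

theorem abs_posPow_comp_sub_le {X : Type*} [SeminormedAddCommGroup X] {s : Set X}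
    {p lam α A L : ℝ} (hp : 1 < p) (hlam : 0 ≤ lam) {v : X → ℝ}
    (hA : ∀ x ∈ s, α + lam * v x ≤ A)
    (hL : ∀ x ∈ s, ∀ y ∈ s, |v x - v y| ≤ L * ‖x - y‖) :
    ∀ x ∈ s, ∀ y ∈ s, |posPow p (α + lam * v x) - posPow p (α + lam * v y)| ≤
      p * posPow p A ^ ((p - 1) / p) * lam * L * ‖x - y‖ := by
  intro x hx y hy
  have h1 : |α + lam * v x - (α + lam * v y)| ≤ lam * (L * ‖x - y‖) := by
    rw [add_sub_add_left_eq_sub, ← mul_sub, abs_mul, abs_of_nonneg hlam]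
    exact mul_le_mul_of_nonneg_left (hL x hx y hy) hlam
  have h2 : 0 ≤ p * posPow p A ^ ((p - 1) / p) :=
    mul_nonneg (by linarith) (Real.rpow_nonneg (posPow_nonneg _ _) _)
  refine (abs_posPow_sub_le hp (hA x hx) (hA y hy)).trans ?_
  exact (mul_le_mul_of_nonneg_left h1 h2).trans (le_of_eq (by ring))

theorem exists_lipschitz_posPow_comp {N : ℕ} {Ω : Set (EuclideanSpace ℝ (Fin N))}
    (hb : Bornology.IsBounded Ω) {p lam : ℝ} (hp : 1 < p) (hlam : 0 ≤ lam) (α : ℝ)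
    {ψ : EuclideanSpace ℝ (Fin N) → ℝ} (hψ : ContDiff ℝ 2 ψ) :
    ∃ L, 0 ≤ L ∧ ∀ x ∈ closure Ω, ∀ y ∈ closure Ω,
      |posPow p (α + lam * ψ x) - posPow p (α + lam * ψ y)| ≤ L * ‖x - y‖ := by
  obtain ⟨L, hL0, hL⟩ := exists_lipschitz_on_closure hb hψ
  obtain ⟨A, -, hA⟩ := exists_abs_le_of_continuous hb
    (continuous_const.add (continuous_const.mul hψ.continuous) :
      Continuous fun x => α + lam * ψ x)
  have h2 : 0 ≤ p * posPow p A ^ ((p - 1) / p) :=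
    mul_nonneg (by linarith) (Real.rpow_nonneg (posPow_nonneg _ _) _)
  exact ⟨_, by positivity,
    abs_posPow_comp_sub_le hp hlam (fun x hx => (abs_le.1 (hA x hx)).2) hL⟩

/-- The Picard iteration for problem `(P)_λ`, started at zero. -/
theorem IsC3Domain.exists_iterates {Ω : Set (EuclideanSpace ℝ (Fin 2))} (hΩ : IsC3Domain Ω)
    (hvol : volume Ω = 1) {p lam : ℝ} (hp : 1 < p) (hlam : 0 ≤ lam) :
    ∃ (α : ℕ → ℝ) (ψ : ℕ → EuclideanSpace ℝ (Fin 2) → ℝ), ψ 0 = 0 ∧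
      (∀ n, ContDiff ℝ 2 (ψ n)) ∧ (∀ n, ∀ x ∈ frontier Ω, ψ n x = 0) ∧
      (∀ n, ∫ x in Ω, posPow p (α n + lam * ψ n x) = 1) ∧
      ∀ n, ∀ x ∈ Ω, lapl (ψ (n + 1)) x = -posPow p (α n + lam * ψ n x) := by
  have step : ∀ ψ : EuclideanSpace ℝ (Fin 2) → ℝ, ContDiff ℝ 2 ψ → ∃ α,
      (∫ x in Ω, posPow p (α + lam * ψ x) = 1) ∧ ∃ ψ', ContDiff ℝ 2 ψ' ∧
      (∀ x ∈ Ω, lapl ψ' x = -posPow p (α + lam * ψ x)) ∧ ∀ x ∈ frontier Ω, ψ' x = 0 := by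
    intro ψ hψ
    obtain ⟨α, hα⟩ := exists_integral_posPow_eq_one hΩ.1 hΩ.2.2.1 hvol hp
      (continuous_const.mul hψ.continuous : Continuous fun x => lam * ψ x)
    obtain ⟨L, hL0, hL⟩ := exists_lipschitz_posPow_comp hΩ.2.2.1 hp hlam α hψ
    exact ⟨α, hα, hΩ.exists_poisson hL0 hL⟩
  choose! a ha T hT using step
  let ψ : ℕ → EuclideanSpace ℝ (Fin 2) → ℝ := fun n => T^[n] 0
  have hs : ∀ n, ψ (n + 1) = T (ψ n) := fun n => Function.iterate_succ_apply' T n 0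
  have hc : ∀ n, ContDiff ℝ 2 (ψ n) := by
    intro n
    induction n with
    | zero => exact contDiff_const
    | succ n ih => rw [hs]; exact (hT _ ih).1
  refine ⟨fun n => a (ψ n), ψ, rfl, hc, ?_, fun n => ha _ (hc n), ?_⟩
  · rintro (_ | n) x hx
    · rfl
    · rw [hs]; exact (hT _ (hc n)).2.2 x hx
  · intro n x hx
    rw [hs]; exact (hT _ (hc n)).2.1 x hx

theorem powNorm_nonlinearity_le {N : ℕ} {Ω : Set (EuclideanSpace ℝ (Fin N))}
    (hΩ : IsOpen Ω) (hb : Bornology.IsBounded Ω) (hvol : volume Ω = 1) {p lam α B : ℝ}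
    (hp : 1 < p) (hlam : 0 ≤ lam) (hα : α ≤ 1) {ψ : EuclideanSpace ℝ (Fin N) → ℝ}
    (hψ : Continuous ψ) (h0 : ∀ x ∈ closure Ω, 0 ≤ ψ x) (hB : powNorm Ω p ψ ≤ B) :
    ∫ x in Ω, posPow p (α + lam * ψ x) ^ 2 ≤ (1 + lam * B) ^ (2 * p) := by
  have hlψ : Continuous fun x => lam * ψ x := continuous_const.mul hψ
  have h1 : powNorm Ω p (fun x => max (α + lam * ψ x) 0) ≤ 1 + lam * B := by
    have hm : powNorm Ω p (fun x => max (α + lam * ψ x) 0) ≤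
        powNorm Ω p (fun x => 1 + lam * ψ x) := by
      refine powNorm_mono hΩ hb hp ((continuous_const.add hlψ).max continuous_const)
        (continuous_const.add hlψ) fun x hx => ?_
      have := mul_nonneg hlam (h0 x (subset_closure hx))
      rw [abs_of_nonneg (le_max_right _ _), abs_of_nonneg (by linarith)]
      exact max_le (by linarith) (by linarith)
    have ha := powNorm_add_le hΩ hb hp (continuous_const (y := (1 : ℝ))) hlψ
    rw [powNorm_one hvol, powNorm_const_mul Ω hp hlam] at ha
    have := mul_le_mul_of_nonneg_left hB hlam
    linarith
  have h2 := Real.rpow_le_rpow (powNorm_nonneg _ _ _) h1 (by linarith : 0 ≤ 2 * p)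
  rw [powNorm_rpow Ω hp] at h2
  refine le_trans (le_of_eq ?_) h2
  congr 1
  funext x
  rw [abs_of_nonneg (le_max_right _ _), mul_comm 2 p, Real.rpow_mul (le_max_right _ _)]
  exact (Real.rpow_natCast _ 2).symm

/-- Uniform bounds and geometric convergence of the Picard iteration. -/
theorem IsC3Domain.exists_convergent_iterates {Ω : Set (EuclideanSpace ℝ (Fin 2))}
    (hΩ : IsC3Domain Ω) (hvol : volume Ω = 1) {p lam : ℝ} (hp : 1 < p) (hlam : 0 ≤ lam)
    (hlt : lam < Lam Ω (2 * p) / p) :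
    ∃ (α : ℕ → ℝ) (ψ : ℕ → EuclideanSpace ℝ (Fin 2) → ℝ) (A L D q : ℝ), 0 ≤ L ∧ q ∈ Ico 0 1 ∧
      (∀ n, ContDiff ℝ 2 (ψ n)) ∧ (∀ n, ∀ x ∈ frontier Ω, ψ n x = 0) ∧
      (∀ n, ∫ x in Ω, posPow p (α n + lam * ψ n x) = 1) ∧
      (∀ n, ∀ x ∈ Ω, lapl (ψ (n + 1)) x = -posPow p (α n + lam * ψ n x)) ∧
      (∀ n, ∀ x ∈ closure Ω, α n + lam * ψ n x ≤ A) ∧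
      (∀ n, ∀ x ∈ closure Ω, ∀ y ∈ closure Ω, |ψ n x - ψ n y| ≤ L * ‖x - y‖) ∧
      ∀ n, ∀ x ∈ closure Ω, |ψ (n + 1) x - ψ n x| ≤ D * q ^ n := by
  obtain ⟨α, ψ, h0, hc, hfr, h_int, hlap⟩ := hΩ.exists_iterates hvol hp hlam
  have hp0 : 0 < p := by linarith
  have hΛ : 0 < Lam Ω (2 * p) := by
    rw [lt_div_iff₀ hp0] at hlt
    exact (mul_nonneg hlam hp0.le).trans_lt hlt
  set θ := lam * p / Lam Ω (2 * p) with hθ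
  have hθ0 : 0 ≤ θ := by positivity
  have hθ1 : θ < 1 := by rwa [hθ, div_lt_one hΛ, ← lt_div_iff₀ hp0]
  have hnn : ∀ n, ∀ x ∈ closure Ω, 0 ≤ ψ n x := by
    rintro (_ | n) x hx
    · simp [h0]
    · exact hΩ.nonneg_of_lapl_nonpos (hc _) (hfr _)
        (fun x hx => by rw [hlap n x hx]; linarith [posPow_nonneg p (α n + lam * ψ n x)]) x hx
  have hα : ∀ n, α n ≤ 1 := by
    intro n
    have h1 : ∫ x in Ω, posPow p (1 + (fun _ => 0 : EuclideanSpace ℝ (Fin 2) → ℝ) x) = 1 := by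
      simp [posPow, Measure.real, hvol]
    have := const_sub_le_of_integral_posPow_eq_one hΩ.1 hΩ.2.2.1 hp (s := 0)
      (v₁ := fun x => lam * ψ n x) (continuous_const.mul (hc n).continuous) continuous_const (h_int n) h1
      (fun x hx => by linarith [mul_nonneg hlam (hnn n x (subset_closure hx))])
    linarith
  have hcontr : ∀ n m, powNorm Ω p (fun x => ψ (n + 1) x - ψ (m + 1) x) ≤
      θ * powNorm Ω p (fun x => ψ n x - ψ m x) := by
    intro n m
    have := Lam_mul_powNorm_le hΩ.1 hΩ.2.2.1 hp hlam (hc n).continuous (hc m).continuous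
      (h_int n) (h_int m) ((hc (n + 1)).sub (hc (m + 1)))
      (fun x hx => by rw [hfr _ x hx, hfr _ x hx, sub_self])
      (fun x hx => by rw [lapl_sub (hc _) (hc _), hlap n x hx, hlap m x hx]; ring)
    rw [hθ, div_mul_eq_mul_div, le_div_iff₀ hΛ]
    linarith
  have hgeo : ∀ n, powNorm Ω p (fun x => ψ (n + 1) x - ψ n x) ≤
      θ ^ n * powNorm Ω p (ψ 1) := by
    intro n
    induction n with
    | zero => simp [h0]
    | succ n ih =>
      refine (hcontr (n + 1) n).trans ((mul_le_mul_of_nonneg_left ih hθ0).trans (le_of_eq ?_))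
      ring
  set S := powNorm Ω p (ψ 1) with hS
  have hS0 : 0 ≤ S := powNorm_nonneg _ _ _
  set B := S / (1 - θ) with hB
  have hBe : S + θ * B = B := by
    rw [hB]; field_simp [(sub_pos.2 hθ1).ne']; ring
  have hB0 : 0 ≤ B := div_nonneg hS0 (by linarith)
  have hBn : ∀ n, powNorm Ω p (ψ n) ≤ B := by
    intro n
    induction n with
    | zero =>
      have : powNorm Ω p (ψ 0) = 0 := by
        simp only [powNorm, h0, Pi.zero_apply, abs_zero]
        rw [Real.zero_rpow (by linarith), integral_zero, Real.zero_rpow (by positivity)]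
      rwa [this]
    | succ n ih =>
      have h1 := hcontr n 0
      simp only [h0, Pi.zero_apply, sub_zero, zero_add] at h1
      have h2 : powNorm Ω p (fun x => ψ 1 x + (ψ (n + 1) x - ψ 1 x)) ≤
          powNorm Ω p (ψ 1) + powNorm Ω p (fun x => ψ (n + 1) x - ψ 1 x) :=
        powNorm_add_le hΩ.1 hΩ.2.2.1 hp (hc 1).continuous
          ((hc (n + 1)).continuous.sub (hc 1).continuous)
      simp only [add_sub_cancel] at h2
      have h3 : powNorm Ω p (fun x => ψ n x) = powNorm Ω p (ψ n) := rfl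
      rw [h3] at h1
      have h4 := mul_le_mul_of_nonneg_left ih hθ0
      exact h2.trans (by linarith)
  obtain ⟨C, hC, hsup⟩ := hΩ.exists_sup_bound
  set A₁ := C * (1 + (1 + lam * B) ^ (2 * p)) with hA₁
  have hA₁0 : 0 ≤ A₁ := by positivity
  have hψA : ∀ n, ∀ x ∈ closure Ω, ψ n x ≤ A₁ := by
    rintro (_ | n) x hx
    · simpa [h0] using hA₁0
    · obtain ⟨L, hL0, hL⟩ := exists_lipschitz_posPow_comp hΩ.2.2.1 hp hlam (α n) (hc n)
      refine (hsup _ _ L hL0 (hc _) (hfr _) (hlap n) (fun _ _ => posPow_nonneg _ _) hL x hx).trans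
        (mul_le_mul_of_nonneg_left (add_le_add_right ?_ _) hC.le)
      exact powNorm_nonlinearity_le hΩ.1 hΩ.2.2.1 hvol hp hlam (hα n) (hc n).continuous
        (hnn n) (hBn n)
  have hA : ∀ n, ∀ x ∈ closure Ω, α n + lam * ψ n x ≤ 1 + lam * A₁ := fun n x hx =>
    add_le_add (hα n) (mul_le_mul_of_nonneg_left (hψA n x hx) hlam)
  obtain ⟨C', hC', hlip⟩ := hΩ.exists_lipschitz_bound
  set L := C' * posPow p (1 + lam * A₁) with hLd
  have hL0 : 0 ≤ L := mul_nonneg hC'.le (posPow_nonneg _ _)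
  have hL : ∀ n, ∀ x ∈ closure Ω, ∀ y ∈ closure Ω, |ψ n x - ψ n y| ≤ L * ‖x - y‖ := by
    rintro (_ | n) x hx y hy
    · simpa [h0] using mul_nonneg hL0 (norm_nonneg (x - y))
    · refine hlip _ _ (posPow_nonneg _ _) (hc _) (hfr _) (fun x hx => ?_) x hx y hy
      rw [hlap n x hx, abs_neg, abs_of_nonneg (posPow_nonneg _ _)]
      exact posPow_mono hp (hA n x (subset_closure hx))
  obtain ⟨K, hK0, hK⟩ := hΩ.exists_interpolation hp (by linarith : 0 < 2 * L + A₁ + 1)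
  have hr : 0 < p / (p + 1) := by positivity
  refine ⟨α, ψ, 1 + lam * A₁, L, K * S ^ (p / (p + 1)), θ ^ (p / (p + 1)), hL0,
    ⟨Real.rpow_nonneg hθ0 _, Real.rpow_lt_one hθ0 hθ1 hr⟩, hc, hfr, h_int, hlap, hA, hL, ?_⟩
  intro n x hx
  refine (hK (fun x => ψ (n + 1) x - ψ n x) ((hc _).continuous.sub (hc _).continuous)
    ?_ ?_ x hx).trans ?_
  · intro y hy
    have h1 := hnn n y hy
    have h2 := hnn (n + 1) y hy
    have h3 := hψA n y hy
    have h4 := hψA (n + 1) y hy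
    exact abs_le.2 ⟨by linarith, by linarith⟩
  · intro y hy z hz
    have h1 := hL n y hy z hz
    have h2 := hL (n + 1) y hy z hz
    have h3 := mul_nonneg (by linarith : 0 ≤ A₁ + 1) (norm_nonneg (y - z))
    have h4 := abs_sub (ψ (n + 1) y - ψ (n + 1) z) (ψ n y - ψ n z)
    have h5 : ψ (n + 1) y - ψ n y - (ψ (n + 1) z - ψ n z) =
      ψ (n + 1) y - ψ (n + 1) z - (ψ n y - ψ n z) := by ring
    rw [h5]
    linarith
  · have h1 := Real.rpow_le_rpow (powNorm_nonneg _ _ _) (hgeo n) hr.le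
    rw [Real.mul_rpow (by positivity) hS0, ← Real.rpow_natCast, ← Real.rpow_mul hθ0,
      mul_comm (n : ℝ), Real.rpow_mul hθ0, Real.rpow_natCast] at h1
    exact (mul_le_mul_of_nonneg_left h1 hK0).trans (le_of_eq (by ring))

theorem IsC3Domain.exists_isSol {Ω : Set (EuclideanSpace ℝ (Fin 2))}
    (hΩ : IsC3Domain Ω) (hvol : volume Ω = 1) {p lam : ℝ} (hp : 1 < p) (hlam : 0 ≤ lam)
    (hlt : lam < Lam Ω (2 * p) / p) : ∃ α ψ, IsSol Ω p lam α ψ := by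
  obtain ⟨α, ψ, A, L, D, q, hL0, hq, hc, hfr, h_int, hlap, hA, hL, hD⟩ :=
    hΩ.exists_convergent_iterates hvol hp hlam hlt
  have hd : ∀ x ∈ closure Ω, ∀ n, dist (ψ n x) (ψ (n + 1) x) ≤ D * q ^ n := fun x hx n => by
    rw [dist_comm, Real.dist_eq]; exact hD n x hx
  have hlim : ∀ x, ∃ l, x ∈ closure Ω → Tendsto (fun n => ψ n x) atTop (𝓝 l) := by
    intro x
    by_cases hx : x ∈ closure Ω
    · obtain ⟨l, hl⟩ := cauchySeq_tendsto_of_complete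
        (cauchySeq_of_le_geometric q D hq.2 (hd x hx))
      exact ⟨l, fun _ => hl⟩
    · exact ⟨0, fun h => absurd h hx⟩
  choose φ hφ using hlim
  have hφd : ∀ x ∈ closure Ω, ∀ n, |ψ n x - φ x| ≤ D * q ^ n / (1 - q) := fun x hx n =>
    dist_le_of_le_geometric_of_tendsto q D hq.2 (hd x hx) (hφ x hx) n
  have hαd : ∀ n, dist (α n) (α (n + 1)) ≤ lam * D * q ^ n := by
    intro n
    refine abs_const_sub_le_of_integral_posPow_eq_one hΩ.1 hΩ.2.2.1 hp
      (v₁ := fun x => lam * ψ n x) (v₂ := fun x => lam * ψ (n + 1) x)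
      (continuous_const.mul (hc n).continuous) (continuous_const.mul (hc _).continuous)
      (h_int n) (h_int _) fun x hx => ?_
    rw [← mul_sub, abs_mul, abs_of_nonneg hlam, abs_sub_comm, mul_assoc]
    exact mul_le_mul_of_nonneg_left (hD n x (subset_closure hx)) hlam
  obtain ⟨β, hβ⟩ := cauchySeq_tendsto_of_complete (cauchySeq_of_le_geometric q _ hq.2 hαd)
  have hβd : ∀ n, |α n - β| ≤ lam * D * q ^ n / (1 - q) := fun n =>
    dist_le_of_le_geometric_of_tendsto q _ hq.2 hαd hβ n
  have hφA : ∀ x ∈ closure Ω, β + lam * φ x ≤ A := fun x hx =>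
    le_of_tendsto' (hβ.add ((hφ x hx).const_mul lam)) fun n => hA n x hx
  have hφL : ∀ x ∈ closure Ω, ∀ y ∈ closure Ω, |φ x - φ y| ≤ L * ‖x - y‖ := fun x hx y hy =>
    le_of_tendsto' ((hφ x hx).sub (hφ y hy)).abs fun n => hL n x hx y hy
  set P := p * posPow p A ^ ((p - 1) / p) with hP
  have hP0 : 0 ≤ P := mul_nonneg (by linarith) (Real.rpow_nonneg (posPow_nonneg _ _) _)
  obtain ⟨u, hu, hul, hu0⟩ := hΩ.exists_poisson (by positivity : 0 ≤ P * lam * L)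
    (abs_posPow_comp_sub_le hp hlam hφA hφL)
  obtain ⟨C, hC0, hC⟩ := hΩ.exists_abs_bound
  have hclose : ∀ x ∈ closure Ω, ∀ n, |u x - ψ (n + 1) x| ≤
      C * (P * (2 * (lam * D * q ^ n / (1 - q)))) := by
    intro x hx n
    have hE : 0 ≤ lam * D * q ^ n / (1 - q) := (abs_nonneg _).trans (hβd n)
    refine hC (fun x => u x - ψ (n + 1) x) _ (by positivity) (hu.sub (hc _))
      (fun y hy => by rw [hu0 y hy, hfr _ y hy, sub_self]) (fun y hy => ?_) x hx
    have hy' := subset_closure hy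
    rw [lapl_sub hu (hc _), hul y hy, hlap n y hy, neg_sub_neg]
    refine (abs_posPow_sub_le hp (hA n y hy') (hφA y hy')).trans ?_
    refine mul_le_mul_of_nonneg_left ?_ hP0
    have h1 : α n + lam * ψ n y - (β + lam * φ y) = (α n - β) + lam * (ψ n y - φ y) := by ring
    have h2 : |lam * (ψ n y - φ y)| ≤ lam * D * q ^ n / (1 - q) := by
      rw [abs_mul, abs_of_nonneg hlam]
      exact (mul_le_mul_of_nonneg_left (hφd y hy' n) hlam).trans (le_of_eq (by ring))
    rw [h1]
    have := abs_add_le (α n - β) (lam * (ψ n y - φ y))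
    linarith [hβd n]
  have huφ : ∀ x ∈ closure Ω, u x = φ x := by
    intro x hx
    have hq0 := tendsto_pow_atTop_nhds_zero_of_lt_one hq.1 hq.2
    have hb : Tendsto (fun n => C * (P * (2 * (lam * D * q ^ n / (1 - q))))) atTop (𝓝 0) := by
      simpa using ((((hq0.const_mul (lam * D)).div_const (1 - q)).const_mul 2).const_mul
        P).const_mul C
    have h1 : Tendsto (fun n => u x - ψ (n + 1) x) atTop (𝓝 0) :=
      squeeze_zero_norm (hclose x hx) hb
    have h2 : Tendsto (fun n => u x - ψ (n + 1) x) atTop (𝓝 (u x - φ x)) :=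
      tendsto_const_nhds.sub ((hφ x hx).comp (tendsto_add_atTop_nat 1))
    exact sub_eq_zero.1 (tendsto_nhds_unique h2 h1)
  refine ⟨β, u, hu, fun x hx => ?_, hu0, ?_⟩
  · rw [hul x hx, neg_neg, huφ x (subset_closure hx)]
    rfl
  · have h1 := tendsto_setIntegral_of_abs_le (μ := volume) (C := posPow p A)
      hΩ.1.measurableSet (by simp [hvol])
      (F := fun n x => posPow p (α n + lam * ψ n x)) (f := fun x => posPow p (β + lam * u x))
      (fun n => ((continuous_posPow hp).comp (continuous_const.add
        (continuous_const.mul (hc n).continuous))).aestronglyMeasurable)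
      (fun n x hx => by
        rw [abs_of_nonneg (posPow_nonneg _ _)]
        exact posPow_mono hp (hA n x (subset_closure hx)))
      (fun x hx => by
        rw [huφ x (subset_closure hx)]
        exact ((continuous_posPow hp).tendsto _).comp
          (hβ.add ((hφ x (subset_closure hx)).const_mul lam)))
    simp only [h_int] at h1
    exact tendsto_nhds_unique h1 tendsto_const_nhds

theorem IsSol.eq_of_lt {Ω : Set (EuclideanSpace ℝ (Fin 2))}
    (hΩ : IsC3Domain Ω) {p lam α₁ α₂ : ℝ} (hp : 1 < p) (hlam : 0 ≤ lam)
    (hlt : lam < Lam Ω (2 * p) / p) {ψ₁ ψ₂ : EuclideanSpace ℝ (Fin 2) → ℝ}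
    (h₁ : IsSol Ω p lam α₁ ψ₁) (h₂ : IsSol Ω p lam α₂ ψ₂) :
    α₁ = α₂ ∧ ∀ x ∈ closure Ω, ψ₁ x = ψ₂ x := by
  obtain ⟨c₁, l₁, z₁, i₁⟩ := h₁
  obtain ⟨c₂, l₂, z₂, i₂⟩ := h₂
  have hp0 : 0 < p := by linarith
  have hz : ContDiff ℝ 2 fun x => ψ₁ x - ψ₂ x := c₁.sub c₂
  have h0 := Lam_mul_powNorm_le hΩ.1 hΩ.2.2.1 hp hlam c₁.continuous c₂.continuous i₁ i₂ hz
    (fun x hx => by rw [z₁ x hx, z₂ x hx, sub_self])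
    (fun x hx => by
      rw [lapl_sub c₁ c₂]
      simp only [posPow, ← l₁ x hx, ← l₂ x hx]
      ring)
  have hN : powNorm Ω p (fun x => ψ₁ x - ψ₂ x) = 0 := by
    rw [lt_div_iff₀ hp0] at hlt
    nlinarith [powNorm_nonneg Ω p (fun x => ψ₁ x - ψ₂ x)]
  obtain ⟨L, hL0, hL⟩ := exists_lipschitz_on_closure hΩ.2.2.1 hz
  obtain ⟨A, hA0, hA⟩ := exists_abs_le_of_continuous hΩ.2.2.1 hz.continuous
  obtain ⟨K, -, hK⟩ := hΩ.exists_interpolation hp (by linarith : 0 < L + A + 1)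
  have heq : ∀ x ∈ closure Ω, ψ₁ x = ψ₂ x := by
    intro x hx
    have h := hK _ hz.continuous (fun x hx => (hA x hx).trans (by linarith))
      (fun x hx y hy => (hL x hx y hy).trans
        (mul_le_mul_of_nonneg_right (by linarith) (norm_nonneg _))) x hx
    rw [hN, Real.zero_rpow (by positivity), mul_zero] at h
    exact sub_eq_zero.1 (abs_nonpos_iff.1 h)
  refine ⟨?_, heq⟩
  have h := abs_const_sub_le_of_integral_posPow_eq_one hΩ.1 hΩ.2.2.1 hp (s := 0)
    (v₁ := fun x => lam * ψ₁ x) (v₂ := fun x => lam * ψ₂ x)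
    (continuous_const.mul c₁.continuous) (continuous_const.mul c₂.continuous) i₁ i₂
    (fun x hx => by rw [heq x (subset_closure hx), sub_self, abs_zero])
  exact sub_eq_zero.1 (abs_nonpos_iff.1 h)

end

theorem stmt7 (Ω : Set (EuclideanSpace ℝ (Fin 2))) (hΩ : IsC3Domain Ω)
    (hvol : volume Ω = 1) (p : ℝ) (hp : 1 < p) (lam : ℝ) (hlam : 0 ≤ lam)
    (hlt : lam < min (Lam Ω (2 * p) / p)
      ((8 * Real.pi / (p + 1)) ^ ((p - 1) / (2 * p)) * Lam Ω (p + 1) ^ ((p + 1) / (2 * p)))) :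
    (∃ (α : ℝ) (ψ : EuclideanSpace ℝ (Fin 2) → ℝ), IsSol Ω p lam α ψ) ∧
    (∀ (α₁ α₂ : ℝ) (ψ₁ ψ₂ : EuclideanSpace ℝ (Fin 2) → ℝ),
      IsSol Ω p lam α₁ ψ₁ → IsSol Ω p lam α₂ ψ₂ →
      α₁ = α₂ ∧ ∀ x ∈ closure Ω, ψ₁ x = ψ₂ x) := by
  have hlt' := hlt.trans_le (min_le_left _ _)
  exact ⟨hΩ.exists_isSol hvol hp hlam hlt', fun _ _ _ _ h₁ h₂ => h₁.eq_of_lt hΩ hp hlam hlt' h₂⟩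

end
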